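/- The module J^{Co₀}_{*,Λ,3} of Conway invariant holomorphic Jacobi forms of integral weight and index 3 is a free module over ℂ[E₄,E₆], generated by ten forms of weights 12, 12, 12, 14, 14, 16, 16, 16, 18 and 18. -/

import Mathlib

open Complex Matrix UpperHalfPlane
open scoped Manifold MatrixGroups Real Topology BigOperators

noncomputable section

/-- Vectors of the rank-24 lattice (coordinates w.r.t. a fixed basis). -/
abbrev LV := Fin 24 → ℤ

/-- Complexified vectors. -/
abbrev CV := Fin 24 → ℂ

/-- The bilinear form attached to a Gram matrix `B`. -/
def pairZ (B : Matrix (Fin 24) (Fin 24) ℤ) (v u : LV) : ℤ := v ⬝ᵥ B.mulVec u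

/-- The complex bilinear extension of the form. -/
def pairC (B : Matrix (Fin 24) (Fin 24) ℤ) (z w : CV) : ℂ :=
  z ⬝ᵥ ((B.map (Int.cast : ℤ → ℂ)).mulVec w)

/-- Inclusion of lattice vectors into complexified vectors. -/
def liftC (v : LV) : CV := fun i => (v i : ℂ)

/-- `B` is a Gram matrix of the Leech lattice: even, unimodular, positive definite of
rank 24, with no vectors of norm 2 (no roots). -/
def IsLeech (B : Matrix (Fin 24) (Fin 24) ℤ) : Prop :=
  B.IsSymm ∧ B.det = 1 ∧ (∀ v : LV, v ≠ 0 → 0 < pairZ B v v) ∧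
    (∀ v : LV, Even (pairZ B v v)) ∧ (∀ v : LV, pairZ B v v ≠ 2)

/-- The automorphism group `Co₀ = Aut(Λ)` of the lattice, as a set of integral matrices. -/
def ConwayGroup (B : Matrix (Fin 24) (Fin 24) ℤ) : Set (Matrix (Fin 24) (Fin 24) ℤ) :=
  {σ | IsUnit σ.det ∧ σᵀ * B * σ = B}

/-- Action of an integral matrix on complexified vectors. -/
def actC (σ : Matrix (Fin 24) (Fin 24) ℤ) (z : CV) : CV :=
  (σ.map (Int.cast : ℤ → ℂ)).mulVec z

/-- `e(x) = exp(2πix)`. -/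
def eC (x : ℂ) : ℂ := Complex.exp (2 * (Real.pi : ℂ) * Complex.I * x)

/-- The Fourier term `qⁿ ζ^ℓ`. -/
def fterm (B : Matrix (Fin 24) (Fin 24) ℤ) (n : ℕ) (ℓ : LV) (τ : UpperHalfPlane) (z : CV) : ℂ :=
  eC ((n : ℂ) * (τ : ℂ)) * eC (pairC B (liftC ℓ) z)

/-- Lower-left entry of `A ∈ SL(2,ℤ)`, as a complex number. -/
def slc (A : SL(2, ℤ)) : ℂ := ((A : Matrix (Fin 2) (Fin 2) ℤ) 1 0 : ℤ)

/-- Lower-right entry of `A ∈ SL(2,ℤ)`, as a complex number. -/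
def sld (A : SL(2, ℤ)) : ℂ := ((A : Matrix (Fin 2) (Fin 2) ℤ) 1 1 : ℤ)

/-- The automorphy factor `cτ + d`. -/
def jfactor (A : SL(2, ℤ)) (τ : UpperHalfPlane) : ℂ := slc A * (τ : ℂ) + sld A

/-- `φ : ℍ × (Λ⊗ℂ) → ℂ` is a Conway invariant weak Jacobi form of weight `k` and index `t`
with Fourier coefficients `f`. -/
structure IsJacobiFormWith (B : Matrix (Fin 24) (Fin 24) ℤ) (k : ℤ) (t : ℕ)
    (φ : UpperHalfPlane → CV → ℂ) (f : ℕ → LV → ℂ) : Prop where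
  holo_tau : ∀ z : CV, MDifferentiable 𝓘(ℂ) 𝓘(ℂ) fun τ : UpperHalfPlane => φ τ z
  holo_z : ∀ τ : UpperHalfPlane, Differentiable ℂ (φ τ)
  conway_invar : ∀ σ ∈ ConwayGroup B, ∀ (τ : UpperHalfPlane) (z : CV), φ τ (actC σ z) = φ τ z
  quasi_periodic : ∀ (x y : LV) (τ : UpperHalfPlane) (z : CV),
    φ τ (z + (τ : ℂ) • liftC x + liftC y) =
      Complex.exp (-(t : ℂ) * (Real.pi : ℂ) * Complex.I * (pairZ B x x : ℂ) * (τ : ℂ)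
        - 2 * (t : ℂ) * (Real.pi : ℂ) * Complex.I * pairC B (liftC x) z) * φ τ z
  modular : ∀ (A : SL(2, ℤ)) (τ : UpperHalfPlane) (z : CV),
    φ (A • τ) ((jfactor A τ)⁻¹ • z) =
      (jfactor A τ) ^ k *
        Complex.exp ((t : ℂ) * (Real.pi : ℂ) * Complex.I * slc A * pairC B z z / jfactor A τ) *
        φ τ z
  expansion : ∀ (τ : UpperHalfPlane) (z : CV),
    HasSum (fun p : ℕ × LV => f p.1 p.2 * fterm B p.1 p.2 τ z) (φ τ z)

/-- Conway invariant weak Jacobi forms. -/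
def IsWeakJacobiForm (B : Matrix (Fin 24) (Fin 24) ℤ) (k : ℤ) (t : ℕ)
    (φ : UpperHalfPlane → CV → ℂ) : Prop :=
  ∃ f, IsJacobiFormWith B k t φ f

/-- Conway invariant holomorphic Jacobi forms. -/
def IsHolJacobiForm (B : Matrix (Fin 24) (Fin 24) ℤ) (k : ℤ) (t : ℕ)
    (φ : UpperHalfPlane → CV → ℂ) : Prop :=
  ∃ f, IsJacobiFormWith B k t φ f ∧
    ∀ (n : ℕ) (ℓ : LV), 2 * (n : ℤ) * t - pairZ B ℓ ℓ < 0 → f n ℓ = 0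

/-- Modular forms of weight `k` on `SL₂(ℤ)`; the ring of all of them is `ℂ[E₄,E₆]`. -/
abbrev MForm (k : ℤ) := ModularForm (CongruenceSubgroup.Gamma 1) k

/-- The family `φ i` (of weights `w i`) freely generates the module of all forms satisfying
`P` over the ring `M_*(SL₂(ℤ)) = ℂ[E₄,E₆]` of modular forms on `SL₂(ℤ)`. -/
def FreelyGenerates (P : ℤ → (UpperHalfPlane → CV → ℂ) → Prop) {n : ℕ}
    (w : Fin n → ℤ) (φ : Fin n → UpperHalfPlane → CV → ℂ) : Prop :=
  (∀ i, P (w i) (φ i)) ∧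
  ∀ (k : ℤ) (ψ : UpperHalfPlane → CV → ℂ), P k ψ →
    ∃! g : (i : Fin n) → MForm (k - w i),
      ∀ (τ : UpperHalfPlane) (z : CV), ψ τ z = ∑ i, (g i) τ * φ i τ z

/-- The point `(aτ+b)/d` of the upper half-plane (for `a, d > 0`). -/
def heckePt (a d b : ℕ) (τ : UpperHalfPlane) : UpperHalfPlane :=
  if h : 0 < ((((a : ℂ) * (τ : ℂ) + (b : ℂ)) / (d : ℂ)).im) then
    ⟨((a : ℂ) * (τ : ℂ) + (b : ℂ)) / (d : ℂ), h⟩ else τ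

/-- The Hecke operator `T₋(m)` on Jacobi forms of weight `k`. -/
def heckeOp (k : ℤ) (m : ℕ) (φ : UpperHalfPlane → CV → ℂ) : UpperHalfPlane → CV → ℂ :=
  fun τ z => (m : ℂ)⁻¹ * ∑ d ∈ m.divisors, ∑ b ∈ Finset.range d,
    ((m / d : ℕ) : ℂ) ^ k * φ (heckePt (m / d) d b τ) (((m / d : ℕ) : ℂ) • z)

/-- The Jacobi theta function `Θ_Λ = A₁` of the lattice. -/
def thetaLeech (B : Matrix (Fin 24) (Fin 24) ℤ) : UpperHalfPlane → CV → ℂ := fun τ z =>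
  ∑' ℓ : LV, Complex.exp ((Real.pi : ℂ) * Complex.I * (pairZ B ℓ ℓ : ℂ) * (τ : ℂ)
    + 2 * (Real.pi : ℂ) * Complex.I * pairC B (liftC ℓ) z)

/-- `σ_k(n) = Σ_{d ∣ n} d^k`. -/
def sigmaNat (k n : ℕ) : ℕ := ∑ d ∈ n.divisors, d ^ k

/-- `A_t = σ₁₁(t)⁻¹ (A₁ | T₋(t))`, a holomorphic Jacobi form of weight 12 and index `t`. -/
def Aform (B : Matrix (Fin 24) (Fin 24) ℤ) (t : ℕ) : UpperHalfPlane → CV → ℂ := fun τ z =>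
  ((sigmaNat 11 t : ℂ))⁻¹ * heckeOp 12 t (thetaLeech B) τ z

/-- The quasimodular Eisenstein series `E₂`. -/
def E2 : UpperHalfPlane → ℂ := fun τ =>
  1 - 24 * ∑' n : ℕ, (sigmaNat 1 (n + 1) : ℂ) * eC (((n : ℂ) + 1) * (τ : ℂ))

/-- The discriminant cusp form `Δ(τ) = q ∏ (1-qⁿ)^24`. -/
def DeltaForm : UpperHalfPlane → ℂ := fun τ =>
  eC (τ : ℂ) * ∏' n : ℕ, (1 - eC (((n : ℂ) + 1) * (τ : ℂ))) ^ 24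

/-- `aτ`. -/
def scaleH (a : ℕ) (τ : UpperHalfPlane) : UpperHalfPlane := heckePt a 1 0 τ

/-- `(τ+j)/t`. -/
def sliceH (t j : ℕ) (τ : UpperHalfPlane) : UpperHalfPlane := heckePt 1 t j τ

/-- `f₂(τ) = (tE₂(tτ) - E₂(τ))/(t-1)`, a modular form of weight 2 on `Γ₀(t)`. -/
def f2w (t : ℕ) (τ : UpperHalfPlane) : ℂ := ((t : ℂ) * E2 (scaleH t τ) - E2 τ) / ((t : ℂ) - 1)

/-- `B_t`, a holomorphic Jacobi form of weight 14 and index `t` (for `t` prime). -/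
def Bform (B : Matrix (Fin 24) (Fin 24) ℤ) (t : ℕ) : UpperHalfPlane → CV → ℂ := fun τ z =>
  ((t : ℂ) ^ 12 / ((t : ℂ) ^ 12 - 1)) *
    (f2w t τ * thetaLeech B (scaleH t τ) ((t : ℂ) • z)
      - (t : ℂ) ^ (-13 : ℤ) *
        ∑ j ∈ Finset.range t, f2w t (sliceH t j τ) * thetaLeech B (sliceH t j τ) z)

/-- Fourier coefficients of `E₂`. -/
def e2coeff : ℕ → ℂ := fun m => if m = 0 then 1 else -24 * (sigmaNat 1 m : ℂ)

/-- Fourier coefficients of the image `H_k(φ)` of the modified heat operator applied to a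
Jacobi form of weight `k` and index `t` with Fourier coefficients `f`:
`H_k(φ) = 𝓗(φ) + ((12-k)/12)E₂φ` where `𝓗` multiplies `f(n,ℓ)` by `n - (ℓ,ℓ)/(2t)`. -/
def heatCoeff (B : Matrix (Fin 24) (Fin 24) ℤ) (k : ℤ) (t : ℕ) (f : ℕ → LV → ℂ) :
    ℕ → LV → ℂ := fun n ℓ =>
  ((n : ℂ) - (pairZ B ℓ ℓ : ℂ) / (2 * (t : ℂ))) * f n ℓ +
    ((12 - k : ℤ) : ℂ) / 12 * ∑ m ∈ Finset.range (n + 1), e2coeff m * f (n - m) ℓ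

/-- The function with Fourier coefficients `f`. -/
def fourierSeries (B : Matrix (Fin 24) (Fin 24) ℤ) (f : ℕ → LV → ℂ) :
    UpperHalfPlane → CV → ℂ := fun τ z =>
  ∑' p : ℕ × LV, f p.1 p.2 * fterm B p.1 p.2 τ z

/-- The family `Φ m = Φ_{12,m}` of Fourier–Jacobi coefficients of the Borcherds form `Φ₁₂`
at the Leech cusp:
`Δ(τ)·exp(−Σ_{m≥1}((Δ⁻¹A₁)|T₋(m))(τ,𝔷)e^{2πimω}) = Σ_{m≥0} Φ_{12,m}(τ,𝔷)e^{2πimω}`. -/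
def IsFJExpansionOfPhi12 (B : Matrix (Fin 24) (Fin 24) ℤ)
    (Φ : ℕ → UpperHalfPlane → CV → ℂ) : Prop :=
  ∀ (τ ω : UpperHalfPlane) (z : CV),
    HasSum (fun m : ℕ => Φ m τ z * eC ((m : ℂ) * (ω : ℂ)))
      (DeltaForm τ * Complex.exp
        (- ∑' m : ℕ, heckeOp 0 (m + 1) (fun σ w => thetaLeech B σ w / DeltaForm σ) τ z *
            eC (((m : ℂ) + 1) * (ω : ℂ))))

/-- `S_t`: the set of lattice vectors of minimal norm in their coset modulo `tΛ`. -/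
def minimalSet (B : Matrix (Fin 24) (Fin 24) ℤ) (t : ℕ) : Set LV :=
  {v | ∀ u : LV, (∃ w : LV, u = v + (t : ℤ) • w) → pairZ B v v ≤ pairZ B u u}

/-- `v` and `u` are conjugate modulo `tΛ` up to the Conway group. -/
def conjModT (B : Matrix (Fin 24) (Fin 24) ℤ) (t : ℕ) (v u : LV) : Prop :=
  ∃ σ ∈ ConwayGroup B, ∃ w : LV, v - σ.mulVec u = (t : ℤ) • w

/-- `s(t) = |(S_t/Co₀)/tΛ|`. -/
def sRank (B : Matrix (Fin 24) (Fin 24) ℤ) (t : ℕ) : ℕ :=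
  Nat.card (Quot (fun v u : minimalSet B t => conjModT B t v.1 u.1))

/-- `R` is a system of representatives for `(S_t/Co₀)/tΛ` (of minimal length). -/
def IsRepSystem (B : Matrix (Fin 24) (Fin 24) ℤ) (t : ℕ) (R : Finset LV) : Prop :=
  (↑R ⊆ minimalSet B t) ∧ ∀ v ∈ minimalSet B t, ∃! r, r ∈ R ∧ conjModT B t v r

/-- The Conway orbit of a lattice vector. -/
def orbitOf (B : Matrix (Fin 24) (Fin 24) ℤ) (v : LV) : Set LV :=
  {u | ∃ σ ∈ ConwayGroup B, u = σ.mulVec v}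

/-- `O` is a Conway orbit of Leech vectors of type `x` (i.e. norm `2x`) with `c` elements. -/
def OrbitData (B : Matrix (Fin 24) (Fin 24) ℤ) (O : Set LV) (x c : ℕ) : Prop :=
  (∃ v : LV, O = orbitOf B v) ∧ (∀ v ∈ O, pairZ B v v = 2 * (x : ℤ)) ∧ Nat.card O = c

/-- `W` is a `d`-dimensional subspace of the space of functions `ℍ × (Λ⊗ℂ) → ℂ`. -/
def SpanDimIs (W : (UpperHalfPlane → CV → ℂ) → Prop) (d : ℕ) : Prop :=
  ∃ φ : Fin d → UpperHalfPlane → CV → ℂ, (∀ i, W (φ i)) ∧ LinearIndependent ℂ φ ∧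
    ∀ ψ, W ψ → ∃ c : Fin d → ℂ, ψ = ∑ i, c i • φ i


section
variable {B : Matrix (Fin 24) (Fin 24) ℤ}
theorem exists_common_den {n : ℕ} (v : Fin n → ℚ) :
    ∃ N : ℕ, 0 < N ∧ ∀ i, ∃ w : ℤ, (w : ℚ) = N * v i := by
  refine ⟨∏ i, (v i).den, Finset.prod_pos fun i _ => (v i).den_pos, fun i => ?_⟩
  obtain ⟨c, hc⟩ : (v i).den ∣ ∏ i, (v i).den := Finset.dvd_prod_of_mem _ (Finset.mem_univ i)
  refine ⟨c * (v i).num, ?_⟩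
  rw [hc]; push_cast
  rw [mul_assoc, mul_comm (c : ℚ) (v i), ← mul_assoc, mul_comm _ (v i), Rat.mul_den_eq_num, mul_comm]
open scoped MatrixOrder Matrix.Norms.L2Operator in
theorem IsLeech.sqrtR (h : IsLeech B) : ∃ A : Matrix (Fin 24) (Fin 24) ℝ,
    Aᵀ * A = B.map (Int.cast : ℤ → ℝ) ∧ IsUnit A.det ∧ |A.det| = 1 := by
  obtain ⟨hs, hd, hp, -, -⟩ := h
  have hsemi : (B.map (Int.cast : ℤ → ℝ)).PosSemidef := by
    refine Matrix.posSemidef_iff_dotProduct_mulVec.2 ⟨?_, ?_⟩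
    · ext i j
      simpa [Matrix.conjTranspose_apply] using hs.apply i j
    · have hZ : ∀ v : LV, 0 ≤ pairZ B v v := fun v => by
        by_cases hv : v = 0
        · simp [hv, pairZ]
        · exact (hp v hv).le
      have hQ : ∀ v : Fin 24 → ℚ, 0 ≤ (fun i => (v i : ℝ)) ⬝ᵥ
          ((B.map (Int.cast : ℤ → ℝ)) *ᵥ fun i => (v i : ℝ)) := by
        intro v
        obtain ⟨N, hN, hdvd⟩ := exists_common_den v
        have hw : ∀ i, ∃ w : ℤ, (w : ℝ) = N * (v i : ℝ) := fun i => by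
          obtain ⟨w, hw⟩ := hdvd i
          exact ⟨w, by exact_mod_cast hw⟩
        choose w hw using hw
        have h1 := hZ w
        have h2 : ((pairZ B w w : ℤ) : ℝ) = N ^ 2 * ((fun i => (v i : ℝ)) ⬝ᵥ
          ((B.map (Int.cast : ℤ → ℝ)) *ᵥ fun i => (v i : ℝ))) := by
          simp only [pairZ, dotProduct, mulVec, Int.cast_sum, Int.cast_mul, hw, Matrix.map_apply,
            Finset.mul_sum]
          refine Finset.sum_congr rfl fun i _ => Finset.sum_congr rfl fun j _ => by ring
        have h3 : (0 : ℝ) ≤ (pairZ B w w : ℤ) := by exact_mod_cast h1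
        rw [h2] at h3
        exact nonneg_of_mul_nonneg_right h3 (by positivity)
      intro x
      have hc : IsClosed {x : Fin 24 → ℝ | 0 ≤ x ⬝ᵥ ((B.map (Int.cast : ℤ → ℝ)) *ᵥ x)} :=
        isClosed_le continuous_const (by simp only [dotProduct, mulVec]; fun_prop)
      have hdense : DenseRange (Pi.map fun (_ : Fin 24) (r : ℚ) => (r : ℝ)) :=
        DenseRange.piMap fun _ => Rat.denseRange_cast
      have := hdense.closure_range ▸ hc.closure_subset_iff.2 (Set.range_subset_iff.2 hQ)
      simpa using this (Set.mem_univ x)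
  obtain ⟨A, hA⟩ := CStarAlgebra.nonneg_iff_eq_star_mul_self.mp hsemi.nonneg
  have hA' : Aᵀ * A = B.map (Int.cast : ℤ → ℝ) := by
    rw [hA, Matrix.star_eq_conjTranspose, Matrix.conjTranspose_eq_transpose_of_trivial]
  have h2 : A.det * A.det = 1 := by
    have := congrArg Matrix.det hA'
    have e : (B.map (Int.cast : ℤ → ℝ)).det = ((B.det : ℤ) : ℝ) := (Int.cast_det B).symm
    rw [Matrix.det_mul, Matrix.det_transpose, e, hd] at this
    simpa using this
  refine ⟨A, hA', IsUnit.of_mul_eq_one _ h2, ?_⟩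
  rcases mul_self_eq_one_iff.1 h2 with h | h <;> simp [h]
theorem IsLeech.lower (h : IsLeech B) : ∃ ε > 0, ∀ x : Fin 24 → ℝ,
    ε * ∑ i, x i ^ 2 ≤ x ⬝ᵥ ((B.map (Int.cast : ℤ → ℝ)) *ᵥ x) := by
  obtain ⟨A, hA, hu, -⟩ := h.sqrtR
  obtain ⟨C, hC', hC⟩ : ∃ C : ℝ, (∑ i, ∑ j, A⁻¹ i j ^ 2) ≤ C ∧ 0 < C :=
    ⟨1 + ∑ i, ∑ j, A⁻¹ i j ^ 2, by linarith, by positivity⟩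
  refine ⟨C⁻¹, inv_pos.2 hC, fun x => ?_⟩
  rw [inv_mul_le_iff₀ hC, ← hA, ← Matrix.mulVec_mulVec, Matrix.dotProduct_mulVec,
    Matrix.vecMul_transpose]
  set y := A *ᵥ x with hy
  have hx : x = A⁻¹ *ᵥ y := by
    rw [hy, Matrix.mulVec_mulVec, Matrix.nonsing_inv_mul _ hu, Matrix.one_mulVec]
  calc ∑ i, x i ^ 2 ≤ ∑ i, (∑ j, A⁻¹ i j ^ 2) * ∑ j, y j ^ 2 := by
        refine Finset.sum_le_sum fun i _ => ?_
        conv_lhs => rw [hx]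
        exact Finset.sum_mul_sq_le_sq_mul_sq Finset.univ (fun j => A⁻¹ i j) y
    _ = (∑ i, ∑ j, A⁻¹ i j ^ 2) * (y ⬝ᵥ y) := by
        rw [Finset.sum_mul]; simp [dotProduct, sq]
    _ ≤ C * (y ⬝ᵥ y) := by
        refine mul_le_mul_of_nonneg_right hC' ?_
        exact Finset.sum_nonneg fun i _ => mul_self_nonneg _
/-- product summability -/
theorem summable_pi_prod {f : ℤ → ℝ} (h0 : ∀ n, 0 ≤ f n) (hf : Summable f) (n : ℕ) :
    Summable fun l : Fin n → ℤ => ∏ i, f (l i) := by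
  induction n with
  | zero => exact Summable.of_finite
  | succ n ih =>
    rw [← (Fin.consEquiv fun _ : Fin (n + 1) => ℤ).summable_iff]
    have := hf.mul_of_nonneg ih h0 fun l => Finset.prod_nonneg fun i _ => h0 _
    refine this.congr fun p => ?_
    simp [Fin.prod_univ_succ, Fin.consEquiv]
theorem summable_gauss1 {a : ℝ} (ha : 0 < a) (b : ℝ) :
    Summable fun n : ℤ => Real.exp (-a * n ^ 2 + b * |(n : ℝ)|) := by
  have key : ∀ c : ℝ, Summable fun n : ℤ => Real.exp (-a * n ^ 2 + c * n) := fun c => by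
    have hτ : 0 < ((a / π : ℝ) * Complex.I : ℂ).im := by simp; positivity
    have h1 := ((summable_jacobiTheta₂_term_iff (-(Complex.I * c) / (2 * π)) ((a / π : ℝ) * Complex.I)).2 hτ).norm
    refine h1.congr fun n => ?_
    rw [jacobiTheta₂_term, Complex.norm_exp]
    congr 1
    have hp : (π : ℂ) ≠ 0 := by exact_mod_cast Real.pi_ne_zero
    have : 2 * ↑π * Complex.I * ↑n * (-(Complex.I * ↑c) / (2 * ↑π)) + ↑π * Complex.I * ↑n ^ 2 * (↑(a / π) * Complex.I)
      = ((-a * n ^ 2 + c * n : ℝ) : ℂ) := by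
      push_cast; field_simp; ring_nf; simp only [Complex.I_sq]; ring
    rw [this, ofReal_re]
  refine Summable.of_nonneg_of_le (fun _ => (Real.exp_pos _).le) (fun n => ?_)
    ((key b).add (key (-b)))
  rcases abs_cases (n : ℝ) with ⟨h, -⟩ | ⟨h, -⟩ <;> rw [h]
  · exact le_add_of_nonneg_right (Real.exp_pos _).le
  · rw [show b * -(n : ℝ) = -b * n by ring]
    exact le_add_of_nonneg_left (Real.exp_pos _).le
/-- Gaussian majorant -/
def gmaj (a b : ℝ) (l : LV) : ℝ := ∏ i, Real.exp (-a * (l i : ℝ) ^ 2 + b * |(l i : ℝ)|)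
theorem gmaj_summable {a : ℝ} (ha : 0 < a) (b : ℝ) : Summable (gmaj a b) :=
  summable_pi_prod (fun _ => (Real.exp_pos _).le) (summable_gauss1 ha b) 24
end

section
variable {B : Matrix (Fin 24) (Fin 24) ℤ}
open MeasureTheory in
theorem poisson_pi {n : ℕ} {f : (Fin n → ℝ) → ℂ} (hf : Continuous f) (hi : Integrable f)
    (hu : ∀ R : ℝ, ∃ u : (Fin n → ℤ) → ℝ, Summable u ∧ ∀ (l : Fin n → ℤ) (x : Fin n → ℝ),
      (∀ i, |x i| ≤ R) → ‖f (x + fun i => (l i : ℝ))‖ ≤ u l)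
    (F : (Fin n → ℤ) → ℂ) (hF : Summable F)
    (hFi : ∀ m : Fin n → ℤ, F m = ∫ x : Fin n → ℝ,
      Complex.exp (-(2 * π * Complex.I * ∑ i, (m i : ℂ) * x i)) * f x) (y : Fin n → ℝ) :
    HasSum (fun m : Fin n → ℤ => F m * Complex.exp (2 * π * Complex.I * ∑ i, (m i : ℂ) * y i))
      (∑' l : Fin n → ℤ, f (y + fun i => (l i : ℝ))) := by
  have hR : ∀ x : Fin n → ℝ, ∀ i, |x i| ≤ ∑ i, |x i| := fun x i =>
    Finset.single_le_sum (f := fun i => |x i|) (fun _ _ => abs_nonneg _) (Finset.mem_univ i)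
  set G : (Fin n → ℝ) → ℂ := fun x => ∑' l : Fin n → ℤ, f (x + fun i => (l i : ℝ)) with hG
  have hsum : ∀ x, Summable fun l : Fin n → ℤ => f (x + fun i => (l i : ℝ)) := fun x => by
    obtain ⟨u, hu1, hu2⟩ := hu (∑ i, |x i|)
    exact Summable.of_norm_bounded hu1 fun l => hu2 l x (hR x)
  have hGc : Continuous G := by
    rw [continuous_iff_continuousAt]
    intro x
    obtain ⟨u, hu1, hu2⟩ := hu (∑ i, |x i| + 1)
    have h1 : ContinuousOn G {x' | ∀ i, |x' i| < ∑ i, |x i| + 1} :=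
      continuousOn_tsum (fun l => by fun_prop) hu1 fun l x' hx' => hu2 l x' fun i => (hx' i).le
    refine h1.continuousAt (IsOpen.mem_nhds ?_ fun i => by linarith [hR x i])
    rw [Set.ofPred_forall]
    exact isOpen_iInter_of_finite fun i => isOpen_lt (by fun_prop) continuous_const
  have hper : ∀ (x : Fin n → ℝ) (l : Fin n → ℤ), G (x + fun i => (l i : ℝ)) = G x := fun x l => by
    simp only [hG]
    rw [← (Equiv.addLeft l).tsum_eq (fun m : Fin n → ℤ => f (x + fun i => (m i : ℝ)))]
    refine tsum_congr fun m => congrArg f ?_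
    ext i; simp [add_assoc]
  let pr : (Fin n → ℝ) → UnitAddTorus (Fin n) := Pi.map fun _ (x : ℝ) => (x : UnitAddCircle)
  have hq : IsOpenQuotientMap pr :=
    IsOpenQuotientMap.piMap fun _ => QuotientAddGroup.isOpenQuotientMap_mk
  have hker : ∀ a b, pr a = pr b → G a = G b := fun a b hab => by
    have : ∀ i, ∃ k : ℤ, b i = a i + k := fun i => by
      have h1 : ((b i - a i : ℝ) : UnitAddCircle) = 0 := by
        rw [AddCircle.coe_sub, sub_eq_zero]; exact (congrFun hab i).symm
      obtain ⟨k, hk⟩ := (AddCircle.coe_eq_zero_iff _).1 h1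
      exact ⟨k, by simp at hk; linarith⟩
    choose k hk using this
    rw [← hper a k]; congr 1; ext i; exact (hk i).symm
  have hg' : ∀ x, G (Function.surjInv hq.surjective (pr x)) = G x := fun x =>
    hker _ _ (Function.surjInv_eq hq.surjective _)
  let g : C(UnitAddTorus (Fin n), ℂ) := ⟨fun t => G (Function.surjInv hq.surjective t),
    hq.isQuotientMap.continuous_iff.2 (by
      rw [show (fun t => G (Function.surjInv hq.surjective t)) ∘ pr = G from funext hg']
      exact hGc)⟩
  have hg : ∀ x, g (pr x) = G x := hg'
  have hmF : ∀ (m : Fin n → ℤ) (x : Fin n → ℝ), UnitAddTorus.mFourier m (pr x) =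
      Complex.exp (2 * π * Complex.I * ∑ i, (m i : ℂ) * x i) := fun m x => by
    rw [UnitAddTorus.mFourier, ContinuousMap.coe_mk, Finset.mul_sum, Complex.exp_sum]
    refine Finset.prod_congr rfl fun i _ => ?_
    simp only [pr, Pi.map]
    rw [fourier_coe_apply]; congr 1; push_cast; ring
  have hcoef : ∀ m, UnitAddTorus.mFourierCoeff g m = F m := fun m => by
    have e0 := UnitAddTorus.mFourierCoeff_eq_integral g m (fun _ => (0 : ℝ))
    rw [e0, hFi]
    set S : Set (Fin n → ℝ) := {x | ∀ i, x i ∈ Set.Ioc (0 : ℝ) (0 + 1)} with hS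
    set h : (Fin n → ℝ) → ℂ := fun x =>
      Complex.exp (-(2 * π * Complex.I * ∑ i, (m i : ℂ) * x i)) * f x with hh
    have hn1 : ∀ x : Fin n → ℝ,
        ‖Complex.exp (-(2 * π * Complex.I * ∑ i, (m i : ℂ) * x i))‖ = 1 := fun x => by
      have : -(2 * π * Complex.I * ∑ i, (m i : ℂ) * x i) =
        ((-(2 * π * ∑ i, (m i : ℝ) * x i) : ℝ) : ℂ) * Complex.I := by push_cast; ring
      rw [this, Complex.norm_exp_ofReal_mul_I]
    have hhi : Integrable h := by
      refine Integrable.mono hi (by fun_prop) (Filter.Eventually.of_forall fun x => ?_)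
      rw [hh, norm_mul, hn1, one_mul]
    have hSm : MeasurableSet S := by
      rw [hS, Set.ofPred_forall]
      exact MeasurableSet.iInter fun i => measurableSet_Ioc.preimage (measurable_pi_apply i)
    let s : (Fin n → ℤ) → Set (Fin n → ℝ) := fun l => (fun x => x + fun i => (l i : ℝ)) '' S
    have hsx : ∀ l x, x ∈ s l ↔ ∀ i, ⌈x i⌉ = l i + 1 := fun l x => by
      constructor
      · rintro ⟨y, hy, rfl⟩ i
        have := hy i
        rw [Int.ceil_eq_iff]; simp at this ⊢; constructor <;> linarith
      · intro hx
        refine ⟨x - fun i => (l i : ℝ), fun i => ?_, by simp⟩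
        have := hx i
        rw [Int.ceil_eq_iff] at this; simp at this ⊢; constructor <;> linarith
    have hemb : ∀ l : Fin n → ℤ,
        MeasurableEmbedding (fun x : Fin n → ℝ => x + fun i => (l i : ℝ)) :=
      fun l => (MeasurableEquiv.addRight (fun i => (l i : ℝ))).measurableEmbedding
    have hsm : ∀ l, MeasurableSet (s l) := fun l => (hemb l).measurableSet_image.2 hSm
    have hdis : Pairwise (Function.onFun Disjoint s) := fun l l' hne =>
      Set.disjoint_left.2 fun x h1 h2 => hne <| by
        ext i
        have a := (hsx l x).1 h1 i
        have b := (hsx l' x).1 h2 i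
        omega
    have hU : (⋃ l, s l) = Set.univ := Set.eq_univ_of_forall fun x =>
      Set.mem_iUnion.2 ⟨fun i => ⌈x i⌉ - 1, (hsx _ x).2 fun i => by ring⟩
    have e1 := integral_iUnion (f := h) (μ := volume) hsm hdis (by rw [hU]; exact hhi.integrableOn)
    rw [hU, setIntegral_univ] at e1
    rw [e1]
    have e2 : ∀ l, ∫ x in s l, h x = ∫ x in S, h (x + fun i => (l i : ℝ)) := fun l =>
      (measurePreserving_add_right volume (fun i => (l i : ℝ))).setIntegral_image_emb (hemb l) _ _
    have e3 : ∀ (l : Fin n → ℤ) (x : Fin n → ℝ), h (x + fun i => (l i : ℝ)) =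
        Complex.exp (-(2 * π * Complex.I * ∑ i, (m i : ℂ) * x i)) *
          f (x + fun i => (l i : ℝ)) := fun l x => by
      simp only [hh]; congr 1
      rw [show -(2 * π * Complex.I * ∑ i, (m i : ℂ) * ((x + fun i => (l i : ℝ)) i : ℝ)) =
        -(2 * π * Complex.I * ∑ i, (m i : ℂ) * x i) +
          ((-∑ i, m i * l i : ℤ) : ℂ) * (2 * π * Complex.I) by
          simp [mul_add, Finset.sum_add_distrib]; ring, Complex.exp_add,
        Complex.exp_int_mul_two_pi_mul_I, mul_one]
    simp only [e2, e3]
    obtain ⟨u, hu1, hu2⟩ := hu 1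
    have hSv : volume S < ⊤ := by
      have : S ⊆ Set.pi Set.univ fun _ => Set.Icc (0 : ℝ) 1 := fun x hx i _ => by
        have := hx i; simp at this; exact ⟨this.1.le, this.2⟩
      refine lt_of_le_of_lt (measure_mono this) (isCompact_univ_pi fun _ => isCompact_Icc).measure_lt_top
    have hub : ∀ l, ∀ x ∈ S, ‖f (x + fun i => (l i : ℝ))‖ ≤ u l := fun l x hx =>
      hu2 l x fun i => by have := hx i; simp at this; rw [abs_le]; constructor <;> linarith
    have hint : ∀ l : Fin n → ℤ, Integrable (fun x => Complex.exp (-(2 * π * Complex.I *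
        ∑ i, (m i : ℂ) * x i)) * f (x + fun i => (l i : ℝ))) (volume.restrict S) := fun l => by
      have := (hhi.comp_add_right (fun i => (l i : ℝ))).integrableOn (s := S)
      simpa only [IntegrableOn, e3] using this
    rw [integral_tsum_of_summable_integral_norm hint]
    · refine setIntegral_congr_fun hSm fun x hx => ?_
      have := hmF (-m) x
      simp only [smul_eq_mul]
      rw [show (fun i => ((x i : ℝ) : UnitAddCircle)) = pr x from rfl, hg, this, tsum_mul_left]
      simp [hG]
    · refine Summable.of_nonneg_of_le (fun l => integral_nonneg fun _ => norm_nonneg _)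
        (fun l => ?_) (hu1.mul_left (volume.real S))
      calc _ ≤ ∫ x in S, u l := by
            refine setIntegral_mono_on (hint l).norm (integrableOn_const hSv.ne) hSm fun x hx => ?_
            rw [norm_mul, hn1, one_mul]; exact hub l x hx
        _ = _ := by simp [mul_comm]
  have hfin := UnitAddTorus.hasSum_mFourier_series_apply_of_summable (f := g)
    (by rw [show UnitAddTorus.mFourierCoeff g = F from funext hcoef]; exact hF) (pr y)
  simpa only [hcoef, hmF, hg, smul_eq_mul] using hfin
end

section
variable {B : Matrix (Fin 24) (Fin 24) ℤ}
/-- real quadratic form -/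
def qR (B : Matrix (Fin 24) (Fin 24) ℤ) (x : Fin 24 → ℝ) : ℝ :=
  x ⬝ᵥ ((B.map (Int.cast : ℤ → ℝ)) *ᵥ x)
def realC (x : Fin 24 → ℝ) : CV := fun i => (x i : ℂ)
theorem realC_intCast (l : LV) : realC (fun i => (l i : ℝ)) = liftC l := by
  ext i; simp [realC, liftC]
theorem pairC_realC (x : Fin 24 → ℝ) : pairC B (realC x) (realC x) = qR B x := by
  simp [pairC, qR, dotProduct, mulVec, realC]
theorem pairC_liftC (x y : LV) : pairC B (liftC x) (liftC y) = pairZ B x y := by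
  simp [pairC, pairZ, dotProduct, mulVec, liftC]
theorem pairC_add_left (x y z : CV) : pairC B (x + y) z = pairC B x z + pairC B y z := by
  simp [pairC, add_dotProduct]
theorem pairC_add_right (x y z : CV) : pairC B z (x + y) = pairC B z x + pairC B z y := by
  simp [pairC, mulVec_add, dotProduct_add]
theorem pairC_smul_left (c : ℂ) (y z : CV) : pairC B (c • y) z = c * pairC B y z := by
  simp [pairC]
theorem pairC_smul_right (c : ℂ) (y z : CV) : pairC B y (c • z) = c * pairC B y z := by
  simp [pairC, mulVec_smul]
theorem pairC_neg_left (y z : CV) : pairC B (-y) z = - pairC B y z := by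
  simp [pairC]
theorem pairC_neg_right (y z : CV) : pairC B y (-z) = - pairC B y z := by
  simp [pairC, mulVec_neg]
theorem pairC_sub_left (x y z : CV) : pairC B (x - y) z = pairC B x z - pairC B y z := by
  simp [pairC, sub_dotProduct]
theorem pairC_sub_right (x y z : CV) : pairC B z (x - y) = pairC B z x - pairC B z y := by
  simp [pairC, mulVec_sub, dotProduct_sub]
theorem IsLeech.pairC_comm (h : IsLeech B) (x y : CV) : pairC B x y = pairC B y x := by
  have hs : (B.map (Int.cast : ℤ → ℂ))ᵀ = B.map (Int.cast : ℤ → ℂ) := by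
    rw [← Matrix.transpose_map, h.1]
  rw [pairC, pairC, dotProduct_mulVec, dotProduct_comm, ← hs, vecMul_transpose, hs]
/-- dot pairing bound -/
theorem norm_pairC_le {C : ℝ} {z : CV} (hz : ∀ i, ‖((B.map (Int.cast : ℤ → ℂ)) *ᵥ z) i‖ ≤ C)
    (x : Fin 24 → ℝ) : ‖pairC B (realC x) z‖ ≤ ∑ i, C * |x i| := by
  rw [pairC, dotProduct]
  refine (norm_sum_le _ _).trans (Finset.sum_le_sum fun i _ => ?_)
  rw [norm_mul, realC, Complex.norm_real, Real.norm_eq_abs, mul_comm]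
  exact mul_le_mul_of_nonneg_right (hz i) (abs_nonneg _)
theorem norm_gauss_le {ε C y : ℝ} (hε : ∀ x : Fin 24 → ℝ, ε * ∑ i, x i ^ 2 ≤ qR B x)
    (hε0 : 0 < ε) {t : ℂ} (hy : 0 < y) (ht : y ≤ t.im) {z : CV}
    (hz : ∀ i, ‖((B.map (Int.cast : ℤ → ℂ)) *ᵥ z) i‖ ≤ C) (x : Fin 24 → ℝ) :
    ‖Complex.exp (π * Complex.I * qR B x * t + 2 * π * Complex.I * pairC B (realC x) z)‖ ≤
      ∏ i, Real.exp (-(π * y * ε) * x i ^ 2 + (2 * π * C) * |x i|) := by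
  rw [Complex.norm_exp, ← Real.exp_sum]
  apply Real.exp_le_exp.2
  have h1 := norm_pairC_le hz x
  have h2 : -(2 * π * (pairC B (realC x) z).im) ≤ 2 * π * ∑ i, C * |x i| := by
    have := (abs_le.1 ((Complex.abs_im_le_norm (pairC B (realC x) z)).trans h1)).1
    nlinarith [Real.pi_pos]
  have h3 : π * (t.im * qR B x) ≥ π * (y * (ε * ∑ i, x i ^ 2)) := by
    have h0 : 0 ≤ ε * ∑ i, x i ^ 2 := by positivity
    have := mul_le_mul ht (hε x) h0 (hy.le.trans ht)
    exact mul_le_mul_of_nonneg_left this Real.pi_pos.le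
  simp only [Finset.sum_add_distrib, ← Finset.mul_sum] at h2 ⊢
  have e : (π * Complex.I * qR B x * t + 2 * π * Complex.I * pairC B (realC x) z).re =
    - (π * (t.im * qR B x)) - 2 * π * (pairC B (realC x) z).im := by
    simp; ring
  rw [e]; linarith
theorem exists_bound_mulVec (z : CV) : ∃ C : ℝ, 0 ≤ C ∧
    ∀ i, ‖((B.map (Int.cast : ℤ → ℂ)) *ᵥ z) i‖ ≤ C :=
  ⟨∑ i, ‖((B.map (Int.cast : ℤ → ℂ)) *ᵥ z) i‖, by positivity, fun i =>
    Finset.single_le_sum (f := fun i => ‖((B.map (Int.cast : ℤ → ℂ)) *ᵥ z) i‖)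
      (fun _ _ => norm_nonneg _) (Finset.mem_univ i)⟩
/-- theta term -/
def thT (B : Matrix (Fin 24) (Fin 24) ℤ) (t : ℂ) (z : CV) (l : LV) : ℂ :=
  Complex.exp ((π : ℂ) * Complex.I * (pairZ B l l : ℂ) * t
    + 2 * (π : ℂ) * Complex.I * pairC B (liftC l) z)
theorem qR_int (l : LV) : qR B (fun i => (l i : ℝ)) = pairZ B l l := by
  simp [qR, pairZ, dotProduct, mulVec]
theorem IsLeech.thT_bound (h : IsLeech B) {y C : ℝ} (hy : 0 < y) : ∃ u : LV → ℝ, Summable u ∧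
    ∀ (t : ℂ) (z : CV) (l : LV), y ≤ t.im → (∀ i, ‖((B.map (Int.cast : ℤ → ℂ)) *ᵥ z) i‖ ≤ C) →
      ‖thT B t z l‖ ≤ u l := by
  obtain ⟨ε, hε, hl⟩ := h.lower
  refine ⟨gmaj (π * y * ε) (2 * π * C), gmaj_summable (by positivity) _, fun t z l ht hz => ?_⟩
  have := norm_gauss_le hl hε hy ht hz (fun i => (l i : ℝ))
  rw [qR_int, realC_intCast] at this
  simpa [thT, gmaj] using this
theorem IsLeech.thT_summable (h : IsLeech B) {t : ℂ} (ht : 0 < t.im) (z : CV) :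
    Summable fun l => ‖thT B t z l‖ := by
  obtain ⟨C, -, hC⟩ := exists_bound_mulVec (B := B) z
  obtain ⟨u, hu, hb⟩ := h.thT_bound (C := C) ht
  exact Summable.of_nonneg_of_le (fun _ => norm_nonneg _) (fun l => hb t z l le_rfl hC) hu
open MeasureTheory in
theorem IsLeech.theta_inv (h : IsLeech B) {t : ℂ} (ht : 0 < t.im) (z : CV) :
    ∑' l, thT B (-t⁻¹) (t⁻¹ • z) l =
      t ^ 12 * Complex.exp (π * Complex.I * pairC B z z / t) * ∑' l, thT B t z l := by
  have ht0 : t ≠ 0 := by rintro rfl; simp at ht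
  obtain ⟨A, hA, hu, hd⟩ := h.sqrtR
  obtain ⟨ε, hε, hlow⟩ := h.lower
  obtain ⟨C, hC0, hC⟩ := exists_bound_mulVec (B := B) z
  set f : (Fin 24 → ℝ) → ℂ := fun x =>
    Complex.exp (π * Complex.I * qR B x * t + 2 * π * Complex.I * pairC B (realC x) z) with hf
  have hqc : Continuous (qR B) := by unfold qR; simp only [dotProduct, mulVec]; fun_prop
  have hpc : ∀ w, Continuous fun x => pairC B (realC x) w := fun w => by
    unfold pairC realC; simp only [dotProduct]; fun_prop
  have hfc : Continuous f := by
    have := hpc z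
    fun_prop
  let AC : Matrix (Fin 24) (Fin 24) ℂ := A.map Complex.ofReal
  have hAC : ∀ x : Fin 24 → ℝ, ∀ i, ((A *ᵥ x) i : ℂ) = (AC *ᵥ realC x) i := fun x i => by
    simp [mulVec, dotProduct, realC, AC]
  have hBC : ACᵀ * AC = B.map (Int.cast : ℤ → ℂ) := by
    ext i j
    have := congrFun (congrFun hA i) j
    simp only [mul_apply, transpose_apply, map_apply] at this
    simp only [AC, mul_apply, transpose_apply, map_apply]
    exact_mod_cast congrArg Complex.ofReal this
  have hpA : ∀ w w' : CV, pairC B w w' = ∑ i, (AC *ᵥ w) i * (AC *ᵥ w') i := fun w w' => by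
    rw [pairC, ← hBC, ← mulVec_mulVec, dotProduct_mulVec, vecMul_transpose]; rfl
  have hb : 0 < (-(π * Complex.I * t) : ℂ).re := by
    simp; positivity
  have hcv : ∀ Ψ : (Fin 24 → ℝ) → ℂ, ∫ x, Ψ (A *ᵥ x) = ∫ x, Ψ x := fun Ψ => by
    have hm := Real.map_matrix_volume_pi_eq_smul_volume_pi hu.ne_zero
    rw [abs_inv, hd] at hm
    simp at hm
    have he : MeasurableEmbedding (A.toLin') := by
      refine Topology.IsClosedEmbedding.measurableEmbedding ?_
      refine LinearMap.isClosedEmbedding_of_injective ?_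
      rw [LinearMap.ker_eq_bot]
      intro a b hab
      exact Matrix.mulVec_injective_of_isUnit ((Matrix.isUnit_iff_isUnit_det _).2 hu) hab
    conv_rhs => rw [← hm, he.integral_map]
    rfl
  have hcvi : ∀ Ψ : (Fin 24 → ℝ) → ℂ, Integrable Ψ → Integrable fun x => Ψ (A *ᵥ x) :=
    fun Ψ hΨ => by
    have hm := Real.map_matrix_volume_pi_eq_smul_volume_pi hu.ne_zero
    rw [abs_inv, hd] at hm
    simp at hm
    rw [← hm] at hΨ
    exact hΨ.comp_measurable (LinearMap.continuous_of_finiteDimensional _).measurable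
  -- the Gaussian in the new coordinates
  have hG : ∀ (w : CV) (x : Fin 24 → ℝ),
      Complex.exp (π * Complex.I * qR B x * t + 2 * π * Complex.I * pairC B (realC x) w) =
      (fun v : Fin 24 → ℝ => Complex.exp (- -(π * Complex.I * t) * ∑ i, (v i : ℂ) ^ 2 +
        ∑ i, (2 * π * Complex.I * (AC *ᵥ w) i) * v i)) (A *ᵥ x) := fun w x => by
    simp only [hAC]
    rw [← pairC_realC, hpA, hpA]
    congr 1
    simp only [Finset.mul_sum, Finset.sum_mul]
    refine congrArg₂ _ (Finset.sum_congr rfl fun i _ => by ring)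
      (Finset.sum_congr rfl fun i _ => by ring)
  have hint : Integrable f := by
    simp only [hf, hG]
    exact hcvi _ (GaussianFourier.integrable_cexp_neg_mul_sum_add hb _)
  have hval : ∀ w : CV, ∫ x : Fin 24 → ℝ,
      Complex.exp (π * Complex.I * qR B x * t + 2 * π * Complex.I * pairC B (realC x) w) =
      (t ^ 12)⁻¹ * Complex.exp (-(π * Complex.I * pairC B w w / t)) := fun w => by
    refine (integral_congr_ae (.of_forall (hG w))).trans ((hcv (fun v : Fin 24 → ℝ => Complex.exp (- -(π * Complex.I * t) *
      ∑ i, (v i : ℂ) ^ 2 + ∑ i, (2 * π * Complex.I * (AC *ᵥ w) i) * v i))).trans ?_)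
    rw [GaussianFourier.integral_cexp_neg_mul_sum_add hb]
    have hp : (π : ℂ) ≠ 0 := by exact_mod_cast Real.pi_ne_zero
    congr 1
    · rw [show ((Fintype.card (Fin 24) : ℂ) / 2) = ((12 : ℕ) : ℂ) by norm_num, Complex.cpow_natCast,
        show (π : ℂ) / -(π * Complex.I * t) = Complex.I * t⁻¹ by
          field_simp; simp, mul_pow, show (Complex.I ^ 12 : ℂ) = 1 by
          rw [show 12 = 4 * 3 by rfl, pow_mul, Complex.I_pow_four, one_pow]]
      simp
    · congr 1
      rw [hpA]
      simp only [mul_pow, ← Finset.mul_sum, Complex.I_sq, ← sq]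
      field_simp; ring_nf; simp [Complex.I_sq]
  have hBu : IsUnit B.det := by rw [h.2.1]; exact isUnit_one
  -- integer dual basis
  let e : LV ≃ LV :=
    { toFun := fun m => B *ᵥ m
      invFun := fun m => B⁻¹ *ᵥ m
      left_inv := fun m => by simp [mulVec_mulVec, Matrix.nonsing_inv_mul _ hBu]
      right_inv := fun m => by simp [mulVec_mulVec, Matrix.mul_nonsing_inv _ hBu] }
  have hdot : ∀ (l : LV) (x : Fin 24 → ℝ), ∑ i, ((e l i : ℤ) : ℂ) * x i =
      pairC B (realC x) (liftC l) := fun l x => by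
    simp only [e, Equiv.coe_fn_mk, pairC, dotProduct, mulVec, realC, liftC, Int.cast_sum,
      Int.cast_mul, Matrix.map_apply]
    exact Finset.sum_congr rfl fun i _ => mul_comm _ _
  let F : LV → ℂ := fun m => ∫ x : Fin 24 → ℝ,
      Complex.exp (-(2 * π * Complex.I * ∑ i, (m i : ℂ) * x i)) * f x
  have hFe : ∀ l, F (e l) = (t ^ 12)⁻¹ * Complex.exp (-(π * Complex.I * pairC B z z / t)) *
      thT B (-t⁻¹) (t⁻¹ • z) l := fun l => by
    have := hval (z - liftC l)
    simp only [F, hdot, hf, ← Complex.exp_add]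
    rw [thT, mul_assoc ((t ^ 12)⁻¹), ← Complex.exp_add]
    convert this using 4
    · rw [pairC_sub_right]; ring
    · simp only [pairC_sub_right, pairC_sub_left, pairC_smul_right, pairC_liftC, h.pairC_comm z]
      field_simp; ring
  have ht' : 0 < (-t⁻¹ : ℂ).im := by
    rw [Complex.neg_im, Complex.inv_im, neg_div, neg_neg]
    exact div_pos ht (Complex.normSq_pos.2 ht0)
  have hFs : Summable F := by
    rw [← e.summable_iff]
    refine Summable.congr ?_ fun l => (hFe l).symm
    exact (h.thT_summable ht' _).of_norm.mul_left _
  have key := poisson_pi hfc hint (fun R => ?_) F hFs (fun m => rfl) 0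
  · have k1 := key.tsum_eq
    simp only [Pi.zero_apply, Complex.ofReal_zero, mul_zero, Finset.sum_const_zero,
      Complex.exp_zero, mul_one, zero_add] at k1
    rw [← e.tsum_eq] at k1
    simp only [hFe, tsum_mul_left] at k1
    have k2 : ∀ l : LV, f (fun i => (l i : ℝ)) = thT B t z l := fun l => by
      simp only [hf, thT, qR_int, realC_intCast]; push_cast; rfl
    simp only [k2] at k1
    rw [← k1, ← mul_assoc]
    have : t ^ 12 * Complex.exp (π * Complex.I * pairC B z z / t) * ((t ^ 12)⁻¹ *
      Complex.exp (-(π * Complex.I * pairC B z z / t))) = 1 := by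
      rw [Complex.exp_neg]
      have := Complex.exp_ne_zero (π * Complex.I * pairC B z z / t)
      field_simp
    rw [this, one_mul]
  · set a := π * t.im * ε with ha
    have ha0 : 0 < a := by positivity
    refine ⟨fun l => Real.exp (2 * π * C * R) ^ 24 * gmaj a (2 * a * R + 2 * π * C) l,
      (gmaj_summable ha0 _).mul_left _, fun l x hx => ?_⟩
    refine (norm_gauss_le hlow hε ht le_rfl hC _).trans ?_
    simp only [gmaj]
    rw [← Fin.prod_const, ← Finset.prod_mul_distrib]
    refine Finset.prod_le_prod (fun i _ => (Real.exp_pos _).le) fun i _ => ?_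
    rw [← Real.exp_add]
    apply Real.exp_le_exp.2
    have h1 := hx i
    simp only [Pi.add_apply]
    have h2 : |x i + l i| ≤ R + |(l i : ℝ)| := (abs_add_le _ _).trans (by linarith)
    have h3 : (x i + l i) ^ 2 ≥ (l i : ℝ) ^ 2 - 2 * R * |(l i : ℝ)| := by
      have : |x i * l i| ≤ R * |(l i : ℝ)| := by
        rw [abs_mul]; exact mul_le_mul_of_nonneg_right h1 (abs_nonneg _)
      nlinarith [abs_le.1 this, sq_nonneg (x i)]
    have h4 := mul_le_mul_of_nonneg_left h2 (show 0 ≤ 2 * π * C by positivity)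
    have h5 := mul_le_mul_of_nonneg_left h3 ha0.le
    nlinarith
end

section
variable {B : Matrix (Fin 24) (Fin 24) ℤ}
section MF
open ModularGroup
theorem slash_all {g : ℍ → ℂ} {k : ℤ} (hT : ∀ τ : ℍ, g (T • τ) = g τ)
    (hS : ∀ τ : ℍ, g (S • τ) = (τ : ℂ) ^ k * g τ) (γ : SL(2, ℤ)) :
    SlashAction.map k γ g = g := by
  refine SlashInvariantForm.slash_action_generators_SL2Z ?_ ?_ γ
  · ext τ
    rw [ModularForm.SL_slash_apply, hS, ModularGroup.denom_S, _root_.zpow_neg]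
    have := zpow_ne_zero k (UpperHalfPlane.ne_zero τ)
    field_simp
  · ext τ
    rw [ModularForm.SL_slash_apply, hT]
    have : denom T τ = 1 := by rw [ModularGroup.denom_apply]; simp [T]
    simp [this]
theorem mkMF {g : ℍ → ℂ} {k : ℤ} (hol : MDifferentiable 𝓘(ℂ) 𝓘(ℂ) g)
    (hT : ∀ τ : ℍ, g (T • τ) = g τ)
    (hS : ∀ τ : ℍ, g (S • τ) = (τ : ℂ) ^ k * g τ) (hb : IsBoundedAtImInfty g) :
    ∃ F : ModularForm 𝒮ℒ k, ⇑F = g :=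
  ⟨{ toFun := g
     slash_action_eq' := fun _ ⟨γ, hγ⟩ => hγ ▸ slash_all hT hS γ
     holo' := hol
     bdd_at_cusps' := fun {c} hc => by
        rw [Subgroup.IsArithmetic.isCusp_iff_isCusp_SL2Z] at hc
        rw [OnePoint.isBoundedAt_iff_forall_SL2Z hc]
        intro γ _
        have := slash_all hT hS γ
        change IsBoundedAtImInfty (SlashAction.map k γ g); rw [this]; exact hb }, rfl⟩
theorem mkCF {g : ℍ → ℂ} {k : ℤ} (hol : MDifferentiable 𝓘(ℂ) 𝓘(ℂ) g)
    (hT : ∀ τ : ℍ, g (T • τ) = g τ)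
    (hS : ∀ τ : ℍ, g (S • τ) = (τ : ℂ) ^ k * g τ) (hb : IsZeroAtImInfty g) :
    ∃ F : CuspForm 𝒮ℒ k, ⇑F = g :=
  ⟨{ toFun := g
     slash_action_eq' := fun _ ⟨γ, hγ⟩ => hγ ▸ slash_all hT hS γ
     holo' := hol
     zero_at_cusps' := fun {c} hc => by
        rw [Subgroup.IsArithmetic.isCusp_iff_isCusp_SL2Z] at hc
        rw [OnePoint.isZeroAt_iff_forall_SL2Z hc]
        intro γ _
        have := slash_all hT hS γ
        change IsZeroAtImInfty (SlashAction.map k γ g); rw [this]; exact hb }, rfl⟩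
end MF
theorem IsLeech.shell_finite (h : IsLeech B) (N : ℤ) : {l : LV | pairZ B l l ≤ N}.Finite := by
  obtain ⟨ε, hε, hl⟩ := h.lower
  obtain ⟨M, hM⟩ := exists_nat_gt ((N : ℝ) / ε)
  refine (Set.finite_Icc (fun _ => -(M : ℤ) : LV) (fun _ => (M : ℤ))).subset fun l hl' => ?_
  have h1 := hl (fun i => (l i : ℝ))
  have h2 := qR_int (B := B) l
  rw [qR] at h2
  rw [h2] at h1
  have h3 : (pairZ B l l : ℝ) ≤ N := by exact_mod_cast hl'
  have h4 : ∑ i, (l i : ℝ) ^ 2 < M := by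
    refine lt_of_le_of_lt ?_ hM
    rw [le_div_iff₀ hε]; linarith
  have h5 : ∀ i, |l i| ≤ (M : ℤ) := fun i => by
    have a : (l i : ℝ) ^ 2 ≤ ∑ i, (l i : ℝ) ^ 2 :=
      Finset.single_le_sum (f := fun i => (l i : ℝ) ^ 2) (fun _ _ => sq_nonneg _) (Finset.mem_univ i)
    have b : (l i) ^ 2 ≤ (M : ℤ) := by exact_mod_cast (a.trans h4.le)
    have c : |l i| ≤ l i ^ 2 := by
      rw [← sq_abs]; rcases (abs_nonneg (l i)).eq_or_lt with h | h
      · rw [← h]; simp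
      · nlinarith
    omega
  exact ⟨fun i => (abs_le.1 (h5 i)).1, fun i => (abs_le.1 (h5 i)).2⟩
/-- vectors of norm `2n` as a finset -/
def IsLeech.shell (h : IsLeech B) (n : ℕ) : Finset LV :=
  (Set.Finite.subset (h.shell_finite (2 * n)) (fun _ hl => le_of_eq hl :
    {l | pairZ B l l = 2 * n} ⊆ _)).toFinset
theorem IsLeech.mem_shell (h : IsLeech B) {n : ℕ} {l : LV} :
    l ∈ h.shell n ↔ pairZ B l l = 2 * n := by
  simp [IsLeech.shell]
theorem IsLeech.pairZ_nonneg (h : IsLeech B) (v : LV) : 0 ≤ pairZ B v v := by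
  by_cases hv : v = 0
  · simp [hv, pairZ]
  · exact (h.2.2.1 v hv).le
/-- half norm -/
def hn (B : Matrix (Fin 24) (Fin 24) ℤ) (l : LV) : ℕ := (pairZ B l l / 2).toNat
theorem IsLeech.two_hn (h : IsLeech B) (l : LV) : pairZ B l l = 2 * hn B l := by
  have h1 := h.pairZ_nonneg l
  obtain ⟨m, hm⟩ := h.2.2.2.1 l
  rw [hn]; omega
theorem IsLeech.hasSum_shell (h : IsLeech B) {f : LV → ℂ} {C : ℝ} (hf : ∀ l, ‖f l‖ ≤ C)
    {t : ℂ} (ht : 0 < t.im) : HasSum (fun n : ℕ => (∑ l ∈ h.shell n, f l) *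
      Complex.exp (2 * π * Complex.I * t) ^ n) (∑' l, f l * thT B t 0 l) := by
  have hs : Summable fun l => f l * thT B t 0 l :=
    Summable.of_norm_bounded ((h.thT_summable ht 0).mul_left C) fun l => by
      rw [norm_mul]; exact mul_le_mul_of_nonneg_right (hf l) (norm_nonneg _)
  have h1 := hs.hasSum
  rw [← (Equiv.sigmaFiberEquiv (hn B)).hasSum_iff] at h1
  refine h1.sigma fun n => ?_
  have h2 : ∀ l, l ∈ h.shell n ↔ hn B l = n := fun l => by
    rw [h.mem_shell, h.two_hn l]; omega
  have h3 : HasSum (fun l : {l // l ∈ h.shell n} => f l * thT B t 0 l)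
      (∑ l ∈ h.shell n, f l * thT B t 0 l) := by
    rw [← Finset.sum_coe_sort]
    exact hasSum_fintype _
  rw [← (Equiv.subtypeEquivRight h2).hasSum_iff] at *
  convert h3 using 1
  · rfl
  rw [Finset.sum_mul]
  refine Finset.sum_congr rfl fun l hl => ?_
  rw [thT, h.mem_shell.1 hl, ← Complex.exp_nat_mul]
  congr 2
  simp [pairC]; ring
/-- differentiability in `t` -/
theorem IsLeech.diff_t (h : IsLeech B) {f : LV → ℂ} {C : ℝ} (hf : ∀ l, ‖f l‖ ≤ C) (z : CV) :
    DifferentiableOn ℂ (fun t => ∑' l, f l * thT B t z l) {t | 0 < t.im} := by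
  intro t ht
  simp only [Set.mem_ofPred_eq] at ht
  have hC : 0 ≤ C := (norm_nonneg _).trans (hf 0)
  obtain ⟨C', -, hC'⟩ := exists_bound_mulVec (B := B) z
  obtain ⟨u, hu, hb⟩ := h.thT_bound (C := C') (half_pos ht)
  have ho : IsOpen {s : ℂ | t.im / 2 < s.im} := isOpen_lt continuous_const Complex.continuous_im
  refine (DifferentiableOn.differentiableAt (s := {s : ℂ | t.im / 2 < s.im})
    (differentiableOn_tsum_of_summable_norm (hu.mul_left C) (fun l => ?_) ho fun l s hs => ?_)
    (ho.mem_nhds (by simp; linarith))).differentiableWithinAt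
  · unfold thT; fun_prop
  · rw [norm_mul]
    exact mul_le_mul (hf l) (hb s z l (le_of_lt hs) hC') (norm_nonneg _) hC
theorem mdiff_of_diffOn {f : ℂ → ℂ} (hf : DifferentiableOn ℂ f {t | 0 < t.im}) :
    MDifferentiable 𝓘(ℂ) 𝓘(ℂ) fun τ : ℍ => f τ := by
  rw [UpperHalfPlane.mdifferentiable_iff]
  refine hf.congr fun z hz => ?_
  simp [UpperHalfPlane.ofComplex_apply_of_im_pos hz]
theorem coe_S_smul (τ : ℍ) : ((ModularGroup.S • τ : ℍ) : ℂ) = -(τ : ℂ)⁻¹ := by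
  rw [UpperHalfPlane.modular_S_smul]; change (-(τ : ℂ))⁻¹ = _; rw [inv_neg]
theorem coe_T_smul (τ : ℍ) : ((ModularGroup.T • τ : ℍ) : ℂ) = (τ : ℂ) + 1 := by
  rw [UpperHalfPlane.modular_T_smul]; simp [add_comm]
end

section
variable {B : Matrix (Fin 24) (Fin 24) ℤ}
theorem IsLeech.theta_form (h : IsLeech B) :
    ∃ F : ModularForm 𝒮ℒ 12, ∀ n, ((h.shell n).card : ℂ) = (qExpansion 1 F).coeff n := by
  have hs : ∀ τ : ℍ, HasSum (fun m : ℕ => ((h.shell m).card : ℂ) • (Function.Periodic.qParam 1 τ) ^ m)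
      (∑' l, thT B τ 0 l) := fun τ => by
    have := h.hasSum_shell (f := fun _ => 1) (C := 1) (by simp) τ.im_pos
    simpa [Function.Periodic.qParam] using this
  have hT : ∀ τ : ℍ, ∑' l, thT B (ModularGroup.T • τ : ℍ) 0 l = ∑' l, thT B τ 0 l := fun τ => by
    refine tsum_congr fun l => ?_
    rw [coe_T_smul, thT, thT, Complex.exp_eq_exp_iff_exists_int]
    exact ⟨hn B l, by rw [h.two_hn l]; push_cast; ring⟩
  have hS : ∀ τ : ℍ, ∑' l, thT B (ModularGroup.S • τ : ℍ) 0 l = (τ : ℂ) ^ (12 : ℤ) * ∑' l, thT B τ 0 l :=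
    fun τ => by
    have := h.theta_inv (t := τ) τ.im_pos 0
    rw [coe_S_smul]
    rw [smul_zero] at this
    rw [this]
    simp [pairC]
  have hd := mdiff_of_diffOn (h.diff_t (f := fun _ => 1) (C := 1) (by simp) 0)
  simp only [one_mul] at hd
  obtain ⟨F, hF⟩ := mkMF hd hT hS (isBoundedAtImInfty_of_hasSum_qExpansion one_pos hs)
  refine ⟨F, fun n => ?_⟩
  refine ModularFormClass.qExpansion_coeff_unique (c := fun m => ((h.shell m).card : ℂ))
    one_pos one_mem_strictPeriods_SL (fun τ => ?_) n
  rw [hF]; exact hs τ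
open EisensteinSeries ModularForm in
theorem E4_coeffs : ∀ n ≤ 6, (qExpansion 1 E₄).coeff n =
    (![1, 240, 2160, 6720, 17520, 30240, 60480] : Fin 7 → ℂ) (Fin.ofNat 7 n) := by
  intro n hn
  have : bernoulli 4 = -1 / 30 := by decide +kernel
  rw [E_qExpansion_coeff _ ⟨2, rfl⟩]
  have e2 : Nat.divisors 2 = {1,2} := by decide
  have e3 : Nat.divisors 3 = {1,3} := by decide
  have e4 : Nat.divisors 4 = {1,2,4} := by decide
  have e5 : Nat.divisors 5 = {1,5} := by decide
  have e6 : Nat.divisors 6 = {1,2,3,6} := by decide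
  interval_cases n <;> norm_num [this, ArithmeticFunction.sigma_apply, e2, e3, e4, e5, e6, Fin.ofNat]
open EisensteinSeries ModularForm in
theorem E6_coeffs : ∀ n ≤ 6, (qExpansion 1 E₆).coeff n =
    (![1, -504, -16632, -122976, -532728, -1575504, -4058208] : Fin 7 → ℂ) (Fin.ofNat 7 n) := by
  intro n hn
  have : bernoulli 6 = 1 / 42 := by decide +kernel
  rw [E_qExpansion_coeff _ ⟨3, rfl⟩]
  have e2 : Nat.divisors 2 = {1,2} := by decide
  have e3 : Nat.divisors 3 = {1,3} := by decide
  have e4 : Nat.divisors 4 = {1,2,4} := by decide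
  have e5 : Nat.divisors 5 = {1,5} := by decide
  have e6 : Nat.divisors 6 = {1,2,3,6} := by decide
  interval_cases n <;> norm_num [this, ArithmeticFunction.sigma_apply, e2, e3, e4, e5, e6, Fin.ofNat]
open EisensteinSeries ModularForm in
theorem IsLeech.card_shells (h : IsLeech B) : (h.shell 2).card = 196560 ∧
    (h.shell 3).card = 16773120 ∧ (h.shell 4).card = 398034000 ∧
    (h.shell 5).card = 4629381120 ∧ (h.shell 6).card = 34417656000 := by
  obtain ⟨F, hF⟩ := h.theta_form
  have e4 := E4_coeffs
  have e6 := E6_coeffs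
  set G : ModularForm 𝒮ℒ 12 := (7 / 12 : ℂ) • ModularForm.mcast (by decide) (E₄.pow 3) +
    (5 / 12 : ℂ) • ModularForm.mcast (by decide) (E₆.pow 2) with hG
  have hGq : qExpansion 1 G = (7 / 12 : ℂ) • (qExpansion 1 E₄ * (qExpansion 1 E₄ * qExpansion 1 E₄)) +
      (5 / 12 : ℂ) • (qExpansion 1 E₆ * qExpansion 1 E₆) := by
    rw [hG, FunLike.coe_add, ModularForm.qExpansion_add one_pos one_mem_strictPeriods_SL,
      FunLike.coe_smul, FunLike.coe_smul, ModularForm.qExpansion_smul one_pos one_mem_strictPeriods_SL,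
      ModularForm.qExpansion_smul one_pos one_mem_strictPeriods_SL, coe_mcast, coe_mcast,
      ModularForm.qExpansion_pow one_pos one_mem_strictPeriods_SL,
      ModularForm.qExpansion_pow one_pos one_mem_strictPeriods_SL]
    congr 2 <;> ring
  have c0 := e4 0 (by norm_num); have c1 := e4 1 (by norm_num); have c2 := e4 2 (by norm_num)
  have c3 := e4 3 (by norm_num); have c4 := e4 4 (by norm_num); have c5 := e4 5 (by norm_num)
  have c6 := e4 6 (by norm_num)
  have d0 := e6 0 (by norm_num); have d1 := e6 1 (by norm_num); have d2 := e6 2 (by norm_num)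
  have d3 := e6 3 (by norm_num); have d4 := e6 4 (by norm_num); have d5 := e6 5 (by norm_num)
  have d6 := e6 6 (by norm_num)
  simp [Fin.ofNat, -PowerSeries.coeff_zero_eq_constantCoeff] at c0 c1 c2 c3 c4 c5 c6 d0 d1 d2 d3 d4 d5 d6
  have key : ∀ n, (qExpansion 1 G).coeff n = _ := fun n => by
    rw [hGq, map_add, PowerSeries.coeff_smul, PowerSeries.coeff_smul, PowerSeries.coeff_mul,
      PowerSeries.coeff_mul]
  have s0 : (h.shell 0).card = 1 := by
    rw [Finset.card_eq_one]
    refine ⟨0, Finset.ext fun l => ?_⟩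
    rw [h.mem_shell, Finset.mem_singleton]
    constructor
    · intro hl; by_contra hne; have := h.2.2.1 l hne; simp at hl; omega
    · rintro rfl; simp [pairZ]
  have s1 : (h.shell 1).card = 0 := by
    rw [Finset.card_eq_zero, Finset.eq_empty_iff_forall_notMem]
    intro l hl; rw [h.mem_shell] at hl; exact h.2.2.2.2 l (by simpa using hl)
  have hFG : F - G = 0 := by
    apply sturm_bound_levelOne
    have : ((Int.toNat 12 / 12 : ℕ) : ℕ∞) = ((1 : ℕ) : ℕ∞) := by rfl
    rw [this]
    refine lt_of_lt_of_le (b := ((2 : ℕ) : ℕ∞)) (by norm_num) (PowerSeries.le_order _ _ ?_)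
    intro i hi
    have hi : i < 2 := by exact_mod_cast hi
    rw [FunLike.coe_sub, ModularForm.qExpansion_sub one_pos one_mem_strictPeriods_SL, map_sub, ← hF]
    interval_cases i
    · rw [s0, key]
      simp [PowerSeries.coeff_mul, -PowerSeries.coeff_zero_eq_constantCoeff, c0, d0]; norm_num
    · rw [s1, key]
      simp [PowerSeries.coeff_mul, -PowerSeries.coeff_zero_eq_constantCoeff, c0, d0,
        Finset.Nat.antidiagonal_succ, c1, d1]; norm_num
  have hFG' : F = G := sub_eq_zero.1 hFG
  have fin : ∀ n, ((h.shell n).card : ℂ) = _ := fun n => by rw [hF, hFG', key n]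
  refine ⟨?_, ?_, ?_, ?_, ?_⟩
  · have := fin 2
    simp [PowerSeries.coeff_mul, -PowerSeries.coeff_zero_eq_constantCoeff, c0, d0,
        Finset.Nat.antidiagonal_succ, c1, d1, c2, d2] at this
    norm_num at this; exact_mod_cast this
  · have := fin 3
    simp [PowerSeries.coeff_mul, -PowerSeries.coeff_zero_eq_constantCoeff, c0, d0,
        Finset.Nat.antidiagonal_succ, c1, d1, c2, d2, c3, d3] at this
    norm_num at this; exact_mod_cast this
  · have := fin 4
    simp [PowerSeries.coeff_mul, -PowerSeries.coeff_zero_eq_constantCoeff, c0, d0,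
        Finset.Nat.antidiagonal_succ, c1, d1, c2, d2, c3, d3, c4, d4] at this
    norm_num at this; exact_mod_cast this
  · have := fin 5
    simp [PowerSeries.coeff_mul, -PowerSeries.coeff_zero_eq_constantCoeff, c0, d0,
        Finset.Nat.antidiagonal_succ, c1, d1, c2, d2, c3, d3, c4, d4, c5, d5] at this
    norm_num at this; exact_mod_cast this
  · have := fin 6
    simp [PowerSeries.coeff_mul, -PowerSeries.coeff_zero_eq_constantCoeff, c0, d0,
        Finset.Nat.antidiagonal_succ, c1, d1, c2, d2, c3, d3, c4, d4, c5, d5, c6, d6] at this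
    norm_num at this; exact_mod_cast this
end

section
variable {B : Matrix (Fin 24) (Fin 24) ℤ}
theorem pairZ_add_left (u v w : LV) : pairZ B (u + v) w = pairZ B u w + pairZ B v w := by
  simp [pairZ, add_dotProduct]
theorem pairZ_add_right (u v w : LV) : pairZ B u (v + w) = pairZ B u v + pairZ B u w := by
  simp [pairZ, mulVec_add, dotProduct_add]
theorem pairZ_sub_left (u v w : LV) : pairZ B (u - v) w = pairZ B u w - pairZ B v w := by
  simp [pairZ, sub_dotProduct]
theorem pairZ_sub_right (u v w : LV) : pairZ B u (v - w) = pairZ B u v - pairZ B u w := by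
  simp [pairZ, mulVec_sub, dotProduct_sub]
theorem pairZ_neg_left (u v : LV) : pairZ B (-u) v = -pairZ B u v := by
  simp [pairZ]
theorem pairZ_neg_right (u v : LV) : pairZ B u (-v) = -pairZ B u v := by
  simp [pairZ, mulVec_neg]
theorem pairZ_smul_left (c : ℤ) (u v : LV) : pairZ B (c • u) v = c * pairZ B u v := by
  rw [pairZ, smul_dotProduct, pairZ, smul_eq_mul]
theorem pairZ_smul_right (c : ℤ) (u v : LV) : pairZ B u (c • v) = c * pairZ B u v := by
  rw [pairZ, mulVec_smul, dotProduct_smul, pairZ, smul_eq_mul]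
theorem pairZ_zero_left (v : LV) : pairZ B 0 v = 0 := by simp [pairZ]
theorem pairZ_zero_right (v : LV) : pairZ B v 0 = 0 := by simp [pairZ]
theorem pairZ_sum_left {ι : Type*} (s : Finset ι) (f : ι → LV) (v : LV) :
    pairZ B (∑ i ∈ s, f i) v = ∑ i ∈ s, pairZ B (f i) v := by
  simp [pairZ, sum_dotProduct]
theorem IsLeech.comm (h : IsLeech B) (u v : LV) : pairZ B u v = pairZ B v u := by
  rw [pairZ, pairZ, dotProduct_mulVec, ← mulVec_transpose, h.1.eq, dotProduct_comm]
theorem IsLeech.N_add (h : IsLeech B) (u v : LV) :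
    pairZ B (u + v) (u + v) = pairZ B u u + 2 * pairZ B u v + pairZ B v v := by
  rw [pairZ_add_left, pairZ_add_right, pairZ_add_right, h.comm v u]; ring
theorem IsLeech.N_sub (h : IsLeech B) (u v : LV) :
    pairZ B (u - v) (u - v) = pairZ B u u - 2 * pairZ B u v + pairZ B v v := by
  rw [pairZ_sub_left, pairZ_sub_right, pairZ_sub_right, h.comm v u]; ring
theorem N_smul (c : ℤ) (v : LV) : pairZ B (c • v) (c • v) = c ^ 2 * pairZ B v v := by
  rw [pairZ_smul_left, pairZ_smul_right]; ring
theorem N_neg (v : LV) : pairZ B (-v) (-v) = pairZ B v v := by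
  rw [pairZ_neg_left, pairZ_neg_right, neg_neg]
theorem IsLeech.four_le (h : IsLeech B) {v : LV} (hv : v ≠ 0) : 4 ≤ pairZ B v v := by
  have h1 := h.2.2.1 v hv
  have h2 := h.2.2.2.1 v
  have h3 := h.2.2.2.2 v
  obtain ⟨m, hm⟩ := h2; omega
theorem IsLeech.eq_zero (h : IsLeech B) {v : LV} (hv : pairZ B v v < 4) : v = 0 := by
  by_contra h0; have := h.four_le h0; omega
/-- congruence mod n -/
def cong (n : ℤ) (u v : LV) : Prop := ∃ w : LV, u = v + n • w
theorem cong.symm {n : ℤ} {u v : LV} (h : cong n u v) : cong n v u := by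
  obtain ⟨w, rfl⟩ := h; exact ⟨-w, by simp⟩
theorem cong.trans {n : ℤ} {u v x : LV} (h : cong n u v) (h' : cong n v x) : cong n u x := by
  obtain ⟨w, rfl⟩ := h; obtain ⟨y, rfl⟩ := h'; exact ⟨w + y, by simp [smul_add]; abel⟩
theorem cong.refl (n : ℤ) (u : LV) : cong n u u := ⟨0, by simp⟩
theorem cong2_iff (u v : LV) : cong 2 u v ↔ (fun i => (u i : ZMod 2)) = fun i => (v i : ZMod 2) := by
  constructor
  · rintro ⟨w, rfl⟩; funext i
    have : (2 : ZMod 2) = 0 := by decide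
    simp [this]
  · intro h
    have : ∀ i, ∃ c, u i = v i + 2 * c := fun i => by
      have := congrFun h i
      rw [ZMod.intCast_eq_intCast_iff_dvd_sub] at this
      obtain ⟨c, hc⟩ := this
      exact ⟨-c, by push_cast at hc; omega⟩
    choose w hw using this
    exact ⟨w, funext fun i => by simp [hw i]⟩
theorem IsLeech.cong2_short (h : IsLeech B) {u v : LV} (hc : cong 2 u v) (h1 : u ≠ v) (h2 : u ≠ -v) :
    16 + 2 * |pairZ B u v| ≤ pairZ B u u + pairZ B v v := by
  obtain ⟨w, rfl⟩ := hc
  have a : w ≠ 0 := by rintro rfl; simp at h1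
  have b : v + w ≠ 0 := fun hb => h2 (by
    have : w = -v := by rw [eq_neg_iff_add_eq_zero, add_comm]; exact hb
    rw [this]; funext i; simp; ring)
  have a' := h.four_le a
  have b' := h.four_le b
  rw [h.N_add] at b'
  rw [h.N_add, pairZ_add_left, pairZ_smul_left, pairZ_smul_right, N_smul, h.comm w v]
  rcases abs_cases (pairZ B v v + 2 * pairZ B v w) with ⟨e, -⟩ | ⟨e, -⟩ <;> rw [e] <;> linarith
theorem IsLeech.orth_card (h : IsLeech B) (Y : Finset LV) (h1 : ∀ y ∈ Y, pairZ B y y = 8)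
    (h2 : ∀ y ∈ Y, ∀ z ∈ Y, y ≠ z → pairZ B y z = 0) : Y.card ≤ 24 := by
  have hl : LinearIndependent ℤ (fun y : Y => (y : LV)) := by
    rw [Fintype.linearIndependent_iff]
    intro g hg i
    have h3 := congrArg (fun x => pairZ B x i) hg
    simp only [pairZ_sum_left, pairZ_smul_left, pairZ_zero_left] at h3
    rw [Finset.sum_eq_single i] at h3
    · rw [h1 i i.2] at h3; omega
    · intro b _ hb
      rw [h2 b b.2 i i.2 (fun hh => hb (Subtype.ext hh)), mul_zero]
    · intro hi; exact absurd (Finset.mem_univ i) hi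
  have := hl.fintype_card_le_finrank
  simpa using this
theorem IsLeech.half (h : IsLeech B) (X : Finset LV) (h1 : ∀ y ∈ X, pairZ B y y = 8)
    (hneg : ∀ y ∈ X, -y ∈ X)
    (h2 : ∀ y ∈ X, ∀ z ∈ X, y ≠ z → y ≠ -z → pairZ B y z = 0) :
    X.card ≤ 48 ∧ (X.card = 48 → ∃ F : Fin 24 → LV, (∀ i, F i ∈ X) ∧
      ∀ i j, i ≠ j → pairZ B (F i) (F j) = 0) := by
  classical
  set Y := X.filter (fun l => toLex l < toLex (-l)) with hY
  set Z := X.filter (fun l => ¬ toLex l < toLex (-l)) with hZ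
  have hne : ∀ l ∈ X, l ≠ -l := fun l hl he => by
    have := h1 l hl
    have h0 : l = 0 := by funext i; have := congrFun he i; simp at this ⊢; omega
    rw [h0, pairZ_zero_left] at this; omega
  have hYZ : Y.card = Z.card := by
    refine Finset.card_bij (fun l _ => -l) ?_ (fun _ _ _ _ => neg_inj.1) ?_
    · intro l hl
      rw [hY, Finset.mem_filter] at hl
      rw [hZ, Finset.mem_filter]
      exact ⟨hneg l hl.1, by rw [neg_neg]; exact hl.2.not_gt⟩
    · intro l hl
      rw [hZ, Finset.mem_filter] at hl
      refine ⟨-l, ?_, neg_neg l⟩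
      rw [hY, Finset.mem_filter]
      refine ⟨hneg l hl.1, ?_⟩
      rw [neg_neg]
      exact lt_of_le_of_ne (not_lt.1 hl.2) fun he => hne l hl.1 (toLex.injective he).symm
  have hsum : Y.card + Z.card = X.card := Finset.card_filter_add_card_filter_not _
  have horth : ∀ y ∈ Y, ∀ z ∈ Y, y ≠ z → pairZ B y z = 0 := fun y hy z hz hyz => by
    rw [hY, Finset.mem_filter] at hy hz
    refine h2 y hy.1 z hz.1 hyz ?_
    rintro rfl
    have := hy.2; rw [neg_neg] at this
    exact absurd hz.2 this.not_gt
  have hY24 := h.orth_card Y (fun y hy => h1 y (Finset.mem_filter.1 hy).1) horth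
  refine ⟨by omega, fun hX => ?_⟩
  have hc : Y.card = 24 := by omega
  let e := (Y.equivFinOfCardEq hc).symm
  exact ⟨fun i => e i, fun i => (Finset.mem_filter.1 (e i).2).1, fun i j hij =>
    horth _ (e i).2 _ (e j).2 fun hh => hij (e.injective (Subtype.ext hh))⟩
theorem IsLeech.class_two (h : IsLeech B) (v : LV) :
    (∃ s, cong 2 s v ∧ (pairZ B s s = 0 ∨ pairZ B s s = 4 ∨ pairZ B s s = 6)) ∨
    ∃ F : Fin 24 → LV, (∀ i, cong 2 (F i) v) ∧ (∀ i, pairZ B (F i) (F i) = 8) ∧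
      ∀ i j, i ≠ j → pairZ B (F i) (F j) = 0 := by
  classical
  set r : LV → (Fin 24 → ZMod 2) := fun l i => (l i : ZMod 2) with hr
  let fb : ℕ → (Fin 24 → ZMod 2) → Finset LV := fun n c => (h.shell n).filter (fun l => r l = c)
  let W : (Fin 24 → ZMod 2) → ℕ := fun c =>
    48 * (fb 0 c).card + 24 * (fb 2 c).card + 24 * (fb 3 c).card + (fb 4 c).card
  have hfb : ∀ n l c, l ∈ fb n c ↔ pairZ B l l = 2 * n ∧ r l = c := fun n l c => by
    simp only [fb, Finset.mem_filter, h.mem_shell]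
  have hcong : ∀ {l m c}, r l = c → r m = c → cong 2 l m := fun {l m c} h1 h2 => by
    rw [cong2_iff]; exact h1.trans h2.symm
  have hrneg : ∀ l, r (-l) = r l := fun l => by
    refine (cong2_iff _ _).1 ⟨-l, ?_⟩; funext i; simp; ring
  have small : ∀ c, (∃ l, r l = c ∧ (pairZ B l l = 0 ∨ pairZ B l l = 4 ∨ pairZ B l l = 6)) → W c ≤ 48 := by
    rintro c ⟨l, hl, hN⟩
    have key : ∀ n ≤ 4, ∀ m ∈ fb n c, m = l ∨ m = -l := fun n hn m hm => by
      rw [hfb] at hm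
      by_contra hcon
      push Not at hcon
      have := h.cong2_short (hcong hm.2 hl) hcon.1 hcon.2
      have := abs_nonneg (pairZ B m l)
      omega
    have kN : ∀ n ≤ 4, ∀ m ∈ fb n c, pairZ B l l = 2 * n := fun n hn m hm => by
      rcases key n hn m hm with rfl | rfl
      · exact ((hfb _ _ _).1 hm).1
      · rw [← ((hfb _ _ _).1 hm).1, N_neg]
    have k2 : ∀ n ≤ 4, (fb n c).card ≤ 2 := fun n hn => by
      refine (Finset.card_le_card (t := {l, -l}) fun m hm => ?_).trans Finset.card_le_two
      simpa using key n hn m hm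
    have k0 : ∀ n : ℕ, n ≤ 4 → pairZ B l l ≠ 2 * n → (fb n c).card = 0 := fun n hn hh => by
      rw [Finset.card_eq_zero, Finset.eq_empty_iff_forall_notMem]
      exact fun m hm => hh (kN n hn m hm)
    show 48 * (fb 0 c).card + 24 * (fb 2 c).card + 24 * (fb 3 c).card + (fb 4 c).card ≤ 48
    have z4 := k0 4 (by norm_num) (by push_cast; omega)
    rcases hN with hN | hN | hN
    · have z2 := k0 2 (by norm_num) (by push_cast; omega)
      have z3 := k0 3 (by norm_num) (by push_cast; omega)
      have : (fb 0 c).card ≤ 1 := by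
        rw [Finset.card_le_one]
        intro a ha b hb
        rw [h.eq_zero (v := a) (by rw [((hfb _ _ _).1 ha).1]; norm_num),
          h.eq_zero (v := b) (by rw [((hfb _ _ _).1 hb).1]; norm_num)]
      omega
    · have z2 := k0 0 (by norm_num) (by push_cast; omega)
      have z3 := k0 3 (by norm_num) (by push_cast; omega)
      have := k2 2 (by norm_num)
      omega
    · have z2 := k0 0 (by norm_num) (by push_cast; omega)
      have z3 := k0 2 (by norm_num) (by push_cast; omega)
      have := k2 3 (by norm_num)
      omega
  have big : ∀ c, (¬ ∃ l, r l = c ∧ (pairZ B l l = 0 ∨ pairZ B l l = 4 ∨ pairZ B l l = 6)) →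
      W c ≤ 48 ∧ (W c = 48 → ∃ F : Fin 24 → LV, (∀ i, F i ∈ fb 4 c) ∧
      ∀ i j, i ≠ j → pairZ B (F i) (F j) = 0) := by
    intro c hc
    push Not at hc
    have z0 : (fb 0 c).card = 0 := by
      rw [Finset.card_eq_zero, Finset.eq_empty_iff_forall_notMem]
      exact fun m hm => (hc m ((hfb _ _ _).1 hm).2).1 (by rw [((hfb _ _ _).1 hm).1]; norm_num)
    have z2 : (fb 2 c).card = 0 := by
      rw [Finset.card_eq_zero, Finset.eq_empty_iff_forall_notMem]
      exact fun m hm => (hc m ((hfb _ _ _).1 hm).2).2.1 (by rw [((hfb _ _ _).1 hm).1]; norm_num)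
    have z3 : (fb 3 c).card = 0 := by
      rw [Finset.card_eq_zero, Finset.eq_empty_iff_forall_notMem]
      exact fun m hm => (hc m ((hfb _ _ _).1 hm).2).2.2 (by rw [((hfb _ _ _).1 hm).1]; norm_num)
    have hW : W c = (fb 4 c).card := by
      show 48 * (fb 0 c).card + 24 * (fb 2 c).card + 24 * (fb 3 c).card + (fb 4 c).card = _
      rw [z0, z2, z3]; simp
    rw [hW]
    refine h.half (fb 4 c) (fun y hy => by rw [((hfb _ _ _).1 hy).1]; norm_num) (fun y hy => ?_)
      fun y hy z hz hyz hyz' => ?_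
    · rw [hfb] at hy ⊢; rw [N_neg, hrneg]; exact hy
    · rw [hfb] at hy hz
      have := h.cong2_short (hcong hy.2 hz.2) hyz hyz'
      have h0 := abs_nonneg (pairZ B y z)
      exact abs_eq_zero.1 (by omega)
  have hle : ∀ c, W c ≤ 48 := fun c => by
    by_cases hc : ∃ l, r l = c ∧ (pairZ B l l = 0 ∨ pairZ B l l = 4 ∨ pairZ B l l = 6)
    · exact small c hc
    · exact (big c hc).1
  have hcard : ∀ n, ∑ c, (fb n c).card = (h.shell n).card := fun n =>
    (Finset.card_eq_sum_card_fiberwise (f := r) (t := Finset.univ) fun _ _ => by simp).symm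
  have s0 : 1 ≤ (h.shell 0).card := by
    rw [Nat.one_le_iff_ne_zero, Finset.card_ne_zero]
    exact ⟨0, by rw [h.mem_shell, pairZ_zero_left]; simp⟩
  have hsum : ∑ c : Fin 24 → ZMod 2, 48 ≤ ∑ c, W c := by
    simp only [W, Finset.sum_add_distrib, ← Finset.mul_sum, hcard]
    obtain ⟨n2, n3, n4, -, -⟩ := h.card_shells
    rw [n2, n3, n4, Finset.sum_const, Finset.card_univ, Fintype.card_fun, ZMod.card, Fintype.card_fin]
    norm_num; omega
  have heq : ∀ c, W c = 48 := fun c => by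
    have := (Finset.sum_eq_sum_iff_of_le fun c _ => hle c).1
      (le_antisymm (Finset.sum_le_sum fun c _ => hle c) hsum) c (Finset.mem_univ c)
    exact this
  by_cases hc : ∃ l, r l = r v ∧ (pairZ B l l = 0 ∨ pairZ B l l = 4 ∨ pairZ B l l = 6)
  · obtain ⟨l, hl, hN⟩ := hc
    exact Or.inl ⟨l, (cong2_iff _ _).2 hl, hN⟩
  · obtain ⟨F, hF, hF2⟩ := (big _ hc).2 (heq _)
    exact Or.inr ⟨F, fun i => (cong2_iff _ _).2 ((hfb _ _ _).1 (hF i)).2,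
      fun i => by rw [((hfb _ _ _).1 (hF i)).1]; norm_num, hF2⟩
end

section
variable {B : Matrix (Fin 24) (Fin 24) ℤ}
section Code
variable {ι : Type} [Fintype ι] [DecidableEq ι]
/-- reduction mod 2 -/
def rd (y : ι → ℤ) : ι → ZMod 2 := fun i => (y i : ZMod 2)
/-- 0/1 lift -/
def lft (c : ι → ZMod 2) : ι → ℤ := fun i => if c i = 0 then 0 else 1
def wt (c : ι → ZMod 2) : ℕ := (Finset.univ.filter fun i => c i ≠ 0).card
theorem rd_lft (c : ι → ZMod 2) : rd (lft c) = c := by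
  funext i; simp only [rd, lft]
  generalize c i = x; revert x; decide
theorem sum_lft (c : ι → ZMod 2) : ∑ i, lft c i = wt c := by
  simp only [lft, wt, Finset.card_filter, ne_eq]
  push_cast
  exact Finset.sum_congr rfl fun i _ => by split_ifs <;> simp_all
theorem rd_eq_iff (y z : ι → ℤ) : rd y = rd z ↔ ∃ w : ι → ℤ, y = z + (2 : ℤ) • w := by
  constructor
  · intro h
    have : ∀ i, ∃ c, y i = z i + 2 * c := fun i => by
      have := congrFun h i
      simp only [rd] at this
      rw [ZMod.intCast_eq_intCast_iff_dvd_sub] at this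
      obtain ⟨c, hc⟩ := this
      exact ⟨-c, by push_cast at hc; omega⟩
    choose w hw using this
    exact ⟨w, funext fun i => by simp [hw i]⟩
  · rintro ⟨w, rfl⟩; funext i
    have : (2 : ZMod 2) = 0 := by decide
    simp [rd, this]
theorem rd_add (y z : ι → ℤ) : rd (y + z) = rd y + rd z := by funext i; simp [rd]
theorem rd_neg (y : ι → ℤ) : rd (-y) = rd y := by
  funext i; simp [rd];
/-- self-dual doubly even codes of minimal weight 8 -/
structure Golay (C : Set (ι → ZMod 2)) : Prop where
  dual : ∀ c, c ∈ C ↔ ∀ d ∈ C, ∑ i, c i * d i = 0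
  four : ∀ c ∈ C, 4 ∣ wt c
  eight : ∀ c ∈ C, c ≠ 0 → 8 ≤ wt c
def inL (C : Set (ι → ZMod 2)) (x : ι → ℤ) : Prop := ∃ y : ι → ℤ, rd y ∈ C ∧
  ((x = (2 : ℤ) • y ∧ 4 ∣ ∑ i, y i) ∨ (x = (2 : ℤ) • y + 1 ∧ 4 ∣ ∑ i, y i + 2))
/-- abstract frame lattices -/
structure FL (L : AddSubgroup (ι → ℤ)) : Prop where
  four : ∀ w : ι → ℤ, 2 ∣ ∑ i, w i → (4 : ℤ) • w ∈ L
  int : ∀ x ∈ L, ∀ y ∈ L, 8 ∣ ∑ i, x i * y i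
  even : ∀ x ∈ L, 16 ∣ ∑ i, x i * x i
  root : ∀ x ∈ L, ∑ i, x i * x i ≠ 16
  dual : ∀ x, (∀ y ∈ L, 8 ∣ ∑ i, x i * y i) → x ∈ L
theorem sum_smul' (c : ℤ) (w : ι → ℤ) : ∑ i, (c • w) i = c * ∑ i, w i := by
  rw [Finset.mul_sum]; rfl
theorem sum_sq_parity (y : ι → ℤ) : 2 ∣ ∑ i, y i * y i - ∑ i, y i := by
  rw [← Finset.sum_sub_distrib]
  exact Finset.dvd_sum fun i _ => by
    have : y i * y i - y i = y i * (y i - 1) := by ring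
    rw [this]; exact even_iff_two_dvd.1 (Int.even_mul_pred_self _)
variable {L : AddSubgroup (ι → ℤ)}
theorem FL.no4 [Nonempty ι] (h : FL L) {w : ι → ℤ} (hw : (4 : ℤ) • w ∈ L) : 2 ∣ ∑ i, w i := by
  by_contra hc
  obtain ⟨a⟩ := ‹Nonempty ι›
  have h1 : 2 ∣ ∑ i, (w - (Pi.single a 1 : ι → ℤ)) i := by
    simp only [Pi.sub_apply, Finset.sum_sub_distrib, Finset.sum_pi_single']
    simp; omega
  have h2 := L.sub_mem hw (h.four _ h1)
  rw [← smul_sub, sub_sub_cancel] at h2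
  refine h.root _ h2 ?_
  rw [Finset.sum_eq_single a] <;> simp +contextual
theorem FL.evensum (h : FL L) {y : ι → ℤ} (hy : (2 : ℤ) • y ∈ L) : 2 ∣ ∑ i, y i ∧ 4 ∣ ∑ i, y i * y i := by
  have h1 := h.even _ hy
  have h2 : ∑ i, ((2 : ℤ) • y) i * ((2 : ℤ) • y) i = 4 * ∑ i, y i * y i := by
    rw [Finset.mul_sum]; refine Finset.sum_congr rfl fun i _ => ?_
    simp only [Pi.smul_apply, smul_eq_mul]; ring
  rw [h2] at h1
  have h3 := sum_sq_parity y
  omega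
theorem FL.par (h : FL L) {x : ι → ℤ} (hx : x ∈ L) (i j : ι) : 2 ∣ x i - x j := by
  have h1 : (4 : ℤ) • (Pi.single i 1 - Pi.single j 1 : ι → ℤ) ∈ L := h.four _ (by
    simp only [Pi.sub_apply, Finset.sum_sub_distrib, Finset.sum_pi_single']; simp)
  have h2 := h.int _ hx _ h1
  have h3 : ∑ k, x k * ((4 : ℤ) • (Pi.single i 1 - Pi.single j 1 : ι → ℤ)) k = 4 * (x i - x j) := by
    simp only [Pi.smul_apply, Pi.sub_apply, smul_eq_mul]
    have : ∀ k, x k * (4 * ((Pi.single i 1 : ι → ℤ) k - (Pi.single j 1 : ι → ℤ) k)) =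
      4 * (x k * (Pi.single i 1 : ι → ℤ) k - x k * (Pi.single j 1 : ι → ℤ) k) := fun k => by ring
    simp_rw [this]
    rw [← Finset.mul_sum, Finset.sum_sub_distrib]
    simp [Pi.single_apply]
  rw [h3] at h2; omega
theorem FL.signs [Nonempty ι] (h : FL L) : ∃ a : ι → ZMod 2, ∀ y : ι → ℤ, (2 : ℤ) • y ∈ L →
    (((∑ i, y i) / 2 : ℤ) : ZMod 2) = ∑ i, a i * rd y i := by
  let C : Submodule (ZMod 2) (ι → ZMod 2) :=
    { carrier := {c | ∃ y : ι → ℤ, (2 : ℤ) • y ∈ L ∧ rd y = c}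
      add_mem' := by
        rintro _ _ ⟨y, hy, rfl⟩ ⟨z, hz, rfl⟩
        exact ⟨y + z, by rw [smul_add]; exact L.add_mem hy hz, rd_add y z⟩
      zero_mem' := ⟨0, by simp, by funext i; simp [rd]⟩
      smul_mem' := by
        rintro c _ ⟨y, hy, rfl⟩
        have : c = 0 ∨ c = 1 := by revert c; decide
        rcases this with rfl | rfl
        · exact ⟨0, by simp, by funext i; simp [rd]⟩
        · exact ⟨y, hy, by simp⟩ }
  have wd : ∀ y z : ι → ℤ, (2 : ℤ) • y ∈ L → (2 : ℤ) • z ∈ L → rd y = rd z →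
      (((∑ i, y i) / 2 : ℤ) : ZMod 2) = (((∑ i, z i) / 2 : ℤ) : ZMod 2) := fun y z hy hz hyz => by
    obtain ⟨w, rfl⟩ := (rd_eq_iff _ _).1 hyz
    have h1 := L.sub_mem hy hz
    rw [← smul_sub, add_sub_cancel_left, smul_smul] at h1
    have h2 := h.no4 h1
    have h3 := (h.evensum hz).1
    have h4 : ∑ i, (z + (2 : ℤ) • w) i = ∑ i, z i + 2 * ∑ i, w i := by
      simp only [Pi.add_apply, Finset.sum_add_distrib, sum_smul']
    rw [h4, ZMod.intCast_eq_intCast_iff_dvd_sub]; push_cast; omega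
  choose! f hf1 hf2 using fun (c : ι → ZMod 2) (hc : c ∈ C) => (hc : ∃ y : ι → ℤ, (2 : ℤ) • y ∈ L ∧ rd y = c)
  let e : C →ₗ[ZMod 2] ZMod 2 := AddMonoidHom.toZModLinearMap 2
    (AddMonoidHom.mk' (fun c : C => (((∑ i, f c.1 i) / 2 : ℤ) : ZMod 2)) fun c d => by
      have := wd (f (c.1 + d.1)) (f c.1 + f d.1) (hf1 _ (C.add_mem c.2 d.2)) (by
        rw [smul_add]; exact L.add_mem (hf1 _ c.2) (hf1 _ d.2)) (by
        rw [rd_add, hf2 _ c.2, hf2 _ d.2, hf2 _ (C.add_mem c.2 d.2)])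
      show (((∑ i, f (c.1 + d.1) i) / 2 : ℤ) : ZMod 2) = _
      rw [this, ← Int.cast_add]
      congr 1
      simp only [Pi.add_apply, Finset.sum_add_distrib]
      have h1 := (h.evensum (hf1 _ c.2)).1
      have h2 := (h.evensum (hf1 _ d.2)).1
      omega)
  obtain ⟨g, hg⟩ := LinearMap.exists_extend e
  refine ⟨fun i => g (Pi.single i 1), fun y hy => ?_⟩
  have hyC : rd y ∈ C := ⟨y, hy, rfl⟩
  have h1 : g (rd y) = e ⟨rd y, hyC⟩ := by rw [← hg]; rfl
  have h2 : e ⟨rd y, hyC⟩ = (((∑ i, f (rd y) i) / 2 : ℤ) : ZMod 2) := rfl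
  rw [wd y _ hy (hf1 _ hyC) (hf2 _ hyC).symm, ← h2, ← h1]
  conv_lhs => rw [← Finset.univ_sum_single (rd y)]
  rw [map_sum]
  refine Finset.sum_congr rfl fun i _ => ?_
  rw [show (Pi.single i (rd y i) : ι → ZMod 2) = rd y i • Pi.single i 1 by
    rw [← Pi.single_smul]; simp, map_smul, smul_eq_mul, mul_comm]
theorem FL.code [Nonempty ι] (hι : Fintype.card ι = 24) (h : FL L)
    (he : ∀ y : ι → ℤ, (2 : ℤ) • y ∈ L → 4 ∣ ∑ i, y i) :
    ∃ C : Set (ι → ZMod 2), Golay C ∧ ∀ x, x ∈ L ↔ inL C x := by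
  set C : Set (ι → ZMod 2) := {c | ∃ y : ι → ℤ, (2 : ℤ) • y ∈ L ∧ rd y = c} with hC
  obtain ⟨a⟩ := id ‹Nonempty ι›
  have cast0 : ∀ y z : ι → ℤ, ((∑ i, y i * z i : ℤ) : ZMod 2) = ∑ i, rd y i * rd z i := fun y z => by
    push_cast; rfl
  have ev : ∀ y : ι → ℤ, (2 : ℤ) • y ∈ L ↔ rd y ∈ C ∧ 4 ∣ ∑ i, y i := fun y => by
    refine ⟨fun hy => ⟨⟨y, hy, rfl⟩, he y hy⟩, ?_⟩
    rintro ⟨⟨z, hz, hzy⟩, h4⟩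
    obtain ⟨w, rfl⟩ := (rd_eq_iff _ _).1 hzy.symm
    have h5 := he z hz
    rw [smul_add, smul_smul]
    refine L.add_mem hz (h.four w ?_)
    have : ∑ i, (z + (2 : ℤ) • w) i = ∑ i, z i + 2 * ∑ i, w i := by
      simp only [Pi.add_apply, Finset.sum_add_distrib, sum_smul']
    rw [this] at h4; omega
  have evenodd : ∀ x ∈ L, (∃ y, x = (2 : ℤ) • y) ∨ ∃ y : ι → ℤ, x = (2 : ℤ) • y + 1 := fun x hx => by
    rcases Int.even_or_odd (x a) with h0 | h0
    · left
      refine ⟨fun i => x i / 2, funext fun i => ?_⟩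
      have := h.par hx i a
      obtain ⟨m, hm⟩ := h0
      simp only [Pi.smul_apply, smul_eq_mul]; omega
    · right
      refine ⟨fun i => x i / 2, funext fun i => ?_⟩
      have := h.par hx i a
      obtain ⟨m, hm⟩ := h0
      simp only [Pi.smul_apply, smul_eq_mul, Pi.add_apply, Pi.one_apply]; omega
  have so : ∀ y z : ι → ℤ, (2 : ℤ) • y ∈ L → (2 : ℤ) • z ∈ L → 2 ∣ ∑ i, y i * z i := fun y z hy hz => by
    have h1 := h.int _ hy _ hz
    have h2 : ∑ i, ((2 : ℤ) • y) i * ((2 : ℤ) • z) i = 4 * ∑ i, y i * z i := by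
      rw [Finset.mul_sum]; refine Finset.sum_congr rfl fun i _ => ?_
      simp only [Pi.smul_apply, smul_eq_mul]; ring
    rw [h2] at h1; omega
  -- odd vector
  obtain ⟨o, ho⟩ : ∃ o : ι → ℤ, (2 : ℤ) • o + 1 ∈ L := by
    by_contra hno
    push Not at hno
    have : (4 : ℤ) • (Pi.single a 1 : ι → ℤ) ∈ L := by
      refine h.dual _ fun y hy => ?_
      rcases evenodd y hy with ⟨z, rfl⟩ | ⟨z, rfl⟩
      · rw [Finset.sum_eq_single a]
        · simp only [Pi.smul_apply, smul_eq_mul, Pi.single_eq_same]; omega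
        · intro b _ hb; simp [hb]
        · simp
      · exact absurd hy (hno z)
    have := h.no4 this
    simp at this
  have oneC : (1 : ι → ZMod 2) ∈ C := by
    refine ⟨(2 : ℤ) • o + 1, ?_, ?_⟩
    · rw [two_smul]; exact L.add_mem ho ho
    · rw [rd_add]; funext i
      have : (2 : ZMod 2) = 0 := by decide
      simp [rd, this]
  have dual : ∀ c, c ∈ C ↔ ∀ d ∈ C, ∑ i, c i * d i = 0 := by
    intro c
    constructor
    · rintro ⟨y, hy, rfl⟩ _ ⟨z, hz, rfl⟩
      rw [← cast0, ZMod.intCast_zmod_eq_zero_iff_dvd]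
      exact_mod_cast so y z hy hz
    · intro hd
      set y0 := lft c with hy0
      have hyc : rd y0 = c := rd_lft c
      have hsum : 2 ∣ ∑ i, y0 i := by
        have := hd 1 oneC
        have h2 := cast0 y0 1
        rw [hyc, show rd (1 : ι → ℤ) = 1 by funext i; simp [rd], this,
          ZMod.intCast_zmod_eq_zero_iff_dvd] at h2
        simpa using h2
      have hpair : ∀ z : ι → ℤ, (2 : ℤ) • z ∈ L → 2 ∣ ∑ i, y0 i * z i := fun z hz => by
        have := hd _ ⟨z, hz, rfl⟩
        rw [← hyc, ← cast0, ZMod.intCast_zmod_eq_zero_iff_dvd] at this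
        exact_mod_cast this
      have build : ∀ t : ℤ, 4 ∣ (2 * ∑ i, y0 i * o i + ∑ i, y0 i) - 2 * t →
          (2 : ℤ) • (y0 - (2 * t) • (Pi.single a 1 : ι → ℤ)) ∈ L := fun t ht => by
        have gen : ∀ z : ι → ℤ, ∑ i, ((2 : ℤ) • (y0 - (2 * t) • (Pi.single a 1 : ι → ℤ))) i * z i =
            2 * ∑ i, y0 i * z i - 4 * t * z a := fun z => by
          have : ∀ i, ((2 : ℤ) • (y0 - (2 * t) • (Pi.single a 1 : ι → ℤ))) i * z i =
              2 * (y0 i * z i) - 4 * t * ((Pi.single a 1 : ι → ℤ) i * z i) := fun i => by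
            simp only [Pi.smul_apply, Pi.sub_apply, smul_eq_mul]; ring
          simp_rw [this]
          rw [Finset.sum_sub_distrib, ← Finset.mul_sum, ← Finset.mul_sum]
          simp [Pi.single_apply]
        have gev : ∀ z : ι → ℤ, (2 : ℤ) • z ∈ L →
            8 ∣ ∑ i, ((2 : ℤ) • (y0 - (2 * t) • (Pi.single a 1 : ι → ℤ))) i * ((2 : ℤ) • z) i := fun z hz => by
          rw [gen]
          have h1 : ∑ i, y0 i * ((2 : ℤ) • z) i = 2 * ∑ i, y0 i * z i := by
            rw [Finset.mul_sum]; refine Finset.sum_congr rfl fun i _ => ?_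
            simp only [Pi.smul_apply, smul_eq_mul]; ring
          rw [h1]
          obtain ⟨m, hm⟩ := hpair z hz
          rw [hm]
          exact ⟨m - t * z a, by simp only [Pi.smul_apply, smul_eq_mul]; ring⟩
        refine h.dual _ fun x hx => ?_
        rcases evenodd x hx with ⟨z, rfl⟩ | ⟨z, rfl⟩
        · exact gev z hx
        · have h1 : (2 : ℤ) • (z - o) ∈ L := by
            have := L.sub_mem hx ho
            rwa [add_sub_add_right_eq_sub, ← smul_sub] at this
          have h2 := gev _ h1
          have h3 : ∀ i, ((2 : ℤ) • z + 1 : ι → ℤ) i = ((2 : ℤ) • (z - o)) i + ((2 : ℤ) • o + 1 : ι → ℤ) i :=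
            fun i => by simp only [Pi.smul_apply, Pi.sub_apply, Pi.add_apply, smul_eq_mul]; ring
          simp_rw [h3, mul_add, Finset.sum_add_distrib]
          refine dvd_add h2 ?_
          rw [gen]
          have h4 : ∑ i, y0 i * ((2 : ℤ) • o + 1 : ι → ℤ) i = 2 * ∑ i, y0 i * o i + ∑ i, y0 i := by
            rw [Finset.mul_sum, ← Finset.sum_add_distrib]
            refine Finset.sum_congr rfl fun i _ => ?_
            simp only [Pi.smul_apply, smul_eq_mul, Pi.add_apply, Pi.one_apply]; ring
          rw [h4]
          obtain ⟨m, hm⟩ := ht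
          refine ⟨m - t * o a, ?_⟩
          simp only [Pi.smul_apply, smul_eq_mul, Pi.add_apply, Pi.one_apply]
          linear_combination 2 * hm
      have mem : ∀ t : ℤ, (2 : ℤ) • (y0 - (2 * t) • (Pi.single a 1 : ι → ℤ)) ∈ L → c ∈ C := fun t ht =>
        ⟨_, ht, by rw [← hyc, rd_eq_iff]; exact ⟨(-t) • (Pi.single a 1 : ι → ℤ), by
          funext i; simp only [Pi.sub_apply, Pi.add_apply, Pi.smul_apply, smul_eq_mul]; ring⟩⟩
      obtain ⟨m, hm⟩ := hsum
      exact mem (∑ i, y0 i * o i + m) (build _ (by rw [hm]; exact ⟨0, by ring⟩))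
  have four : ∀ c ∈ C, 4 ∣ wt c := by
    rintro _ ⟨y, hy, rfl⟩
    have h1 := (h.evensum hy).2
    have h2 : (4 : ℤ) ∣ ∑ i, y i * y i - wt (rd y) := by
      rw [← sum_lft, ← Finset.sum_sub_distrib]
      refine Finset.dvd_sum fun i _ => ?_
      have hl : lft (rd y) i = if (2 : ℤ) ∣ y i then 0 else 1 := by
        simp only [lft]; congr 1; rw [rd, ZMod.intCast_zmod_eq_zero_iff_dvd]; rfl
      rw [hl]
      split_ifs with h0
      · obtain ⟨m, hm⟩ := h0
        rw [hm]; exact ⟨m * m, by push_cast; ring⟩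
      · have : y i % 2 = 1 := by push_cast at h0; omega
        obtain ⟨m, hm⟩ : ∃ m, y i = 2 * m + 1 := ⟨y i / 2, by omega⟩
        rw [hm]; exact ⟨m * m + m, by ring⟩
    omega
  refine ⟨C, ⟨dual, four, ?_⟩, fun x => ?_⟩
  · intro c hc h0
    have h4 := four c hc
    have hw0 : wt c ≠ 0 := by
      simp only [wt, Finset.card_ne_zero]
      obtain ⟨i, hi⟩ := Function.ne_iff.1 h0
      exact ⟨i, by simpa using hi⟩
    by_contra hlt
    have hw : wt c = 4 := by omega
    have h1 : (2 : ℤ) • lft c ∈ L := by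
      rw [ev, rd_lft, sum_lft, hw]; exact ⟨hc, by norm_num⟩
    refine h.root _ h1 ?_
    have : ∀ i, ((2 : ℤ) • lft c) i * ((2 : ℤ) • lft c) i = 4 * lft c i := fun i => by
      simp only [Pi.smul_apply, smul_eq_mul, lft]; split_ifs <;> norm_num
    simp_rw [this]
    rw [← Finset.mul_sum, sum_lft, hw]; norm_num
  · have oddL : ∀ y : ι → ℤ, (2 : ℤ) • y + 1 ∈ L → rd y ∈ C ∧ 4 ∣ ∑ i, y i + 2 := fun y hy => by
      have hyC : rd y ∈ C := by
        rw [dual]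
        rintro _ ⟨z, hz, rfl⟩
        rw [← cast0, ZMod.intCast_zmod_eq_zero_iff_dvd]
        have h1 := h.int _ hy _ hz
        have h2 : ∑ i, ((2 : ℤ) • y + 1 : ι → ℤ) i * ((2 : ℤ) • z) i = 4 * ∑ i, y i * z i + 2 * ∑ i, z i := by
          rw [Finset.mul_sum, Finset.mul_sum, ← Finset.sum_add_distrib]
          refine Finset.sum_congr rfl fun i _ => ?_
          simp only [Pi.smul_apply, smul_eq_mul, Pi.add_apply, Pi.one_apply]; ring
        have h3 := he z hz
        rw [h2] at h1; push_cast; omega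
      refine ⟨hyC, ?_⟩
      obtain ⟨z, hz, hzy⟩ := id hyC
      obtain ⟨w, rfl⟩ := (rd_eq_iff _ _).1 hzy.symm
      have h3 := he z hz
      have h1 : (4 : ℤ) • w + 1 ∈ L := by
        have := L.sub_mem hy hz
        rwa [smul_add, smul_smul, add_assoc, add_sub_cancel_left] at this
      have h2 := h.even _ h1
      have h4 : ∑ i, ((4 : ℤ) • w + 1 : ι → ℤ) i * ((4 : ℤ) • w + 1 : ι → ℤ) i =
          16 * ∑ i, w i * w i + 8 * ∑ i, w i + 24 := by
        have : (24 : ℤ) = ∑ i : ι, 1 := by simp [hι]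
        rw [Finset.mul_sum, Finset.mul_sum, ← Finset.sum_add_distrib, this, ← Finset.sum_add_distrib]
        refine Finset.sum_congr rfl fun i _ => ?_
        simp only [Pi.smul_apply, smul_eq_mul, Pi.add_apply, Pi.one_apply]; ring
      have : ∑ i, (z + (2 : ℤ) • w) i = ∑ i, z i + 2 * ∑ i, w i := by
        simp only [Pi.add_apply, Finset.sum_add_distrib, sum_smul']
      rw [this]; rw [h4] at h2; omega
    constructor
    · intro hx
      rcases evenodd x hx with ⟨y, rfl⟩ | ⟨y, rfl⟩
      · exact ⟨y, ((ev y).1 hx).1, Or.inl ⟨by rfl, ((ev y).1 hx).2⟩⟩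
      · exact ⟨y, (oddL y hx).1, Or.inr ⟨by rfl, (oddL y hx).2⟩⟩
    · rintro ⟨y, hyC, ⟨rfl, h4⟩ | ⟨rfl, h4⟩⟩
      · exact (ev y).2 ⟨hyC, h4⟩
      · obtain ⟨hoC, ho4⟩ := oddL o ho
        have : (2 : ℤ) • (y - o) ∈ L := by
          rw [ev]
          constructor
          · rw [sub_eq_add_neg, rd_add, rd_neg, dual]
            intro d hd
            simp only [Pi.add_apply, add_mul, Finset.sum_add_distrib]
            rw [(dual _).1 hyC d hd, (dual _).1 hoC d hd, add_zero]
          · simp only [Pi.sub_apply, Finset.sum_sub_distrib]; omega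
        have h5 := L.add_mem this ho
        rw [smul_sub, ← add_assoc, sub_add_cancel] at h5
        exact h5
end Code
end

section
variable {B : Matrix (Fin 24) (Fin 24) ℤ}
section Frames
variable {ι : Type} [Fintype ι] [DecidableEq ι]
/-- coordinate frames -/
structure LFr (B : Matrix (Fin 24) (Fin 24) ℤ) (F : ι → LV) : Prop where
  n8 : ∀ i, pairZ B (F i) (F i) = 8
  orth : ∀ i j, i ≠ j → pairZ B (F i) (F j) = 0
  cg : ∀ i j, cong 2 (F i) (F j)
theorem LFr.pp {F : ι → LV} (hF : LFr B F) (i j : ι) :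
    pairZ B (F i) (F j) = if i = j then 8 else 0 := by
  split_ifs with h
  · rw [h]; exact hF.n8 j
  · exact hF.orth i j h
theorem LFr.eight (hι : Fintype.card ι = 24) {F : ι → LV} (hF : LFr B F) (v : LV) :
    (8 : ℤ) • v = ∑ i, pairZ B v (F i) • F i := by
  have e : ι ≃ Fin 24 := Fintype.equivFinOfCardEq hι
  set M : Matrix (Fin 24) (Fin 24) ℤ := Matrix.of fun i k => F (e.symm i) k with hM
  have h1 : M * B * Mᵀ = (8 : ℤ) • (1 : Matrix (Fin 24) (Fin 24) ℤ) := by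
    ext i j
    have : (M * B * Mᵀ) i j = pairZ B (F (e.symm i)) (F (e.symm j)) := by
      rw [Matrix.mul_assoc, pairZ]
      simp only [Matrix.mul_apply, dotProduct, mulVec, hM, Matrix.of_apply, Matrix.transpose_apply]
    rw [this, hF.pp]
    simp [Matrix.one_apply]
  have h2 : B * Mᵀ * M = (8 : ℤ) • (1 : Matrix (Fin 24) (Fin 24) ℤ) := by
    have inj : Function.Injective fun X : Matrix (Fin 24) (Fin 24) ℤ => X.map (Int.cast : ℤ → ℚ) :=
      Matrix.map_injective Int.cast_injective
    apply inj
    have h3 := congrArg (fun X : Matrix (Fin 24) (Fin 24) ℤ => X.map (Int.castRingHom ℚ)) h1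
    have sm : ((8 : ℤ) • (1 : Matrix (Fin 24) (Fin 24) ℤ)).map (Int.castRingHom ℚ) = (8 : ℚ) • 1 := by
      ext i j; rw [Matrix.map_apply, Matrix.smul_apply, Matrix.smul_apply]; simp [Matrix.one_apply]
    simp only [Matrix.map_mul, sm] at h3
    show (B * Mᵀ * M).map (Int.castRingHom ℚ) = ((8 : ℤ) • (1 : Matrix (Fin 24) (Fin 24) ℤ)).map (Int.castRingHom ℚ)
    simp only [Matrix.map_mul, sm]
    have h4 : M.map (Int.castRingHom ℚ) * ((8 : ℚ)⁻¹ • (B.map (Int.castRingHom ℚ) * Mᵀ.map (Int.castRingHom ℚ))) = 1 := by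
      rw [Matrix.mul_smul, ← Matrix.mul_assoc, h3, smul_smul]; norm_num
    have h5 := mul_eq_one_comm.1 h4
    rw [Matrix.smul_mul] at h5
    rw [← h5, smul_smul]; norm_num
  have h3 : v ᵥ* (B * Mᵀ * M) = (8 : ℤ) • v := by rw [h2, Matrix.vecMul_smul, Matrix.vecMul_one]
  rw [← h3]
  have h4 : ∀ i, (v ᵥ* (B * Mᵀ)) i = pairZ B v (F (e.symm i)) := fun i => by
    rw [← Matrix.vecMul_vecMul, Matrix.vecMul_transpose, pairZ, Matrix.dotProduct_mulVec]
    simp only [mulVec, dotProduct, hM, Matrix.of_apply]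
    exact Finset.sum_congr rfl fun k _ => mul_comm _ _
  funext k
  rw [← Matrix.vecMul_vecMul, Finset.sum_apply, ← e.symm.sum_comp]
  simp only [Matrix.vecMul, dotProduct, Pi.smul_apply, smul_eq_mul]
  exact Finset.sum_congr rfl fun i _ => by
    have := h4 i
    simp only [Matrix.vecMul, dotProduct] at this
    rw [this]; simp [hM]
theorem LFr.inner (h : IsLeech B) (hι : Fintype.card ι = 24) {F : ι → LV} (hF : LFr B F) (u v : LV) :
    8 * pairZ B u v = ∑ i, pairZ B u (F i) * pairZ B v (F i) := by
  rw [← pairZ_smul_left, hF.eight hι, pairZ_sum_left]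
  exact Finset.sum_congr rfl fun i _ => by rw [pairZ_smul_left, h.comm (F i)]
def coL (B : Matrix (Fin 24) (Fin 24) ℤ) (F : ι → LV) : AddSubgroup (ι → ℤ) :=
  (AddMonoidHom.mk' (fun v : LV => fun i => pairZ B v (F i)) fun u v => by
    funext i; exact pairZ_add_left _ _ _).range
theorem mem_coL {F : ι → LV} {x : ι → ℤ} : x ∈ coL B F ↔ ∃ v, ∀ i, pairZ B v (F i) = x i := by
  simp only [coL, AddMonoidHom.mem_range, AddMonoidHom.mk'_apply, funext_iff]
theorem LFr.FL [Nonempty ι] (h : IsLeech B) (hι : Fintype.card ι = 24) {F : ι → LV} (hF : LFr B F) :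
    FL (coL B F) := by
  have ps : ∀ (w : ι → ℤ) j, pairZ B (∑ i, w i • F i) (F j) = 8 * w j := fun w j => by
    rw [pairZ_sum_left, Finset.sum_eq_single j]
    · rw [pairZ_smul_left, hF.n8, mul_comm]
    · intro i _ hij; rw [pairZ_smul_left, hF.orth i j hij, mul_zero]
    · simp
  have key : ∀ x ∈ coL B F, ∀ y ∈ coL B F, ∃ u v, (∑ i, x i * y i = 8 * pairZ B u v) ∧ (x = y → u = v) := by
    intro x hx y hy
    obtain ⟨u, hu⟩ := mem_coL.1 hx
    by_cases hxy : x = y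
    · subst hxy
      exact ⟨u, u, by simp only [hF.inner h hι, hu], fun _ => rfl⟩
    · obtain ⟨v, hv⟩ := mem_coL.1 hy
      exact ⟨u, v, by simp only [hF.inner h hι, hu, hv], fun e => absurd e hxy⟩
  refine ⟨fun w hw => ?_, fun x hx y hy => ?_, fun x hx => ?_, fun x hx => ?_, fun x hx => ?_⟩
  · obtain ⟨a⟩ := ‹Nonempty ι›
    choose k hk using fun i => hF.cg i a
    obtain ⟨m, hm⟩ := hw
    refine mem_coL.2 ⟨m • F a + ∑ i, w i • k i, fun j => ?_⟩
    have h1 : (2 : ℤ) • (m • F a + ∑ i, w i • k i) = ∑ i, w i • F i := by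
      have : ∀ i, w i • F i = w i • F a + (2 : ℤ) • (w i • k i) := fun i => by
        conv_lhs => rw [hk i]
        rw [smul_add, smul_comm]
      simp_rw [this]
      rw [Finset.sum_add_distrib, ← Finset.sum_smul, hm, smul_add, smul_smul, Finset.smul_sum]
    have h2 := ps w j
    rw [← h1, pairZ_smul_left] at h2
    simp only [Pi.smul_apply, smul_eq_mul]; omega
  · obtain ⟨u, v, e, -⟩ := key x hx y hy
    exact ⟨_, e⟩
  · obtain ⟨u, v, e, e'⟩ := key x hx x hx
    rw [e, e' rfl]
    obtain ⟨m, hm⟩ := h.2.2.2.1 v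
    exact ⟨m, by rw [hm]; ring⟩
  · obtain ⟨u, v, e, e'⟩ := key x hx x hx
    rw [e, e' rfl]
    have := h.2.2.2.2 v
    omega
  · set X : LV := ∑ i, x i • F i with hX
    have h8 : ∀ u, ∃ m, pairZ B u X = 8 * m := fun u => by
      obtain ⟨m, hm⟩ := hx (fun i => pairZ B u (F i)) (mem_coL.2 ⟨u, fun i => rfl⟩)
      refine ⟨m, ?_⟩
      rw [h.comm, hX, pairZ_sum_left, ← hm]
      exact Finset.sum_congr rfl fun i _ => by rw [pairZ_smul_left, h.comm]
    have hB : ∀ k, ∃ m, (B *ᵥ X) k = 8 * m := fun k => by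
      obtain ⟨m, hm⟩ := h8 (Pi.single k 1)
      exact ⟨m, by rw [← hm, pairZ]; simp⟩
    choose y hy using hB
    have h1 : X = (8 : ℤ) • (B.adjugate *ᵥ y) := by
      have : B *ᵥ X = (8 : ℤ) • y := funext hy
      rw [← Matrix.mulVec_smul, ← this, Matrix.mulVec_mulVec, Matrix.adjugate_mul, h.2.1]; simp
    refine mem_coL.2 ⟨B.adjugate *ᵥ y, fun j => ?_⟩
    have h2 := ps x j
    rw [← hX, h1, pairZ_smul_left] at h2
    omega
/-- normalised frames -/
structure NF (B : Matrix (Fin 24) (Fin 24) ℤ) (C : Set (ι → ZMod 2)) (F : ι → LV) : Prop where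
  frm : LFr B F
  gol : Golay C
  mem : ∀ x : ι → ℤ, (∃ v, ∀ i, pairZ B v (F i) = x i) ↔ inL C x
theorem inL_neg {C : Set (ι → ZMod 2)} (hC : Golay C) {x : ι → ℤ} (hx : inL C x)
    (h1 : (1 : ι → ZMod 2) ∈ C) (hι : Fintype.card ι = 24) : inL C (-x) := by
  obtain ⟨y, hy, ⟨rfl, h4⟩ | ⟨rfl, h4⟩⟩ := hx
  · exact ⟨-y, by rwa [rd_neg], Or.inl ⟨by rw [smul_neg], by simpa using h4⟩⟩
  · refine ⟨-y - 1, ?_, Or.inr ⟨?_, ?_⟩⟩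
    · rw [sub_eq_add_neg, ← neg_add, rd_neg, rd_add, hC.dual]
      intro d hd
      simp only [Pi.add_apply, add_mul, Finset.sum_add_distrib]
      rw [(hC.dual _).1 hy d hd, show rd (1 : ι → ℤ) = 1 by funext i; simp [rd], (hC.dual _).1 h1 d hd, add_zero]
    · funext i; simp only [Pi.neg_apply, Pi.add_apply, Pi.smul_apply, Pi.sub_apply, smul_eq_mul, Pi.one_apply]; ring
    · simp only [Pi.neg_apply, Pi.sub_apply, Finset.sum_sub_distrib, Finset.sum_neg_distrib, Pi.one_apply]
      simp only [Finset.sum_const, Finset.card_univ, hι, nsmul_eq_mul]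
      push_cast; omega
theorem LFr.flip {F : ι → LV} (hF : LFr B F) (e : ι → ℤ) (he : ∀ i, e i = 1 ∨ e i = -1) :
    LFr B (fun i => e i • F i) := by
  have c2 : ∀ i, cong 2 (e i • F i) (F i) := fun i => by
    rcases he i with h | h <;> rw [h]
    · rw [one_smul]; exact cong.refl _ _
    · exact ⟨-F i, by funext k; simp; ring⟩
  refine ⟨fun i => ?_, fun i j hij => ?_, fun i j => (c2 i).trans ((hF.cg i j).trans (c2 j).symm)⟩
  · rw [N_smul, hF.n8]; rcases he i with h | h <;> rw [h] <;> norm_num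
  · rw [pairZ_smul_left, pairZ_smul_right, hF.orth i j hij]; simp
theorem LFr.exists_NF (h : IsLeech B) (hι : Fintype.card ι = 24) {F : ι → LV} (hF : LFr B F) :
    ∃ (C : Set (ι → ZMod 2)) (e : ι → ℤ), (∀ i, e i = 1 ∨ e i = -1) ∧ NF B C (fun i => e i • F i) := by
  have : Nonempty ι := Fintype.card_pos_iff.1 (by omega)
  obtain ⟨a, ha⟩ := (hF.FL h hι).signs
  set e : ι → ℤ := fun i => if a i = 0 then 1 else -1 with he
  have he' : ∀ i, e i = 1 ∨ e i = -1 := fun i => by simp only [he]; split_ifs <;> simp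
  have hF' := hF.flip e he'
  obtain ⟨C, hC, hC'⟩ := (hF'.FL h hι).code hι (fun y hy => by
    obtain ⟨v, hv⟩ := mem_coL.1 hy
    have ee : ∀ i, e i * e i = 1 := fun i => by rcases he' i with h | h <;> rw [h] <;> norm_num
    have h1 : (2 : ℤ) • (fun i => e i * y i) ∈ coL B F := mem_coL.2 ⟨v, fun i => by
      have := hv i
      rw [pairZ_smul_right] at this
      simp only [Pi.smul_apply, smul_eq_mul] at this ⊢
      linear_combination e i * this - pairZ B v (F i) * ee i⟩
    have h2 := ha _ h1
    have h3 := ((hF.FL h hι).evensum h1).1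
    obtain ⟨m, hm⟩ := h3
    rw [hm, Int.mul_ediv_cancel_left _ (by norm_num)] at h2
    have h4 : ∑ i, y i = 2 * m + 2 * ∑ i, (if a i = 0 then 0 else y i) := by
      rw [← hm, Finset.mul_sum, ← Finset.sum_add_distrib]
      refine Finset.sum_congr rfl fun i _ => ?_
      simp only [he]; split_ifs <;> ring
    have h5 : ((∑ i, (if a i = 0 then 0 else y i) : ℤ) : ZMod 2) = ∑ i, a i * rd (fun i => e i * y i) i := by
      push_cast
      refine Finset.sum_congr rfl fun i _ => ?_
      simp only [rd, he]
      have : a i = 0 ∨ a i = 1 := by generalize a i = t; revert t; decide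
      rcases this with h | h <;> rw [h] <;> simp
    have h6 : ((m + ∑ i, (if a i = 0 then 0 else y i) : ℤ) : ZMod 2) = 0 := by
      rw [Int.cast_add, h5, ← h2]
      exact CharTwo.add_self_eq_zero _
    rw [ZMod.intCast_zmod_eq_zero_iff_dvd] at h6
    rw [h4]; push_cast at h6; omega)
  exact ⟨C, e, he', hF', hC, fun x => by rw [← hC', mem_coL]⟩
variable {C : Set (ι → ZMod 2)}
theorem wt_one (hι : Fintype.card ι = 24) : wt (1 : ι → ZMod 2) = 24 := by simp [wt, hι]
theorem self_prod (c : ι → ZMod 2) : ∑ i, c i * c i = (wt c : ZMod 2) := by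
  simp only [wt, Finset.card_filter]
  push_cast
  refine Finset.sum_congr rfl fun i _ => ?_
  generalize c i = x; revert x; decide
theorem Golay.one (hC : Golay C) : (1 : ι → ZMod 2) ∈ C := by
  rw [hC.dual]
  intro d hd
  have h1 := (hC.dual d).1 hd d hd
  have : ∀ x : ZMod 2, x * x = 1 * x := by decide
  simp_rw [this] at h1
  exact h1
theorem Golay.add (hC : Golay C) {c d : ι → ZMod 2} (hc : c ∈ C) (hd : d ∈ C) : c + d ∈ C := by
  rw [hC.dual]; intro e he
  simp only [Pi.add_apply, add_mul, Finset.sum_add_distrib]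
  rw [(hC.dual _).1 hc e he, (hC.dual _).1 hd e he, add_zero]
theorem Golay.zero (hC : Golay C) : 0 ∈ C := by rw [hC.dual]; simp
theorem NF.neg (hι : Fintype.card ι = 24) {F : ι → LV} (hF : NF B C F) : NF B C (fun i => -F i) := by
  have := hF.frm.flip (fun _ => -1) (fun _ => Or.inr rfl)
  simp only [_root_.neg_smul, one_smul] at this
  refine ⟨this, hF.gol, fun x => ?_⟩
  constructor
  · rintro ⟨v, hv⟩
    have := (hF.mem (-x)).1 ⟨v, fun i => by rw [Pi.neg_apply, ← hv i, pairZ_neg_right, neg_neg]⟩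
    simpa using inL_neg hF.gol this hF.gol.one hι
  · intro hx
    obtain ⟨v, hv⟩ := (hF.mem _).2 (inL_neg hF.gol hx hF.gol.one hι)
    exact ⟨v, fun i => by rw [pairZ_neg_right, hv]; simp⟩
/-- every norm-8 vector starts a normalised frame -/
theorem IsLeech.frame_of (h : IsLeech B) {f : LV} (hf : pairZ B f f = 8) :
    ∃ (C : Set (Fin 24 → ZMod 2)) (F : Fin 24 → LV) (i : Fin 24), NF B C F ∧ F i = f := by
  rcases h.class_two f with ⟨s, hs, hN⟩ | ⟨F, h1, h2, h3⟩
  · exfalso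
    have a : s ≠ f := by rintro rfl; omega
    have b : s ≠ -f := by rintro rfl; rw [N_neg] at hN; omega
    have := h.cong2_short hs a b
    have := abs_nonneg (pairZ B s f)
    omega
  have hF : LFr B F := ⟨h2, fun i j hij => h3 i j hij, fun i j => (h1 i).trans (h1 j).symm⟩
  obtain ⟨C, e, he, hNF⟩ := hF.exists_NF h (by simp)
  have key : ∃ i, f = F i ∨ f = -F i := by
    by_contra hno
    push Not at hno
    have orth : ∀ i, pairZ B f (F i) = 0 := fun i => by
      have := h.cong2_short (h1 i).symm (hno i).1 (hno i).2
      have h0 := abs_nonneg (pairZ B f (F i))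
      rw [hf, h2] at this
      exact abs_eq_zero.1 (by omega)
    have := hF.inner h (by simp) f f
    simp only [orth, hf] at this
    simp at this
  obtain ⟨i, hi⟩ := key
  have : e i • F i = f ∨ e i • F i = -f := by
    rcases he i with h | h <;> rcases hi with hi | hi <;> rw [h, hi] <;> simp
  rcases this with h' | h'
  · exact ⟨C, _, i, hNF, h'⟩
  · exact ⟨C, _, i, hNF.neg (by simp), by show -(e i • F i) = f; rw [h', neg_neg]⟩
/-- conjugacy mod 3 -/
def cj (B : Matrix (Fin 24) (Fin 24) ℤ) (u v : LV) : Prop :=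
  ∃ σ ∈ ConwayGroup B, cong 3 v (σ.mulVec u)
theorem NF.ext (h : IsLeech B) (hι : Fintype.card ι = 24) {F : ι → LV} (hF : LFr B F) {u v : LV}
    (huv : ∀ i, pairZ B u (F i) = pairZ B v (F i)) : u = v := by
  have h1 := hF.eight hι u
  simp_rw [huv] at h1
  rw [← hF.eight hι v] at h1
  exact smul_right_injective LV (by norm_num : (8 : ℤ) ≠ 0) h1
theorem mem_conway (h : IsLeech B) (σ : Matrix (Fin 24) (Fin 24) ℤ)
    (hσ : ∀ u v, pairZ B (σ *ᵥ u) (σ *ᵥ v) = pairZ B u v) : σ ∈ ConwayGroup B := by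
  have h1 : σᵀ * B * σ = B := by
    ext i j
    have := hσ (Pi.single i 1) (Pi.single j 1)
    simp only [pairZ] at this
    rw [Matrix.mulVec_mulVec, Matrix.dotProduct_mulVec, Matrix.vecMul_mulVec, ← Matrix.dotProduct_mulVec,
      ← Matrix.mul_assoc] at this
    simpa using this
  refine ⟨?_, h1⟩
  have := congrArg Matrix.det h1
  rw [Matrix.det_mul, Matrix.det_mul, Matrix.det_transpose, h.2.1] at this
  exact IsUnit.of_mul_eq_one σ.det (by linarith)
theorem pairZ_conway {σ : Matrix (Fin 24) (Fin 24) ℤ} (hσ : σ ∈ ConwayGroup B) (u v : LV) :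
    pairZ B (σ *ᵥ u) (σ *ᵥ v) = pairZ B u v := by
  simp only [pairZ]
  rw [Matrix.mulVec_mulVec, Matrix.dotProduct_mulVec, Matrix.vecMul_mulVec, ← Matrix.dotProduct_mulVec,
      ← Matrix.mul_assoc, hσ.2]
theorem NF.conj (h : IsLeech B) (hι : Fintype.card ι = 24) {F F' : ι → LV} (hF : NF B C F) (hF' : NF B C F')
    {u u' : LV} (hu : ∀ i, (3 : ℤ) ∣ pairZ B u' (F' i) - pairZ B u (F i)) : cj B u u' := by
  choose s hs using fun v => (hF'.mem _).2 ((hF.mem _).1 ⟨v, fun i => rfl⟩)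
  let sl : LV →ₗ[ℤ] LV := AddMonoidHom.toIntLinearMap (AddMonoidHom.mk' s fun u v =>
    NF.ext h hι hF'.frm fun i => by simp only [pairZ_add_left, hs])
  have hm : ∀ v, (LinearMap.toMatrix' sl) *ᵥ v = s v := fun v => by
    rw [← Matrix.toLin'_apply, Matrix.toLin'_toMatrix']; rfl
  refine ⟨LinearMap.toMatrix' sl, mem_conway h _ fun u v => ?_, ?_⟩
  · rw [hm, hm]
    have h1 := hF.frm.inner h hι u v
    have h2 := hF'.frm.inner h hι (s u) (s v)
    simp only [hs] at h2
    omega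
  · rw [hm]
    choose x hx using hu
    refine ⟨(3 : ℤ) • (u' - s u) - ∑ i, x i • F' i, ?_⟩
    have h1 := hF'.frm.eight hι (u' - s u)
    simp_rw [pairZ_sub_left, hs, hx, mul_smul] at h1
    rw [← Finset.smul_sum] at h1
    rw [smul_sub, ← h1]
    funext i; simp only [Pi.add_apply, Pi.sub_apply, Pi.smul_apply, smul_eq_mul]; ring
end Frames
end

section
variable {B : Matrix (Fin 24) (Fin 24) ℤ}
section Sextet
variable {ι : Type} [Fintype ι] [DecidableEq ι] {C : Set (ι → ZMod 2)}
def ind (s : Finset ι) : ι → ZMod 2 := fun i => if i ∈ s then 1 else 0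
def spt (c : ι → ZMod 2) : Finset ι := Finset.univ.filter fun i => c i ≠ 0
theorem ind_spt (c : ι → ZMod 2) : ind (spt c) = c := by
  funext i; simp only [ind, spt, Finset.mem_filter, Finset.mem_univ, true_and]
  generalize c i = x; revert x; decide
theorem spt_ind (s : Finset ι) : spt (ind s) = s := by
  ext i; simp [ind, spt]
theorem wt_ind (s : Finset ι) : wt (ind s) = s.card := by
  have := spt_ind s
  simp only [spt] at this
  rw [wt, this]
theorem ind_add (s t : Finset ι) : ind s + ind t = ind (symmDiff s t) := by
  funext i; simp only [ind, Pi.add_apply, Finset.mem_symmDiff]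
  by_cases a : i ∈ s <;> by_cases b : i ∈ t <;> simp [a, b]
  exact CharTwo.add_self_eq_zero 1
theorem card_sd (s t : Finset ι) : (symmDiff s t).card + 2 * (s ∩ t).card = s.card + t.card := by
  have h1 := Finset.card_sdiff_add_card_inter s t
  have h2 := Finset.card_sdiff_add_card_inter t s
  rw [Finset.inter_comm] at h2
  have h3 : (symmDiff s t).card = (s \ t).card + (t \ s).card := by
    rw [symmDiff_def, Finset.sup_eq_union, Finset.card_union_of_disjoint]
    exact disjoint_sdiff_sdiff
  omega
theorem Golay.sd (hC : Golay C) {s t : Finset ι} (hs : ind s ∈ C) (ht : ind t ∈ C) : ind (symmDiff s t) ∈ C := by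
  rw [← ind_add]; exact hC.add hs ht
theorem Golay.min8 (hC : Golay C) {s : Finset ι} (hs : ind s ∈ C) (h0 : s.Nonempty) : 8 ≤ s.card := by
  rw [← wt_ind]; refine hC.eight _ hs fun h => ?_
  have := spt_ind s
  rw [h] at this
  rw [← this] at h0
  simp [spt] at h0
theorem Golay.ev (hC : Golay C) {s t : Finset ι} (hs : ind s ∈ C) (ht : ind t ∈ C) : 2 ∣ (s ∩ t).card := by
  have h1 := hC.four _ hs
  have h2 := hC.four _ ht
  have h3 := hC.four _ (hC.sd hs ht)
  rw [wt_ind] at h1 h2 h3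
  have := card_sd s t
  omega
theorem Golay.five_eq (hC : Golay C) {s t : Finset ι} (hs : ind s ∈ C) (ht : ind t ∈ C) (h1 : s.card = 8)
    (h2 : t.card = 8) (h3 : 5 ≤ (s ∩ t).card) : s = t := by
  by_contra hne
  have := hC.min8 (hC.sd hs ht) (by
    rw [Finset.nonempty_iff_ne_empty]; intro h; exact hne (symmDiff_eq_bot.1 h))
  have := card_sd s t
  omega
theorem NF.five (h : IsLeech B) (hι : Fintype.card ι = 24) {F : ι → LV} (hF : NF B C F) {T : Finset ι}
    (hT : T.card = 4) {p : ι} (hp : p ∉ T) :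
    ∃ T' : Finset ι, p ∈ T' ∧ T'.card = 4 ∧ Disjoint T T' ∧ ind (T ∪ T') ∈ C := by
  have hs : ∑ i, (if i ∈ T then (1 : ℤ) else 0) = 4 := by simp [hT]
  obtain ⟨v, hv⟩ := (hF.mem fun i => 4 * (if i ∈ T then 1 else 0)).2
    ⟨fun i => 2 * (if i ∈ T then 1 else 0), by
      convert hF.gol.zero using 1
      have : (2 : ZMod 2) = 0 := by decide
      funext i; simp [rd, this], Or.inl ⟨by funext i; simp only [Pi.smul_apply, smul_eq_mul]; ring, by
      rw [← Finset.mul_sum, hs]; norm_num⟩⟩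
  have hN : pairZ B v v = 8 := by
    have := hF.frm.inner h hι v v
    simp only [hv] at this
    have e : ∀ i, 4 * (if i ∈ T then (1 : ℤ) else 0) * (4 * (if i ∈ T then 1 else 0)) = 16 * (if i ∈ T then 1 else 0) :=
      fun i => by split_ifs <;> norm_num
    simp_rw [e] at this
    rw [← Finset.mul_sum, hs] at this
    omega
  rcases h.class_two v with ⟨s, hs, hN'⟩ | ⟨G, h1, h2, h3⟩
  · exfalso
    have a : s ≠ v := by rintro rfl; omega
    have b : s ≠ -v := by rintro rfl; rw [N_neg] at hN'; omega
    have := h.cong2_short hs a b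
    have := abs_nonneg (pairZ B s v)
    omega
  have hG : LFr B G := ⟨h2, fun i j hij => h3 i j hij, fun i j => (h1 i).trans (h1 j).symm⟩
  obtain ⟨i, hi⟩ : ∃ i, pairZ B (F p) (G i) ≠ 0 := by
    by_contra hno
    push Not at hno
    have := hG.inner h (by simp) (F p) (F p)
    simp [hno, hF.frm.n8] at this
  obtain ⟨w, hw⟩ := h1 i
  rw [h.comm] at hi
  have hco : ∀ k, pairZ B (G i) (F k) = 4 * (if k ∈ T then 1 else 0) + 2 * pairZ B w (F k) := fun k => by
    rw [hw, pairZ_add_left, hv, pairZ_smul_left]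
  have hn := hF.frm.inner h hι (G i) (G i)
  rw [h2] at hn
  obtain ⟨y, hy, ⟨e, -⟩ | ⟨e, -⟩⟩ := (hF.mem _).1 ⟨w, fun i => rfl⟩
  swap
  · exfalso
    have : ∀ k, 4 ≤ pairZ B (G i) (F k) * pairZ B (G i) (F k) := fun k => by
      rw [hco, show pairZ B w (F k) = 2 * y k + 1 from congrFun e k]
      split_ifs
      · nlinarith [Int.emod_emod_of_dvd (y k) (dvd_refl 2), sq_nonneg (y k + 1), (by
          rcases le_or_gt 0 (y k + 1) with h | h
          · have : (0:ℤ) ≤ (y k + 1) * (y k + 2) := by nlinarith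
            exact this
          · nlinarith : 0 ≤ (y k + 1) * (y k + 2))]
      · nlinarith [(by
          rcases le_or_gt 0 (y k) with h | h
          · nlinarith
          · nlinarith : 0 ≤ (y k) * (y k + 1))]
    have := Finset.sum_le_sum fun k (_ : k ∈ Finset.univ) => this k
    rw [← hn] at this
    simp [hι] at this
  set z : ι → ℤ := fun k => (if k ∈ T then 1 else 0) + y k with hz
  have hcz : ∀ k, pairZ B (G i) (F k) = 4 * z k := fun k => by
    rw [hco, show pairZ B w (F k) = 2 * y k from congrFun e k, hz]; ring
  have hzn : ∑ k, z k * z k = 4 := by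
    simp_rw [hcz] at hn
    have : ∀ k, 4 * z k * (4 * z k) = 16 * (z k * z k) := fun k => by ring
    simp_rw [this] at hn
    rw [← Finset.mul_sum] at hn; omega
  have hzC : ind (symmDiff T (spt (rd z))) ∈ C := by
    rw [← ind_add, ind_spt]
    have : ind T + rd z = rd y := by
      have h2 : (2 : ZMod 2) = 0 := by decide
      funext k; simp only [ind, rd, hz, Pi.add_apply]; push_cast
      split_ifs
      · linear_combination h2
      · ring
    rwa [this]
  have hle : ∀ k, (if k ∈ spt (rd z) then (1 : ℤ) else 0) ≤ z k * z k := fun k => by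
    split_ifs with hk
    · have : z k ≠ 0 := by
        intro h0; rw [spt, Finset.mem_filter] at hk; exact hk.2 (by rw [rd, h0]; rfl)
      have := mul_self_pos.2 this; omega
    · exact mul_self_nonneg _
  have hc4 : (spt (rd z)).card ≤ 4 := by
    have := Finset.sum_le_sum fun k (_ : k ∈ Finset.univ) => hle k
    rw [hzn] at this
    simp at this; exact_mod_cast this
  have hzp : z p ≠ 0 := by intro h0; rw [hcz, h0] at hi; simp at hi
  have cs := card_sd T (spt (rd z))
  have hpT : p ∈ spt (rd z) := by
    by_contra hpn
    have h4 : 4 ≤ z p * z p := by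
      have hpn' : rd z p = 0 := by
        by_contra h0; exact hpn (Finset.mem_filter.2 ⟨Finset.mem_univ _, h0⟩)
      rw [rd, ZMod.intCast_zmod_eq_zero_iff_dvd] at hpn'
      obtain ⟨m, hm⟩ := hpn'
      have : m ≠ 0 := by rintro rfl; simp at hm; exact hzp hm
      have := mul_self_pos.2 this
      rw [hm]; push_cast; nlinarith
    have h0 : spt (rd z) = ∅ := by
      rw [Finset.eq_empty_iff_forall_notMem]
      intro k hk
      have hkp : k ≠ p := by rintro rfl; exact hpn hk
      have h5 := Finset.add_le_sum (s := Finset.univ) (f := fun k => z k * z k) (fun i _ => mul_self_nonneg _)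
        (Finset.mem_univ k) (Finset.mem_univ p) hkp
      have h6 := hle k
      rw [if_pos hk] at h6
      rw [hzn] at h5
      omega
    rw [h0] at cs hzC
    have := hF.gol.min8 hzC (by
      rw [Finset.nonempty_iff_ne_empty]; intro h; rw [h] at cs; simp at cs; omega)
    simp at cs; omega
  have hm := hF.gol.min8 hzC ⟨p, by rw [Finset.mem_symmDiff]; exact Or.inr ⟨hpT, hp⟩⟩
  have hdis : Disjoint T (spt (rd z)) := by
    rw [Finset.disjoint_iff_inter_eq_empty, ← Finset.card_eq_zero]; omega
  refine ⟨_, hpT, by omega, hdis, ?_⟩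
  rwa [hdis.symmDiff_eq_sup] at hzC
end Sextet
end

section
abbrev Om := Fin 6 × Fin 4
/-- multiplication by the primitive element -/
def mw : Fin 4 → Fin 4 := ![0, 2, 3, 1]
def mv : Fin 4 → Fin 4 := ![0, 3, 1, 2]
def kx (x : Fin 4) : Fin 6 → Fin 4 := ![x, 0, 0, x, x, x]
def ky (y : Fin 4) : Fin 6 → Fin 4 := ![0, y, 0, y, mw y, mv y]
def kz (z : Fin 4) : Fin 6 → Fin 4 := ![0, 0, z, z, mv z, mw z]
def dif (k k' : Fin 6 → Fin 4) : ℕ := (Finset.univ.filter fun i => k i ≠ k' i).card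
theorem dif3 {k k' : Fin 6 → Fin 4} (h4 : 4 ≤ dif k k') (i j l : Fin 6) (hd : i ≠ j ∧ i ≠ l ∧ j ≠ l)
    (h1 : k i = k' i) (h2 : k j = k' j) (h3 : k l = k' l) : False := by
  have hs : (Finset.univ.filter fun i => k i ≠ k' i) ⊆ Finset.univ \ {i, j, l} := by
    intro m hm
    simp only [Finset.mem_filter, Finset.mem_univ, true_and] at hm
    simp only [Finset.mem_sdiff, Finset.mem_univ, true_and, Finset.mem_insert, Finset.mem_singleton]
    rintro (rfl | rfl | rfl) <;> contradiction
  have h5 := Finset.card_le_card hs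
  rw [Finset.card_sdiff_of_subset (Finset.subset_univ _), Finset.card_eq_three.2 ⟨i, j, l, hd.1, hd.2.1, hd.2.2, rfl⟩] at h5
  simp only [Finset.card_univ, Fintype.card_fin] at h5
  rw [dif] at h4; omega
theorem der3 (b c : Fin 4 → Fin 4) (hb : b 0 = 0) (hc : c 0 = 0) (hbi : ∀ x x', x ≠ x' → b x ≠ b x')
    (hci : ∀ x x', x ≠ x' → c x ≠ c x') (h : ∀ y, y ≠ 0 → y ≠ b y ∧ y ≠ c y ∧ b y ≠ c y) :
    (b = mw ∧ c = mv) ∨ (b = mv ∧ c = mw) := by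
  have ext4 : ∀ f g : Fin 4 → Fin 4, f 0 = g 0 → f 1 = g 1 → f 2 = g 2 → f 3 = g 3 → f = g := fun f g a b c d =>
      funext fun i => by fin_cases i <;> assumption
  have D : ∀ x y z : Fin 4, x ≠ 0 → y ≠ 0 → z ≠ 0 → x ≠ y → x ≠ z → y ≠ z → x ≠ 1 → y ≠ 2 → z ≠ 3 →
    (x = 2 ∧ y = 3 ∧ z = 1) ∨ (x = 3 ∧ y = 1 ∧ z = 2) := by decide
  have gen : ∀ b : Fin 4 → Fin 4, b 0 = 0 → (∀ x x', x ≠ x' → b x ≠ b x') → (∀ y, y ≠ 0 → y ≠ b y) →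
      b = mw ∨ b = mv := fun b hb hbi h => by
    have n : ∀ x, x ≠ 0 → b x ≠ 0 := fun x hx => by rw [← hb]; exact hbi _ _ hx
    rcases D (b 1) (b 2) (b 3) (n _ (by decide)) (n _ (by decide)) (n _ (by decide)) (hbi _ _ (by decide))
      (hbi _ _ (by decide)) (hbi _ _ (by decide)) (h 1 (by decide)).symm (h 2 (by decide)).symm (h 3 (by decide)).symm
      with ⟨h1, h2, h3⟩ | ⟨h1, h2, h3⟩
    · exact Or.inl (ext4 _ _ hb h1 h2 h3)
    · exact Or.inr (ext4 _ _ hb h1 h2 h3)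
  have hne : b ≠ c := fun e => (h 1 (by decide)).2.2 (by rw [e])
  rcases gen b hb hbi fun y hy => (h y hy).1 with h1 | h1 <;>
    rcases gen c hc hci fun y hy => (h y hy).2.1 with h2 | h2
  · exact absurd (h1.trans h2.symm) hne
  · exact Or.inl ⟨h1, h2⟩
  · exact Or.inr ⟨h1, h2⟩
  · exact absurd (h1.trans h2.symm) hne
/-- recovering the labels -/
theorem mds (S : Set (Fin 6 → Fin 4))
    (hE : ∀ x y z, ∃ k ∈ S, k 0 = x ∧ k 1 = y ∧ k 2 = z)
    (hW : ∀ k ∈ S, ∀ k' ∈ S, k ≠ k' → 4 ≤ dif k k') :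
    ∃ ρ : Fin 6 → Equiv.Perm (Fin 4), ρ 0 0 = 0 ∧ ρ 1 0 = 0 ∧ ρ 1 1 = 1 ∧ ρ 2 0 = 0 ∧
      ∀ x, (fun i => ρ i (kx x i)) ∈ S ∧ (fun i => ρ i (ky x i)) ∈ S ∧ (fun i => ρ i (kz x i)) ∈ S := by
  choose p hpS hp0 hp1 hp2 using fun x => hE x 0 0
  choose q hqS hq0 hq1 hq2 using fun x => hE 0 x 0
  choose r hrS hr0 hr1 hr2 using fun x => hE 0 0 x
  have uq : ∀ k ∈ S, ∀ k' ∈ S, k 0 = k' 0 → k 1 = k' 1 → k 2 = k' 2 → k = k' := fun k hk k' hk' a b c => by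
    by_contra hne
    have := hW k hk k' hk' hne
    exact dif3 this 0 1 2 (by decide) a b c
  have hpq : p 0 = q 0 := uq _ (hpS _) _ (hqS _) (by rw [hp0, hq0]) (by rw [hp1, hq1]) (by rw [hp2, hq2])
  have hpr : p 0 = r 0 := uq _ (hpS _) _ (hrS _) (by rw [hp0, hr0]) (by rw [hp1, hr1]) (by rw [hp2, hr2])
  have big : ∀ k k' : Fin 6 → Fin 4, 4 ≤ dif k k' →
      ((k 1 = k' 1 ∧ k 2 = k' 2) ∨ (k 0 = k' 0 ∧ k 2 = k' 2) ∨ (k 0 = k' 0 ∧ k 1 = k' 1)) →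
      k 3 ≠ k' 3 ∧ k 4 ≠ k' 4 ∧ k 5 ≠ k' 5 := fun k k' h4 h => by
    rcases h with ⟨a, b⟩ | ⟨a, b⟩ | ⟨a, b⟩
    · exact ⟨fun e => dif3 h4 1 2 3 (by decide) a b e, fun e => dif3 h4 1 2 4 (by decide) a b e,
        fun e => dif3 h4 1 2 5 (by decide) a b e⟩
    · exact ⟨fun e => dif3 h4 0 2 3 (by decide) a b e, fun e => dif3 h4 0 2 4 (by decide) a b e,
        fun e => dif3 h4 0 2 5 (by decide) a b e⟩
    · exact ⟨fun e => dif3 h4 0 1 3 (by decide) a b e, fun e => dif3 h4 0 1 4 (by decide) a b e,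
        fun e => dif3 h4 0 1 5 (by decide) a b e⟩
  have pin : ∀ x x', x ≠ x' → p x 3 ≠ p x' 3 ∧ p x 4 ≠ p x' 4 ∧ p x 5 ≠ p x' 5 := fun x x' h =>
    big _ _ (hW _ (hpS _) _ (hpS _) fun e => h (by rw [← hp0 x, e, hp0]))
      (Or.inl ⟨by rw [hp1, hp1], by rw [hp2, hp2]⟩)
  have qin : ∀ x x', x ≠ x' → q x 3 ≠ q x' 3 ∧ q x 4 ≠ q x' 4 ∧ q x 5 ≠ q x' 5 := fun x x' h =>
    big _ _ (hW _ (hqS _) _ (hqS _) fun e => h (by rw [← hq1 x, e, hq1]))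
      (Or.inr (Or.inl ⟨by rw [hq0, hq0], by rw [hq2, hq2]⟩))
  have rin : ∀ x x', x ≠ x' → r x 3 ≠ r x' 3 ∧ r x 4 ≠ r x' 4 ∧ r x 5 ≠ r x' 5 := fun x x' h =>
    big _ _ (hW _ (hrS _) _ (hrS _) fun e => h (by rw [← hr2 x, e, hr2]))
      (Or.inr (Or.inr ⟨by rw [hr0, hr0], by rw [hr1, hr1]⟩))
  have mk : ∀ f : Fin 4 → Fin 4, (∀ x x', x ≠ x' → f x ≠ f x') → ∃ e : Equiv.Perm (Fin 4), ∀ x, e x = f x :=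
    fun f hf => ⟨Equiv.ofBijective f (Finite.injective_iff_bijective.1 fun x x' h => by
      by_contra hne; exact hf x x' hne h), fun x => rfl⟩
  obtain ⟨p3, hp3⟩ := mk (fun x => p x 3) fun x x' h => (pin x x' h).1
  obtain ⟨p4, hp4⟩ := mk (fun x => p x 4) fun x x' h => (pin x x' h).2.1
  obtain ⟨p5, hp5⟩ := mk (fun x => p x 5) fun x x' h => (pin x x' h).2.2
  obtain ⟨q3, hq3⟩ := mk (fun x => q x 3) fun x x' h => (qin x x' h).1
  obtain ⟨r3, hr3⟩ := mk (fun x => r x 3) fun x x' h => (rin x x' h).1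
  set s0 : Equiv.Perm (Fin 4) := q3.trans p3.symm with hs0
  set s2 : Equiv.Perm (Fin 4) := q3.trans r3.symm with hs2
  have s00 : s0 0 = 0 := by rw [hs0]; simp [Equiv.symm_apply_eq, hq3, hp3, hpq]
  have s20 : s2 0 = 0 := by rw [hs2]; simp [Equiv.symm_apply_eq, hq3, hr3, ← hpq, hpr]
  -- normalised coordinates
  set e4 : Equiv.Perm (Fin 4) := s0.trans p4 with he4
  set e5 : Equiv.Perm (Fin 4) := s0.trans p5 with he5
  have P3 : ∀ x, p (s0 x) 3 = q3 x := fun x => by rw [← hp3, hs0]; simp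
  have R3 : ∀ x, r (s2 x) 3 = q3 x := fun x => by rw [← hr3, hs2]; simp
  have Q3 : ∀ x, q x 3 = q3 x := fun x => (hq3 x).symm
  have P4 : ∀ x, p (s0 x) 4 = e4 x := fun x => by rw [he4]; simp [hp4]
  have P5 : ∀ x, p (s0 x) 5 = e5 x := fun x => by rw [he5]; simp [hp5]
  set b : Fin 4 → Fin 4 := fun y => e4.symm (q y 4) with hb
  set c : Fin 4 → Fin 4 := fun y => e5.symm (q y 5) with hc
  set b' : Fin 4 → Fin 4 := fun y => e4.symm (r (s2 y) 4) with hb'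
  set c' : Fin 4 → Fin 4 := fun y => e5.symm (r (s2 y) 5) with hc'
  have Q4 : ∀ x, q x 4 = e4 (b x) := fun x => by simp [hb]
  have Q5 : ∀ x, q x 5 = e5 (c x) := fun x => by simp [hc]
  have R4 : ∀ x, r (s2 x) 4 = e4 (b' x) := fun x => by simp [hb']
  have R5 : ∀ x, r (s2 x) 5 = e5 (c' x) := fun x => by simp [hc']
  have b0 : b 0 = 0 := by rw [hb]; simp only; rw [Equiv.symm_apply_eq, ← P4, s00, hpq]
  have c0 : c 0 = 0 := by rw [hc]; simp only; rw [Equiv.symm_apply_eq, ← P5, s00, hpq]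
  have b0' : b' 0 = 0 := by rw [hb']; simp only; rw [Equiv.symm_apply_eq, ← P4, s20, s00, hpr]
  have c0' : c' 0 = 0 := by rw [hc']; simp only; rw [Equiv.symm_apply_eq, ← P5, s20, s00, hpr]
  have bin : ∀ x x', x ≠ x' → b x ≠ b x' := fun x x' h => by
    have := (qin x x' h).2.1; rw [Q4, Q4] at this; exact fun e => this (by rw [e])
  have cin : ∀ x x', x ≠ x' → c x ≠ c x' := fun x x' h => by
    have := (qin x x' h).2.2; rw [Q5, Q5] at this; exact fun e => this (by rw [e])
  have bin' : ∀ x x', x ≠ x' → b' x ≠ b' x' := fun x x' h => by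
    have := (rin (s2 x) (s2 x') (fun e => h (s2.injective e))).2.1
    rw [R4, R4] at this; exact fun e => this (by rw [e])
  have cin' : ∀ x x', x ≠ x' → c' x ≠ c' x' := fun x x' h => by
    have := (rin (s2 x) (s2 x') (fun e => h (s2.injective e))).2.2
    rw [R5, R5] at this; exact fun e => this (by rw [e])
  have ne0 : ∀ (s : Equiv.Perm (Fin 4)), s 0 = 0 → ∀ x, x ≠ 0 → s x ≠ 0 := fun s h x hx e =>
    hx (s.injective (by rw [e, h]))
  have xy : ∀ x y, x ≠ 0 → y ≠ 0 → (x = y → x ≠ b y ∧ x ≠ c y) ∧ (x = b y → x ≠ c y) := fun x y hx hy => by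
    have h1 := hW _ (hpS (s0 x)) _ (hqS y) fun e => by
      have := congrFun e 0; rw [hp0, hq0] at this; exact ne0 _ s00 _ hx this
    exact ⟨fun e => ⟨fun e' => dif3 h1 2 3 4 (by decide) (by rw [hp2, hq2]) (by rw [P3, Q3, e]) (by rw [P4, Q4, e']),
      fun e' => dif3 h1 2 3 5 (by decide) (by rw [hp2, hq2]) (by rw [P3, Q3, e]) (by rw [P5, Q5, e'])⟩,
      fun e e' => dif3 h1 2 4 5 (by decide) (by rw [hp2, hq2]) (by rw [P4, Q4, e]) (by rw [P5, Q5, e'])⟩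
  have xz : ∀ x y, x ≠ 0 → y ≠ 0 → (x = y → x ≠ b' y ∧ x ≠ c' y) ∧ (x = b' y → x ≠ c' y) := fun x y hx hy => by
    have h1 := hW _ (hpS (s0 x)) _ (hrS (s2 y)) fun e => by
      have := congrFun e 0; rw [hp0, hr0] at this; exact ne0 _ s00 _ hx this
    exact ⟨fun e => ⟨fun e' => dif3 h1 1 3 4 (by decide) (by rw [hp1, hr1]) (by rw [P3, R3, e]) (by rw [P4, R4, e']),
      fun e' => dif3 h1 1 3 5 (by decide) (by rw [hp1, hr1]) (by rw [P3, R3, e]) (by rw [P5, R5, e'])⟩,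
      fun e e' => dif3 h1 1 4 5 (by decide) (by rw [hp1, hr1]) (by rw [P4, R4, e]) (by rw [P5, R5, e'])⟩
  have yz : ∀ y, y ≠ 0 → b y ≠ b' y := fun y hy => by
    have h1 := hW _ (hqS y) _ (hrS (s2 y)) fun e => by
      have := congrFun e 1; rw [hq1, hr1] at this; exact hy this
    exact fun e => dif3 h1 0 3 4 (by decide) (by rw [hq0, hr0]) (by rw [Q3, R3]) (by rw [Q4, R4, e])
  have Hb := der3 b c b0 c0 bin cin fun y hy => ⟨((xy y y hy hy).1 rfl).1, ((xy y y hy hy).1 rfl).2,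
    (xy (b y) y (by rw [← b0]; exact bin _ _ hy) hy).2 rfl⟩
  have Hb' := der3 b' c' b0' c0' bin' cin' fun y hy => ⟨((xz y y hy hy).1 rfl).1, ((xz y y hy hy).1 rfl).2,
    (xz (b' y) y (by rw [← b0']; exact bin' _ _ hy) hy).2 rfl⟩
  have fin : ∀ σ : Equiv.Perm (Fin 4), σ 0 = 0 → σ 1 = 1 → (∀ x, b (σ x) = σ (mw x) ∧ c (σ x) = σ (mv x) ∧
      b' (σ x) = σ (mv x) ∧ c' (σ x) = σ (mw x)) →
      ∃ ρ : Fin 6 → Equiv.Perm (Fin 4), ρ 0 0 = 0 ∧ ρ 1 0 = 0 ∧ ρ 1 1 = 1 ∧ ρ 2 0 = 0 ∧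
      ∀ x, (fun i => ρ i (kx x i)) ∈ S ∧ (fun i => ρ i (ky x i)) ∈ S ∧ (fun i => ρ i (kz x i)) ∈ S := by
    intro σ σ0 σ1 hσ
    refine ⟨![σ.trans s0, σ, σ.trans s2, σ.trans q3, σ.trans e4, σ.trans e5], by simp [σ0, s00], σ0, σ1,
      by simp [σ0, s20], fun x => ⟨?_, ?_, ?_⟩⟩
    · convert hpS (s0 (σ x)) using 1
      funext i; fin_cases i <;> simp [kx, σ0, s20, hp0, hp1, hp2, P3, P4, P5]
    · convert hqS (σ x) using 1
      funext i; fin_cases i <;> simp [ky, σ0, s00, s20, hq0, hq1, hq2, Q3, Q4, Q5, hσ]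
    · convert hrS (s2 (σ x)) using 1
      funext i; fin_cases i <;> simp [kz, σ0, s00, hr0, hr1, hr2, R3, R4, R5, hσ]
  have y1 := yz 1 (by decide)
  rcases Hb with ⟨h1, h2⟩ | ⟨h1, h2⟩ <;> rcases Hb' with ⟨h3, h4⟩ | ⟨h3, h4⟩
  · rw [h1, h3] at y1; exact absurd rfl y1
  · exact fin 1 rfl rfl fun x => by rw [h1, h2, h3, h4]; simp
  · exact fin (Equiv.swap 2 3) (by decide) (by decide) fun x => by
      rw [h1, h2, h3, h4]; revert x; decide
  · rw [h1, h3] at y1; exact absurd rfl y1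
end

section
variable {B : Matrix (Fin 24) (Fin 24) ℤ}
section Pull
variable {ι κ : Type} [Fintype ι] [DecidableEq ι] [Fintype κ] [DecidableEq κ] {C : Set (ι → ZMod 2)}
def pull (e : κ ≃ ι) (C : Set (ι → ZMod 2)) : Set (κ → ZMod 2) := {c | c ∘ e.symm ∈ C}
theorem wt_pull (e : κ ≃ ι) (c : κ → ZMod 2) : wt (c ∘ e.symm) = wt c := by
  simp only [wt, Finset.card_filter]
  rw [← e.sum_comp]; simp
theorem inL_pull (e : κ ≃ ι) (x : κ → ℤ) : inL (pull e C) x ↔ inL C (x ∘ e.symm) := by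
  constructor
  · rintro ⟨y, hy, h⟩
    refine ⟨y ∘ e.symm, hy, ?_⟩
    have : ∑ i, (y ∘ e.symm) i = ∑ i, y i := by rw [← e.sum_comp]; simp
    rw [this]
    rcases h with ⟨rfl, h⟩ | ⟨rfl, h⟩
    · exact Or.inl ⟨rfl, h⟩
    · exact Or.inr ⟨rfl, h⟩
  · rintro ⟨y, hy, h⟩
    have e1 : (y ∘ e) ∘ e.symm = y := by funext i; simp
    have ex : x = (x ∘ e.symm) ∘ e := by funext i; simp
    refine ⟨y ∘ e, by show rd (y ∘ e) ∘ e.symm ∈ C; convert hy using 1; funext i; simp [rd], ?_⟩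
    have : ∑ i, (y ∘ e) i = ∑ i, y i := e.sum_comp y
    rw [this, ex]
    rcases h with ⟨h', h⟩ | ⟨h', h⟩
    · exact Or.inl ⟨by rw [h']; rfl, h⟩
    · exact Or.inr ⟨by rw [h']; rfl, h⟩
theorem NF.pl (e : κ ≃ ι) {F : ι → LV} (hF : NF B C F) : NF B (pull e C) (F ∘ e) := by
  refine ⟨⟨fun i => hF.frm.n8 _, fun i j hij => hF.frm.orth _ _ fun h => hij (e.injective h), fun i j => hF.frm.cg _ _⟩,
    ⟨fun c => ?_, fun c hc => ?_, fun c hc h0 => ?_⟩, fun x => ?_⟩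
  · show c ∘ e.symm ∈ C ↔ _
    rw [hF.gol.dual]
    constructor
    · intro h d hd
      have := h _ hd
      rw [← e.sum_comp] at this; simpa using this
    · intro h d hd
      have := h (d ∘ e) (by show (d ∘ e) ∘ e.symm ∈ C; convert hd using 1; funext i; simp)
      rw [← e.sum_comp]; simpa using this
  · rw [← wt_pull e]; exact hF.gol.four _ hc
  · rw [← wt_pull e]; refine hF.gol.eight _ hc fun h => h0 ?_
    funext i
    have := congrFun h (e i); simpa using this
  · rw [inL_pull, ← hF.mem]
    constructor
    · rintro ⟨v, hv⟩; exact ⟨v, fun i => by rw [Function.comp, ← hv, Function.comp]; simp⟩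
    · rintro ⟨v, hv⟩; exact ⟨v, fun i => by rw [Function.comp, hv]; simp⟩
theorem Golay.ext_disj (hC : Golay C) {S A X : Finset ι} {p : ι} (h1 : Disjoint S A) (h2 : Disjoint S X)
    (hA : A.card = 4) (hX : X.card = 4) (h3 : ind (S ∪ A) ∈ C) (h4 : ind (S ∪ X) ∈ C) (hp : p ∈ X) (hpA : p ∉ A) :
    Disjoint A X ∧ ind (A ∪ X) ∈ C := by
  have e : symmDiff (S ∪ A) (S ∪ X) = symmDiff A X := by
    ext i
    have a : i ∈ S → i ∉ A := fun h => Finset.disjoint_left.1 h1 h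
    have b : i ∈ S → i ∉ X := fun h => Finset.disjoint_left.1 h2 h
    simp only [Finset.mem_symmDiff, Finset.mem_union]; tauto
  have h5 := hC.sd h3 h4
  rw [e] at h5
  have h6 := hC.min8 h5 ⟨p, by rw [Finset.mem_symmDiff]; exact Or.inr ⟨hp, hpA⟩⟩
  have h7 := card_sd A X
  have h8 : Disjoint A X := Finset.disjoint_iff_inter_eq_empty.2 (Finset.card_eq_zero.1 (by omega))
  refine ⟨h8, ?_⟩
  rw [h8.symmDiff_eq_sup] at h5
  exact h5
theorem NF.sextet (h : IsLeech B) (hι : Fintype.card ι = 24) {F : ι → LV} (hF : NF B C F) {T1 T2 : Finset ι}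
    (c1 : T1.card = 4) (c2 : T2.card = 4) (h12 : Disjoint T1 T2) (hC : ind (T1 ∪ T2) ∈ C) {q : ι} (hq1 : q ∉ T1)
    (hq2 : q ∉ T2) (n : ℕ) (hn : n ≤ 3) :
    ∃ T : ℕ → Finset ι, T 0 = T1 ∧ T 1 = T2 ∧ q ∈ T 2 ∧ (∀ i < n + 3, (T i).card = 4) ∧
      ∀ i < n + 3, ∀ j < i, Disjoint (T j) (T i) ∧ ind (T j ∪ T i) ∈ C := by
  induction n with
  | zero =>
    obtain ⟨X, hqX, cX, d, hX⟩ := hF.five h hι c1 hq1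
    have h3 := hF.gol.ext_disj h12 d c2 cX hC hX hqX hq2
    refine ⟨fun i => if i = 0 then T1 else if i = 1 then T2 else X, rfl, rfl, hqX, fun i hi => ?_, fun i hi j hj => ?_⟩
    · interval_cases i <;> simp [c1, c2, cX]
    · interval_cases i <;> interval_cases j <;> simp [d, hX, h12, hC, h3]
  | succ n ih =>
    obtain ⟨T, t0, t1, t2, hc, hT⟩ := ih (by omega)
    obtain ⟨p, hp⟩ : ∃ p, p ∉ (Finset.range (n + 3)).biUnion T := by
      by_contra hno
      push Not at hno
      have h1 := Finset.card_biUnion_le (s := Finset.range (n + 3)) (t := T)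
      rw [Finset.eq_univ_of_forall hno, Finset.card_univ, hι,
        Finset.sum_congr rfl fun i hi => hc i (Finset.mem_range.1 hi)] at h1
      simp at h1; omega
    simp only [Finset.mem_biUnion, Finset.mem_range, not_exists, not_and] at hp
    obtain ⟨X, hpX, cX, d, hX⟩ := hF.five h hι (hc 0 (by omega)) (hp 0 (by omega))
    have hall : ∀ j < n + 3, Disjoint (T j) X ∧ ind (T j ∪ X) ∈ C := fun j hj => by
      rcases Nat.eq_zero_or_pos j with rfl | hj0
      · exact ⟨d, hX⟩
      · obtain ⟨a, b⟩ := hT j hj 0 hj0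
        exact hF.gol.ext_disj a d (hc j hj) cX b hX hpX (hp j hj)
    refine ⟨fun i => if i < n + 3 then T i else X, by simp [t0], by simp [t1], by simp [t2], fun i hi => ?_,
      fun i hi j hj => ?_⟩
    · dsimp only; split_ifs with h'
      · exact hc i h'
      · exact cX
    · have : j < n + 3 := by omega
      dsimp only; rw [if_pos this]
      split_ifs with h'
      · exact hT i h' j hj
      · exact hall j this
theorem enum4 {T : Finset ι} (hT : T.card = 4) {a b : ι} (ha : a ∈ T) (hb : b ∈ T) (hab : a ≠ b) :
    ∃ f : Fin 4 → ι, Function.Injective f ∧ (∀ x, f x ∈ T) ∧ f 0 = a ∧ f 1 = b := by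
  have h1 : ((T.erase a).erase b).card = 2 := by
    rw [Finset.card_erase_of_mem (by simp [hb, hab.symm]), Finset.card_erase_of_mem ha, hT]
  obtain ⟨c, d, hcd, h2⟩ := Finset.card_eq_two.1 h1
  have hc : c ∈ (T.erase a).erase b := by rw [h2]; simp
  have hd : d ∈ (T.erase a).erase b := by rw [h2]; simp
  simp only [Finset.mem_erase] at hc hd
  refine ⟨![a, b, c, d], ?_, ?_, rfl, rfl⟩
  · intro x y hxy
    fin_cases x <;> fin_cases y <;> simp_all
  · intro x; fin_cases x <;> simp_all
theorem enum4' {T : Finset ι} (hT : T.card = 4) {a : ι} (ha : a ∈ T) :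
    ∃ f : Fin 4 → ι, Function.Injective f ∧ (∀ x, f x ∈ T) ∧ f 0 = a := by
  obtain ⟨b, hb, hab⟩ := Finset.exists_mem_ne (by omega : 1 < T.card) a
  obtain ⟨f, h1, h2, h3, -⟩ := enum4 hT ha hb hab.symm
  exact ⟨f, h1, h2, h3⟩
end Pull
def colw (i : Fin 6) : Om → ZMod 2 := fun p => if p.1 = i then 1 else 0
def Kw (k : Fin 6 → Fin 4) : Om → ZMod 2 := fun p => if p.2 = k p.1 then 1 else 0
structure Std (D : Set (Om → ZMod 2)) : Prop where
  col : ∀ i, i ≠ 0 → colw 0 + colw i ∈ D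
  x : ∀ x, colw 0 + Kw (kx x) ∈ D
  y : ∀ x, colw 0 + Kw (ky x) ∈ D
  z : ∀ x, colw 0 + Kw (kz x) ∈ D
def gw : Fin 12 → Om → ZMod 2 := ![colw 0 + colw 1, colw 0 + colw 2, colw 0 + colw 3, colw 0 + colw 4,
  colw 0 + colw 5, colw 0 + Kw (kx 0), colw 0 + Kw (kx 1), colw 0 + Kw (kx 2), colw 0 + Kw (ky 1),
  colw 0 + Kw (ky 2), colw 0 + Kw (kz 1), colw 0 + Kw (kz 2)]
theorem Std.gen {D : Set (Om → ZMod 2)} (h : Std D) (j : Fin 12) : gw j ∈ D := by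
  fin_cases j
  · exact h.col 1 (by decide)
  · exact h.col 2 (by decide)
  · exact h.col 3 (by decide)
  · exact h.col 4 (by decide)
  · exact h.col 5 (by decide)
  · exact h.x 0
  · exact h.x 1
  · exact h.x 2
  · exact h.y 1
  · exact h.y 2
  · exact h.z 1
  · exact h.z 2
def bitw (n : ℕ) (p : Om) : ZMod 2 := if n.testBit (4 * p.1.1 + p.2.1) then 1 else 0
def tE : Fin 12 → ℕ := ![127, 1807, 5737, 67177, 71543, 1641, 10, 12, 95, 63, 1295, 783]
def tK : Fin 12 → ℕ := ![128, 2048, 32768, 942080, 14704640, 15753216, 11182080, 13418496, 13017088, 6995968, 7118848,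
  10928128]
set_option maxRecDepth 100000 in
theorem gen_id : ∀ p p' : Om, (∑ j, gw j p * bitw (tE j) p') + (∑ j, bitw (tK j) p * gw j p') =
    if p = p' then 1 else 0 := by decide +kernel
theorem Std.le {D D' : Set (Om → ZMod 2)} (hD : Golay D) (hD' : Golay D') (h : Std D) (h' : Std D') : D ⊆ D' := by
  intro c hc
  rw [hD'.dual]
  intro d hd
  have h1 : ∀ j, ∑ p, gw j p * d p = 0 := fun j => (hD'.dual _).1 (h'.gen j) d hd
  have h2 : ∀ j, ∑ p, gw j p * c p = 0 := fun j => (hD.dual _).1 (h.gen j) c hc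
  have h3 : ∑ p, c p * d p = ∑ p, ∑ p', (if p = p' then 1 else 0) * (d p * c p') := by
    refine Finset.sum_congr rfl fun p _ => ?_
    simp [mul_comm]
  have key : ∀ a b : Fin 12 → Om → ZMod 2, ∑ p, ∑ p', (∑ j, a j p * b j p') * (d p * c p') =
      ∑ j, (∑ p, a j p * d p) * (∑ p', b j p' * c p') := fun a b => by
    simp_rw [Finset.sum_mul_sum, Finset.sum_mul]
    rw [Finset.sum_comm (s := Finset.univ (α := Fin 12))]
    refine Finset.sum_congr rfl fun p _ => ?_
    rw [Finset.sum_comm]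
    exact Finset.sum_congr rfl fun p _ => Finset.sum_congr rfl fun p' _ => by ring
  have h4 : ∑ p, c p * d p = (∑ j, (∑ p, gw j p * d p) * (∑ p', bitw (tE j) p' * c p')) +
      (∑ j, (∑ p, bitw (tK j) p * d p) * (∑ p', gw j p' * c p')) := by
    rw [h3, ← key, ← key]
    simp_rw [← gen_id, add_mul, Finset.sum_add_distrib]
  rw [h4]; simp [h1, h2]
theorem Std.conj (h : IsLeech B) {D D' : Set (Om → ZMod 2)} {F F' : Om → LV} (hF : NF B D F) (hF' : NF B D' F')
    (hD : Std D) (hD' : Std D') {u u' : LV} (hc : ∀ i, 3 ∣ pairZ B u' (F' i) - pairZ B u (F i)) : cj B u u' := by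
  have : D = D' := Set.Subset.antisymm (hD.le hF.gol hF'.gol hD') (hD'.le hF'.gol hF.gol hD)
  subst this
  exact hF.conj h (by simp) hF' hc
end

section
variable {B : Matrix (Fin 24) (Fin 24) ℤ}
theorem ind_col (i : Fin 6) : ind (Finset.univ.filter fun p : Om => p.1 = i) = colw i := by
  funext p; simp [ind, colw]
theorem ind_K (k : Fin 6 → Fin 4) : ind (Finset.univ.filter fun p : Om => p.2 = k p.1) = Kw k := by
  funext p; simp [ind, Kw]
theorem oct_sum (O : Finset Om) : O.card = ∑ i, (Finset.univ.filter fun x => (i, x) ∈ O).card := by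
  have : O = Finset.univ.filter fun p => p ∈ O := by ext; simp
  conv_lhs => rw [this]
  simp only [Finset.card_filter]
  rw [Fintype.sum_prod_type]
theorem oct_col (O : Finset Om) (s : Finset (Fin 6)) : (O ∩ Finset.univ.filter fun p : Om => p.1 ∈ s).card =
    ∑ i ∈ s, (Finset.univ.filter fun x => (i, x) ∈ O).card := by
  rw [oct_sum, ← Finset.sum_subset (Finset.subset_univ s)]
  · refine Finset.sum_congr rfl fun i hi => ?_
    congr 1; ext x; simp [hi]
  · intro i _ hi
    rw [Finset.card_eq_zero]; ext x; simp [hi]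
theorem oct_one (h : IsLeech B) {D : Set (Om → ZMod 2)} {F : Om → LV} (hF : NF B D F)
    (hcol : ∀ i j, i ≠ j → colw i + colw j ∈ D) (x y z : Fin 4) :
    ∃ k : Fin 6 → Fin 4, colw 0 + Kw k ∈ D ∧ k 0 = x ∧ k 1 = y ∧ k 2 = z := by
  set T : Finset Om := Finset.univ.filter fun p => (p.1 = 0 ∧ p.2 ≠ x) ∨ p = (1, y) with hT
  have cT : T.card = 4 := by
    rw [hT]; revert x y; decide
  obtain ⟨T', hp, cT', hd, hO⟩ := hF.five h (by simp) cT (p := (2, z)) (by simp [hT])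
  set O := T ∪ T' with hOd
  have cO : O.card = 8 := by rw [hOd, Finset.card_union_of_disjoint hd, cT, cT']
  set n : Fin 6 → ℕ := fun i => (Finset.univ.filter fun a => (i, a) ∈ O).card with hn
  have hw : ∀ i j, i ≠ j → ind (Finset.univ.filter fun p : Om => p.1 ∈ ({i, j} : Finset (Fin 6))) ∈ D := fun i j hij => by
    convert hcol i j hij using 1
    funext p
    simp only [ind, colw, Pi.add_apply, Finset.mem_filter, Finset.mem_univ, true_and, Finset.mem_insert, Finset.mem_singleton]
    by_cases a : p.1 = i <;> by_cases b : p.1 = j <;> simp [a, b, hij, hij.symm]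
  have par : ∀ i j, i ≠ j → 2 ∣ n i + n j := fun i j hij => by
    have := hF.gol.ev hO (hw i j hij)
    rwa [oct_col, Finset.sum_pair hij] at this
  have hsum : ∑ i, n i = 8 := by rw [← cO, oct_sum]
  have le4 : ∀ i, n i ≤ 4 := fun i => (Finset.card_le_univ _).trans (by simp)
  have mO : ∀ a, a ≠ x → (0, a) ∈ O := fun a ha => by simp [hOd, hT, ha]
  have m1 : ((1 : Fin 6), y) ∈ O := by simp [hOd, hT]
  have m2 : ((2 : Fin 6), z) ∈ O := by simp [hOd, hp]
  have n0 : 3 ≤ n 0 := by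
    have : (Finset.univ.erase x) ⊆ Finset.univ.filter fun a => ((0 : Fin 6), a) ∈ O := fun a ha => by
      simp at ha; simp [mO a ha]
    have := Finset.card_le_card this
    simpa using this
  have n1 : 1 ≤ n 1 := Finset.card_pos.2 ⟨y, by simp [m1]⟩
  have n2 : 1 ≤ n 2 := Finset.card_pos.2 ⟨z, by simp [m2]⟩
  have p1 := par 0 1 (by decide)
  have p2 := par 0 2 (by decide)
  have p3 := par 0 3 (by decide)
  have p4 := par 0 4 (by decide)
  have p5 := par 0 5 (by decide)
  have l0 := le4 0
  rw [Fin.sum_univ_six] at hsum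
  have n03 : n 0 = 3 := by
    by_contra h3
    have h4 : n 0 = 4 := by omega
    have h5 : O = Finset.univ.filter fun p : Om => p.1 ∈ ({0, 1} : Finset (Fin 6)) := by
      refine hF.gol.five_eq hO (hw 0 1 (by decide)) cO (by decide) ?_
      rw [oct_col, Finset.sum_pair (by decide)]
      show 5 ≤ n 0 + n 1
      omega
    rw [h5] at m2
    simp at m2
  have all1 : ∀ i, i ≠ 0 → n i = 1 := fun i hi => by
    have : n 1 = 1 ∧ n 2 = 1 ∧ n 3 = 1 ∧ n 4 = 1 ∧ n 5 = 1 := by omega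
    fin_cases i <;> simp_all
  have hx : (0, x) ∉ O := fun hx => by
    have : (Finset.univ.filter fun a => ((0 : Fin 6), a) ∈ O) = Finset.univ := by
      ext a; by_cases ha : a = x
      · simp [ha, hx]
      · simp [mO a ha]
    have h4 : n 0 = 4 := by rw [hn]; simp only [this]; simp
    omega
  have hk : ∀ i, ∃ a, i ≠ 0 → ∀ b, (i, b) ∈ O ↔ b = a := fun i => by
    by_cases hi : i = 0
    · exact ⟨0, fun h => absurd hi h⟩
    · obtain ⟨a, ha⟩ := Finset.card_eq_one.1 (all1 i hi)
      exact ⟨a, fun _ b => by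
        have := Finset.ext_iff.1 ha b
        simpa using this⟩
  choose k hk using hk
  refine ⟨Function.update k 0 x, ?_, by simp, ?_, ?_⟩
  · convert hO using 1
    funext ⟨i, b⟩
    simp only [Pi.add_apply, colw, Kw, ind]
    by_cases hi : i = 0
    · subst hi
      by_cases hb : b = x
      · simp [hb, hx]; decide
      · simp [hb, mO b hb]
    · simp [hi, hk i hi b]
  · rw [Function.update_of_ne (by decide)]; exact ((hk 1 (by decide) y).1 m1).symm
  · rw [Function.update_of_ne (by decide)]; exact ((hk 2 (by decide) z).1 m2).symm
theorem K_dif {D : Set (Om → ZMod 2)} (hD : Golay D) {k k' : Fin 6 → Fin 4} (h1 : colw 0 + Kw k ∈ D)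
    (h2 : colw 0 + Kw k' ∈ D) (hne : k ≠ k') : 4 ≤ dif k k' := by
  have h3 := hD.add h1 h2
  have e2 : (2 : ZMod 2) = 0 := by decide
  rw [show colw 0 + Kw k + (colw 0 + Kw k') = Kw k + Kw k' by
    funext p; simp only [Pi.add_apply]; linear_combination (colw 0 p) * e2] at h3
  have h4 := hD.eight _ h3 fun h0 => hne (by
    funext i
    have := congrFun h0 (i, k i)
    simp only [Pi.add_apply, Kw, if_true, Pi.zero_apply] at this
    by_contra hc
    rw [if_neg hc] at this; revert this; decide)
  have h5 : wt (Kw k + Kw k') = 2 * dif k k' := by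
    simp only [wt, dif, Finset.card_filter]
    rw [Fintype.sum_prod_type, Finset.mul_sum]
    refine Finset.sum_congr rfl fun i _ => ?_
    simp only [Pi.add_apply, Kw]
    have key : ∀ a b : Fin 4, (∑ y : Fin 4, if ((if y = a then (1 : ZMod 2) else 0) + if y = b then 1 else 0) ≠ 0 then 1 else 0) =
      2 * (if a ≠ b then 1 else 0) := by decide
    convert key (k i) (k' i) using 1
    exact Finset.sum_congr rfl fun _ _ => by congr
  omega
def rhoE (ρ : Fin 6 → Equiv.Perm (Fin 4)) : Om ≃ Om := Equiv.prodShear (Equiv.refl _) ρ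
theorem NF.label {ι : Type} [Fintype ι] [DecidableEq ι] {C : Set (ι → ZMod 2)} (h : IsLeech B)
    (hι : Fintype.card ι = 24) {F : ι → LV} (hF : NF B C F) {T1 T2 : Finset ι} (c1 : T1.card = 4) (c2 : T2.card = 4)
    (h12 : Disjoint T1 T2) (hC : ind (T1 ∪ T2) ∈ C) {o1 o2 d q : ι} (m1 : o1 ∈ T1) (m2 : o2 ∈ T2) (md : d ∈ T2)
    (h2d : o2 ≠ d) (hq1 : q ∉ T1) (hq2 : q ∉ T2) :
    ∃ e : Om ≃ ι, e (0, 0) = o1 ∧ e (1, 0) = o2 ∧ e (1, 1) = d ∧ e (2, 0) = q ∧ (∀ x, e (0, x) ∈ T1) ∧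
      (∀ x, e (1, x) ∈ T2) ∧ Std (pull e C) := by
  obtain ⟨T, t0, t1, t2, hc, hT⟩ := hF.sextet h hι c1 c2 h12 hC hq1 hq2 3 le_rfl
  have hdis : ∀ i < 6, ∀ j < 6, i ≠ j → Disjoint (T i) (T j) ∧ ind (T i ∪ T j) ∈ C := fun i hi j hj hij => by
    rcases lt_or_gt_of_ne hij with hl | hl
    · exact hT j hj i hl
    · have := hT i hi j hl
      rw [Finset.union_comm]; exact ⟨this.1.symm, this.2⟩
  have ne : ∀ i < 6, ∃ a, a ∈ T i := fun i hi => Finset.card_pos.1 (by rw [hc i hi]; norm_num)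
  obtain ⟨f0, i0, r0, v0⟩ := enum4' c1 m1
  obtain ⟨f1, i1, r1, v1, w1⟩ := enum4 c2 m2 md h2d
  obtain ⟨f2, i2, r2, v2⟩ := enum4' (hc 2 (by norm_num)) t2
  obtain ⟨f3, i3, r3, -⟩ := enum4' (hc 3 (by norm_num)) (ne 3 (by norm_num)).choose_spec
  obtain ⟨f4, i4, r4, -⟩ := enum4' (hc 4 (by norm_num)) (ne 4 (by norm_num)).choose_spec
  obtain ⟨f5, i5, r5, -⟩ := enum4' (hc 5 (by norm_num)) (ne 5 (by norm_num)).choose_spec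
  set f : Fin 6 → Fin 4 → ι := ![f0, f1, f2, f3, f4, f5] with hf
  have fi : ∀ i, Function.Injective (f i) := fun i => by fin_cases i <;> assumption
  have fr : ∀ (i : Fin 6) x, f i x ∈ T i := fun i => by
    fin_cases i
    · intro x; show f0 x ∈ T 0; rw [t0]; exact r0 x
    · intro x; show f1 x ∈ T 1; rw [t1]; exact r1 x
    all_goals assumption
  have uq : ∀ (i j : Fin 6) a, a ∈ T i → a ∈ T j → i = j := fun i j a hi hj => by
    by_contra hne
    exact Finset.disjoint_left.1 (hdis i i.2 j j.2 (fun h => hne (Fin.ext h))).1 hi hj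
  have inj : Function.Injective fun p : Om => f p.1 p.2 := by
    rintro ⟨i, x⟩ ⟨j, y⟩ hxy
    simp only at hxy
    have hij : i = j := uq i j (f i x) (fr i x) (by rw [hxy]; exact fr j y)
    subst hij
    rw [fi i hxy]
  set e0 : Om ≃ ι := Equiv.ofBijective _ ((Fintype.bijective_iff_injective_and_card _).2 ⟨inj, by simp [hι]⟩) with he0
  have e0v : ∀ i x, e0 (i, x) = f i x := fun i x => rfl
  have hcol : ∀ i j, i ≠ j → colw i + colw j ∈ pull e0 C := fun i j hij => by
    have hh := hdis i i.2 j j.2 (fun h => hij (Fin.ext h))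
    show (colw i + colw j) ∘ e0.symm ∈ C
    convert hh.2 using 1
    funext a
    obtain ⟨⟨l, x⟩, rfl⟩ := e0.surjective a
    have k1 : ∀ i : Fin 6, e0 (l, x) ∈ T i ↔ l = i := fun i =>
      ⟨fun hm => uq _ _ _ (fr l x) hm, fun hm => by subst hm; exact fr _ x⟩
    simp only [Function.comp, Equiv.symm_apply_apply, Pi.add_apply, colw, ind, Finset.mem_union, k1]
    by_cases a : l = i <;> by_cases b : l = j <;> simp [a, b, hij, hij.symm]
  have hF0 := hF.pl e0
  obtain ⟨ρ, ρ0, ρ1, ρ11, ρ2, hρ⟩ := mds {k | colw 0 + Kw k ∈ pull e0 C}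
    (fun x y z => oct_one h hF0 hcol x y z) (fun k hk k' hk' hne => K_dif hF0.gol hk hk' hne)
  have st : ∀ k, colw 0 + Kw (fun i => ρ i (k i)) ∈ pull e0 C → colw 0 + Kw k ∈ pull ((rhoE ρ).trans e0) C := fun k hk => by
    show (colw 0 + Kw k) ∘ ((rhoE ρ).trans e0).symm ∈ C
    have hk' : (colw 0 + Kw (fun i => ρ i (k i))) ∘ e0.symm ∈ C := hk
    convert hk' using 1
    funext a
    obtain ⟨⟨l, x⟩, rfl⟩ := ((rhoE ρ).trans e0).surjective a
    simp only [Function.comp, Equiv.symm_apply_apply]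
    simp [colw, Kw, rhoE]
  refine ⟨(rhoE ρ).trans e0, ?_, ?_, ?_, ?_, fun x => ?_, fun x => ?_, ⟨fun i hi => ?_, fun x => st _ (hρ x).1,
    fun x => st _ (hρ x).2.1, fun x => st _ (hρ x).2.2⟩⟩
  · simp [rhoE, e0v, ρ0, hf, v0]
  · simp [rhoE, e0v, ρ1, hf, v1]
  · simp [rhoE, e0v, ρ11, hf, w1]
  · simp [rhoE, e0v, ρ2, hf, v2]
  · simp [rhoE, e0v, hf, r0]
  · simp [rhoE, e0v, hf, r1]
  · show (colw 0 + colw i) ∘ ((rhoE ρ).trans e0).symm ∈ C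
    have hk' : (colw 0 + colw i) ∘ e0.symm ∈ C := hcol 0 i hi.symm
    convert hk' using 1
    funext a
    obtain ⟨⟨l, x⟩, rfl⟩ := ((rhoE ρ).trans e0).surjective a
    simp only [Function.comp, Equiv.symm_apply_apply]
    simp [colw, rhoE]
end

section
variable {B : Matrix (Fin 24) (Fin 24) ℤ}
variable {ι : Type} [Fintype ι] [DecidableEq ι] {C : Set (ι → ZMod 2)}
def sg (c : ι → ZMod 2) : ι → ℤ := fun i => 1 - 2 * lft c i
theorem inL_sg (hC : Golay C) {c : ι → ZMod 2} (hc : c ∈ C) {x : ι → ℤ} (hx : inL C x) :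
    inL C (fun i => sg c i * x i) := by
  obtain ⟨y, hy, hx⟩ := hx
  have h2 : (2 : ℤ) ∣ ∑ i, lft c i * y i := by
    have h0 := (hC.dual c).1 hc _ hy
    rw [← rd_lft c] at h0
    refine (ZMod.intCast_zmod_eq_zero_iff_dvd (∑ i, lft c i * y i) 2).1 ?_
    push_cast; exact h0
  have h4 : (4 : ℤ) ∣ ∑ i, lft c i := by rw [sum_lft]; exact_mod_cast hC.four c hc
  rcases hx with ⟨rfl, hs⟩ | ⟨rfl, hs⟩
  · refine ⟨fun i => y i - 2 * (lft c i * y i), ?_, .inl ⟨?_, ?_⟩⟩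
    · convert hy using 1; funext i
      simp only [rd]; push_cast; rw [show (2 : ZMod 2) = 0 from rfl]; ring
    · funext i; simp only [sg, Pi.smul_apply, smul_eq_mul]; ring
    · rw [Finset.sum_sub_distrib, ← Finset.mul_sum]; omega
  · refine ⟨fun i => y i - (2 * (lft c i * y i) + lft c i), ?_, .inr ⟨?_, ?_⟩⟩
    · convert hC.add hy hc using 1; funext i
      have := congrFun (rd_lft c) i
      simp only [rd] at this
      simp only [rd, Pi.add_apply]; push_cast; rw [this, show (2 : ZMod 2) = 0 from rfl]
      generalize c i = a; generalize ((y i : ℤ) : ZMod 2) = b; revert a b; decide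
    · funext i; simp only [sg, Pi.smul_apply, smul_eq_mul, Pi.add_apply, Pi.one_apply]; ring
    · rw [Finset.sum_sub_distrib, Finset.sum_add_distrib, ← Finset.mul_sum]; omega
theorem sg_pm (c : ι → ZMod 2) (i) : sg c i = 1 ∨ sg c i = -1 := by
  simp only [sg, lft]; split_ifs <;> simp
theorem sg_sq (c : ι → ZMod 2) (i) : sg c i * sg c i = 1 := by
  rcases sg_pm c i with h | h <;> rw [h] <;> rfl
theorem NF.sgn {F : ι → LV} (hF : NF B C F) {c : ι → ZMod 2} (hc : c ∈ C) :
    NF B C (fun i => sg c i • F i) := by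
  refine ⟨hF.frm.flip _ (sg_pm c), hF.gol, fun x => ?_⟩
  have e1 : (∃ v, ∀ i, pairZ B v (sg c i • F i) = x i) ↔ ∃ v, ∀ i, pairZ B v (F i) = sg c i * x i := by
    refine exists_congr fun v => forall_congr' fun i => ?_
    rw [pairZ_smul_right]
    rcases sg_pm c i with h | h <;> rw [h] <;> constructor <;> intro <;> linarith
  rw [e1, hF.mem]
  refine ⟨fun hh => ?_, fun hh => inL_sg hF.gol hc hh⟩
  have := inL_sg hF.gol hc hh
  convert this using 1; funext i
  rw [← mul_assoc, sg_sq, one_mul]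
theorem Golay.real (hC : Golay C) (S : Finset ι) (h0 : ∀ d ∈ C, (∀ i ∉ S, d i = 0) → d = 0) (t : ι → ZMod 2) :
    ∃ c ∈ C, ∀ i ∈ S, c i = t i := by
  let M : Submodule (ZMod 2) (ι → ZMod 2) :=
    { carrier := {x | ∃ c ∈ C, ∀ i ∈ S, c i = x i}
      add_mem' := by
        rintro a b ⟨c, hc, h1⟩ ⟨d, hd, h2⟩
        exact ⟨c + d, hC.add hc hd, fun i hi => by simp [h1 i hi, h2 i hi]⟩
      zero_mem' := ⟨0, hC.zero, fun i _ => rfl⟩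
      smul_mem' := by
        rintro a x ⟨c, hc, h1⟩
        refine ⟨if a = 0 then 0 else c, by split_ifs; exacts [hC.zero, hc], fun i hi => ?_⟩
        have : a = 0 ∨ a = 1 := by revert a; decide
        rcases this with rfl | rfl <;> simp [h1 i hi] }
  by_contra hcon
  have ht : t ∉ M := hcon
  obtain ⟨f, hf, hM⟩ := Submodule.exists_le_ker_of_notMem ht
  have hfx : ∀ x, f x = ∑ i, x i * f (Pi.single i 1) := fun x => by
    conv_lhs => rw [← Finset.univ_sum_single x]
    rw [map_sum]
    refine Finset.sum_congr rfl fun i _ => ?_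
    rw [← smul_eq_mul, ← map_smul]; congr 1; funext j
    by_cases hj : j = i
    · subst hj; simp
    · simp [hj]
  have hd : (fun i => f (Pi.single i 1)) ∈ C := (hC.dual _).2 fun c hc => by
    have : f c = 0 := hM (show c ∈ M from ⟨c, hc, fun i _ => rfl⟩)
    rw [hfx] at this; rw [← this]; exact Finset.sum_congr rfl fun i _ => mul_comm _ _
  have := h0 _ hd fun i hi => hM (show Pi.single i 1 ∈ M from ⟨0, hC.zero, fun j hj => by
    have : j ≠ i := fun h => hi (h ▸ hj)
    simp [this]⟩)
  apply hf; rw [hfx]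
  exact Finset.sum_eq_zero fun i _ => by rw [congrFun this i]; simp
theorem NF.signs {F : ι → LV} (hF : NF B C F) (S : Finset ι) (h0 : ∀ d ∈ C, (∀ i ∉ S, d i = 0) → d = 0)
    (t : ι → ℤ) (ht : ∀ i ∈ S, t i = 1 ∨ t i = -1) :
    ∃ s : ι → ℤ, (∀ i, s i = 1 ∨ s i = -1) ∧ (∀ i ∈ S, s i = t i) ∧ NF B C (fun i => s i • F i) := by
  obtain ⟨c, hc, h⟩ := hF.gol.real S h0 (fun i => if t i = 1 then 0 else 1)
  refine ⟨sg c, sg_pm c, fun i hi => ?_, hF.sgn hc⟩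
  simp only [sg, lft, h i hi]
  rcases ht i hi with h | h <;> rw [h] <;> simp
/-- supports too small for codewords -/
theorem Golay.small (hC : Golay C) {S : Finset ι} (hS : S.card < 8) : ∀ d ∈ C, (∀ i ∉ S, d i = 0) → d = 0 := by
  intro d hd h; by_contra h0
  have := hC.eight d hd h0
  have h2 : wt d ≤ S.card := Finset.card_le_card fun i hi => by
    by_contra hn; simp [h i hn] at hi
  omega
theorem LFr.two (h : IsLeech B) {F : ι → LV} (hF : LFr B F) {k l : ι} (hkl : k ≠ l) {ε δ : ℤ} (hε : ε = 1 ∨ ε = -1)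
    (hδ : δ = 1 ∨ δ = -1) : ∃ u : LV, pairZ B u u = 4 ∧ ∀ w, 2 * pairZ B w u = ε * pairZ B w (F k) + δ * pairZ B w (F l) := by
  obtain ⟨w, hw⟩ := hF.cg k l
  obtain ⟨u, hu⟩ : ∃ u : LV, (2 : ℤ) • u = ε • F k + δ • F l := by
    rcases hε with rfl | rfl <;> rcases hδ with rfl | rfl <;> rw [hw]
    · exact ⟨w + F l, by module⟩
    · exact ⟨w, by module⟩
    · exact ⟨-w, by module⟩
    · exact ⟨-w - F l, by module⟩
  have e : ∀ w, 2 * pairZ B w u = ε * pairZ B w (F k) + δ * pairZ B w (F l) := fun w => by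
    rw [← pairZ_smul_right, hu, pairZ_add_right, pairZ_smul_right, pairZ_smul_right]
  refine ⟨u, ?_, e⟩
  have e1 := e u; have e2 := e (F k); have e3 := e (F l)
  rw [h.comm u (F k), h.comm u (F l)] at e1
  rw [hF.n8, hF.orth _ _ hkl] at e2
  rw [hF.n8, hF.orth _ _ hkl.symm] at e3
  rcases hε with rfl | rfl <;> rcases hδ with rfl | rfl <;> linarith
/-- counts -/
def cnt (x : ι → ℤ) (E : Finset ι) (a : ℤ) : ℤ := ((Finset.univ \ E).filter (x · = a)).card
theorem sum_cnt (x : ι → ℤ) (E : Finset ι) (V : Finset ℤ) (hV : ∀ i, x i ∈ V) (f : ℤ → ℤ) :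
    ∑ i, f (x i) = ∑ i ∈ E, f (x i) + ∑ a ∈ V, f a * cnt x E a := by
  rw [← Finset.sum_sdiff (Finset.subset_univ E), add_comm]; congr 1
  rw [← Finset.sum_fiberwise_of_maps_to (g := x) (t := V) fun i _ => hV i]
  refine Finset.sum_congr rfl fun a _ => ?_
  rw [Finset.sum_congr rfl (g := fun _ => f a) fun i hi => by rw [(Finset.mem_filter.1 hi).2]]
  simp [cnt, mul_comm]
theorem cnt_nonneg (x : ι → ℤ) (E : Finset ι) (a : ℤ) : 0 ≤ cnt x E a := by simp [cnt]
theorem cnt_pick {x : ι → ℤ} {E : Finset ι} {a : ℤ} (h : 1 ≤ cnt x E a) : ∃ i, i ∉ E ∧ x i = a := by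
  have : 0 < ((Finset.univ \ E).filter (x · = a)).card := by unfold cnt at h; omega
  obtain ⟨i, hi⟩ := Finset.card_pos.1 this
  simp at hi; exact ⟨i, hi⟩
theorem cnt_pick2 {x : ι → ℤ} {E : Finset ι} {a : ℤ} (h : 2 ≤ cnt x E a) :
    ∃ i j, i ≠ j ∧ i ∉ E ∧ j ∉ E ∧ x i = a ∧ x j = a := by
  have : 1 < ((Finset.univ \ E).filter (x · = a)).card := by unfold cnt at h; omega
  obtain ⟨i, hi, j, hj, hij⟩ := Finset.one_lt_card.1 this
  simp at hi hj; exact ⟨i, j, hij, hi.1, hj.1, hi.2, hj.2⟩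
def m4 (r a : ℤ) : ℤ := if a % 4 = r then 1 else 0
theorem wt_rd (y : ι → ℤ) (r : ℤ) (x : ι → ℤ) (h : ∀ i, x i % 4 = r ↔ y i % 2 = 1) :
    (wt (rd y) : ℤ) = ∑ i, m4 r (x i) := by
  simp only [wt, Finset.card_filter, m4]; push_cast
  refine Finset.sum_congr rfl fun i _ => ?_
  have : rd y i ≠ 0 ↔ y i % 2 = 1 := by
    simp only [rd, ne_eq]; rw [ZMod.intCast_zmod_eq_zero_iff_dvd (y i) 2]; omega
  simp only [this, h]
theorem inL.prof (hC : Golay C) (hι : Fintype.card ι = 24) {x : ι → ℤ} (hx : inL C x) (hn : ∑ i, x i * x i ≤ 48) (E : Finset ι) :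
    ∃ (r : ℤ) (V : Finset ℤ), ((r = 2 ∧ V = {-4, -2, 0, 2, 4}) ∨ (r = 3 ∧ V = {-5, -3, -1, 1, 3, 5})) ∧ (∀ i, x i ∈ V) ∧
     (∑ i ∈ E, m4 r (x i) + ∑ a ∈ V, m4 r a * cnt x E a = 0 ∨ 8 ≤ ∑ i ∈ E, m4 r (x i) + ∑ a ∈ V, m4 r a * cnt x E a) ∧
     4 ∣ ∑ i ∈ E, m4 r (x i) + ∑ a ∈ V, m4 r a * cnt x E a ∧
     (∑ i, x i) % 8 = (r - 2) * 4 ∧ ∑ i, x i = ∑ i ∈ E, x i + ∑ a ∈ V, a * cnt x E a ∧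
     ∑ i, x i * x i = ∑ i ∈ E, x i * x i + ∑ a ∈ V, a * a * cnt x E a ∧
     (24 : ℤ) = E.card + ∑ a ∈ V, cnt x E a := by
  have h6 : ∀ i, -6 ≤ x i ∧ x i ≤ 6 := fun i => by
    have : x i * x i ≤ 48 := (Finset.single_le_sum (f := fun i => x i * x i) (fun i _ => mul_self_nonneg _) (Finset.mem_univ i)).trans hn
    constructor <;> nlinarith
  obtain ⟨y, hy, hx⟩ := hx
  have hw := hC.four _ hy
  have hw8 : wt (rd y) = 0 ∨ 8 ≤ wt (rd y) := by
    by_cases h0 : rd y = 0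
    · left; simp [h0, wt]
    · right; exact hC.eight _ hy h0
  have key : ∀ (r : ℤ) (V : Finset ℤ), (∀ i, x i % 4 = r ↔ y i % 2 = 1) → (∀ i, x i ∈ V) →
     (∑ i ∈ E, m4 r (x i) + ∑ a ∈ V, m4 r a * cnt x E a = 0 ∨ 8 ≤ ∑ i ∈ E, m4 r (x i) + ∑ a ∈ V, m4 r a * cnt x E a) ∧
     4 ∣ ∑ i ∈ E, m4 r (x i) + ∑ a ∈ V, m4 r a * cnt x E a ∧ ∑ i, x i = ∑ i ∈ E, x i + ∑ a ∈ V, a * cnt x E a ∧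
     ∑ i, x i * x i = ∑ i ∈ E, x i * x i + ∑ a ∈ V, a * a * cnt x E a ∧
     (24 : ℤ) = E.card + ∑ a ∈ V, cnt x E a := fun r V h1 h2 => by
    have e1 := wt_rd y r x h1
    rw [sum_cnt x E V h2 (m4 r)] at e1
    have e2 := sum_cnt x E V h2 (fun _ => 1)
    simp [hι] at e2
    refine ⟨by rw [← e1]; omega, by rw [← e1]; omega, sum_cnt x E V h2 id, sum_cnt x E V h2 (fun a => a * a), by exact_mod_cast e2⟩
  rcases hx with ⟨rfl, hs⟩ | ⟨rfl, hs⟩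
  · have b6 : ∀ i, y i ≠ 3 ∧ y i ≠ -3 := fun i => by
      rw [← not_or]; intro hi
      have h8 : 8 ≤ wt (rd y) := hw8.resolve_left fun h0 => by
        have := Finset.card_eq_zero.1 h0
        have h1 := Finset.filter_eq_empty_iff.1 this (Finset.mem_univ i)
        simp only [rd, not_not] at h1; rw [ZMod.intCast_zmod_eq_zero_iff_dvd (y i) 2] at h1; omega
      have hle : ∑ j, (m4 1 (y j ^ 2) + if j = i then 8 else 0) ≤ ∑ j, y j * y j := Finset.sum_le_sum fun j _ => by
        have := h6 j; simp only [Pi.smul_apply, smul_eq_mul] at this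
        have h3 : -3 ≤ y j ∧ y j ≤ 3 := by omega
        split_ifs with hj
        · subst hj; rcases hi with hi | hi <;> rw [hi] <;> simp [m4]
        · obtain ⟨h1, h2⟩ := h3; interval_cases y j <;> simp [m4]
      have hw' := wt_rd y 1 (fun j => y j ^ 2) fun j => by
        rcases Int.even_or_odd' (y j) with ⟨k, hk | hk⟩ <;> rw [hk] <;> ring_nf <;> omega
      rw [Finset.sum_add_distrib, ← hw'] at hle
      simp only [Finset.sum_ite_eq', Finset.mem_univ, if_true, Pi.smul_apply, smul_eq_mul] at hle hn
      have : ∑ i, 2 * y i * (2 * y i) = 4 * ∑ i, y i * y i := by rw [Finset.mul_sum]; exact Finset.sum_congr rfl fun _ _ => by ring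
      omega
    have hV : ∀ i, ((2 : ℤ) • y) i ∈ ({-4, -2, 0, 2, 4} : Finset ℤ) := fun i => by
      have := h6 i; have := b6 i; simp only [Pi.smul_apply, smul_eq_mul, Finset.mem_insert, Finset.mem_singleton] at *; omega
    obtain ⟨k1, k2, k3, k4, k5⟩ := key 2 _ (fun i => by simp only [Pi.smul_apply, smul_eq_mul]; omega) hV
    refine ⟨2, _, .inl ⟨rfl, rfl⟩, hV, k1, k2, ?_, k3, k4, k5⟩
    simp only [Pi.smul_apply, smul_eq_mul]; rw [← Finset.mul_sum]; omega
  · have hV : ∀ i, ((2 : ℤ) • y + 1) i ∈ ({-5, -3, -1, 1, 3, 5} : Finset ℤ) := fun i => by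
      have := h6 i; simp only [Pi.smul_apply, smul_eq_mul, Pi.add_apply, Pi.one_apply, Finset.mem_insert, Finset.mem_singleton] at *; omega
    obtain ⟨k1, k2, k3, k4, k5⟩ := key 3 _ (fun i => by simp only [Pi.smul_apply, smul_eq_mul, Pi.add_apply, Pi.one_apply]; omega) hV
    refine ⟨3, _, .inr ⟨rfl, rfl⟩, hV, k1, k2, ?_, k3, k4, k5⟩
    simp only [Pi.smul_apply, smul_eq_mul, Pi.add_apply, Pi.one_apply]
    rw [Finset.sum_add_distrib, ← Finset.mul_sum]; simp [hι]; omega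
end

section
variable {B : Matrix (Fin 24) (Fin 24) ℤ}
variable {ι : Type} [Fintype ι] [DecidableEq ι] {C : Set (ι → ZMod 2)}
/-- coordinates modulo three in a standard frame -/
def rep (B : Matrix (Fin 24) (Fin 24) ℤ) (x : Om → ℤ) (v : LV) : Prop :=
  ∃ D F, NF B D F ∧ Std D ∧ ∀ i : Om, (3 : ℤ) ∣ pairZ B v (F i) - x i
theorem rep.conj (h : IsLeech B) {x : Om → ℤ} {v v' : LV} (h1 : rep B x v) (h2 : rep B x v') : cj B v v' := by
  obtain ⟨D, F, hF, hD, hc⟩ := h1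
  obtain ⟨D', F', hF', hD', hc'⟩ := h2
  exact Std.conj h hF hF' hD hD' fun i => by have := hc i; have := hc' i; omega
theorem rep_of {F : ι → LV} (hF : NF B C F) {e : Om ≃ ι} (he : Std (pull e C)) {x : Om → ℤ} {v : LV}
    (hx : ∀ i, (3 : ℤ) ∣ pairZ B v (F (e i)) - x i) : rep B x v := ⟨_, _, hF.pl e, he, hx⟩
theorem exists_not (hι : Fintype.card ι = 24) (S : Finset ι) (hS : S.card < 24) : ∃ a, a ∉ S := by
  by_contra hh; push Not at hh
  have : S = Finset.univ := Finset.eq_univ_iff_forall.2 hh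
  rw [this, Finset.card_univ] at hS; omega
theorem exists_T (hι : Fintype.card ι = 24) {a b c : ι} (hb : b ≠ a) (hc : c ≠ a) : ∃ T : Finset ι, T.card = 4 ∧ b ∈ T ∧ c ∈ T ∧ a ∉ T := by
  obtain ⟨T, h1, h2, h3⟩ := Finset.exists_subsuperset_card_eq (s := {b, c}) (t := Finset.univ \ {a}) (n := 4)
    (by intro i; simp; rintro (rfl | rfl) <;> assumption) (Finset.card_le_two.trans (by norm_num))
    (by rw [Finset.card_sdiff_of_subset (Finset.subset_univ _)]; simp [hι])
  refine ⟨T, h3, h1 (by simp), h1 (by simp), fun ha => ?_⟩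
  have := h2 ha; simp at this
theorem NF.lab3 (h : IsLeech B) (hι : Fintype.card ι = 24) {F : ι → LV} (hF : NF B C F) {a b c : ι} (hb : b ≠ a) (hc : c ≠ a)
    (hbc : b ≠ c) : ∃ e : Om ≃ ι, e (0, 0) = a ∧ e (1, 0) = b ∧ e (1, 1) = c ∧ Std (pull e C) := by
  obtain ⟨T, hT, h1, h2, h3⟩ := exists_T hι hb hc
  obtain ⟨T', ha, hT', hd, hC⟩ := hF.five h hι hT h3
  obtain ⟨q, hq⟩ := exists_not hι (T' ∪ T) (by have := Finset.card_union_le T' T; omega)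
  rw [Finset.mem_union, not_or] at hq
  rw [Finset.union_comm] at hC
  obtain ⟨e, e1, e2, e3, -, -, -, e4⟩ := hF.label h hι hT' hT hd.symm hC ha h1 h2 hbc hq.1 hq.2
  exact ⟨e, e1, e2, e3, e4⟩
theorem NF.labO (h : IsLeech B) (hι : Fintype.card ι = 24) {F : ι → LV} (hF : NF B C F) {O : Finset ι} (hO : ind O ∈ C)
    (h8 : O.card = 8) {p q : ι} (hp : p ∈ O) (hq : q ∉ O) : ∃ e : Om ≃ ι, e (0, 0) = p ∧ e (2, 0) = q ∧
      (∀ a, e a ∈ O ↔ a.1 = 0 ∨ a.1 = 1) ∧ Std (pull e C) := by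
  obtain ⟨T, h1, h2, h3⟩ := Finset.exists_subsuperset_card_eq (s := {p}) (t := O) (n := 4) (by simpa) (by simp) (by omega)
  have hc : (O \ T).card = 4 := by rw [Finset.card_sdiff_of_subset h2]; omega
  obtain ⟨b, hb, c, hcc, hbc⟩ := Finset.one_lt_card.1 (show 1 < (O \ T).card by omega)
  have hu : T ∪ O \ T = O := Finset.union_sdiff_of_subset h2
  obtain ⟨e, e1, e2, e3, e4, e5, e6, e7⟩ := hF.label h hι h3 hc Finset.disjoint_sdiff (by rwa [hu]) (h1 (Finset.mem_singleton_self p)) hb hcc hbc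
    (fun hh => hq (h2 hh)) (fun hh => hq (Finset.mem_sdiff.1 hh).1)
  refine ⟨e, e1, e4, fun a => ?_, e7⟩
  have hs : (Finset.univ.filter fun a : Om => a.1 = 0 ∨ a.1 = 1).map e.toEmbedding = O := by
    refine Finset.eq_of_subset_of_card_le (fun i hi => ?_) ?_
    · obtain ⟨⟨x, y⟩, ha, rfl⟩ := Finset.mem_map.1 hi
      simp only [Finset.mem_filter, Finset.mem_univ, true_and] at ha
      rcases ha with rfl | rfl
      · exact h2 (e5 y)
      · exact (Finset.mem_sdiff.1 (e6 y)).1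
    · rw [Finset.card_map, h8]; decide
  rw [← hs]; simp
theorem NF.labA (h : IsLeech B) (hι : Fintype.card ι = 24) {F : ι → LV} (hF : NF B C F) {O A : Finset ι} (hO : ind O ∈ C)
    (h8 : O.card = 8) (hA : A ⊆ O) (h3 : A.card = 3) {p : ι} (hp : p ∉ O) : ∃ e : Om ≃ ι, e (0, 0) = p ∧
      (∀ a, e a ∈ A ↔ a.1 = 0 ∧ a.2 ≠ 0) ∧ (∀ a, e a ∈ O ↔ (colw 0 + Kw (kx 0)) a ≠ 0) ∧ Std (pull e C) := by
  have hpA : p ∉ A := fun hh => hp (hA hh)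
  have hT : (insert p A).card = 4 := by rw [Finset.card_insert_of_notMem hpA, h3]
  have hc : (O \ A).card = 5 := by rw [Finset.card_sdiff_of_subset hA]; omega
  obtain ⟨b, hb, c, hcc, hbc⟩ := Finset.one_lt_card.1 (show 1 < (O \ A).card by omega)
  rw [Finset.mem_sdiff] at hb hcc
  have hb' : b ∉ insert p A := by
    rw [Finset.mem_insert, not_or]; exact ⟨fun hh => hp (hh ▸ hb.1), hb.2⟩
  obtain ⟨T', hbT, hT', hd, hC⟩ := hF.five h hι hT hb'
  have key : ∀ x ∈ O, x ∈ T' → x = b := fun x hx hxT => by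
    by_contra hne
    have hs : insert x (insert b A) ⊆ O ∩ (insert p A ∪ T') := by
      intro i; simp only [Finset.mem_insert, Finset.mem_inter, Finset.mem_union]
      rintro (rfl | rfl | hi)
      · exact ⟨hx, .inr hxT⟩
      · exact ⟨hb.1, .inr hbT⟩
      · exact ⟨hA hi, .inl (.inr hi)⟩
    have hxA : x ∉ A := fun hh => Finset.disjoint_left.1 hd (Finset.mem_insert_of_mem hh) hxT
    have h5 : (insert x (insert b A)).card = 5 := by
      rw [Finset.card_insert_of_notMem, Finset.card_insert_of_notMem hb.2, h3]
      simp [hne, hxA]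
    have := hF.gol.five_eq hO hC h8 (by rw [Finset.card_union_of_disjoint hd]; omega)
      (by rw [← h5]; exact Finset.card_le_card hs)
    exact hp (by rw [this]; simp)
  obtain ⟨d, hd1, hd2⟩ := Finset.exists_mem_ne (show 1 < T'.card by omega) b
  have hcp : c ∉ insert p A := by
    rw [Finset.mem_insert, not_or]; exact ⟨fun hh => hp (hh ▸ hcc.1), hcc.2⟩
  obtain ⟨e, e1, e2, e3, e4, e5, e6, e7⟩ := hF.label h hι hT hT' hd hC (Finset.mem_insert_self p A) hbT hd1 hd2.symm hcp
    (fun hh => hbc (key c hcc.1 hh).symm)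
  have hAm : (Finset.univ.filter fun a : Om => a.1 = 0 ∧ a.2 ≠ 0).map e.toEmbedding = A := by
    refine Finset.eq_of_subset_of_card_le (fun i hi => ?_) ?_
    · obtain ⟨⟨x, y⟩, ha, rfl⟩ := Finset.mem_map.1 hi
      simp only [Finset.mem_filter, Finset.mem_univ, true_and] at ha
      obtain ⟨rfl, hy⟩ := ha
      refine (Finset.mem_insert.1 (e5 y)).resolve_left fun hh => hy ?_
      have := e.injective (hh.trans e1.symm); simpa using this
    · rw [Finset.card_map, h3]; decide
  have hA' : ∀ a, e a ∈ A ↔ a.1 = 0 ∧ a.2 ≠ 0 := fun a => by rw [← hAm]; simp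
  refine ⟨e, e1, hA', ?_, e7⟩
  have hX : ind (Finset.univ.filter fun a : Om => (colw 0 + Kw (kx 0)) a ≠ 0) ∈ pull e C := by
    have := e7.x 0
    rwa [← ind_spt (colw 0 + Kw (kx 0))] at this
  have hO' : ind (Finset.univ.filter fun a : Om => e a ∈ O) ∈ pull e C := by
    show _ ∘ e.symm ∈ C
    convert hO using 1; funext i; simp [ind]
  have he := (hF.pl e).gol.five_eq hX hO' (by decide) (by
    rw [← h8, ← Finset.card_map e.toEmbedding]; congr 1; ext i; simp only [Finset.mem_map_equiv]; simp) (by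
    have : (({(0, 1), (0, 2), (0, 3), (1, 0), (2, 0)} : Finset Om)).card = 5 := by decide
    refine this.symm.le.trans (Finset.card_le_card ?_)
    have k : ∀ y : Fin 4, y ≠ 0 → e (0, y) ∈ O := fun y hy => hA ((hA' _).2 ⟨rfl, hy⟩)
    intro a ha
    rw [Finset.mem_inter, Finset.mem_filter, Finset.mem_filter]
    simp only [Finset.mem_insert, Finset.mem_singleton] at ha
    rcases ha with rfl | rfl | rfl | rfl | rfl
    · exact ⟨by decide, by simp, k 1 (by decide)⟩
    · exact ⟨by decide, by simp, k 2 (by decide)⟩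
    · exact ⟨by decide, by simp, k 3 (by decide)⟩
    · exact ⟨by decide, by simp, e2 ▸ hb.1⟩
    · exact ⟨by decide, by simp, e4 ▸ hcc.1⟩)
  intro a
  have := congrArg (a ∈ ·) he
  simpa using this.symm
end

section
variable {B : Matrix (Fin 24) (Fin 24) ℤ}
variable {ι : Type} [Fintype ι] [DecidableEq ι] {C : Set (ι → ZMod 2)}
theorem m4v2 : m4 2 (-4) = 0 ∧ m4 2 (-2) = 1 ∧ m4 2 0 = 0 ∧ m4 2 2 = 1 ∧ m4 2 4 = 0 := by decide
theorem m4v3 : m4 3 (-5) = 1 ∧ m4 3 (-3) = 0 ∧ m4 3 (-1) = 1 ∧ m4 3 1 = 0 ∧ m4 3 3 = 1 ∧ m4 3 5 = 0 := by decide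
/-- coordinate profile of a short vector in a frame -/
theorem NF.prof (h : IsLeech B) (hι : Fintype.card ι = 24) {F : ι → LV} (hF : NF B C F) {v : LV} {n : ℤ}
    (hn : pairZ B v v = n) (h6 : n ≤ 6) {x : ι → ℤ} (hx : ∀ i, pairZ B v (F i) = x i) (E : Finset ι) :
    ∃ W : ℤ, (W = 0 ∨ 8 ≤ W) ∧ 4 ∣ W ∧
    (((∀ i, x i = -4 ∨ x i = -2 ∨ x i = 0 ∨ x i = 2 ∨ x i = 4) ∧
      0 ≤ cnt x E (-4) ∧ 0 ≤ cnt x E (-2) ∧ 0 ≤ cnt x E 0 ∧ 0 ≤ cnt x E 2 ∧ 0 ≤ cnt x E 4 ∧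
      W = ∑ i ∈ E, m4 2 (x i) + cnt x E (-2) + cnt x E 2 ∧ (∑ i, x i) % 8 = 0 ∧
      ∑ i, x i = ∑ i ∈ E, x i - 4 * cnt x E (-4) - 2 * cnt x E (-2) + 2 * cnt x E 2 + 4 * cnt x E 4 ∧
      8 * n = ∑ i ∈ E, x i * x i + 16 * cnt x E (-4) + 4 * cnt x E (-2) + 4 * cnt x E 2 + 16 * cnt x E 4 ∧
      24 = (E.card : ℤ) + cnt x E (-4) + cnt x E (-2) + cnt x E 0 + cnt x E 2 + cnt x E 4) ∨
     ((∀ i, x i = -5 ∨ x i = -3 ∨ x i = -1 ∨ x i = 1 ∨ x i = 3 ∨ x i = 5) ∧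
      0 ≤ cnt x E (-5) ∧ 0 ≤ cnt x E (-3) ∧ 0 ≤ cnt x E (-1) ∧ 0 ≤ cnt x E 1 ∧ 0 ≤ cnt x E 3 ∧ 0 ≤ cnt x E 5 ∧
      W = ∑ i ∈ E, m4 3 (x i) + cnt x E (-5) + cnt x E (-1) + cnt x E 3 ∧ (∑ i, x i) % 8 = 4 ∧
      ∑ i, x i = ∑ i ∈ E, x i - 5 * cnt x E (-5) - 3 * cnt x E (-3) - cnt x E (-1) + cnt x E 1 + 3 * cnt x E 3 + 5 * cnt x E 5 ∧
      8 * n = ∑ i ∈ E, x i * x i + 25 * cnt x E (-5) + 9 * cnt x E (-3) + cnt x E (-1) + cnt x E 1 + 9 * cnt x E 3 + 25 * cnt x E 5 ∧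
      24 = (E.card : ℤ) + cnt x E (-5) + cnt x E (-3) + cnt x E (-1) + cnt x E 1 + cnt x E 3 + cnt x E 5)) := by
  have hs := hF.frm.inner h hι v v
  simp only [hx, hn] at hs
  obtain ⟨r, V, hV, hxV, k1, k2, k3, k4, k5, k6⟩ := ((hF.mem x).1 ⟨v, hx⟩).prof hF.gol hι (by omega) E
  have nn := cnt_nonneg x E
  rcases hV with ⟨rfl, rfl⟩ | ⟨rfl, rfl⟩
  · simp only [Finset.mem_insert, Finset.mem_singleton] at hxV
    have hS : ∀ f : ℤ → ℤ, ∑ a ∈ ({-4, -2, 0, 2, 4} : Finset ℤ), f a = f (-4) + f (-2) + f 0 + f 2 + f 4 := fun f => by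
      simp; ring
    simp only [hS] at k1 k2 k4 k5 k6
    rw [k5] at hs
    obtain ⟨e1, e2, e3, e4, e5⟩ := m4v2
    rw [e1, e2, e3, e4, e5] at k1 k2
    refine ⟨_, k1, k2, .inl ⟨hxV, nn _, nn _, nn _, nn _, nn _, ?_, k3, ?_, ?_, ?_⟩⟩
    · ring
    all_goals linarith
  · simp only [Finset.mem_insert, Finset.mem_singleton] at hxV
    have hS : ∀ f : ℤ → ℤ, ∑ a ∈ ({-5, -3, -1, 1, 3, 5} : Finset ℤ), f a = f (-5) + f (-3) + f (-1) + f 1 + f 3 + f 5 := fun f => by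
      simp; ring
    simp only [hS] at k1 k2 k4 k5 k6
    rw [k5] at hs
    obtain ⟨e1, e2, e3, e4, e5, e6⟩ := m4v3
    rw [e1, e2, e3, e4, e5, e6] at k1 k2
    refine ⟨_, k1, k2, .inr ⟨hxV, nn _, nn _, nn _, nn _, nn _, nn _, ?_, k3, ?_, ?_, ?_⟩⟩
    · ring
    all_goals linarith
theorem IsLeech.exists_frame (h : IsLeech B) : ∃ (C : Set (Fin 24 → ZMod 2)) (F : Fin 24 → LV), NF B C F := by
  obtain ⟨f, hf⟩ : ∃ f, f ∈ h.shell 4 := Finset.card_pos.1 (by rw [h.card_shells.2.2.1]; norm_num)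
  obtain ⟨C, F, -, hF, -⟩ := h.frame_of (f := f) (by rw [h.mem_shell.1 hf]; norm_num)
  exact ⟨C, F, hF⟩
theorem IsLeech.aux4 (h : IsLeech B) {a : LV} (ha : pairZ B a a = 4) : ∃ u, pairZ B u u = 4 ∧ pairZ B a u = 0 := by
  obtain ⟨C, F, hF⟩ := h.exists_frame
  suffices ∃ c, 2 ≤ cnt (fun i => pairZ B a (F i)) ∅ c by
    obtain ⟨c, hc⟩ := this
    obtain ⟨i, j, hij, -, -, h1, h2⟩ := cnt_pick2 hc
    obtain ⟨u, hu, hw⟩ := hF.frm.two h hij (.inl rfl : (1 : ℤ) = 1 ∨ _) (.inr rfl : (-1 : ℤ) = 1 ∨ _)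
    refine ⟨u, hu, ?_⟩
    have := hw a; rw [h1, h2] at this; omega
  by_contra hcon; push Not at hcon
  obtain ⟨W, -, -, ⟨-, -, -, -, -, -, -, -, -, -, k⟩ | ⟨-, -, -, -, -, -, -, -, -, -, -, k⟩⟩ := hF.prof h (by simp) ha (by norm_num) (fun _ => rfl) ∅
  · have := hcon (-4); have := hcon (-2); have := hcon 0; have := hcon 2; have := hcon 4
    simp at k; omega
  · have := hcon (-5); have := hcon (-3); have := hcon (-1); have := hcon 1; have := hcon 3; have := hcon 5
    simp at k; omega
theorem IsLeech.aux6 (h : IsLeech B) {s : LV} (hs : pairZ B s s = 6) : ∃ m, pairZ B m m = 4 ∧ pairZ B s m = -1 := by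
  obtain ⟨C, F, hF⟩ := h.exists_frame
  set x : Fin 24 → ℤ := fun i => pairZ B s (F i) with hx
  have fin : ∀ i j, i ≠ j → ∀ ε δ : ℤ, (ε = 1 ∨ ε = -1) → (δ = 1 ∨ δ = -1) → ε * x i + δ * x j = -2 →
      ∃ m, pairZ B m m = 4 ∧ pairZ B s m = -1 := fun i j hij ε δ h1 h2 h3 => by
    obtain ⟨u, hu, hw⟩ := hF.frm.two h hij h1 h2
    exact ⟨u, hu, by have := hw s; simp only [hx] at h3; omega⟩
  obtain ⟨W, k1, k2, ⟨-, a1, a2, a3, a4, a5, k3, k4, k5, k6, k7⟩ | ⟨-, a1, a2, a3, a4, a5, a6, k3, k4, k5, k6, k7⟩⟩ :=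
    hF.prof h (by simp) hs (by norm_num) (x := x) (fun _ => rfl) ∅ <;> simp only [Finset.sum_empty, Finset.card_empty] at k3 k5 k6 k7
  · have h0 : 1 ≤ cnt x ∅ 0 := by omega
    obtain ⟨i, -, hi⟩ := cnt_pick h0
    have : 1 ≤ cnt x ∅ 2 ∨ 1 ≤ cnt x ∅ (-2) := by omega
    rcases this with h2 | h2 <;> obtain ⟨j, -, hj⟩ := cnt_pick h2
    · exact fin i j (fun hh => by rw [hh] at hi; omega) 1 (-1) (by simp) (by simp) (by rw [hi, hj]; norm_num)
    · exact fin i j (fun hh => by rw [hh] at hi; omega) 1 1 (by simp) (by simp) (by rw [hi, hj]; norm_num)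
  · have : 2 ≤ cnt x ∅ 1 ∨ 2 ≤ cnt x ∅ (-1) := by omega
    rcases this with h2 | h2 <;> obtain ⟨i, j, hij, -, -, hi, hj⟩ := cnt_pick2 h2
    · exact fin i j hij (-1) (-1) (by simp) (by simp) (by rw [hi, hj]; norm_num)
    · exact fin i j hij 1 1 (by simp) (by simp) (by rw [hi, hj]; norm_num)
/-- sums of squares -/
theorem rest_zero {x : ι → ℤ} {E : Finset ι} (h : ∑ i, x i * x i = ∑ i ∈ E, x i * x i) : ∀ i ∉ E, x i = 0 := by
  intro i hi
  rw [← Finset.sum_sdiff (Finset.subset_univ E)] at h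
  have h0 : ∑ i ∈ Finset.univ \ E, x i * x i = 0 := by linarith
  have := (Finset.sum_eq_zero_iff_of_nonneg fun i _ => mul_self_nonneg (x i)).1 h0 i (by simp [hi])
  exact mul_self_eq_zero.1 this
theorem pm_mul {s : ℤ} (h : s = 1 ∨ s = -1) : s * s = 1 := by rcases h with rfl | rfl <;> rfl
theorem IsLeech.T2 (h : IsLeech B) {a u : LV} (ha : pairZ B a a = 4) (hu : pairZ B u u = 4) (hau : pairZ B a u = 0) :
    ∃ (C : Set (Fin 24 → ZMod 2)) (F : Fin 24 → LV) (i j : Fin 24), NF B C F ∧ i ≠ j ∧ F i = a + u ∧ pairZ B a (F i) = 4 ∧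
      pairZ B a (F j) = 4 ∧ ∀ k, k ≠ i → k ≠ j → pairZ B a (F k) = 0 := by
  obtain ⟨C, F, i, hF, hi⟩ := h.frame_of (f := a + u) (by rw [h.N_add]; omega)
  set x : Fin 24 → ℤ := fun i => pairZ B a (F i) with hx
  have xi : x i = 4 := by simp only [hx, hi, pairZ_add_right]; omega
  have : 1 ≤ cnt x {i} 4 ∨ 1 ≤ cnt x {i} (-4) := by
    obtain ⟨W, k1, k2, ⟨-, a1, a2, a3, a4, a5, k3, k4, k5, k6, k7⟩ | ⟨b, -⟩⟩ :=
      hF.prof h (by simp) ha (by norm_num) (x := x) (fun _ => rfl) {i}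
    · simp only [Finset.sum_singleton, xi, m4v2] at k3 k6
      omega
    · have := b i; omega
  have : ∃ j, i ≠ j ∧ (x j = 4 ∨ x j = -4) := by
    rcases this with h1 | h1 <;> obtain ⟨j, hj, hj'⟩ := cnt_pick h1 <;>
      exact ⟨j, fun hh => hj (by simp [hh]), by simp [hj']⟩
  obtain ⟨j, hij, hj⟩ := this
  have h0 : ∀ k ∉ ({i, j} : Finset (Fin 24)), x k = 0 := rest_zero (by
    have := hF.frm.inner h (by simp) a a
    rw [Finset.sum_pair hij, ← this, ha, xi]; rcases hj with hj | hj <;> rw [hj] <;> norm_num)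
  obtain ⟨s, s1, s2, hF'⟩ := hF.signs {i, j} (hF.gol.small (Finset.card_le_two.trans_lt (by norm_num)))
    (fun k => if k = i then 1 else if x j = 4 then 1 else -1) (fun k _ => by split_ifs <;> simp)
  have si := s2 i (by simp); have sj := s2 j (by simp)
  simp only [if_true, hij.symm, if_false] at si sj
  refine ⟨C, _, i, j, hF', hij, by rw [si, one_smul, hi], ?_, ?_, fun k h1 h2 => ?_⟩
  · rw [pairZ_smul_right, si]; linarith
  · rw [pairZ_smul_right, sj]
    rcases hj with hj | hj
    · rw [if_pos hj]; linarith
    · rw [if_neg (by omega)]; linarith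
  · rw [pairZ_smul_right]; have := h0 k (by simp [h1, h2]); simp only [hx] at this; rw [this, mul_zero]
theorem IsLeech.T3 (h : IsLeech B) {s m : LV} (hs : pairZ B s s = 6) (hm : pairZ B m m = 4) (hsm : pairZ B s m = -1) :
    ∃ (C : Set (Fin 24 → ZMod 2)) (F : Fin 24 → LV) (i : Fin 24), NF B C F ∧ F i = s + m ∧ pairZ B s (F i) = 5 ∧
      ∀ k, k ≠ i → pairZ B s (F k) = 1 := by
  obtain ⟨C, F, i, hF, hi⟩ := h.frame_of (f := s + m) (by rw [h.N_add]; omega)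
  set x : Fin 24 → ℤ := fun i => pairZ B s (F i) with hx
  have xi : x i = 5 := by simp only [hx, hi, pairZ_add_right]; omega
  have hpm : ∀ k, k ≠ i → x k = 1 ∨ x k = -1 := fun k hk => by
    obtain ⟨W, k1, k2, ⟨b, -⟩ | ⟨b, a1, a2, a3, a4, a5, a6, k3, k4, k5, k6, k7⟩⟩ :=
      hF.prof h (by simp) hs (by norm_num) (x := x) (fun _ => rfl) {i, k}
    · have := b i; omega
    · simp only [Finset.sum_pair hk.symm, Finset.card_pair hk.symm, xi] at k6 k7
      rcases b k with b | b | b | b | b | b <;> simp [b] at k6 k7 ⊢ <;> omega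
  obtain ⟨y, hy, hxy⟩ := (hF.mem x).1 ⟨s, fun _ => rfl⟩
  have hxy : x = (2 : ℤ) • y + 1 := by
    rcases hxy with hh | hh
    · have := congrFun hh.1 i; simp only [Pi.smul_apply, smul_eq_mul] at this; omega
    · exact hh.1
  have hxy' : ∀ k, x k = 2 * y k + 1 := fun k => by rw [hxy]; simp
  have hsg : ∀ k, sg (rd y) k = if y k % 2 = 0 then 1 else -1 := fun k => by
    have : rd y k = 0 ↔ y k % 2 = 0 := by
      simp only [rd]; rw [ZMod.intCast_zmod_eq_zero_iff_dvd (y k) 2]; omega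
    simp only [sg, lft, this]; split_ifs <;> rfl
  have si : sg (rd y) i = 1 := by rw [hsg, if_pos (by have := hxy' i; omega)]
  refine ⟨C, _, i, hF.sgn hy, by rw [si, one_smul, hi], by rw [pairZ_smul_right, si]; linarith, fun k hk => ?_⟩
  rw [pairZ_smul_right, hsg]
  have := hxy' k; show _ * x k = 1
  rcases hpm k hk with h1 | h1 <;> rw [h1]
  · rw [if_pos (by omega)]; rfl
  · rw [if_neg (by omega)]; rfl
end

section
variable {B : Matrix (Fin 24) (Fin 24) ℤ}
/-- representatives of the ten classes, in frame coordinates -/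
def xr : Fin 10 → Om → ℤ := ![fun _ => 0, fun p => if p = (0, 0) then -1 else 1,
  fun p => if p = (0, 0) then -1 else if p = (1, 0) ∨ p = (1, 1) then 1 else 0, fun _ => -1,
  fun p => if p = (0, 0) then 0 else if p.1 = 0 then -1 else if p.2 = 0 then 0 else 1,
  fun p => if p = (0, 0) then -1 else 0, fun p => if p = (0, 0) ∨ p = (1, 0) then 0 else 1,
  fun p => if p = (0, 0) ∨ p = (1, 0) then 1 else 0,
  fun p => if p = (0, 0) then 0 else if p = (2, 0) then 1 else if p.1 = 0 ∨ p.1 = 1 then 2 else 0,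
  fun p => if p = (0, 0) then -1 else if p.1 = 0 ∨ p.1 = 1 then 1 else 0]
theorem mem_spt_rd {ι : Type} [Fintype ι] [DecidableEq ι] (y : ι → ℤ) (k : ι) : k ∈ spt (rd y) ↔ y k % 2 = 1 := by
  have : rd y k = 0 ↔ (2 : ℤ) ∣ y k := ZMod.intCast_zmod_eq_zero_iff_dvd (y k) 2
  rw [spt, Finset.mem_filter, ne_eq, this]; simp only [Finset.mem_univ, true_and]; omega
theorem ne3 (i j : Fin 24) : ∃ l, l ≠ i ∧ l ≠ j := by
  obtain ⟨l, hl⟩ := exists_not (by simp) ({i, j} : Finset (Fin 24)) (Finset.card_le_two.trans_lt (by norm_num))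
  simp at hl; exact ⟨l, hl⟩
theorem IsLeech.R8 (h : IsLeech B) {v : LV} (hv : pairZ B v v = 8) : rep B (xr 5) v := by
  obtain ⟨C, F, i, hF, hi⟩ := h.frame_of hv
  obtain ⟨j, hj, -⟩ := ne3 i i
  obtain ⟨k, hk, hkj⟩ := ne3 i j
  obtain ⟨e, e1, e2, e3, he⟩ := hF.lab3 h (by simp) hj hk hkj.symm
  refine rep_of hF he fun p => ?_
  show _ ∣ _ - if p = (0, 0) then (-1 : ℤ) else 0
  rw [← hi, hF.frm.pp]
  by_cases hp : p = (0, 0)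
  · simp [hp, e1]
  · rw [if_neg hp, if_neg (fun hh => hp (e.injective (hh.symm.trans e1.symm)))]; simp
theorem IsLeech.R6 (h : IsLeech B) {v : LV} (hv : pairZ B v v = 6) : rep B (xr 1) v := by
  obtain ⟨m, hm, hvm⟩ := h.aux6 hv
  obtain ⟨C, F, i, hF, -, hi, hk⟩ := h.T3 hv hm hvm
  obtain ⟨j, hj, -⟩ := ne3 i i
  obtain ⟨k, hk', hkj⟩ := ne3 i j
  obtain ⟨e, e1, e2, e3, he⟩ := hF.lab3 h (by simp) hj hk' hkj.symm
  refine rep_of hF he fun p => ?_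
  show _ ∣ _ - if p = (0, 0) then (-1 : ℤ) else 1
  by_cases hp : p = (0, 0)
  · simp [hp, e1, hi]
  · rw [if_neg hp, hk _ (fun hh => hp (e.injective (hh.trans e1.symm)))]; simp
theorem IsLeech.R4 (h : IsLeech B) {v : LV} (hv : pairZ B v v = 4) : rep B (xr 7) v := by
  obtain ⟨m, hm, hvm⟩ := h.aux4 hv
  obtain ⟨C, F, i, j, hF, hij, -, hi, hj, hk⟩ := h.T2 hv hm hvm
  obtain ⟨k, hk', hkj⟩ := ne3 i j
  obtain ⟨e, e1, e2, e3, he⟩ := hF.lab3 h (by simp) hij.symm hk' hkj.symm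
  refine rep_of hF he fun p => ?_
  show _ ∣ _ - if p = (0, 0) ∨ p = (1, 0) then (1 : ℤ) else 0
  split_ifs with hp
  · rcases hp with rfl | rfl
    · rw [e1, hi]; decide
    · rw [e2, hj]; decide
  · rw [not_or] at hp
    rw [hk _ (fun hh => hp.1 (e.injective (hh.trans e1.symm))) (fun hh => hp.2 (e.injective (hh.trans e2.symm)))]; simp
theorem NF.two' (h : IsLeech B) {C : Set (Fin 24 → ZMod 2)} {F : Fin 24 → LV} (hF : NF B C F) {a b : LV} {k l : Fin 24} (hkl : k ≠ l)
    (hk : pairZ B a (F k) = 0) (hl : pairZ B a (F l) = 0) {ε δ c : ℤ} (hε : ε = 1 ∨ ε = -1) (hδ : δ = 1 ∨ δ = -1)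
    (hc : ε * pairZ B b (F k) + δ * pairZ B b (F l) = 2 * c) : ∃ u, pairZ B u u = 4 ∧ pairZ B a u = 0 ∧ pairZ B b u = c := by
  obtain ⟨u, hu, hw⟩ := hF.frm.two h hkl hε hδ
  refine ⟨u, hu, ?_, ?_⟩
  · have := hw a; rw [hk, hl] at this; omega
  · have := hw b; omega
/-- inner products with a vector `(4,4,0,…)` -/
theorem NF.in2 (h : IsLeech B) {C : Set (Fin 24 → ZMod 2)} {F : Fin 24 → LV} (hF : NF B C F) {a : LV} {i j : Fin 24} (hij : i ≠ j)
    (hi : pairZ B a (F i) = 4) (hj : pairZ B a (F j) = 4) (hk : ∀ k, k ≠ i → k ≠ j → pairZ B a (F k) = 0) (b : LV) :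
    2 * pairZ B a b = pairZ B b (F i) + pairZ B b (F j) := by
  have := hF.frm.inner h (by simp) a b
  rw [← Finset.sum_subset (Finset.subset_univ {i, j}), Finset.sum_pair hij, hi, hj] at this
  · omega
  · intro k _ hk'; simp only [Finset.mem_insert, Finset.mem_singleton, not_or] at hk'
    rw [hk k hk'.1 hk'.2, zero_mul]
theorem IsLeech.R10 (h : IsLeech B) {a b : LV} (ha : pairZ B a a = 4) (hb : pairZ B b b = 4) (hab : pairZ B a b = 1) :
    rep B (xr 8) (a + b) := by
  obtain ⟨u, hu, hau, hbu⟩ : ∃ u, pairZ B u u = 4 ∧ pairZ B a u = 0 ∧ pairZ B b u = 1 := by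
    obtain ⟨m, hm, ham⟩ := h.aux4 ha
    obtain ⟨C, F, i, j, hF, hij, -, hi, hj, hk⟩ := h.T2 ha hm ham
    have h2 := hF.in2 h hij hi hj hk b
    set x : Fin 24 → ℤ := fun i => pairZ B b (F i) with hx
    have h2' : x i + x j = 2 := by rw [← h2, hab]; rfl
    have go : ∀ k l, k ∉ ({i, j} : Finset (Fin 24)) → l ∉ ({i, j} : Finset (Fin 24)) → k ≠ l → ∀ ε δ : ℤ, (ε = 1 ∨ ε = -1) → (δ = 1 ∨ δ = -1) →
        ε * x k + δ * x l = 2 → ∃ u, pairZ B u u = 4 ∧ pairZ B a u = 0 ∧ pairZ B b u = 1 := fun k l h1 h2 h3 ε δ h4 h5 h6 => by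
      simp at h1 h2
      exact hF.two' h h3 (hk k h1.1 h1.2) (hk l h2.1 h2.2) h4 h5 h6
    obtain ⟨W, k1, k2, ⟨b, a1, a2, a3, a4, a5, k3, k4, k5, k6, k7⟩ | ⟨b, a1, a2, a3, a4, a5, a6, k3, k4, k5, k6, k7⟩⟩ :=
      hF.prof h (by simp) hb (by norm_num) (x := x) (fun _ => rfl) {i, j} <;>
      simp only [Finset.sum_pair hij, Finset.card_pair hij] at k3 k5 k6 k7
    · have : 1 ≤ cnt x {i, j} 0 ∧ (1 ≤ cnt x {i, j} 2 ∨ 1 ≤ cnt x {i, j} (-2)) := by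
        have hj' : x j = 2 - x i := by omega
        rw [hj'] at k3 k5 k6
        have := b j
        rcases b i with b | b | b | b | b <;> rw [b] at k3 k5 k6 hj' <;> norm_num at k3 k5 k6 hj' <;>
          simp only [m4v2] at k3 <;> omega
      obtain ⟨k, hk, hk0⟩ := cnt_pick this.1
      rcases this.2 with h3 | h3 <;> obtain ⟨l, hl, hl0⟩ := cnt_pick h3 <;> have hkl : k ≠ l := fun hh => by rw [hh] at hk0; omega
      · exact go k l hk hl hkl 1 1 (by simp) (by simp) (by omega)
      · exact go k l hk hl hkl 1 (-1) (by simp) (by simp) (by omega)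
    · have : 2 ≤ cnt x {i, j} 1 ∨ 2 ≤ cnt x {i, j} (-1) := by
        have := mul_self_nonneg (x i); have := mul_self_nonneg (x j); omega
      rcases this with h3 | h3 <;> obtain ⟨k, l, hkl, hk, hl, hk0, hl0⟩ := cnt_pick2 h3
      · exact go k l hk hl hkl 1 1 (by simp) (by simp) (by omega)
      · exact go k l hk hl hkl (-1) (-1) (by simp) (by simp) (by omega)
  obtain ⟨C, F, i, j, hF, hij, hFi, hi, hj, hk⟩ := h.T2 ha hu hau
  have h2 := hF.in2 h hij hi hj hk b
  set x : Fin 24 → ℤ := fun i => pairZ B b (F i) with hx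
  have xi : x i = 2 := by simp only [hx, hFi, pairZ_add_right]; rw [h.comm b a]; omega
  have xj : x j = 0 := by simp only [hx] at xi ⊢; omega
  obtain ⟨y, hy, hxy⟩ := (hF.mem x).1 ⟨b, fun _ => rfl⟩
  have hxy : x = (2 : ℤ) • y := by
    rcases hxy with hh | hh
    · exact hh.1
    · have := congrFun hh.1 i; simp only [Pi.smul_apply, smul_eq_mul, Pi.add_apply, Pi.one_apply] at this; omega
  have hxy' : ∀ k, x k = 2 * y k := fun k => by rw [hxy]; rfl
  set O := spt (rd y) with hO
  have hOC : ind O ∈ C := by rw [hO, ind_spt]; exact hy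
  have mO : ∀ k, k ∈ O ↔ y k % 2 = 1 := mem_spt_rd y
  have hiO : i ∈ O := (mO i).2 (by have := hxy' i; omega)
  have hjO : j ∉ O := fun hh => by have := (mO j).1 hh; have := hxy' j; omega
  have h8 := hF.gol.min8 hOC ⟨i, hiO⟩
  have hsq : ∑ k, y k * y k = 8 := by
    have := hF.frm.inner h (by simp) b b
    have e : ∑ k, pairZ B b (F k) * pairZ B b (F k) = 4 * ∑ k, y k * y k := by
      rw [Finset.mul_sum]; exact Finset.sum_congr rfl fun k _ => by
        have := hxy' k; simp only [hx] at this; rw [this]; ring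
    omega
  have hind : ∀ k, (if k ∈ O then (1 : ℤ) else 0) ≤ y k * y k := fun k => by
    split_ifs with hk
    · rcases lt_or_ge (y k) 0 with h' | h'
      · nlinarith
      · have := (mO k).1 hk; have : 1 ≤ y k := by omega
        nlinarith
    · exact mul_self_nonneg _
  have hsO : ∑ k, (if k ∈ O then (1 : ℤ) else 0) = O.card := by simp
  have hO8 : O.card = 8 := by
    have := Finset.sum_le_sum fun k (_ : k ∈ Finset.univ) => hind k
    omega
  have heq : ∀ k, (if k ∈ O then (1 : ℤ) else 0) = y k * y k := fun k =>
    (Finset.sum_eq_sum_iff_of_le fun k _ => hind k).1 (by rw [hsO, hsq, hO8]; rfl) k (Finset.mem_univ k)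
  have hon : ∀ k ∈ O, x k = 2 ∨ x k = -2 := fun k hk => by
    have := heq k; rw [if_pos hk] at this
    have h1 : y k = 1 ∨ y k = -1 := by
      have : (y k - 1) * (y k + 1) = 0 := by linarith
      rcases mul_eq_zero.1 this with h | h <;> omega
    have := hxy' k; omega
  have hoff : ∀ k ∉ O, x k = 0 := fun k hk => by
    have := heq k; rw [if_neg hk] at this
    rw [hxy', mul_self_eq_zero.1 this.symm]; rfl
  set S := insert j (O.erase i) with hS
  have hS8 : S.card = 8 := by
    rw [hS, Finset.card_insert_of_notMem (fun hh => hjO (Finset.mem_of_mem_erase hh)), Finset.card_erase_of_mem hiO, hO8]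
  obtain ⟨s, s1, s2, hF'⟩ := hF.signs S (fun d hd hdS => by
      by_contra hd0
      have hsub : spt d ⊆ S := fun k hk => by
        by_contra hkS; simp [spt, hdS k hkS] at hk
      have hw : 8 ≤ (spt d).card := hF.gol.eight d hd hd0
      have hE : spt d = S := Finset.eq_of_subset_of_card_le hsub (by omega)
      have hSC : ind S ∈ C := by rw [← hE, ind_spt]; exact hd
      have := hF.gol.five_eq hSC hOC hS8 hO8 (le_trans (by rw [Finset.card_erase_of_mem hiO, hO8]; norm_num)
        (Finset.card_le_card (s := O.erase i) fun k hk => Finset.mem_inter.2 ⟨Finset.mem_insert_of_mem hk, Finset.mem_of_mem_erase hk⟩))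
      exact hjO (by rw [← this]; simp [hS]))
    (fun k => if k = j then 1 else if x k = 2 then 1 else -1) (fun k _ => by split_ifs <;> simp)
  obtain ⟨e, e1, e2, e3, he⟩ := hF'.labO h (by simp) hOC hO8 hiO hjO
  refine rep_of hF' he fun p => ?_
  show _ ∣ _ - if p = (0, 0) then (0 : ℤ) else if p = (2, 0) then 1 else if p.1 = 0 ∨ p.1 = 1 then 2 else 0
  rw [pairZ_smul_right, pairZ_add_left]
  by_cases hp0 : p = (0, 0)
  · rw [if_pos hp0, hp0, e1, hi]; simp only [hx] at xi; rw [xi]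
    exact ⟨s i * 2, by ring⟩
  rw [if_neg hp0]
  have hpi : e p ≠ i := fun hh => hp0 (e.injective (hh.trans e1.symm))
  by_cases hp1 : p = (2, 0)
  · rw [if_pos hp1, hp1, e2, hj, s2 j (by simp [hS])]; simp only [hx] at xj; rw [xj]; simp
  rw [if_neg hp1]
  have hpj : e p ≠ j := fun hh => hp1 (e.injective (hh.trans e2.symm))
  rw [hk _ hpi hpj, zero_add]
  by_cases hpO : e p ∈ O
  · rw [if_pos ((e3 p).1 hpO), s2 _ (by simp [hS, hpi, hpO])]
    simp only [hpj, if_false]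
    have := hon _ hpO
    show _ ∣ _ * x (e p) - 2
    rcases this with h' | h' <;> rw [h'] <;> norm_num
  · rw [if_neg (fun hh => hpO ((e3 p).2 hh))]
    show _ ∣ _ * x (e p) - 0
    rw [hoff _ hpO]; simp
end

section
variable {B : Matrix (Fin 24) (Fin 24) ℤ}
theorem IsLeech.R12A_aux (h : IsLeech B) {a b : LV} (hb : pairZ B b b = 4) (hab : pairZ B a b = 2)
    {C : Set (Fin 24 → ZMod 2)} {F : Fin 24 → LV} {i j : Fin 24} (hF : NF B C F) (hij : i ≠ j) (hi : pairZ B a (F i) = 4)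
    (hj : pairZ B a (F j) = 4) (hk : ∀ k, k ≠ i → k ≠ j → pairZ B a (F k) = 0) :
    ∃ u, pairZ B u u = 4 ∧ pairZ B a u = 0 ∧ (pairZ B b u = 2 ∨ (pairZ B b u = 0 ∧ pairZ B b (F i) % 2 = 1)) := by
  have h2 := hF.in2 h hij hi hj hk b
  set x : Fin 24 → ℤ := fun i => pairZ B b (F i) with hx
  have h2' : x i + x j = 4 := by rw [← h2, hab]; rfl
  have go : ∀ k l, k ∉ ({i, j} : Finset (Fin 24)) → l ∉ ({i, j} : Finset (Fin 24)) → k ≠ l → ∀ ε δ : ℤ, (ε = 1 ∨ ε = -1) → (δ = 1 ∨ δ = -1) →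
      ∀ c, ε * x k + δ * x l = 2 * c → ∃ u, pairZ B u u = 4 ∧ pairZ B a u = 0 ∧ pairZ B b u = c := fun k l h1 h2 h3 ε δ h4 h5 c h6 => by
    simp at h1 h2
    exact hF.two' h h3 (hk k h1.1 h1.2) (hk l h2.1 h2.2) h4 h5 h6
  obtain ⟨W, k1, k2, ⟨b, a1, a2, a3, a4, a5, k3, k4, k5, k6, k7⟩ | ⟨b, a1, a2, a3, a4, a5, a6, k3, k4, k5, k6, k7⟩⟩ :=
    hF.prof h (by simp) hb (by norm_num) (x := x) (fun _ => rfl) {i, j} <;>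
    simp only [Finset.sum_pair hij, Finset.card_pair hij] at k3 k5 k6 k7
  · suffices ∃ u, pairZ B u u = 4 ∧ pairZ B a u = 0 ∧ pairZ B _ u = 2 by
      obtain ⟨u, h1, h2, h3⟩ := this; exact ⟨u, h1, h2, .inl h3⟩
    have : (1 ≤ cnt x {i, j} 0 ∧ (1 ≤ cnt x {i, j} 4 ∨ 1 ≤ cnt x {i, j} (-4))) ∨ 2 ≤ cnt x {i, j} 2 ∨ 2 ≤ cnt x {i, j} (-2) := by
      have hj' : x j = 4 - x i := by omega
      rw [hj'] at k3 k5 k6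
      have := b j
      rcases b i with b | b | b | b | b <;> rw [b] at k3 k5 k6 hj' <;> norm_num at k3 k5 k6 hj' <;>
        simp only [m4v2] at k3 <;> omega
    rcases this with ⟨h0, h3⟩ | h3 | h3
    · obtain ⟨k, hk, hk0⟩ := cnt_pick h0
      rcases h3 with h3 | h3 <;> obtain ⟨l, hl, hl0⟩ := cnt_pick h3 <;> have hkl : k ≠ l := fun hh => by rw [hh] at hk0; omega
      · exact go k l hk hl hkl 1 1 (by simp) (by simp) 2 (by omega)
      · exact go k l hk hl hkl 1 (-1) (by simp) (by simp) 2 (by omega)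
    · obtain ⟨k, l, hkl, hk, hl, hk0, hl0⟩ := cnt_pick2 h3
      exact go k l hk hl hkl 1 1 (by simp) (by simp) 2 (by omega)
    · obtain ⟨k, l, hkl, hk, hl, hk0, hl0⟩ := cnt_pick2 h3
      exact go k l hk hl hkl (-1) (-1) (by simp) (by simp) 2 (by omega)
  · have : ∃ c, 2 ≤ cnt x {i, j} c := by
      by_contra hcon; push Not at hcon
      have := hcon (-5); have := hcon (-3); have := hcon (-1); have := hcon 1; have := hcon 3; have := hcon 5
      omega
    obtain ⟨c, hc⟩ := this
    obtain ⟨k, l, hkl, hk, hl, hk0, hl0⟩ := cnt_pick2 hc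
    obtain ⟨u, h1, h2, h3⟩ := go k l hk hl hkl 1 (-1) (by simp) (by simp) 0 (by omega)
    exact ⟨u, h1, h2, .inr ⟨h3, by have := b i; simp only [hx] at this; omega⟩⟩
theorem IsLeech.R12A (h : IsLeech B) {a b : LV} (ha : pairZ B a a = 4) (hb : pairZ B b b = 4) (hab : pairZ B a b = 2) :
    rep B (xr 2) (a + b) := by
  obtain ⟨u, hu, hau, hbu⟩ : ∃ u, pairZ B u u = 4 ∧ pairZ B a u = 0 ∧ pairZ B b u = 2 := by
    obtain ⟨m, hm, ham⟩ := h.aux4 ha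
    obtain ⟨C, F, i, j, hF, hij, -, hi, hj, hk⟩ := h.T2 ha hm ham
    obtain ⟨u, hu, hau, hh | ⟨hh, -⟩⟩ := h.R12A_aux hb hab hF hij hi hj hk
    · exact ⟨u, hu, hau, hh⟩
    obtain ⟨C, F, i, j, hF, hij, hFi, hi, hj, hk⟩ := h.T2 ha hu hau
    obtain ⟨u', hu, hau, hh' | ⟨-, hh'⟩⟩ := h.R12A_aux hb hab hF hij hi hj hk
    · exact ⟨u', hu, hau, hh'⟩
    rw [hFi, pairZ_add_right, h.comm b a] at hh'; omega
  obtain ⟨C, F, i, j, hF, hij, hFi, hi, hj, hk⟩ := h.T2 ha hu hau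
  have h2 := hF.in2 h hij hi hj hk b
  set x : Fin 24 → ℤ := fun i => pairZ B b (F i) with hx
  have xi : x i = 4 := by simp only [hx, hFi, pairZ_add_right]; rw [h.comm b a]; omega
  have xj : x j = 0 := by simp only [hx] at xi ⊢; omega
  have : 1 ≤ cnt x {i, j} 4 ∨ 1 ≤ cnt x {i, j} (-4) := by
    obtain ⟨W, k1, k2, ⟨-, a1, a2, a3, a4, a5, k3, k4, k5, k6, k7⟩ | ⟨b, -⟩⟩ :=
      hF.prof h (by simp) hb (by norm_num) (x := x) (fun _ => rfl) {i, j}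
    · simp only [Finset.sum_pair hij, xi, xj, m4v2] at k3 k6
      omega
    · have := b i; omega
  have : ∃ l, l ≠ i ∧ l ≠ j ∧ (x l = 4 ∨ x l = -4) := by
    rcases this with h1 | h1 <;> obtain ⟨j, hj, hj'⟩ := cnt_pick h1 <;> simp at hj <;>
      exact ⟨j, hj.1, hj.2, by simp [hj']⟩
  obtain ⟨l, hli, hlj, hl⟩ := this
  have h0 : ∀ k ∉ ({i, l} : Finset (Fin 24)), x k = 0 := rest_zero (by
    have := hF.frm.inner h (by simp) b b
    rw [Finset.sum_pair hli.symm, ← this, hb, xi]; rcases hl with hj | hj <;> rw [hj] <;> norm_num)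
  obtain ⟨s, s1, s2, hF'⟩ := hF.signs {i, j, l} (hF.gol.small (Finset.card_le_three.trans_lt (by norm_num)))
    (fun k => if k = l ∧ x l = -4 then -1 else 1) (fun k _ => by split_ifs <;> simp)
  obtain ⟨e, e1, e2, e3, he⟩ := hF'.lab3 h (by simp) hij.symm hli hlj.symm
  refine rep_of hF' he fun p => ?_
  show _ ∣ _ - if p = (0, 0) then (-1 : ℤ) else if p = (1, 0) ∨ p = (1, 1) then 1 else 0
  rw [pairZ_smul_right, pairZ_add_left]
  show _ ∣ _ * (_ + x (e p)) - _
  by_cases hp0 : p = (0, 0)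
  · rw [if_pos hp0, hp0, e1, hi, xi, s2 i (by simp)]; simp [hli.symm]
  rw [if_neg hp0]
  have hpi : e p ≠ i := fun hh => hp0 (e.injective (hh.trans e1.symm))
  by_cases hp1 : p = (1, 0)
  · rw [if_pos (.inl hp1), hp1, e2, hj, xj, s2 j (by simp)]; simp [hlj.symm]
  have hpj : e p ≠ j := fun hh => hp1 (e.injective (hh.trans e2.symm))
  rw [hk _ hpi hpj]
  by_cases hp2 : p = (1, 1)
  · rw [if_pos (.inr hp2), hp2, e3, s2 l (by simp)]
    rcases hl with hl | hl <;> rw [hl] <;> norm_num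
  have hpl : e p ≠ l := fun hh => hp2 (e.injective (hh.trans e3.symm))
  rw [h0 _ (by simp [hpi, hpl])]; simp [hp1, hp2]
theorem NF.in3 (h : IsLeech B) {C : Set (Fin 24 → ZMod 2)} {F : Fin 24 → LV} (hF : NF B C F) {s : LV} {i : Fin 24}
    (hi : pairZ B s (F i) = 5) (hk : ∀ k, k ≠ i → pairZ B s (F k) = 1) (w : LV) :
    8 * pairZ B s w = 4 * pairZ B w (F i) + ∑ k, pairZ B w (F k) := by
  rw [hF.frm.inner h (by simp) s w, ← Finset.add_sum_erase _ _ (Finset.mem_univ i),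
    ← Finset.add_sum_erase Finset.univ (fun k => pairZ B w (F k)) (Finset.mem_univ i), hi]
  rw [Finset.sum_congr rfl (g := fun k => pairZ B w (F k)) fun k hh => by rw [hk k (Finset.ne_of_mem_erase hh), one_mul]]
  ring
/-- change of frame -/
theorem IsLeech.st3 (h : IsLeech B) {s w : LV} (hs : pairZ B s s = 6) {C : Set (Fin 24 → ZMod 2)} {F : Fin 24 → LV} {i : Fin 24} (hF : NF B C F)
    (hk : ∀ k, k ≠ i → pairZ B s (F k) = 1) {k l : Fin 24} (hki : k ∉ ({i} : Finset (Fin 24))) (hli : l ∉ ({i} : Finset (Fin 24)))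
    (hkl : k ≠ l) {c d : ℤ} (hd : pairZ B s w = d)
    (hc : pairZ B w (F k) + pairZ B w (F l) = 2 * c) :
    ∃ (C : Set (Fin 24 → ZMod 2)) (F : Fin 24 → LV) (i : Fin 24), NF B C F ∧ pairZ B s (F i) = 5 ∧
      (∀ k, k ≠ i → pairZ B s (F k) = 1) ∧ pairZ B w (F i) = d - c := by
  obtain ⟨m, hm, hw⟩ := hF.frm.two h hkl (.inr rfl : (-1 : ℤ) = 1 ∨ _) (.inr rfl : (-1 : ℤ) = 1 ∨ _)
  have h1 := hw s; have h2 := hw w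
  rw [hk k (by simpa using hki), hk l (by simpa using hli)] at h1
  obtain ⟨C, F, i, hF, hi, h5, hk⟩ := h.T3 hs hm (by omega)
  refine ⟨C, F, i, hF, h5, hk, ?_⟩
  rw [hi, pairZ_add_right, h.comm w s]; omega
theorem IsLeech.R14 (h : IsLeech B) {s w : LV} (hs : pairZ B s s = 6) (hw : pairZ B w w = 4) (hsw : pairZ B s w = 2) :
    rep B (xr 6) (s + w) := by
  obtain ⟨m, hm, hsm⟩ := h.aux6 hs
  obtain ⟨C, F, i, hF, -, hi, hk⟩ := h.T3 hs hm hsm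
  have s1 : ∃ (C : Set (Fin 24 → ZMod 2)) (F : Fin 24 → LV) (i : Fin 24), NF B C F ∧ pairZ B s (F i) = 5 ∧
      (∀ k, k ≠ i → pairZ B s (F k) = 1) ∧ pairZ B w (F i) = 2 - 0 := by
    have h3 := hF.in3 h hi hk w
    set x : Fin 24 → ℤ := fun i => pairZ B w (F i) with hx
    have h3' : 4 * x i + ∑ k, x k = 16 := by rw [← h3, hsw]; rfl
    obtain ⟨W, k1, k2, ⟨b, a1, a2, a3, a4, a5, k3, k4, k5, k6, k7⟩ | ⟨b, a1, a2, a3, a4, a5, a6, k3, k4, k5, k6, k7⟩⟩ :=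
      hF.prof h (by simp) hw (by norm_num) (x := x) (fun _ => rfl) {i} <;>
      simp only [Finset.sum_singleton, Finset.card_singleton] at k3 k5 k6 k7
    · have : 2 ≤ cnt x {i} 0 := by
        have := mul_self_nonneg (x i); omega
      obtain ⟨k, l, hkl, hk', hl, hk0, hl0⟩ := cnt_pick2 this
      exact h.st3 hs hF hk hk' hl hkl hsw (by simp only [hx] at hk0 hl0; omega)
    · have : 1 ≤ cnt x {i} 1 ∧ 1 ≤ cnt x {i} (-1) := by
        rcases b i with b | b | b | b | b | b <;> rw [b] at k3 k5 k6 h3' <;> norm_num at k6 <;>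
          simp only [m4v3] at k3 <;> omega
      obtain ⟨k, hk', hk0⟩ := cnt_pick this.1
      obtain ⟨l, hl, hl0⟩ := cnt_pick this.2
      exact h.st3 hs hF hk hk' hl (fun hh => by rw [hh] at hk0; omega) hsw (by simp only [hx] at hk0 hl0; omega)
  obtain ⟨C, F, i, hF, hi, hk, hwi⟩ := s1
  have s2 : ∃ (C : Set (Fin 24 → ZMod 2)) (F : Fin 24 → LV) (i : Fin 24), NF B C F ∧ pairZ B s (F i) = 5 ∧
      (∀ k, k ≠ i → pairZ B s (F k) = 1) ∧ pairZ B w (F i) = 2 - -2 := by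
    have h3 := hF.in3 h hi hk w
    set x : Fin 24 → ℤ := fun i => pairZ B w (F i) with hx
    have xi : x i = 2 := hwi
    have h3' : 4 * x i + ∑ k, x k = 16 := by rw [← h3, hsw]; rfl
    rw [xi] at h3'
    obtain ⟨W, k1, k2, ⟨b, a1, a2, a3, a4, a5, k3, k4, k5, k6, k7⟩ | ⟨b, -⟩⟩ :=
      hF.prof h (by simp) hw (by norm_num) (x := x) (fun _ => rfl) {i}
    · simp only [Finset.sum_singleton, Finset.card_singleton, xi, m4v2] at k3 k5 k6 k7
      have : 2 ≤ cnt x {i} (-2) := by omega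
      obtain ⟨k, l, hkl, hk', hl, hk0, hl0⟩ := cnt_pick2 this
      exact h.st3 hs hF hk hk' hl hkl hsw (by simp only [hx] at hk0 hl0; omega)
    · have := b i; omega
  obtain ⟨C, F, i, hF, hi, hk, hwi⟩ := s2
  have h3 := hF.in3 h hi hk w
  set x : Fin 24 → ℤ := fun i => pairZ B w (F i) with hx
  have xi : x i = 4 := hwi
  have h3' : 4 * x i + ∑ k, x k = 16 := by rw [← h3, hsw]; rfl
  rw [xi] at h3'
  have : 1 ≤ cnt x {i} (-4) := by
    obtain ⟨W, k1, k2, ⟨b, a1, a2, a3, a4, a5, k3, k4, k5, k6, k7⟩ | ⟨b, -⟩⟩ :=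
      hF.prof h (by simp) hw (by norm_num) (x := x) (fun _ => rfl) {i}
    · simp only [Finset.sum_singleton, Finset.card_singleton, xi, m4v2] at k3 k5 k6 k7
      omega
    · have := b i; omega
  obtain ⟨j, hj, hj'⟩ := cnt_pick this
  have hji : j ≠ i := by simpa using hj
  have h0 : ∀ k ∉ ({i, j} : Finset (Fin 24)), x k = 0 := rest_zero (by
    have := hF.frm.inner h (by simp) w w
    rw [Finset.sum_pair hji.symm, ← this, hw, xi, hj']; norm_num)
  obtain ⟨l, hli, hlj⟩ := ne3 i j
  obtain ⟨e, e1, e2, e3, he⟩ := hF.lab3 h (by simp) hji hli hlj.symm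
  refine rep_of hF he fun p => ?_
  show _ ∣ _ - if p = (0, 0) ∨ p = (1, 0) then (0 : ℤ) else 1
  rw [pairZ_add_left]
  show _ ∣ _ + x (e p) - _
  by_cases hp0 : p = (0, 0)
  · rw [if_pos (.inl hp0), hp0, e1, hi, xi]; norm_num
  have hpi : e p ≠ i := fun hh => hp0 (e.injective (hh.trans e1.symm))
  rw [hk _ hpi]
  by_cases hp1 : p = (1, 0)
  · rw [if_pos (.inr hp1), hp1, e2, hj']; norm_num
  have hpj : e p ≠ j := fun hh => hp1 (e.injective (hh.trans e2.symm))
  rw [h0 _ (by simp [hpi, hpj])]; simp [hp0, hp1]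
end

section
variable {B : Matrix (Fin 24) (Fin 24) ℤ}
theorem IsLeech.R18a (h : IsLeech B) {s w : LV} (hs : pairZ B s s = 6) (hw : pairZ B w w = 6) (hsw : pairZ B s w = 3)
    {C : Set (Fin 24 → ZMod 2)} {F : Fin 24 → LV} {i : Fin 24} (hF : NF B C F) (hi : pairZ B s (F i) = 5)
    (hk : ∀ k, k ≠ i → pairZ B s (F k) = 1) :
    ∃ (C : Set (Fin 24 → ZMod 2)) (F : Fin 24 → LV) (i : Fin 24), NF B C F ∧ pairZ B s (F i) = 5 ∧
      (∀ k, k ≠ i → pairZ B s (F k) = 1) ∧ (pairZ B w (F i) = 3 - -1 ∨ pairZ B w (F i) = 3 - 1) := by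
  have h3 := hF.in3 h hi hk w
  set x : Fin 24 → ℤ := fun i => pairZ B w (F i) with hx
  have h3' : 4 * x i + ∑ k, x k = 24 := by rw [← h3, hsw]; rfl
  have go : ∀ a b : ℤ, (a + b = -2 ∨ a + b = 2) → a ≠ b → 1 ≤ cnt x {i} a → 1 ≤ cnt x {i} b →
     ∃ (C : Set (Fin 24 → ZMod 2)) (F : Fin 24 → LV) (i : Fin 24), NF B C F ∧ pairZ B s (F i) = 5 ∧
      (∀ k, k ≠ i → pairZ B s (F k) = 1) ∧ (pairZ B w (F i) = 3 - -1 ∨ pairZ B w (F i) = 3 - 1) := by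
    intro a b hab hne h1 h2
    obtain ⟨k, hk', hk0⟩ := cnt_pick h1
    obtain ⟨l, hl, hl0⟩ := cnt_pick h2
    have hkl : k ≠ l := fun hh => by rw [hh] at hk0; omega
    simp only [hx] at hk0 hl0
    rcases hab with hab | hab
    · obtain ⟨C, F, i, a1, a2, a3, a4⟩ := h.st3 hs hF hk hk' hl hkl hsw (c := -1) (by omega)
      exact ⟨C, F, i, a1, a2, a3, .inl a4⟩
    · obtain ⟨C, F, i, a1, a2, a3, a4⟩ := h.st3 hs hF hk hk' hl hkl hsw (c := 1) (by omega)
      exact ⟨C, F, i, a1, a2, a3, .inr a4⟩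
  obtain ⟨W, k1, k2, ⟨b, a1, a2, a3, a4, a5, k3, k4, k5, k6, k7⟩ | ⟨b, a1, a2, a3, a4, a5, a6, k3, k4, k5, k6, k7⟩⟩ :=
    hF.prof h (by simp) hw (by norm_num) (x := x) (fun _ => rfl) {i} <;>
    simp only [Finset.sum_singleton, Finset.card_singleton] at k3 k5 k6 k7
  · have : (1 ≤ cnt x {i} 0 ∧ 1 ≤ cnt x {i} (-2)) ∨ (1 ≤ cnt x {i} 0 ∧ 1 ≤ cnt x {i} 2) ∨ x i = 4 := by
      rcases b i with b | b | b | b | b <;> rw [b] at k3 k5 k6 h3' ⊢ <;> norm_num at k6 ⊢ <;>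
        simp only [m4v2] at k3 <;> omega
    rcases this with ⟨h1, h2⟩ | ⟨h1, h2⟩ | h1
    · exact go _ _ (by omega) (by omega) h1 h2
    · exact go _ _ (by omega) (by omega) h1 h2
    · exact ⟨C, F, i, hF, hi, hk, .inl h1⟩
  · have : (1 ≤ cnt x {i} (-3) ∧ 1 ≤ cnt x {i} 1) ∨ 2 ≤ cnt x {i} (-1) ∨ 2 ≤ cnt x {i} 1 := by
      have := mul_self_nonneg (x i); omega
    rcases this with ⟨h1, h2⟩ | h1 | h1
    · exact go _ _ (by omega) (by omega) h1 h2
    · obtain ⟨k, l, hkl, hk', hl, hk0, hl0⟩ := cnt_pick2 h1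
      simp only [hx] at hk0 hl0
      obtain ⟨C, F, i, a1, a2, a3, a4⟩ := h.st3 hs hF hk hk' hl hkl hsw (c := -1) (by omega)
      exact ⟨C, F, i, a1, a2, a3, .inl a4⟩
    · obtain ⟨k, l, hkl, hk', hl, hk0, hl0⟩ := cnt_pick2 h1
      simp only [hx] at hk0 hl0
      obtain ⟨C, F, i, a1, a2, a3, a4⟩ := h.st3 hs hF hk hk' hl hkl hsw (c := 1) (by omega)
      exact ⟨C, F, i, a1, a2, a3, .inr a4⟩
theorem IsLeech.R18 (h : IsLeech B) {s w : LV} (hs : pairZ B s s = 6) (hw : pairZ B w w = 6) (hsw : pairZ B s w = 3) :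
    rep B (xr 4) (s + w) := by
  obtain ⟨C, F, i, hF, hi, hk, hwi⟩ : ∃ (C : Set (Fin 24 → ZMod 2)) (F : Fin 24 → LV) (i : Fin 24), NF B C F ∧ pairZ B s (F i) = 5 ∧
      (∀ k, k ≠ i → pairZ B s (F k) = 1) ∧ pairZ B w (F i) = 3 - -1 := by
    obtain ⟨m, hm, hsm⟩ := h.aux6 hs
    obtain ⟨C, F, i, hF, -, hi, hk⟩ := h.T3 hs hm hsm
    obtain ⟨C, F, i, hF, hi, hk, h4 | h4⟩ := h.R18a hs hw hsw hF hi hk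
    · exact ⟨C, F, i, hF, hi, hk, h4⟩
    have h3 := hF.in3 h hi hk w
    set x : Fin 24 → ℤ := fun i => pairZ B w (F i) with hx
    have xi : x i = 2 := h4
    have h3' : 4 * x i + ∑ k, x k = 24 := by rw [← h3, hsw]; rfl
    rw [xi] at h3'
    obtain ⟨W, k1, k2, ⟨b, a1, a2, a3, a4, a5, k3, k4, k5, k6, k7⟩ | ⟨b, -⟩⟩ :=
      hF.prof h (by simp) hw (by norm_num) (x := x) (fun _ => rfl) {i}
    · simp only [Finset.sum_singleton, Finset.card_singleton, xi, m4v2] at k3 k5 k6 k7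
      have : 1 ≤ cnt x {i} (-2) ∧ 1 ≤ cnt x {i} 0 := by omega
      obtain ⟨k, hk', hk0⟩ := cnt_pick this.1
      obtain ⟨l, hl, hl0⟩ := cnt_pick this.2
      have hkl : k ≠ l := fun hh => by rw [hh] at hk0; omega
      exact h.st3 hs hF hk hk' hl hkl hsw (by simp only [hx] at hk0 hl0; omega)
    · have := b i; omega
  have h3 := hF.in3 h hi hk w
  set x : Fin 24 → ℤ := fun i => pairZ B w (F i) with hx
  have xi : x i = 4 := hwi
  have h3' : 4 * x i + ∑ k, x k = 24 := by rw [← h3, hsw]; rfl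
  rw [xi] at h3'
  obtain ⟨y, hy, hxy⟩ := (hF.mem x).1 ⟨w, fun _ => rfl⟩
  have hxy : x = (2 : ℤ) • y := by
    rcases hxy with hh | hh
    · exact hh.1
    · have := congrFun hh.1 i; simp only [Pi.smul_apply, smul_eq_mul, Pi.add_apply, Pi.one_apply] at this; omega
  have hxy' : ∀ k, x k = 2 * y k := fun k => by rw [hxy]; rfl
  set O := spt (rd y) with hO
  have hOC : ind O ∈ C := by rw [hO, ind_spt]; exact hy
  have mO : ∀ k, k ∈ O ↔ y k % 2 = 1 := mem_spt_rd y
  have hiO : i ∉ O := fun hh => by have := (mO i).1 hh; have := hxy' i; omega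
  obtain ⟨W, k1, k2, ⟨b, a1, a2, a3, a4, a5, k3, k4, k5, k6, k7⟩ | ⟨b, -⟩⟩ :=
    hF.prof h (by simp) hw (by norm_num) (x := x) (fun _ => rfl) {i}
  swap
  · have := b i; omega
  simp only [Finset.sum_singleton, Finset.card_singleton, xi, m4v2] at k3 k5 k6 k7
  have c1 : cnt x {i} (-2) = 3 ∧ cnt x {i} 2 = 5 ∧ cnt x {i} 4 = 0 ∧ cnt x {i} (-4) = 0 := by omega
  have no4 : ∀ k, k ≠ i → x k = -2 ∨ x k = 0 ∨ x k = 2 := fun k hk => by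
    have z : ∀ c, cnt x {i} c = 0 → x k ≠ c := fun c hc hh => by
      have : k ∈ (Finset.univ \ {i}).filter (x · = c) := by simp [hk, hh]
      unfold cnt at hc
      have := Finset.card_pos.2 ⟨k, this⟩; omega
    have := z _ c1.2.2.1; have := z _ c1.2.2.2
    have := b k; omega
  set A := Finset.univ.filter fun k => x k = -2 with hA
  have hAO : A ⊆ O := fun k hk => by
    rw [hA, Finset.mem_filter] at hk
    have := hxy' k; rw [mO]; omega
  have hc : ∀ c, c ≠ 4 → cnt x {i} c = (Finset.univ.filter fun k => x k = c).card := fun c hc => by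
    unfold cnt; congr 2; ext k
    simp only [Finset.mem_filter, Finset.mem_sdiff, Finset.mem_univ, true_and, Finset.mem_singleton]
    exact ⟨fun h => h.2, fun h => ⟨fun hh => hc (by rw [← h, hh, xi]), h⟩⟩
  have hA3 : A.card = 3 := by
    have : cnt x {i} (-2) = A.card := hc (-2) (by norm_num)
    omega
  have hO8 : O.card = 8 := by
    have h1 : cnt x {i} (-2) = A.card := hc (-2) (by norm_num)
    have h2 := hc 2 (by norm_num)
    have : O = A ∪ Finset.univ.filter fun k => x k = 2 := by
      ext k
      have h1 := hxy' k; rw [mO, Finset.mem_union, Finset.mem_filter, Finset.mem_filter]; simp only [Finset.mem_univ, true_and]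
      by_cases hki : k = i
      · rw [hki] at h1 ⊢; omega
      · have := no4 k hki; omega
    rw [this, Finset.card_union_of_disjoint]
    · omega
    · rw [Finset.disjoint_left]; intro k h1 h2
      rw [Finset.mem_filter] at h1 h2; omega
  obtain ⟨e, e1, e2, e3, he⟩ := hF.labA h (by simp) hOC hO8 hAO hA3 hiO
  refine rep_of hF he fun p => ?_
  show _ ∣ _ - if p = (0, 0) then (0 : ℤ) else if p.1 = 0 then -1 else if p.2 = 0 then 0 else 1
  rw [pairZ_add_left]
  show _ ∣ _ + x (e p) - _
  by_cases hp0 : p = (0, 0)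
  · rw [if_pos hp0, hp0, e1, hi, xi]; norm_num
  rw [if_neg hp0]
  have hpi : e p ≠ i := fun hh => hp0 (e.injective (hh.trans e1.symm))
  rw [hk _ hpi]
  have hA' : e p ∈ A ↔ x (e p) = -2 := by simp [hA]
  by_cases hp1 : p.1 = 0
  · rw [if_pos hp1, hA'.1 ((e2 p).2 ⟨hp1, fun h2 => hp0 (Prod.ext hp1 h2)⟩)]; norm_num
  have hnA : x (e p) ≠ -2 := fun hh => hp1 ((e2 p).1 (hA'.2 hh)).1
  have dd : ∀ p : Om, p.1 ≠ 0 → ((colw 0 + Kw (kx 0)) p ≠ 0 ↔ p.2 = 0) := by decide +kernel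
  have hOp := (e3 p).trans (dd p hp1)
  rw [mO] at hOp
  rw [if_neg hp1]
  have := hxy' (e p); have := no4 _ hpi
  by_cases hp2 : p.2 = 0
  · rw [if_pos hp2]; have := hOp.2 hp2; omega
  · rw [if_neg hp2]; have := mt hOp.1 hp2; omega
end

section
variable {B : Matrix (Fin 24) (Fin 24) ℤ}
def mn (B : Matrix (Fin 24) (Fin 24) ℤ) (v : LV) : Prop := ∀ u, cong 3 u v → pairZ B v v ≤ pairZ B u u
def nn : Fin 10 → ℤ := ![0, 6, 12, 12, 18, 8, 14, 4, 10, 16]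
theorem cong2_neg {s v : LV} (h : cong 2 s v) : cong 2 (-s) v := by
  obtain ⟨w, rfl⟩ := h; exact ⟨-v - w, by funext k; simp; ring⟩
theorem mn.le (h : IsLeech B) {v s : LV} (hv : mn B v) (hs : cong 2 s v) :
    pairZ B v v ≤ 3 * pairZ B s s - 2 * |pairZ B v s| := by
  have go : ∀ s, cong 2 s v → pairZ B v v ≤ 3 * pairZ B s s - 2 * pairZ B v s := by
    rintro s ⟨w, rfl⟩
    have := hv _ ⟨w, rfl⟩
    rw [h.N_add, N_smul, pairZ_smul_right] at this
    rw [h.N_add, N_smul, pairZ_add_right, pairZ_smul_right]; linarith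
  have h1 := go s hs; have h2 := go _ (cong2_neg hs)
  rw [N_neg, pairZ_neg_right] at h2
  rcases abs_choice (pairZ B v s) with e | e <;> rw [e] <;> linarith
theorem mn.two (h : IsLeech B) {v u : LV} (hv : mn B v) (hu : v = (2 : ℤ) • u) : v = 0 := by
  have := hv (-u) ⟨-u, by rw [hu]; funext k; simp; ring⟩
  rw [hu, N_smul, N_neg] at this
  have := h.pairZ_nonneg u
  rw [hu, h.eq_zero (v := u) (by linarith)]; simp
theorem NF.nine (h : IsLeech B) {C : Set (Fin 24 → ZMod 2)} {F : Fin 24 → LV} (hF : NF B C F) {v : LV} (hv : mn B v)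
    {x : Fin 24 → ℤ} (hx : ∀ i, pairZ B v (F i) = x i) {O : Finset (Fin 24)} (hO : ind O ∈ C) (hO8 : O.card = 8)
    (hon : ∀ k ∈ O, x k = 4 ∨ x k = -4) (hoff : ∀ k ∉ O, x k = 0) : rep B (xr 9) v := by
  obtain ⟨p, hp⟩ : O.Nonempty := Finset.card_pos.1 (by omega)
  obtain ⟨q, hq⟩ := exists_not (by simp) O (by omega)
  obtain ⟨s, s1, s2, hF'⟩ := hF.signs (O.erase p) (hF.gol.small (by rw [Finset.card_erase_of_mem hp]; omega))
    (fun k => if x k = 4 then 1 else -1) (fun k _ => by split_ifs <;> simp)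
  have e4 : ∀ k ∈ O, k ≠ p → s k * x k = 4 := fun k hk hkp => by
    rw [s2 k (by simp [hkp, hk])]; rcases hon k hk with h' | h' <;> rw [h'] <;> norm_num
  have ep : s p * x p = -4 := by
    by_contra hne
    have ep : s p * x p = 4 := by
      rcases hon p hp with h' | h' <;> rcases s1 p with h'' | h'' <;> rw [h', h''] at hne ⊢ <;> simp at hne ⊢
    obtain ⟨u, hu⟩ := (hF'.mem (fun k => if k ∈ O then 2 else 0)).2 ⟨fun k => if k ∈ O then 1 else 0, by
      have : rd (fun k => if k ∈ O then (1 : ℤ) else 0) = ind O := by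
        funext k; simp only [rd, ind]; split_ifs <;> simp
      rw [this]; exact hO, .inl ⟨by funext k; simp, by simp [hO8]⟩⟩
    have hv2 : v = (2 : ℤ) • u := NF.ext h (by simp) hF'.frm fun k => by
      rw [pairZ_smul_left, hu, pairZ_smul_right, hx]
      by_cases hk : k ∈ O
      · rw [if_pos hk]
        by_cases hkp : k = p
        · rw [hkp, ep]; rfl
        · rw [e4 k hk hkp]; rfl
      · rw [if_neg hk, hoff k hk]; simp
    have := hv.two h hv2
    have hh := hx p; rw [this, pairZ_zero_left] at hh
    rcases hon p hp with h' | h' <;> omega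
  obtain ⟨e, e1, e2, e3, he⟩ := hF'.labO h (by simp) hO hO8 hp hq
  refine rep_of hF' he fun a => ?_
  show _ ∣ _ - if a = (0, 0) then (-1 : ℤ) else if a.1 = 0 ∨ a.1 = 1 then 1 else 0
  rw [pairZ_smul_right, hx]
  by_cases ha : a = (0, 0)
  · rw [if_pos ha, ha, e1, ep]; norm_num
  rw [if_neg ha]
  by_cases hk : e a ∈ O
  · rw [if_pos ((e3 a).1 hk), e4 _ hk (fun hh => ha (e.injective (hh.trans e1.symm)))]; norm_num
  · rw [if_neg (fun hh => hk ((e3 a).2 hh)), hoff _ hk]; simp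
theorem NF.three (h : IsLeech B) {C : Set (Fin 24 → ZMod 2)} {F : Fin 24 → LV} (hF : NF B C F) {v : LV}
    (hc : ∃ c ∈ C, ∀ i, pairZ B v (F i) = sg c i * 2) : rep B (xr 3) v := by
  obtain ⟨c, hcC, hc⟩ := hc
  have hF' := hF.sgn hcC
  obtain ⟨j, hj, -⟩ := ne3 0 0
  obtain ⟨k, hk, hkj⟩ := ne3 0 j
  obtain ⟨e, e1, e2, e3, he⟩ := hF'.lab3 h (by simp) hj hk hkj.symm
  refine rep_of hF' he fun p => ?_
  show _ ∣ _ - (-1 : ℤ)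
  rw [pairZ_smul_right, hc, ← mul_assoc, sg_sq]; norm_num
theorem mn.frame (h : IsLeech B) {v : LV} (hv : mn B v) (h0 : v ≠ 0) {F : Fin 24 → LV} (h1 : ∀ i, cong 2 (F i) v)
    (h2 : ∀ i, pairZ B (F i) (F i) = 8) (h3 : ∀ i j, i ≠ j → pairZ B (F i) (F j) = 0) :
    ∃ j, pairZ B v v = nn j ∧ rep B (xr j) v ∧ j ≠ 2 := by
  have hL : LFr B F := ⟨h2, h3, fun i j => (h1 i).trans (h1 j).symm⟩
  obtain ⟨C, e, he, hF⟩ := hL.exists_NF h (by simp)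
  replace h1 : ∀ i, cong 2 (e i • F i) v := fun i => by
    rcases he i with h | h <;> rw [h]
    · rw [one_smul]; exact h1 i
    · rw [_root_.neg_smul, one_smul]; exact cong2_neg (h1 i)
  generalize hF'e : (fun i => e i • F i) = F' at hF
  replace h1 : ∀ i, cong 2 (F' i) v := fun i => by rw [← hF'e]; exact h1 i
  clear h2 h3 hL hF'e he
  obtain ⟨x, hx⟩ : ∃ x : Fin 24 → ℤ, ∀ i, pairZ B v (F' i) = x i := ⟨_, fun _ => rfl⟩
  have hle : ∀ i, pairZ B v v ≤ 24 - 2 * |x i| := fun i => by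
    have := hv.le h (h1 i); rw [hF.frm.n8, hx] at this; linarith
  have hsq : 8 * pairZ B v v = ∑ i, x i * x i := by
    have := hF.frm.inner h (by simp) v v; simpa only [hx] using this
  obtain ⟨w, hw⟩ := h1 0
  have hz : ∀ i, 8 * (if 0 = i then 1 else 0) - x i = 2 * pairZ B w (F' i) := fun i => by
    have := hF.frm.pp 0 i
    rw [hw, pairZ_add_left, pairZ_smul_left, hx] at this
    split_ifs at this ⊢ <;> omega
  obtain ⟨y, hy, hxy⟩ := (hF.mem (fun i => pairZ B w (F' i))).1 ⟨w, fun _ => rfl⟩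
  rcases hxy with ⟨hxy, -⟩ | ⟨hxy, -⟩
  · have hxy' : ∀ i, x i = 8 * (if 0 = i then 1 else 0) - 4 * y i := fun i => by
      have := congrFun hxy i; simp only [Pi.smul_apply, smul_eq_mul] at this
      have := hz i; omega
    have hb : ∀ i, x i * x i + 16 * |x i| ≤ 192 := fun i => by
      have := Finset.single_le_sum (f := fun i => x i * x i) (fun i _ => mul_self_nonneg _) (Finset.mem_univ i)
      have := hle i; linarith
    by_cases h8 : ∃ i, 8 ≤ |x i|
    · obtain ⟨i, hi⟩ := h8
      have h1 := hle i
      have := Finset.single_le_sum (f := fun i => x i * x i) (fun i _ => mul_self_nonneg _) (Finset.mem_univ i)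
      have h2 : 8 * 8 ≤ |x i| * |x i| := mul_le_mul hi hi (by norm_num) (abs_nonneg _)
      rw [abs_mul_abs_self] at h2
      have : pairZ B v v = 8 := by omega
      exact ⟨5, this, h.R8 this, by decide⟩
    push Not at h8
    set O := spt (rd y) with hO
    have mO : ∀ k, k ∈ O ↔ y k % 2 = 1 := mem_spt_rd y
    have hOC : ind O ∈ C := by rw [hO, ind_spt]; exact hy
    have hx4 : ∀ i, x i = 4 ∨ x i = -4 ∨ x i = 0 := fun i => by
      have := abs_lt.1 (h8 i); have := hxy' i; omega
    have hO' : ∀ k, k ∈ O ↔ x k ≠ 0 := fun k => by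
      rw [mO]; have := hx4 k; have := hxy' k; split_ifs at this <;> omega
    have hs : 8 * pairZ B v v = 16 * O.card := by
      rw [hsq, Finset.card_eq_sum_ones, Nat.cast_sum, Finset.mul_sum, ← Finset.sum_subset (Finset.subset_univ O)]
      · refine Finset.sum_congr rfl fun k hk => ?_
        have := (hO' k).1 hk
        rcases hx4 k with h' | h' | h' <;> rw [h'] at this ⊢ <;> simp at this ⊢
      · intro k _ hk
        rw [hO', not_not] at hk; rw [hk]; rfl
    have hne : O.Nonempty := by
      rw [Finset.nonempty_iff_ne_empty]; intro hE
      rw [hE, Finset.card_empty] at hs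
      exact h0 (h.eq_zero (by omega))
    have := hF.gol.min8 hOC hne
    have hO8 : O.card = 8 := by
      obtain ⟨p, hp⟩ := hne
      have hh := hle p
      have : |x p| = 4 := by
        have := (hO' p).1 hp
        rcases hx4 p with h' | h' | h' <;> rw [h'] at this ⊢ <;> simp at this ⊢
      omega
    refine ⟨9, by rw [hO8] at hs; show _ = (16 : ℤ); omega, hF.nine h hv hx hOC hO8 (fun k hk => ?_) (fun k hk => ?_), by decide⟩
    · have := (hO' k).1 hk; have := hx4 k; omega
    · rwa [hO', not_not] at hk
  · have hxy' : ∀ i, x i = 8 * (if 0 = i then 1 else 0) - 4 * y i - 2 := fun i => by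
      have := congrFun hxy i; simp only [Pi.smul_apply, smul_eq_mul, Pi.add_apply, Pi.one_apply] at this
      have := hz i; omega
    have hnn : ∀ i, 0 ≤ x i * x i - 4 := fun i => by
      have := hxy' i
      rcases lt_or_ge (x i) 0 with h' | h'
      · have : x i ≤ -2 := by omega
        nlinarith
      · have : 2 ≤ x i := by omega
        nlinarith
    have hx2 : ∀ i, x i = 2 ∨ x i = -2 := fun i => by
      have := Finset.single_le_sum (f := fun i => x i * x i - 4) (fun i _ => hnn i) (Finset.mem_univ i)
      simp only [Finset.sum_sub_distrib, ← hsq, Finset.sum_const, Finset.card_univ, Fintype.card_fin] at this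
      have h1 := hle i
      have h2 : |x i| < 6 := by
        by_contra hcon; push Not at hcon
        have h2 : 6 * 6 ≤ |x i| * |x i| := mul_le_mul hcon hcon (by norm_num) (abs_nonneg _)
        rw [abs_mul_abs_self] at h2
        simp at this; omega
      have := abs_lt.1 h2; have := hxy' i; omega
    refine ⟨3, ?_, hF.three h ⟨rd y + 1, hF.gol.add hy hF.gol.one, fun i => ?_⟩, by decide⟩
    · have : ∑ i, x i * x i = 96 := by
        rw [Finset.sum_congr rfl (g := fun _ => 4) fun i _ => by rcases hx2 i with h' | h' <;> rw [h'] <;> rfl]; simp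
      show _ = (12 : ℤ); omega
    · rw [hx]
      have h1 := hxy' i; have h2 := hx2 i
      have : (rd y + 1) i = 0 ↔ y i % 2 = 1 := by
        have : (rd y + 1) i = ((y i + 1 : ℤ) : ZMod 2) := by simp [rd]
        rw [this, ZMod.intCast_zmod_eq_zero_iff_dvd]; push_cast; omega
      simp only [sg, lft, this]
      split_ifs at h1 ⊢ <;> omega
end

section
variable {B : Matrix (Fin 24) (Fin 24) ℤ}
theorem IsLeech.even (h : IsLeech B) (v : LV) : pairZ B v v % 2 = 0 := by have := h.two_hn v; omega
theorem mn.cls (h : IsLeech B) {v : LV} (hv : mn B v) : ∃ j, pairZ B v v = nn j ∧ rep B (xr j) v ∧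
    (pairZ B v v = 12 → (j = 2 ↔ ∃ s, cong 2 s v ∧ pairZ B s s = 4)) := by
  have zero : v = 0 → ∃ j, pairZ B v v = nn j ∧ rep B (xr j) v ∧
    (pairZ B v v = 12 → (j = 2 ↔ ∃ s, cong 2 s v ∧ pairZ B s s = 4)) := by
    rintro rfl
    obtain ⟨C, F, hF⟩ := h.exists_frame
    obtain ⟨j, hj, -⟩ := ne3 0 0
    obtain ⟨k, hk, hkj⟩ := ne3 0 j
    obtain ⟨e, e1, e2, e3, he⟩ := hF.lab3 h (by simp) hj hk hkj.symm
    refine ⟨0, pairZ_zero_left _, rep_of hF he fun p => ?_, fun hh => ?_⟩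
    · rw [pairZ_zero_left]; show _ ∣ 0 - (0 : ℤ); simp
    · rw [pairZ_zero_left] at hh; omega
  rcases h.class_two v with ⟨s, hs, hN⟩ | ⟨F, h1, h2, h3⟩
  · obtain ⟨s, hs, hN, hp⟩ : ∃ s, cong 2 s v ∧ (pairZ B s s = 0 ∨ pairZ B s s = 4 ∨ pairZ B s s = 6) ∧ 0 ≤ pairZ B v s := by
      rcases le_or_gt 0 (pairZ B v s) with h' | h'
      · exact ⟨s, hs, hN, h'⟩
      · exact ⟨-s, cong2_neg hs, by rwa [N_neg], by rw [pairZ_neg_right]; omega⟩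
    have hle := hv.le h hs
    rw [abs_of_nonneg hp] at hle
    obtain ⟨w, rfl⟩ := hs.symm
    have hvs : pairZ B (s + (2 : ℤ) • w) s = pairZ B s s + 2 * pairZ B s w := by rw [pairZ_add_left, pairZ_smul_left, h.comm w s]
    rw [hvs] at hp hle
    have hNv : pairZ B (s + (2 : ℤ) • w) (s + (2 : ℤ) • w) = pairZ B s s + 4 * pairZ B s w + 4 * pairZ B w w := by
      rw [h.N_add, N_smul, pairZ_smul_right]; ring
    have hNa : pairZ B (s + w) (s + w) = pairZ B s s + 2 * pairZ B s w + pairZ B w w := h.N_add _ _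
    have hip : pairZ B (s + w) w = pairZ B s w + pairZ B w w := pairZ_add_left _ _ _
    have hva : s + (2 : ℤ) • w = (s + w) + w := by rw [two_smul]; abel
    have he := h.even w
    rw [hNv] at hle ⊢
    rcases hN with hN | hN | hN
    · rw [← hNv]; refine zero (hv.two h (u := w) ?_)
      rw [h.eq_zero (v := s) (by omega), zero_add]
    all_goals
      by_cases hw0 : w = 0
      · have e : s + (2 : ℤ) • w = s := by rw [hw0, smul_zero, add_zero]
        rw [← hNv, e]
        first
        | exact ⟨7, hN, h.R4 hN, by omega⟩
        | exact ⟨1, hN, h.R6 hN, by omega⟩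
      have hw4 := h.four_le hw0
    · rw [hva]
      exact ⟨2, by show _ = (12 : ℤ); omega, h.R12A (by omega) (by omega) (by omega), fun _ => ⟨fun _ => ⟨s, by rwa [← hva], hN⟩, fun _ => rfl⟩⟩
    · rw [hva]
      have : (pairZ B w w = 4 ∧ (pairZ B s w = -2 ∨ pairZ B s w = -3)) ∨ (pairZ B w w = 6 ∧ pairZ B s w = -3) := by omega
      rcases this with ⟨h1, h2 | h2⟩ | ⟨h1, h2⟩
      · exact ⟨6, by show _ = (14 : ℤ); omega, h.R14 (by omega) (by omega) (by omega), by omega⟩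
      · exact ⟨8, by show _ = (10 : ℤ); omega, h.R10 (by omega) (by omega) (by omega), by omega⟩
      · exact ⟨4, by show _ = (18 : ℤ); omega, h.R18 (by omega) (by omega) (by omega), by omega⟩
  · by_cases h0 : v = 0
    · exact zero h0
    obtain ⟨j, hj, hr, hj2⟩ := hv.frame h h0 h1 h2 h3
    refine ⟨j, hj, hr, fun _ => ⟨fun hh => absurd hh hj2, ?_⟩⟩
    rintro ⟨s, hs, hN⟩
    have hne : ∀ u, s = u → pairZ B u u = 8 → False := fun u h1 h2 => by rw [← h1] at h2; omega
    have := h.cong2_short (hs.trans (h1 0).symm) (fun hh => hne _ hh (h2 0)) (fun hh => hne _ hh (by rw [N_neg]; exact h2 0))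
    have := abs_nonneg (pairZ B s (F 0)); have := h2 0; omega
theorem conway_one : (1 : Matrix (Fin 24) (Fin 24) ℤ) ∈ ConwayGroup B := by simp [ConwayGroup]
theorem cong.mulVec {σ : Matrix (Fin 24) (Fin 24) ℤ} {n : ℤ} {u v : LV} (hc : cong n u v) : cong n (σ.mulVec u) (σ.mulVec v) := by
  obtain ⟨w, rfl⟩ := hc; exact ⟨σ.mulVec w, by rw [Matrix.mulVec_add, Matrix.mulVec_smul]⟩
theorem conway_inv (h : IsLeech B) {σ : Matrix (Fin 24) (Fin 24) ℤ} (hσ : σ ∈ ConwayGroup B) :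
    ∃ ρ ∈ ConwayGroup B, (∀ v, ρ *ᵥ (σ *ᵥ v) = v) ∧ (∀ v, σ *ᵥ (ρ *ᵥ v) = v) := by
  have e1 : ∀ v, σ *ᵥ (σ⁻¹ *ᵥ v) = v := fun v => by rw [Matrix.mulVec_mulVec, Matrix.mul_nonsing_inv _ hσ.1, Matrix.one_mulVec]
  refine ⟨σ⁻¹, mem_conway h _ fun u v => ?_, fun v => ?_, e1⟩
  · rw [← pairZ_conway hσ, e1, e1]
  · rw [Matrix.mulVec_mulVec, Matrix.nonsing_inv_mul _ hσ.1, Matrix.one_mulVec]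
theorem cj.symm (h : IsLeech B) {u v : LV} (hc : cj B u v) : cj B v u := by
  obtain ⟨σ, hσ, hc⟩ := hc
  obtain ⟨ρ, hρ, h1, -⟩ := conway_inv h hσ
  exact ⟨ρ, hρ, by have := (hc.mulVec (σ := ρ)).symm; rwa [h1] at this⟩
theorem cj.trans (h : IsLeech B) {u v w : LV} (hc : cj B u v) (hd : cj B v w) : cj B u w := by
  obtain ⟨σ, hσ, hc⟩ := hc
  obtain ⟨ρ, hρ, hd⟩ := hd
  refine ⟨ρ * σ, mem_conway h _ fun u v => ?_, ?_⟩
  · rw [← Matrix.mulVec_mulVec, ← Matrix.mulVec_mulVec, pairZ_conway hρ, pairZ_conway hσ]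
  · rw [← Matrix.mulVec_mulVec]; exact hd.trans hc.mulVec
theorem cj_of_cong {u v : LV} (hc : cong 3 v u) : cj B u v := ⟨1, conway_one, by rwa [Matrix.one_mulVec]⟩
theorem mn.conway (h : IsLeech B) {σ : Matrix (Fin 24) (Fin 24) ℤ} (hσ : σ ∈ ConwayGroup B) {v : LV} (hv : mn B v) : mn B (σ *ᵥ v) := by
  intro u hu
  obtain ⟨ρ, hρ, h1, -⟩ := conway_inv h hσ
  have := hv (ρ *ᵥ u) (by have := hu.mulVec (σ := ρ); rwa [h1] at this)
  rwa [pairZ_conway hρ, ← pairZ_conway hσ] at this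
theorem IsLeech.exists_mn (h : IsLeech B) (v : LV) : ∃ u, cong 3 u v ∧ mn B u := by
  classical
  have : ∃ n : ℕ, ∃ u, cong 3 u v ∧ hn B u = n := ⟨_, v, cong.refl _ _, rfl⟩
  obtain ⟨u, hu, hn'⟩ := Nat.find_spec this
  refine ⟨u, hu, fun w hw => ?_⟩
  have := Nat.find_min' this ⟨w, hw.trans hu, rfl⟩
  rw [← hn'] at this
  rw [h.two_hn, h.two_hn]; omega
theorem mn.A (h : IsLeech B) {u v : LV} (hN : pairZ B u u = 12) (hN' : pairZ B v v = 12) (hc : cong 3 v u) (hne : v ≠ u) :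
    ∃ s, cong 2 s v ∧ pairZ B s s = 4 := by
  obtain ⟨w, rfl⟩ := hc
  have hw := h.four_le (v := w) (by rintro rfl; simp at hne)
  have e := h.even w
  rw [h.N_add, N_smul, pairZ_smul_right] at hN'
  have := h.pairZ_nonneg ((2 : ℤ) • u + (3 : ℤ) • w)
  rw [h.N_add, N_smul, N_smul, pairZ_smul_right, pairZ_smul_left] at this
  exact ⟨u + w, ⟨-w, by funext k; simp; ring⟩, by rw [h.N_add]; omega⟩
structure Cls (B : Matrix (Fin 24) (Fin 24) ℤ) (cls : LV → Fin 10) : Prop where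
  cj : ∀ u v, cls u = cls v ↔ cj B u v
  of : ∀ v, mn B v → ∀ j, pairZ B v v = nn j → (pairZ B v v = 12 → (j = 2 ↔ ∃ s, cong 2 s v ∧ pairZ B s s = 4)) → cls v = j
  q : ∀ v, pairZ B v v % 6 = nn (cls v) % 6
theorem nn_eq : ∀ i j, nn i = nn j → (nn i = 12 → (i = 2 ↔ j = 2)) → i = j := by decide
theorem cong3_N (h : IsLeech B) {u v : LV} (hc : cong 3 u v) : pairZ B u u % 6 = pairZ B v v % 6 := by
  obtain ⟨w, rfl⟩ := hc
  rw [h.N_add, N_smul, pairZ_smul_right]; have := h.even w; omega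
theorem IsLeech.exists_cls (h : IsLeech B) : ∃ cls, Cls B cls := by
  choose u hu hm using h.exists_mn
  choose c hN hr hA using fun v => (hm v).cls h
  have key : ∀ v w, mn B v → mn B w → _root_.cj B v w → pairZ B v v = pairZ B w w ∧
      (pairZ B v v = 12 → ((∃ s, cong 2 s v ∧ pairZ B s s = 4) → ∃ s, cong 2 s w ∧ pairZ B s s = 4)) := by
    rintro v w hv hw ⟨σ, hσ, hc⟩
    have hv' := hv.conway h hσ
    have e : pairZ B v v = pairZ B w w := by
      have h1 := hw _ hc.symm; have h2 := hv' _ hc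
      rw [pairZ_conway hσ] at h1 h2; omega
    refine ⟨e, fun h12 ⟨s, hs, hN⟩ => ?_⟩
    by_cases hne : w = σ *ᵥ v
    · exact ⟨σ *ᵥ s, by rw [hne]; exact hs.mulVec, by rw [pairZ_conway hσ, hN]⟩
    · exact mn.A h (by rw [pairZ_conway hσ, h12]) (by rw [← e, h12]) hc hne
  have key2 : ∀ v w, mn B v → mn B w → _root_.cj B v w → pairZ B v v = pairZ B w w ∧
      (pairZ B v v = 12 → ((∃ s, cong 2 s v ∧ pairZ B s s = 4) ↔ ∃ s, cong 2 s w ∧ pairZ B s s = 4)) := fun v w hv hw hc => by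
    obtain ⟨e, h1⟩ := key v w hv hw hc
    exact ⟨e, fun h12 => ⟨h1 h12, (key w v hw hv (hc.symm h)).2 (by omega)⟩⟩
  refine ⟨c, fun v w => ⟨fun hc => ?_, fun hc => ?_⟩, fun v hv j hj hA' => ?_, fun v => ?_⟩
  · have h1 := hr v; rw [hc] at h1
    exact (cj_of_cong (hu v)).trans h ((h1.conj h (hr w)).trans h (cj_of_cong (hu w).symm))
  · obtain ⟨e, h1⟩ := key2 _ _ (hm v) (hm w) ((cj_of_cong (hu v).symm).trans h (hc.trans h (cj_of_cong (hu w))))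
    exact nn_eq _ _ (by rw [← hN, ← hN, e]) fun h12 => by
      rw [← hN] at h12; rw [hA v h12, hA w (by omega), h1 h12]
  · obtain ⟨e, h1⟩ := key2 _ _ hv (hm v) (cj_of_cong (hu v))
    exact nn_eq _ _ (by rw [← hN, ← hj, e]) fun h12 => by
      rw [← hN] at h12; rw [hA v h12, hA' (by omega), h1 (by omega)]
  · rw [← hN, cong3_N h (hu v)]
end

section
variable {B : Matrix (Fin 24) (Fin 24) ℤ}
/-- congruent vectors -/
theorem IsLeech.cong3_short (h : IsLeech B) {u v : LV} (hc : cong 3 u v) (h1 : u ≠ v) :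
    ∃ m, u = v + (3 : ℤ) • m ∧ 4 ≤ pairZ B m m ∧ pairZ B u u = pairZ B v v + 6 * pairZ B v m + 9 * pairZ B m m ∧
     pairZ B (v + (2 : ℤ) • m) (v + (2 : ℤ) • m) = pairZ B v v + 4 * pairZ B v m + 4 * pairZ B m m ∧
     pairZ B (v + m) (v + m) = pairZ B v v + 2 * pairZ B v m + pairZ B m m := by
  obtain ⟨m, rfl⟩ := hc
  refine ⟨m, rfl, h.four_le (by rintro rfl; simp at h1), ?_, ?_, h.N_add _ _⟩ <;>
    rw [h.N_add, N_smul, pairZ_smul_right] <;> ring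
theorem IsLeech.mn_of (h : IsLeech B) {v : LV} (hv : ∀ u, cong 3 u v → u ≠ v → pairZ B u u < pairZ B v v → False) : mn B v := by
  intro u hu
  by_contra hcon; push Not at hcon
  exact hv u hu (by rintro rfl; omega) hcon
theorem IsLeech.mn_small (h : IsLeech B) {v : LV} (hv : pairZ B v v ≤ 14) : mn B v := by
  refine h.mn_of fun u hu hne hlt => ?_
  obtain ⟨m, -, hm, h1, h2, h3⟩ := h.cong3_short hu hne
  have e1 := h.pairZ_nonneg (v + (2 : ℤ) • m)
  have e3 := h.pairZ_nonneg (v + m)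
  have e2 := h.pairZ_nonneg u
  have := cong3_N h hu
  have := h.even m
  have e5 : pairZ B (v + (2 : ℤ) • m) (v + (2 : ℤ) • m) = 0 ∨ 4 ≤ pairZ B (v + (2 : ℤ) • m) (v + (2 : ℤ) • m) := by
    by_cases h0 : v + (2 : ℤ) • m = 0
    · left; rw [h0, pairZ_zero_left]
    · right; exact h.four_le h0
  have e6 : pairZ B (v + m) (v + m) = 0 ∨ 4 ≤ pairZ B (v + m) (v + m) := by
    by_cases h0 : v + m = 0
    · left; rw [h0, pairZ_zero_left]
    · right; exact h.four_le h0
  omega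
theorem Cls.sur (h : IsLeech B) {cls : LV → Fin 10} (hc : Cls B cls) : Function.Surjective cls ∧
    (∀ v, pairZ B v v = 8 → cls v = 5) ∧ (∀ v, pairZ B v v = 14 → cls v = 6) ∧ ∃ v, pairZ B v v = 14 := by
  obtain ⟨D, F, hF, hD⟩ : ∃ (D : Set (Om → ZMod 2)) (F : Om → LV), NF B D F ∧ Std D := by
    obtain ⟨C, F, hF⟩ := h.exists_frame
    obtain ⟨j, hj, -⟩ := ne3 0 0
    obtain ⟨k, hk, hkj⟩ := ne3 0 j
    obtain ⟨e, e1, e2, e3, he⟩ := hF.lab3 h (by simp) hj hk hkj.symm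
    exact ⟨_, _, hF.pl e, he⟩
  have sm : ∀ v, pairZ B v v ≤ 14 → ∀ j, pairZ B v v = nn j → pairZ B v v ≠ 12 → cls v = j := fun v hv j hj h12 =>
    hc.of v (h.mn_small hv) j hj fun hh => absurd hh h12
  have ve : ∀ y : Om → ℤ, (rd y = 0 ∨ rd y = colw 0 + colw 1 ∨ rd y = 1) → 4 ∣ ∑ i, y i → ∃ v, ∀ i, pairZ B v (F i) = 2 * y i :=
    fun y hy hs => (hF.mem (fun i => 2 * y i)).2 ⟨y, by
      rcases hy with hy | hy | hy <;> rw [hy]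
      exacts [hF.gol.zero, hD.col 1 (by decide), hF.gol.one], .inl ⟨rfl, hs⟩⟩
  have vo : ∀ y : Om → ℤ, (rd y = 0 ∨ rd y = 1) → 4 ∣ ∑ i, y i + 2 → ∃ v, ∀ i, pairZ B v (F i) = 2 * y i + 1 :=
    fun y hy hs => (hF.mem (fun i => 2 * y i + 1)).2 ⟨y, by
      rcases hy with hy | hy <;> rw [hy]
      exacts [hF.gol.zero, hF.gol.one], .inr ⟨rfl, hs⟩⟩
  have ip : ∀ u v (x y : Om → ℤ), (∀ i, pairZ B u (F i) = x i) → (∀ i, pairZ B v (F i) = y i) → 8 * pairZ B u v = ∑ i, x i * y i :=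
    fun u v x y hx hy => by have := hF.frm.inner h (by simp) u v; simpa only [hx, hy] using this
  have c2 : ∀ v w (x y : Om → ℤ), (∀ i, pairZ B v (F i) = x i) → (∀ i, pairZ B w (F i) = y i) →
      (∀ i, (if (0, 0) = i then 8 else 0) = x i + 2 * y i) → cong 2 (F (0, 0)) v := fun v w x y hx hy hh =>
    ⟨w, NF.ext h (by simp) hF.frm fun i => by rw [hF.frm.pp, pairZ_add_left, pairZ_smul_left, hx, hy, hh]⟩
  have c2' : ∀ v u, cong 2 (F (0, 0)) v → cong 2 u v → 8 ≤ pairZ B u u := fun v u h1 h2 => by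
    by_cases e1 : u = F (0, 0)
    · rw [e1, hF.frm.n8]
    by_cases e2 : u = -F (0, 0)
    · rw [e2, N_neg, hF.frm.n8]
    have := h.cong2_short (h2.trans h1.symm) e1 e2
    have := abs_nonneg (pairZ B u (F (0, 0))); have := hF.frm.n8 (0, 0); omega
  have t14 : ∃ v, pairZ B v v = 14 := by
    obtain ⟨v, hv⟩ := vo (fun i => if i = (0, 0) then 4 else if i = (1, 0) then -2 else 0) (by decide +kernel) (by decide +kernel)
    exact ⟨v, by have := ip v v _ _ hv hv; rw [show (∑ i, _ : ℤ) = 112 by decide +kernel] at this; omega⟩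
  refine ⟨fun j => ?_, fun v hv => sm v (by omega) 5 hv (by omega), fun v hv => sm v (by omega) 6 hv (by omega), t14⟩
  have shl : ∀ n, 0 < (h.shell n).card → ∃ v, pairZ B v v = 2 * n := fun n hn => by
    obtain ⟨v, hv⟩ := Finset.card_pos.1 hn; exact ⟨v, h.mem_shell.1 hv⟩
  obtain ⟨k2, k3, k4, k5, -⟩ := h.card_shells
  fin_cases j
  · exact ⟨0, sm 0 (by rw [pairZ_zero_left]; norm_num) 0 (pairZ_zero_left _) (by rw [pairZ_zero_left]; norm_num)⟩
  · obtain ⟨v, hv⟩ := shl 3 (by omega)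
    exact ⟨v, sm v (by omega) 1 hv (by omega)⟩
  · obtain ⟨a, ha⟩ := ve (fun i => if i = (0, 0) ∨ i = (0, 1) then 2 else 0) (by decide +kernel) (by decide +kernel)
    obtain ⟨b, hb⟩ := ve (fun i => if i = (0, 0) ∨ i = (0, 2) then 2 else 0) (by decide +kernel) (by decide +kernel)
    have h1 := ip a a _ _ ha ha; have h2 := ip b b _ _ hb hb; have h3 := ip a b _ _ ha hb
    rw [show (∑ i, _ : ℤ) = 32 by decide +kernel] at h1 h2
    rw [show (∑ i, _ : ℤ) = 16 by decide +kernel] at h3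
    have h4 := h.N_add a b; have h5 := h.N_sub a b
    exact ⟨a + b, hc.of _ (h.mn_small (by omega)) 2 (by show _ = (12 : ℤ); omega) fun _ =>
      ⟨fun _ => ⟨a - b, ⟨-b, by funext k; simp; ring⟩, by omega⟩, fun _ => rfl⟩⟩
  · obtain ⟨v, hv⟩ := ve (fun i => 1) (by decide +kernel) (by decide +kernel)
    obtain ⟨w, hw⟩ := vo (fun i => if i = (0, 0) then 1 else -1) (by decide +kernel) (by decide +kernel)
    have h1 := ip v v _ _ hv hv
    rw [show (∑ i, _ : ℤ) = 96 by decide +kernel] at h1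
    refine ⟨v, hc.of _ (h.mn_small (by omega)) 3 (by show _ = (12 : ℤ); omega) fun _ => ⟨fun hh => absurd hh (by decide), ?_⟩⟩
    rintro ⟨s, hs, hN⟩
    have := c2' v s (c2 v _ _ _ hv hw (by decide +kernel)) hs
    omega
  · obtain ⟨s, hs⟩ := vo (fun i => if i = (2, 0) then 2 else 0) (by decide +kernel) (by decide +kernel)
    obtain ⟨w, hw⟩ := ve (fun i => if i = (2, 0) then 2 else if i.1 = 0 ∧ i.2 ≠ 0 then -1 else if i.1 = 0 ∨ i.1 = 1 then 1 else 0) (by decide +kernel) (by decide +kernel)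
    have h1 := ip s s _ _ hs hs; have h2 := ip w w _ _ hw hw; have h3 := ip s w _ _ hs hw
    rw [show (∑ i, _ : ℤ) = 48 by decide +kernel] at h1 h2
    rw [show (∑ i, _ : ℤ) = 24 by decide +kernel] at h3
    have h4 := h.N_add s w; have h5 := h.N_sub s w
    have hsw : cong 2 (s - w) (s + w) := ⟨-w, by funext k; simp; ring⟩
    refine ⟨s + w, hc.of _ (h.mn_of fun u hu hne hlt => ?_) 4 (by show _ = (18 : ℤ); omega) (by omega)⟩
    obtain ⟨m, hum, hm, e1, e2, e3⟩ := h.cong3_short hu hne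
    have := cong3_N h hu
    have := h.even m
    have := h.pairZ_nonneg u
    have key : s + w + (2 : ℤ) • m ≠ s - w → s + w + (2 : ℤ) • m ≠ -(s - w) → False := fun k1 k2 => by
      have := h.cong2_short (cong.trans ⟨m, rfl⟩ hsw.symm) k1 k2
      have := abs_nonneg (pairZ B (s + w + (2 : ℤ) • m) (s - w)); omega
    have key2 : ∀ t, s + w + (2 : ℤ) • m = t → pairZ B t t = 6 → ∀ z, m = z → pairZ B z z = 6 → False := fun t k1 k2 z k3 k4 => by
      rw [k1] at e2; rw [k3] at e1 e2 hm; omega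
    by_cases k1 : s + w + (2 : ℤ) • m = s - w
    · refine key2 _ k1 (by omega) (-w) ?_ (by rw [N_neg]; omega)
      funext k; have := congrFun k1 k; simp only [Pi.add_apply, Pi.sub_apply, Pi.smul_apply, smul_eq_mul, Pi.neg_apply] at this ⊢; omega
    by_cases k2 : s + w + (2 : ℤ) • m = -(s - w)
    · refine key2 _ k2 (by rw [N_neg]; omega) (-s) ?_ (by rw [N_neg]; omega)
      funext k; have := congrFun k2 k; simp only [Pi.add_apply, Pi.sub_apply, Pi.smul_apply, smul_eq_mul, Pi.neg_apply] at this ⊢; omega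
    exact key k1 k2
  · obtain ⟨v, hv⟩ := shl 4 (by omega)
    exact ⟨v, sm v (by omega) 5 hv (by omega)⟩
  · obtain ⟨v, hv⟩ := t14
    exact ⟨v, sm v (by omega) 6 hv (by omega)⟩
  · obtain ⟨v, hv⟩ := shl 2 (by omega)
    exact ⟨v, sm v (by omega) 7 hv (by omega)⟩
  · obtain ⟨v, hv⟩ := shl 5 (by omega)
    exact ⟨v, sm v (by omega) 8 hv (by omega)⟩
  · obtain ⟨v, hv⟩ := ve (fun i => if i = (0, 0) then -2 else if i.1 = 0 ∨ i.1 = 1 then 2 else 0) (by decide +kernel) (by decide +kernel)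
    obtain ⟨w, hw⟩ := ve (fun i => if i = (0, 0) then 3 else if i.1 = 0 ∨ i.1 = 1 then -1 else 0) (by decide +kernel) (by decide +kernel)
    have h1 := ip v v _ _ hv hv
    rw [show (∑ i, _ : ℤ) = 128 by decide +kernel] at h1
    refine ⟨v, hc.of _ (h.mn_of fun u hu hne hlt => ?_) 9 (by show _ = (16 : ℤ); omega) (by omega)⟩
    obtain ⟨m, hum, hm, e1, e2, e3⟩ := h.cong3_short hu hne
    have := c2' v (v + (2 : ℤ) • m) (c2 v _ _ _ hv hw (by decide +kernel)) ⟨m, rfl⟩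
    have := cong3_N h hu
    have := h.even m
    have := h.pairZ_nonneg u
    omega
end

section
variable {B : Matrix (Fin 24) (Fin 24) ℤ}
open MeasureTheory in
theorem IsLeech.uniq (h : IsLeech B) {a : LV → ℂ} (ha : Summable fun l => ‖a l‖)
    (h0 : ∀ z, ∑' l, a l * Complex.exp (2 * π * Complex.I * pairC B (liftC l) z) = 0) (l : LV) : a l = 0 := by
  letI : MeasureSpace UnitAddCircle := ⟨AddCircle.haarAddCircle⟩
  haveI : IsProbabilityMeasure (volume : Measure UnitAddCircle) :=
    inferInstanceAs (IsProbabilityMeasure AddCircle.haarAddCircle)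
  have hBu : IsUnit B.det := by rw [h.2.1]; exact isUnit_one
  have hi : Function.Injective fun m : LV => B *ᵥ m := Matrix.mulVec_injective_of_isUnit ((Matrix.isUnit_iff_isUnit_det _).2 hBu)
  let F : LV → C(UnitAddTorus (Fin 24), ℂ) := fun l => a l • UnitAddTorus.mFourier (B *ᵥ l)
  have hs : Summable F := Summable.of_norm (by
    refine ha.congr fun l => ?_
    rw [norm_smul, UnitAddTorus.mFourier_norm, mul_one])
  have hz : ∑' l, F l = 0 := by
    ext t
    choose x hx using fun i => QuotientAddGroup.mk_surjective (t i)
    rw [← ContinuousMap.tsum_apply hs]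
    refine Eq.trans (tsum_congr fun l => ?_) (h0 (realC x))
    simp only [F, ContinuousMap.smul_apply, smul_eq_mul]
    congr 1
    rw [UnitAddTorus.mFourier, ContinuousMap.coe_mk, h.pairC_comm, pairC, dotProduct, Finset.mul_sum, Complex.exp_sum]
    refine Finset.prod_congr rfl fun i _ => ?_
    rw [← hx i]
    refine fourier_coe_apply.trans (congrArg _ ?_)
    simp only [mulVec, dotProduct, realC, liftC, Matrix.map_apply]; push_cast; ring
  have h1 := hs.hasSum.mapL ((innerSL ℂ (UnitAddTorus.mFourierLp 2 (B *ᵥ l))).comp (ContinuousMap.toLp (E := ℂ) 2 volume ℂ))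
  rw [hz, map_zero] at h1
  have h2 := hasSum_single (f := fun l' => innerSL ℂ (UnitAddTorus.mFourierLp 2 (B *ᵥ l))
    (ContinuousMap.toLp (E := ℂ) 2 volume ℂ (F l'))) l fun l' hl' => by
    simp only [F, map_smul, innerSL_apply_apply]
    rw [show (ContinuousMap.toLp (E := ℂ) 2 volume ℂ) (UnitAddTorus.mFourier (B *ᵥ l')) = UnitAddTorus.mFourierLp 2 (B *ᵥ l') from rfl,
      UnitAddTorus.orthonormal_mFourier.2 fun e => hl' (hi e.symm), smul_zero]
  have h3 := h2.unique h1
  simp only [F, map_smul, innerSL_apply_apply] at h3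
  rw [show (ContinuousMap.toLp (E := ℂ) 2 volume ℂ) (UnitAddTorus.mFourier (B *ᵥ l)) = UnitAddTorus.mFourierLp 2 (B *ᵥ l) from rfl,
    inner_self_eq_norm_sq_to_K, UnitAddTorus.orthonormal_mFourier.1] at h3
  simpa using h3
/-- theta functions -/
def Th (B : Matrix (Fin 24) (Fin 24) ℤ) (cls : LV → Fin 10) (g : Fin 10 → ℂ) (t : ℂ) (z : CV) : ℂ :=
  ∑' l, g (cls l) * thT B (t / 3) z l
variable {cls : LV → Fin 10} {t : ℂ} {g : Fin 10 → ℂ}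
theorem im3 (ht : 0 < t.im) : 0 < (t / 3).im := by
  rw [show t / 3 = ((1 / 3 : ℝ) : ℂ) * t by push_cast; ring, Complex.im_ofReal_mul]; positivity
theorem g_le (g : Fin 10 → ℂ) (j : Fin 10) : ‖g j‖ ≤ ∑ j, ‖g j‖ :=
  Finset.single_le_sum (f := fun j => ‖g j‖) (fun _ _ => norm_nonneg _) (Finset.mem_univ j)
theorem IsLeech.Th_sum (h : IsLeech B) (g : Fin 10 → ℂ) (ht : 0 < t.im) (z : CV) :
    Summable fun l => g (cls l) * thT B (t / 3) z l :=
  Summable.of_norm_bounded ((h.thT_summable (im3 ht) z).mul_left (∑ j, ‖g j‖)) fun l => by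
    rw [norm_mul]; exact mul_le_mul_of_nonneg_right (g_le _ _) (norm_nonneg _)
theorem IsLeech.Th_lin (h : IsLeech B) {ι : Type*} (s : Finset ι) (c : ι → ℂ) (G : ι → Fin 10 → ℂ) (ht : 0 < t.im) (z : CV) :
    Th B cls (∑ i ∈ s, c i • G i) t z = ∑ i ∈ s, c i * Th B cls (G i) t z := by
  simp only [Th, ← tsum_mul_left]
  rw [← Summable.tsum_finsetSum fun i _ => (h.Th_sum (G i) ht z).mul_left (c i)]
  refine tsum_congr fun l => ?_
  simp [Finset.sum_apply, Finset.sum_mul, mul_assoc]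
theorem thT_split (l : LV) (z : CV) : thT B t z l = thT B t 0 l * Complex.exp (2 * π * Complex.I * pairC B (liftC l) z) := by
  rw [thT, thT, ← Complex.exp_add]; simp [pairC]
theorem IsLeech.Th_inj (h : IsLeech B) (hc : Function.Surjective cls) {g g' : Fin 10 → ℂ} (ht : 0 < t.im)
    (he : ∀ z, Th B cls g t z = Th B cls g' t z) : g = g' := by
  ext j
  obtain ⟨l, rfl⟩ := hc j
  have := h.uniq (a := fun l => (g (cls l) - g' (cls l)) * thT B (t / 3) 0 l) ?_ (fun z => ?_) l
  · exact sub_eq_zero.1 ((mul_eq_zero.1 this).resolve_right (Complex.exp_ne_zero _))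
  · exact (h.Th_sum (cls := cls) (g - g') ht 0).norm
  · rw [← sub_eq_zero.2 (he z), Th, Th, ← (h.Th_sum g ht z).tsum_sub (h.Th_sum g' ht z)]
    refine tsum_congr fun l => ?_
    rw [thT_split (z := z)]; ring
theorem Th_re (e : LV ≃ LV) {z' : CV} {c : ℂ} (he : ∀ l, cls (e l) = cls l)
    (ht : ∀ l, thT B (t / 3) z l = c * thT B (t / 3) z' (e l)) : Th B cls g t z = c * Th B cls g t z' := by
  rw [Th, Th, ← e.tsum_eq (fun l => g (cls l) * thT B (t / 3) z' l), ← tsum_mul_left]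
  exact tsum_congr fun l => by rw [he, ht]; ring
theorem pairC_act {σ : Matrix (Fin 24) (Fin 24) ℤ} (hσ : σ ∈ ConwayGroup B) (l : LV) (z : CV) :
    pairC B (liftC (σ *ᵥ l)) (actC σ z) = pairC B (liftC l) z := by
  have e : liftC (σ *ᵥ l) = (σ.map (Int.cast : ℤ → ℂ)) *ᵥ liftC l := by
    ext i; simp [liftC, mulVec, dotProduct]
  have e2 : (σ.map (Int.cast : ℤ → ℂ))ᵀ * B.map (Int.cast : ℤ → ℂ) * σ.map (Int.cast : ℤ → ℂ) = B.map (Int.cast : ℤ → ℂ) := by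
    have := congrArg (fun A : Matrix (Fin 24) (Fin 24) ℤ => A.map (Int.castRingHom ℂ)) hσ.2
    simp only [Matrix.map_mul, ← Matrix.transpose_map] at this; exact this
  rw [e, actC, pairC, pairC]
  conv_rhs => rw [← e2, ← mulVec_mulVec, ← mulVec_mulVec, dotProduct_mulVec, vecMul_transpose]
theorem Th_act (h : IsLeech B) (hc : Cls B cls) {σ : Matrix (Fin 24) (Fin 24) ℤ} (hσ : σ ∈ ConwayGroup B) (z : CV) :
    Th B cls g t (actC σ z) = Th B cls g t z := by
  obtain ⟨ρ, hρ, h1, h2⟩ := conway_inv h hσ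
  have key := fun l => pairC_act hσ l z
  refine (Th_re (c := 1) ⟨fun l => ρ *ᵥ l, fun l => σ *ᵥ l, h2, h1⟩ (fun l => ?_) fun l => ?_).trans (one_mul _)
  · exact (hc.cj _ _).2 ⟨σ, hσ, by simp only [Equiv.coe_fn_mk, h2]; exact cong.refl _ _⟩
  · simp only [Equiv.coe_fn_mk, thT]
    rw [one_mul, pairZ_conway hρ, ← key, h2]
theorem neg_conway : (-1 : Matrix (Fin 24) (Fin 24) ℤ) ∈ ConwayGroup B := by
  refine ⟨?_, by simp⟩
  rw [Matrix.det_neg]; simp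
theorem Th_neg (h : IsLeech B) (hc : Cls B cls) (z : CV) : Th B cls g t (-z) = Th B cls g t z := by
  rw [← Th_act h hc neg_conway z]; congr 1
  ext i; simp [actC, Matrix.map, mulVec, dotProduct, Matrix.one_apply]
theorem Th_qp (h : IsLeech B) (hc : Cls B cls) (x y : LV) (z : CV) :
    Th B cls g t (z + t • liftC x + liftC y) = Complex.exp (-(3 : ℕ) * π * Complex.I * pairZ B x x * t
      - 2 * (3 : ℕ) * π * Complex.I * pairC B (liftC x) z) * Th B cls g t z := by
  refine Th_re (Equiv.addRight ((3 : ℤ) • x)) (fun l => ?_) fun l => ?_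
  · exact (hc.cj _ _).2 (cj_of_cong (cong.symm ⟨x, rfl⟩))
  · rw [Equiv.coe_addRight, thT, thT, ← Complex.exp_add]
    have e : liftC (l + (3 : ℤ) • x) = liftC l + (3 : ℂ) • liftC x := by ext i; simp [liftC]
    rw [e, h.N_add, N_smul, pairZ_smul_right, Complex.exp_eq_exp_iff_exists_int]
    refine ⟨pairZ B l y, ?_⟩
    simp only [pairC_add_right, pairC_add_left, pairC_smul_right, pairC_smul_left, pairC_liftC]
    push_cast; ring
end

section
variable {B : Matrix (Fin 24) (Fin 24) ℤ}
variable {cls : LV → Fin 10} {t : ℂ} {g : Fin 10 → ℂ}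
def W : ℂ := Complex.exp (2 * π * Complex.I / 3)
theorem W_ne : W ≠ 0 := Complex.exp_ne_zero _
theorem W_zpow (n : ℤ) : W ^ n = Complex.exp (2 * π * Complex.I * n / 3) := by
  rw [W, ← Complex.exp_int_mul]; congr 1; ring
theorem W3 : W ^ 3 = 1 := by
  rw [W, ← Complex.exp_nat_mul, ← Complex.exp_two_pi_mul_I]; congr 1; push_cast; ring
theorem W_mod {m n : ℤ} (k : ℤ) (hk : m = n + 3 * k) : W ^ m = W ^ n := by
  rw [hk, zpow_add₀ W_ne, _root_.zpow_mul, show W ^ (3 : ℤ) = 1 by exact_mod_cast W3, _root_.one_zpow, mul_one]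
def qq : Fin 10 → ℕ := ![0, 0, 0, 0, 0, 1, 1, 2, 2, 2]
def MM : (Fin 10 → ℂ) →ₗ[ℂ] (Fin 10 → ℂ) where
  toFun g j := W ^ qq j * g j
  map_add' a b := by ext; simp [mul_add]
  map_smul' a b := by ext; simp; ring
theorem MM_apply (g : Fin 10 → ℂ) (j) : MM g j = W ^ qq j * g j := rfl
theorem MM3 (g : Fin 10 → ℂ) : MM (MM (MM g)) = g := by
  ext j; simp only [MM_apply]
  have : (W ^ qq j) ^ 3 = 1 := by rw [← pow_mul, mul_comm, pow_mul, W3, one_pow]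
  linear_combination g j * this
theorem Cls.W (hc : Cls B cls) (l : LV) : ∃ m : ℤ, pairZ B l l = 2 * qq (cls l) + 6 * m := by
  have h1 := hc.q l
  have h2 : ∀ j, (2 * qq j : ℤ) % 6 = nn j % 6 := by decide
  have := h2 (cls l)
  exact ⟨(pairZ B l l - 2 * qq (cls l)) / 6, by omega⟩
theorem Th_T (hc : Cls B cls) (z : CV) : Th B cls g (t + 1) z = Th B cls (MM g) t z := by
  refine tsum_congr fun l => ?_
  obtain ⟨m, hm⟩ := hc.W l
  have : thT B ((t + 1) / 3) z l = W ^ qq (cls l) * thT B (t / 3) z l := by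
    have := W_zpow (qq (cls l) + 3 * m)
    rw [W_mod m rfl, zpow_natCast] at this
    rw [this, thT, thT, ← Complex.exp_add, hm]; congr 1; push_cast; ring
  rw [this, MM_apply]; ring
def lf3 (s : Fin 24 → Fin 3) : LV := fun i => ((s i : ℕ) : ℤ)
def e3 : LV ≃ LV × (Fin 24 → Fin 3) :=
  (Equiv.piCongrRight fun _ => Int.divModEquiv 3).trans (Equiv.arrowProdEquivProdArrow _ _ _)
theorem e3_symm (p : LV × (Fin 24 → Fin 3)) : e3.symm p = lf3 p.2 + (3 : ℤ) • p.1 := by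
  ext i; simp [e3, Equiv.arrowProdEquivProdArrow, lf3]; ring
theorem lft_red (v : LV) : cong 3 v (lf3 (e3 v).2) := ⟨(e3 v).1, by rw [← e3_symm, Equiv.symm_apply_apply]⟩
theorem lft_inj {s s' : Fin 24 → Fin 3} (hc : cong 3 (lf3 s) (lf3 s')) : s = s' := by
  obtain ⟨w, hw⟩ := hc
  ext i
  have := congrFun hw i
  simp only [lf3, Pi.add_apply, Pi.smul_apply, smul_eq_mul] at this
  have := (s i).2; have := (s' i).2; omega
def Fh (B : Matrix (Fin 24) (Fin 24) ℤ) (cls : LV → Fin 10) (c : Fin 10 → ℂ) (l : LV) : ℂ :=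
  (3 ^ 12)⁻¹ * ∑ s, c (cls (lf3 s)) * W ^ pairZ B l (lf3 s)
theorem Fh_cls (h : IsLeech B) (hc : Cls B cls) (c : Fin 10 → ℂ) {l l' : LV} (hl : cls l = cls l') :
    Fh B cls c l = Fh B cls c l' := by
  obtain ⟨σ, hσ, w, rfl⟩ := (hc.cj _ _).1 hl
  obtain ⟨ρ, hρ, h1, h2⟩ := conway_inv h hσ
  rw [Fh, Fh]; congr 1
  let r : (Fin 24 → Fin 3) → (Fin 24 → Fin 3) := fun s => (e3 (σ *ᵥ lf3 s)).2
  have hr : ∀ s, cong 3 (lf3 (r s)) (σ *ᵥ lf3 s) := fun s => (lft_red _).symm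
  have hi : Function.Injective r := fun s s' e => by
    have := ((hr s).symm.trans (e ▸ hr s')).mulVec (σ := ρ)
    have q := h1 (lf3 s); have q' := h1 (lf3 s')
    rw [q, q'] at this
    exact lft_inj this
  conv_rhs => rw [← (Finite.injective_iff_bijective.1 hi).sum_comp]
  refine Finset.sum_congr rfl fun s _ => ?_
  obtain ⟨x, hx⟩ := hr s
  rw [← (hc.cj _ _).2 ⟨σ, hσ, hr s⟩, hx]
  congr 1
  refine (W_mod (pairZ B (σ *ᵥ l) x + pairZ B w (σ *ᵥ lf3 s) + 3 * pairZ B w x) ?_).symm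
  simp only [pairZ_add_left, pairZ_add_right, pairZ_smul_left, pairZ_smul_right, pairZ_conway hσ]; ring
/-- the S-matrix -/
def FF (B : Matrix (Fin 24) (Fin 24) ℤ) (cls : LV → Fin 10) : (Fin 10 → ℂ) →ₗ[ℂ] (Fin 10 → ℂ) where
  toFun c j := Fh B cls c (Function.invFun cls j)
  map_add' a b := by ext; simp [Fh, add_mul, Finset.sum_add_distrib, mul_add]
  map_smul' a b := by ext; simp [Fh, Finset.mul_sum]; exact Finset.sum_congr rfl fun _ _ => by ring
theorem FF_cls (h : IsLeech B) (hc : Cls B cls) (c : Fin 10 → ℂ) (l : LV) : FF B cls c (cls l) = Fh B cls c l :=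
  Fh_cls h hc c (Function.invFun_eq ⟨l, rfl⟩)
theorem Th_F (h : IsLeech B) (hc : Cls B cls) (c : Fin 10 → ℂ) (ht : 0 < t.im) (z : CV) :
    Th B cls (FF B cls c) (-t⁻¹) (t⁻¹ • z) = t ^ 12 * Complex.exp (3 * π * Complex.I * pairC B z z / t) * Th B cls c t z := by
  have t0 : t ≠ 0 := by rintro rfl; simp at ht
  have ht3 : 0 < (3 * t).im := by simpa using ht
  have hi : 0 < (-(3 * t)⁻¹).im := by
    rw [Complex.neg_im, Complex.inv_im, neg_div, neg_neg]; exact div_pos ht3 (Complex.normSq_pos.2 (by simpa))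
  have e1 : Th B cls c t z = ∑ s, c (cls (lf3 s)) * (Complex.exp (π * Complex.I * pairZ B (lf3 s) (lf3 s) * t / 3 + 2 * π * Complex.I * pairC B (liftC (lf3 s)) z) *
      ∑' m, thT B (3 * t) ((3 : ℂ) • z + t • liftC (lf3 s)) m) := by
    rw [Th, ← e3.symm.tsum_eq]
    have := (e3.symm.summable_iff.2 (h.Th_sum (cls := cls) c ht z))
    rw [← (Equiv.prodComm _ _).tsum_eq]
    refine (Summable.tsum_prod ((Equiv.prodComm _ _).summable_iff.2 this)).trans ?_
    rw [tsum_fintype]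
    refine Finset.sum_congr rfl fun s _ => ?_
    rw [← tsum_mul_left, ← tsum_mul_left]
    refine tsum_congr fun m => ?_
    change c (cls (e3.symm (m, s))) * thT B (t / 3) z (e3.symm (m, s)) = _
    rw [e3_symm]; dsimp only
    congr 1
    · rw [(hc.cj _ _).2 (cj_of_cong (v := lf3 s) (cong.symm ⟨m, rfl⟩))]
    · have e : liftC (lf3 s + (3 : ℤ) • m) = liftC (lf3 s) + (3 : ℂ) • liftC m := by ext i; simp [liftC]
      rw [thT, thT, ← Complex.exp_add, e, h.N_add, N_smul, pairZ_smul_right]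
      simp only [pairC_add_right, pairC_add_left, pairC_smul_right, pairC_smul_left, pairC_liftC]
      rw [h.comm m (lf3 s)]; congr 1; push_cast; ring
  have e2 : ∀ s, ∑' l, W ^ pairZ B l (lf3 s) * thT B (-t⁻¹ / 3) (t⁻¹ • z) l = (3 ^ 12 * t ^ 12 * Complex.exp (3 * π * Complex.I * pairC B z z / t)) *
      (Complex.exp (π * Complex.I * pairZ B (lf3 s) (lf3 s) * t / 3 + 2 * π * Complex.I * pairC B (liftC (lf3 s)) z) *
      ∑' m, thT B (3 * t) ((3 : ℂ) • z + t • liftC (lf3 s)) m) := fun s => by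
    refine Eq.trans (tsum_congr fun l => ?_) ((h.theta_inv ht3 ((3 : ℂ) • z + t • liftC (lf3 s))).trans ?_)
    · rw [W_zpow, thT, thT, ← Complex.exp_add]
      congr 1
      simp only [pairC_add_right, pairC_smul_right, pairC_liftC]
      field_simp; ring
    · rw [mul_pow, mul_assoc _ (Complex.exp _) (_ * _), ← mul_assoc (Complex.exp _) (Complex.exp _), ← Complex.exp_add, mul_assoc]
      congr 3
      simp only [pairC_add_right, pairC_add_left, pairC_smul_right, pairC_smul_left, pairC_liftC, h.pairC_comm z]
      field_simp; ring
  have e3 : Th B cls (FF B cls c) (-t⁻¹) (t⁻¹ • z) = (3 ^ 12)⁻¹ * ∑ s, c (cls (lf3 s)) * ∑' l, W ^ pairZ B l (lf3 s) * thT B (-t⁻¹ / 3) (t⁻¹ • z) l := by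
    have hs : ∀ s, Summable fun l => W ^ pairZ B l (lf3 s) * thT B (-t⁻¹ / 3) (t⁻¹ • z) l := fun s => by
      refine Summable.of_norm ((h.thT_summable (t := -t⁻¹ / 3) (by convert hi using 2; field_simp) (t⁻¹ • z)).congr fun l => ?_)
      rw [norm_mul, norm_zpow, W, show 2 * (π : ℂ) * Complex.I / 3 = ((2 * π / 3 : ℝ) : ℂ) * Complex.I by push_cast; ring,
        Complex.norm_exp_ofReal_mul_I, _root_.one_zpow, one_mul]
    simp only [← tsum_mul_left]
    rw [← Summable.tsum_finsetSum fun s _ => (hs s).mul_left _, ← tsum_mul_left, Th]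
    refine tsum_congr fun l => ?_
    rw [FF_cls h hc, Fh, Finset.mul_sum, Finset.sum_mul, Finset.mul_sum]
    exact Finset.sum_congr rfl fun s _ => by ring
  rw [e3, e1, Finset.mul_sum, Finset.mul_sum]
  refine Finset.sum_congr rfl fun s _ => ?_
  rw [e2]; field_simp
theorem im_neg_inv (ht : 0 < t.im) : 0 < (-t⁻¹).im := by
  rw [Complex.neg_im, Complex.inv_im, neg_div, neg_neg]; exact div_pos ht (Complex.normSq_pos.2 (by rintro rfl; simp at ht))
theorem Th_S (h : IsLeech B) (hc : Cls B cls) (c : Fin 10 → ℂ) (ht : 0 < t.im) (z : CV) :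
    Th B cls c (-t⁻¹) (t⁻¹ • z) = t ^ 12 * Complex.exp (3 * π * Complex.I * pairC B z z / t) * Th B cls (FF B cls c) t z := by
  have t0 : t ≠ 0 := by rintro rfl; simp at ht
  have := Th_F h hc c (im_neg_inv ht) (t⁻¹ • z)
  rw [show (-(-t⁻¹)⁻¹ : ℂ) = t by field_simp, show (-t⁻¹)⁻¹ • t⁻¹ • z = -z by rw [smul_smul, show (-t⁻¹)⁻¹ * t⁻¹ = (-1 : ℂ) by field_simp, neg_one_smul],
    Th_neg h hc] at this
  rw [this]
  simp only [pairC_smul_right, pairC_smul_left]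
  have e : ∀ a b x : ℂ, b * a = 1 → x = t ^ 12 * b * ((-t⁻¹) ^ 12 * a * x) := fun a b x hab => by
    field_simp; linear_combination -x * hab
  refine e _ _ _ ?_
  rw [← Complex.exp_add]; refine (congrArg _ ?_).trans Complex.exp_zero; field_simp; ring
theorem FF2 (h : IsLeech B) (hc : Cls B cls) (c : Fin 10 → ℂ) : FF B cls (FF B cls c) = c := by
  have hI : 0 < Complex.I.im := by simp
  refine h.Th_inj (Cls.sur h hc).1 hI fun z => ?_
  have h1 := Th_S h hc (FF B cls c) hI z
  rw [Th_F h hc c hI] at h1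
  exact (mul_left_cancel₀ (mul_ne_zero (pow_ne_zero _ Complex.I_ne_zero) (Complex.exp_ne_zero _)) h1).symm
theorem FM3 (h : IsLeech B) (hc : Cls B cls) (c : Fin 10 → ℂ) :
    FF B cls (MM (FF B cls (MM (FF B cls (MM c))))) = c := by
  have key : ∀ (t : ℂ) (z : CV) (c : Fin 10 → ℂ), 0 < t.im → Th B cls (FF B cls (MM c)) t z =
      (t⁻¹) ^ 12 * Complex.exp (-(3 * π * Complex.I * pairC B z z / t)) * Th B cls c (-t⁻¹ + 1) (t⁻¹ • z) := fun t z c ht => by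
    have t0 : t ≠ 0 := by rintro rfl; simp at ht
    rw [Th_T hc, Th_S h hc _ ht, Complex.exp_neg]
    have := Complex.exp_ne_zero (3 * π * Complex.I * pairC B z z / t)
    field_simp
  have im1 : ∀ t : ℂ, 0 < t.im → 0 < (-t⁻¹ + 1).im := fun t ht => by simpa using im_neg_inv ht
  obtain ⟨t, hI⟩ : ∃ t : ℂ, 0 < t.im := ⟨Complex.I, by simp⟩
  refine h.Th_inj (Cls.sur h hc).1 hI fun z => ?_
  have i1 := im1 _ hI
  have i2 := im1 _ i1
  have t0 : t ≠ 0 := by rintro rfl; simp at hI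
  have t1 : t - 1 ≠ 0 := by
    intro e; rw [sub_eq_zero.1 e] at hI; simp at hI
  have t1' : -1 + t ≠ 0 := by rwa [neg_add_eq_sub]
  have a1 : -t⁻¹ + 1 = (t - 1) / t := by field_simp; ring
  have a2 : -(-t⁻¹ + 1)⁻¹ + 1 = -1 / (t - 1) := by rw [a1]; field_simp; ring
  rw [key _ _ _ hI, key _ _ _ i1, key _ _ _ i2, a2, a1, show (-(-1 / (t - 1))⁻¹ + 1 : ℂ) = t by field_simp; ring]
  simp only [smul_smul, pairC_smul_right, pairC_smul_left]
  rw [show (-1 / (t - 1))⁻¹ * (((t - 1) / t)⁻¹ * t⁻¹) = (-1 : ℂ) by field_simp, neg_one_smul, Th_neg h hc]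
  have e : ∀ a b d x : ℂ, a * b * d = 1 → (t⁻¹) ^ 12 * a * (((t - 1) / t)⁻¹ ^ 12 * b * ((-1 / (t - 1))⁻¹ ^ 12 * d * x)) = x := fun a b d x hab => by
    field_simp; linear_combination x * hab
  refine e _ _ _ _ ?_
  rw [← Complex.exp_add, ← Complex.exp_add]; refine (congrArg _ ?_).trans Complex.exp_zero; field_simp; ring
end

section
variable {B : Matrix (Fin 24) (Fin 24) ℤ}
variable {cls : LV → Fin 10}
open ModularGroup
theorem IsLeech.uniq2 (h : IsLeech B) {a b : LV → ℂ} {P : CV → ℂ}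
    (ha : ∀ z, HasSum (fun l => a l * eC (pairC B (liftC l) z)) (P z))
    (hb : ∀ z, HasSum (fun l => b l * eC (pairC B (liftC l) z)) (P z)) : a = b := by
  have hs : ∀ z, HasSum (fun l => (a l - b l) * eC (pairC B (liftC l) z)) 0 := fun z => by
    simpa [sub_mul] using (ha z).sub (hb z)
  ext l
  refine sub_eq_zero.1 (h.uniq (a := fun l => a l - b l) ?_ (fun z => (hs z).tsum_eq) l)
  have := (hs 0).summable.norm
  simpa [pairC, eC] using this
/-- vector valued modular forms -/
structure VF (B : Matrix (Fin 24) (Fin 24) ℤ) (cls : LV → Fin 10) (κ : ℤ) (H : ℍ → Fin 10 → ℂ) : Prop where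
  hol : ∀ j, MDifferentiable 𝓘(ℂ) 𝓘(ℂ) fun τ => H τ j
  bdd : ∀ j, IsBoundedAtImInfty fun τ => H τ j
  T : ∀ τ, MM (H (T • τ)) = H τ
  S : ∀ τ : ℍ, H (S • τ) = (τ : ℂ) ^ κ • FF B cls (H τ)
theorem eC_add (x y : ℂ) : eC (x + y) = eC x * eC y := by rw [eC, eC, eC, ← Complex.exp_add]; congr 1; ring
theorem norm_eC (x : ℂ) : ‖eC x‖ = Real.exp (-2 * π * x.im) := by
  rw [eC, Complex.norm_exp]; congr 1; simp [mul_assoc]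
theorem eC_bound {c : ℕ → ℂ} {a : ℝ} (hc : ∀ n : ℕ, (n : ℝ) < a → c n = 0) {y : ℝ} (hs : Summable fun n : ℕ => c n * eC (n * (y * Complex.I))) :
    ∃ u : ℕ → ℝ, Summable u ∧ ∀ (n : ℕ) (t : ℂ), y ≤ t.im → ‖c n * eC ((n - a) * t)‖ ≤ u n := by
  refine ⟨fun n => ‖c n * eC (n * (y * Complex.I))‖ * Real.exp (2 * π * a * y), hs.norm.mul_right _, fun n t ht => ?_⟩
  by_cases hn : (n : ℝ) < a
  · simp [hc n hn]
  · dsimp only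
    rw [norm_mul, norm_mul, mul_assoc, norm_eC, norm_eC, ← Real.exp_add]
    gcongr
    have h1 : (((n : ℂ) - a) * t).im = (n - a) * t.im := by
      rw [show ((n : ℂ) - a) = ((n - a : ℝ) : ℂ) by push_cast; rfl, Complex.im_ofReal_mul]
    have h2 : ((n : ℂ) * (y * Complex.I)).im = n * y := by simp
    rw [h1, h2]
    have := mul_le_mul_of_nonneg_left ht (sub_nonneg.2 (not_lt.1 hn))
    nlinarith [Real.pi_pos]
theorem eC_series {c : ℕ → ℂ} {a : ℝ} (hc : ∀ n : ℕ, (n : ℝ) < a → c n = 0) (hs : ∀ y : ℝ, 0 < y → Summable fun n : ℕ => c n * eC (n * (y * Complex.I))) :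
    MDifferentiable 𝓘(ℂ) 𝓘(ℂ) (fun τ : ℍ => ∑' n, c n * eC ((n - a) * τ)) ∧
    IsBoundedAtImInfty (fun τ : ℍ => ∑' n, c n * eC ((n - a) * τ)) := by
  constructor
  · refine mdiff_of_diffOn (f := fun t => ∑' n, c n * eC ((n - a) * t)) fun t ht => ?_
    simp only [Set.mem_ofPred_eq] at ht
    obtain ⟨u, hu, hb⟩ := eC_bound hc (hs (t.im / 2) (by positivity))
    have ho : IsOpen {s : ℂ | t.im / 2 < s.im} := isOpen_lt continuous_const Complex.continuous_im
    have hd := differentiableOn_tsum_of_summable_norm (F := fun n (t : ℂ) => c n * eC ((n - a) * t)) hu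
      (fun n => by unfold eC; fun_prop) ho (fun n s hs => hb n s (le_of_lt hs))
    exact (hd.differentiableAt (ho.mem_nhds (by simp; linarith))).differentiableWithinAt
  · obtain ⟨u, hu, hb⟩ := eC_bound hc (hs 1 one_pos)
    refine UpperHalfPlane.isBoundedAtImInfty_iff.2 ⟨∑' n, u n, 1, fun τ hτ => ?_⟩
    exact tsum_of_norm_bounded hu.hasSum fun n => hb n τ hτ
theorem forward (h : IsLeech B) (hc : Cls B cls) {k : ℤ} {ψ : ℍ → CV → ℂ} (hψ : IsHolJacobiForm B k 3 ψ) :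
    ∃ H, VF B cls (k - 12) H ∧ ∀ τ z, ψ τ z = Th B cls (H τ) τ z := by
  obtain ⟨f, hj, hf⟩ := hψ
  let A : ℍ → LV → ℂ := fun τ l => ∑' n, f n l * eC (n * τ)
  have hA0 : ∀ τ : ℍ, Summable fun p : LV × ℕ => f p.2 p.1 * eC (p.2 * τ) := fun τ => by
    have := (Equiv.prodComm LV ℕ).summable_iff.2 (hj.expansion τ 0).summable
    refine this.congr fun p => ?_
    simp [fterm, pairC, eC]
  have hs : ∀ (τ : ℍ) l, Summable fun n => f n l * eC (n * τ) := fun τ l => (hA0 τ).prod_factor l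
  have hA : ∀ (τ : ℍ) z, HasSum (fun l => A τ l * eC (pairC B (liftC l) z)) (ψ τ z) := fun τ z => by
    have := (Equiv.prodComm LV ℕ).hasSum_iff.2 (hj.expansion τ z)
    refine this.prod_fiberwise fun l => ?_
    refine ((hs τ l).hasSum.mul_right (eC (pairC B (liftC l) z))).congr_fun fun n => ?_
    simp [fterm, mul_assoc]
  have h1 : ∀ (τ : ℍ) σ, σ ∈ ConwayGroup B → ∀ l, A τ (σ *ᵥ l) = A τ l := fun τ σ hσ l => by
    obtain ⟨ρ, hρ, e1, e2⟩ := conway_inv h hσ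
    refine congrFun (h.uniq2 (a := fun l => A τ (σ *ᵥ l)) (fun z => ?_) (hA τ)) l
    have := (Equiv.mk (fun l => σ *ᵥ l) (fun l => ρ *ᵥ l) e1 e2).hasSum_iff.2 (hA τ (actC σ z))
    rw [hj.conway_invar σ hσ] at this
    refine this.congr_fun fun l => ?_
    simp only [Function.comp, Equiv.coe_fn_mk, pairC_act hσ]
  have h2 : ∀ (τ : ℍ) (x l : LV), A τ (l + (3 : ℤ) • x) = A τ l * Complex.exp (3 * π * Complex.I * pairZ B x x * τ + 2 * π * Complex.I * pairZ B l x * τ) := fun τ x l => by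
    have := h.uniq2 (a := fun l => A τ (l + (3 : ℤ) • x))
      (b := fun l => A τ l * Complex.exp (3 * π * Complex.I * pairZ B x x * τ + 2 * π * Complex.I * pairZ B l x * τ))
      (P := fun z => Complex.exp (-(2 * 3 * π * Complex.I * pairC B (liftC x) z)) * ψ τ z) (fun z => ?_) (fun z => ?_)
    · exact congrFun this l
    · refine (((Equiv.addRight ((3 : ℤ) • x)).hasSum_iff.2 (hA τ z)).mul_left _).congr_fun fun l => ?_
      have e : liftC (l + (3 : ℤ) • x) = liftC l + (3 : ℂ) • liftC x := by ext i; simp [liftC]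
      simp only [Function.comp, Equiv.coe_addRight, e, pairC_add_left, pairC_smul_left, eC_add]
      have : Complex.exp (-(2 * 3 * π * Complex.I * pairC B (liftC x) z)) * eC (3 * pairC B (liftC x) z) = 1 := by
        rw [eC, ← Complex.exp_add]; refine (congrArg _ ?_).trans Complex.exp_zero; ring
      linear_combination (-A τ (l + (3 : ℤ) • x) * eC (pairC B (liftC l) z)) * this
    · have := (hA τ (z + (τ : ℂ) • liftC x + liftC 0)).mul_left (Complex.exp (3 * π * Complex.I * pairZ B x x * τ))
      rw [hj.quasi_periodic, ← mul_assoc, ← Complex.exp_add] at this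
      rw [show 3 * π * Complex.I * pairZ B x x * τ + (-((3 : ℕ) : ℂ) * π * Complex.I * pairZ B x x * τ - 2 * ((3 : ℕ) : ℂ) * π * Complex.I * pairC B (liftC x) z)
        = -(2 * 3 * π * Complex.I * pairC B (liftC x) z) by push_cast; ring] at this
      refine this.congr_fun fun l => ?_
      rw [show liftC 0 = 0 by ext i; simp [liftC], add_zero, pairC_add_right, pairC_smul_right, pairC_liftC, eC_add, Complex.exp_add,
        show Complex.exp (2 * π * Complex.I * pairZ B l x * τ) = eC (τ * pairZ B l x) by rw [eC]; congr 1; ring]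
      ring
  let C : ℍ → LV → ℂ := fun τ l => ∑' n, f n l * eC ((n - (pairZ B l l / 6 : ℝ)) * τ)
  have hC : ∀ τ l, C τ l = A τ l * Complex.exp (-(π * Complex.I * pairZ B l l * τ / 3)) := fun τ l => by
    simp only [C, A]
    rw [← tsum_mul_right]
    refine tsum_congr fun n => ?_
    rw [mul_assoc, eC, eC, ← Complex.exp_add]; congr 2; push_cast; ring
  have hC2 : ∀ τ l l', cls l = cls l' → C τ l = C τ l' := fun τ l l' e => by
    obtain ⟨σ, hσ, w, rfl⟩ := (hc.cj _ _).1 e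
    rw [hC, hC, h2, h1 τ σ hσ, h.N_add, N_smul, pairZ_smul_right, pairZ_conway hσ, mul_assoc (A τ l), ← Complex.exp_add]
    congr 2; push_cast; ring
  let H : ℍ → Fin 10 → ℂ := fun τ j => C τ (Function.invFun cls j)
  have hH : ∀ τ l, H τ (cls l) = C τ l := fun τ l => hC2 τ _ _ (Function.invFun_eq ⟨l, rfl⟩)
  have hTh : ∀ τ z, ψ τ z = Th B cls (H τ) τ z := fun τ z => by
    rw [← (hA τ z).tsum_eq, Th]
    refine tsum_congr fun l => ?_
    rw [hH, hC, mul_assoc, thT, ← Complex.exp_add, eC]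
    congr 2; ring
  have hser := fun l => eC_series (c := fun n => f n l) (a := pairZ B l l / 6) (fun n hn => hf n l (by
    have : ((n : ℝ)) * 6 < pairZ B l l := by linarith
    have : (n : ℤ) * 6 < pairZ B l l := by exact_mod_cast this
    push_cast; linarith)) (fun y hy => hs ⟨y * Complex.I, by simpa⟩ l)
  have sur := (Cls.sur h hc).1
  refine ⟨H, ⟨fun j => (hser _).1, fun j => (hser _).2, fun τ => ?_, fun τ => ?_⟩, hTh⟩
  · refine h.Th_inj sur τ.im_pos fun z => ?_
    rw [← hTh, ← Th_T hc, ← coe_T_smul, ← hTh]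
    have := hj.modular T τ z
    simpa [jfactor, slc, sld, T] using this
  · have t0 : (τ : ℂ) ≠ 0 := τ.ne_zero
    have : FF B cls (H (S • τ)) = (τ : ℂ) ^ (k - 12) • H τ := by
      refine h.Th_inj sur τ.im_pos fun z => ?_
      have h3 := hj.modular S τ z
      have hS : jfactor S τ = τ := by simp [jfactor, slc, sld, S]
      rw [hS, hTh, coe_S_smul, Th_S h hc _ τ.im_pos, hTh] at h3
      have h4 := h.Th_lin (cls := cls) {()} (fun _ => (τ : ℂ) ^ (k - 12)) (fun _ => H τ) τ.im_pos z
      simp only [Finset.sum_singleton] at h4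
      rw [h4]
      have e : Complex.exp ((3 : ℕ) * π * Complex.I * slc S * pairC B z z / τ) = Complex.exp (3 * π * Complex.I * pairC B z z / τ) := by
        simp [slc, S]
      rw [e] at h3
      have e0 := Complex.exp_ne_zero (3 * π * Complex.I * pairC B z z / τ)
      rw [zpow_sub₀ t0, show (τ : ℂ) ^ (12 : ℤ) = τ ^ 12 from zpow_natCast _ 12]
      field_simp
      refine mul_left_cancel₀ e0 ?_
      linear_combination h3
    rw [← map_smul, ← FF2 h hc (H (S • τ)), this]
end

section
variable {B : Matrix (Fin 24) (Fin 24) ℤ}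
variable {cls : LV → Fin 10}
open ModularGroup
theorem qser {u : ℍ → ℂ} (hol : MDifferentiable 𝓘(ℂ) 𝓘(ℂ) u) (hb : IsBoundedAtImInfty u) (hT : ∀ τ : ℍ, u (T • τ) = u τ) :
    ∃ c : ℕ → ℂ, (∀ τ : ℍ, HasSum (fun m : ℕ => c m * eC (m * τ)) (u τ)) ∧ (IsZeroAtImInfty u → c 0 = 0) := by
  have hp : Function.Periodic (u ∘ ofComplex) (1 : ℝ) := fun z => by
    by_cases hz : 0 < z.im
    · have h1 : 0 < (z + (1 : ℝ)).im := by simpa using hz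
      simp only [Function.comp, ofComplex_apply_of_im_pos h1, ofComplex_apply_of_im_pos hz]
      rw [← hT ⟨z, hz⟩]; congr 1; apply UpperHalfPlane.ext; rw [coe_T_smul]; simp
    · have h1 : (z + (1 : ℝ)).im ≤ 0 := by simpa using hz
      simp only [Function.comp, ofComplex_apply_of_im_nonpos h1, ofComplex_apply_of_im_nonpos (not_lt.1 hz)]
  refine ⟨fun m => (qExpansion 1 u).coeff m, fun τ => ?_, fun hz => ?_⟩
  · refine (hasSum_qExpansion one_pos hp hol hb τ).congr_fun fun m => ?_
    rw [Function.Periodic.qParam, ← Complex.exp_nat_mul, eC, smul_eq_mul]; congr 2; push_cast; ring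
  · dsimp only
    rw [qExpansion_coeff_zero one_pos (analyticAt_cuspFunction_zero one_pos hp hol hb) hp, hz.valueAtInfty_eq_zero]
theorem IsLeech.Th_holz (h : IsLeech B) (g : Fin 10 → ℂ) {t : ℂ} (ht : 0 < t.im) : Differentiable ℂ (Th B cls g t) := by
  intro z₀
  obtain ⟨ε, hε, hl⟩ := h.lower
  let K : ℝ := ∑ i, ∑ j, ‖(B i j : ℂ)‖
  have hK0 : 0 ≤ K := by positivity
  have hK : ∀ (w : CV) i, ‖((B.map (Int.cast : ℤ → ℂ)) *ᵥ w) i‖ ≤ K * ‖w‖ := fun w i => by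
    simp only [mulVec, dotProduct, Matrix.map_apply]
    refine (norm_sum_le _ _).trans ?_
    refine le_trans (b := (∑ j, ‖(B i j : ℂ)‖) * ‖w‖) ?_ (mul_le_mul_of_nonneg_right
      (Finset.single_le_sum (f := fun i => ∑ j, ‖(B i j : ℂ)‖) (fun _ _ => by positivity) (Finset.mem_univ i)) (norm_nonneg _))
    rw [Finset.sum_mul]
    refine Finset.sum_le_sum fun j _ => ?_
    rw [norm_mul]; exact mul_le_mul_of_nonneg_left (norm_le_pi_norm w j) (norm_nonneg _)
  let L0 : LV → CV →ₗ[ℂ] ℂ := fun l =>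
    { toFun := fun w => pairC B (liftC l) w, map_add' := fun a b => pairC_add_right a b _, map_smul' := fun a b => pairC_smul_right a _ b }
  let L : LV → CV →L[ℂ] ℂ := fun l => LinearMap.toContinuousLinearMap (L0 l)
  have hL : ∀ l w, L l w = pairC B (liftC l) w := fun l w => rfl
  have hLn : ∀ l, ‖L l‖ ≤ K * ∑ i, |(l i : ℝ)| := fun l => by
    refine ContinuousLinearMap.opNorm_le_bound _ (by positivity) fun w => ?_
    rw [hL]
    have := norm_pairC_le (hK w) (fun i => (l i : ℝ))
    rw [realC_intCast, ← Finset.mul_sum] at this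
    linarith
  let s : Set CV := Metric.ball z₀ 1
  let C : ℝ := K * (‖z₀‖ + 1)
  have hz : ∀ z ∈ s, ∀ i, ‖((B.map (Int.cast : ℤ → ℂ)) *ᵥ z) i‖ ≤ C := fun z hz i => by
    refine (hK z i).trans (mul_le_mul_of_nonneg_left ?_ hK0)
    have h1 : ‖z - z₀‖ < 1 := by simpa [s, dist_eq_norm] using hz
    have := norm_le_norm_add_norm_sub' z z₀
    linarith
  have hy := im3 ht
  let y := (t / 3).im
  have main := hasFDerivAt_tsum_of_isPreconnected (𝕜 := ℂ) (f := fun l z => g (cls l) * thT B (t / 3) z l) (s := s) (x := z₀) (x₀ := z₀)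
    (f' := fun l z => (g (cls l) * thT B (t / 3) z l * (2 * π * Complex.I)) • L l)
    (u := fun l => (∑ j, ‖g j‖) * gmaj (π * y * ε) (2 * π * C + 2 * π * K) l)
    ((gmaj_summable (by positivity) _).mul_left _) Metric.isOpen_ball (convex_ball _ _).isPreconnected
    (fun l z _ => ?_) (fun l z hzs => ?_) (Metric.mem_ball_self one_pos) (h.Th_sum g ht z₀) (Metric.mem_ball_self one_pos)
  · exact main.differentiableAt
  · have h1 : HasFDerivAt (fun z => Complex.exp (π * Complex.I * pairZ B l l * (t / 3) + 2 * π * Complex.I * L l z)) _ z :=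
      (((L l).hasFDerivAt.const_mul (2 * π * Complex.I)).const_add _).cexp
    refine (h1.const_mul (g (cls l))).congr_fderiv ?_
    ext w; simp only [ContinuousLinearMap.smul_apply, smul_eq_mul, thT, hL]; ring
  · have h1 := norm_gauss_le hl hε hy le_rfl (hz z hzs) (fun i => (l i : ℝ))
    rw [qR_int, realC_intCast] at h1
    have h2 : ‖thT B (t / 3) z l‖ ≤ gmaj (π * y * ε) (2 * π * C) l := by simpa [thT, gmaj, y] using h1
    have h3 : gmaj (π * y * ε) (2 * π * C + 2 * π * K) l = gmaj (π * y * ε) (2 * π * C) l * Real.exp (2 * π * K * ∑ i, |(l i : ℝ)|) := by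
      simp only [gmaj, ← Real.exp_sum, ← Real.exp_add, Finset.mul_sum, ← Finset.sum_add_distrib]
      congr 1; exact Finset.sum_congr rfl fun i _ => by ring
    have h4 : 2 * π * ‖L l‖ ≤ Real.exp (2 * π * K * ∑ i, |(l i : ℝ)|) := by
      refine le_trans ?_ ((le_add_of_nonneg_right zero_le_one).trans (Real.add_one_le_exp _))
      rw [mul_assoc (2 * π) K]; exact mul_le_mul_of_nonneg_left (hLn l) (by positivity)
    rw [norm_smul, norm_mul, norm_mul, h3, mul_assoc, mul_assoc, show ‖(2 * π * Complex.I : ℂ)‖ = 2 * π by simp [Real.pi_pos.le]]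
    exact mul_le_mul (g_le _ _) (mul_le_mul h2 h4 (by positivity) ((norm_nonneg _).trans h2)) (by positivity) (by positivity)
theorem jf_denom (A : SL(2, ℤ)) (τ : ℍ) : jfactor A τ = denom A τ := by rw [ModularGroup.denom_apply]; rfl
theorem jf_ne (A : SL(2, ℤ)) (τ : ℍ) : jfactor A τ ≠ 0 := by rw [jf_denom]; exact denom_ne_zero _ _
theorem sl_mul (A C : SL(2, ℤ)) : slc (A * C) = slc A * C.1 0 0 + sld A * slc C ∧ sld (A * C) = slc A * C.1 0 1 + sld A * sld C := by
  have e : (A * C).1 = A.1 * C.1 := rfl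
  simp only [slc, sld, e, Matrix.mul_apply, Fin.sum_univ_two]; push_cast; exact ⟨rfl, rfl⟩
theorem jf_mul (A C : SL(2, ℤ)) (τ : ℍ) : jfactor (A * C) τ = jfactor A (C • τ) * jfactor C τ := by
  have h1 := jf_ne C τ
  have h2 : ((C • τ : ℍ) : ℂ) = ((C.1 0 0 : ℂ) * τ + C.1 0 1) / jfactor C τ := by
    rw [coe_specialLinearGroup_apply]; simp [jfactor, slc, sld]
  rw [jfactor, jfactor, h2, (sl_mul A C).1, (sl_mul A C).2]
  field_simp
  simp only [jfactor]; ring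
theorem slc_mul (A C : SL(2, ℤ)) (τ : ℍ) : slc (A * C) * jfactor C τ = slc C * jfactor (A * C) τ + slc A := by
  have := C.det_coe
  rw [Matrix.det_fin_two] at this
  have h1 : (C.1 0 0 : ℂ) * sld C - C.1 0 1 * slc C = 1 := by unfold slc sld; exact_mod_cast this
  simp only [jfactor, (sl_mul A C).1, (sl_mul A C).2]
  linear_combination slc A * h1
theorem modular_all (k : ℤ) {ψ : ℍ → CV → ℂ}
    (hS : ∀ (τ : ℍ) z, ψ (S • τ) ((jfactor S τ)⁻¹ • z) = jfactor S τ ^ k * Complex.exp ((3 : ℕ) * π * Complex.I * slc S * pairC B z z / jfactor S τ) * ψ τ z)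
    (hT : ∀ (τ : ℍ) z, ψ (T • τ) ((jfactor T τ)⁻¹ • z) = jfactor T τ ^ k * Complex.exp ((3 : ℕ) * π * Complex.I * slc T * pairC B z z / jfactor T τ) * ψ τ z)
    (A : SL(2, ℤ)) : ∀ (τ : ℍ) z, ψ (A • τ) ((jfactor A τ)⁻¹ • z) = jfactor A τ ^ k * Complex.exp ((3 : ℕ) * π * Complex.I * slc A * pairC B z z / jfactor A τ) * ψ τ z := by
  have hA : A ∈ Subgroup.closure {S, T} := by simp [SpecialLinearGroup.SL2Z_generators]
  have h1 : ∀ τ : ℍ, jfactor 1 τ = 1 := fun τ => by simp [jfactor, slc, sld]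
  induction hA using Subgroup.closure_induction with
  | mem x hx => rcases hx with rfl | rfl; exacts [hS, hT]
  | one => intro τ z; simp [h1, slc]
  | mul A C _ _ iA iC =>
    intro τ z
    have e := slc_mul A C τ
    have n1 := jf_ne A (C • τ); have n2 := jf_ne C τ
    rw [jf_mul] at e ⊢
    rw [mul_smul, mul_inv, mul_smul, iA, iC, mul_zpow]
    have : ∀ a b c x y d : ℂ, a * b = c → x * a * (y * b * d) = x * y * c * d := fun a b c x y d e => by rw [← e]; ring
    refine this _ _ _ _ _ _ ?_
    rw [← Complex.exp_add]; congr 1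
    simp only [pairC_smul_right, pairC_smul_left]
    field_simp
    linear_combination -pairC B z z * e
  | inv A _ iA =>
    intro τ z
    have e := jf_mul A A⁻¹ τ
    have e2 := slc_mul A A⁻¹ τ
    rw [mul_inv_cancel, h1] at e e2
    have n2 := jf_ne A⁻¹ τ
    have e3 : (jfactor A (A⁻¹ • τ)) = (jfactor A⁻¹ τ)⁻¹ := by field_simp; linear_combination -e
    have := iA (A⁻¹ • τ) ((jfactor A⁻¹ τ)⁻¹ • z)
    rw [e3, smul_inv_smul, inv_inv, smul_smul, mul_inv_cancel₀ n2, one_smul] at this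
    rw [this]
    have e4 : slc A⁻¹ = - slc A := by simp [slc] at e2 ⊢; linear_combination -e2
    have : ∀ a b x y : ℂ, a * b = 1 → y ≠ 0 → x = y ^ k * a * (y⁻¹ ^ k * b * x) := fun a b x y e hy => by
      rw [_root_.inv_zpow]; field_simp; linear_combination -x * e
    refine this _ _ _ _ ?_ n2
    rw [← Complex.exp_add]; refine (congrArg _ ?_).trans Complex.exp_zero
    simp only [pairC_smul_right, pairC_smul_left, e4]
    field_simp; ring
theorem bdd_mul_zero {f g : ℍ → ℂ} (hf : IsBoundedAtImInfty f) (hg : IsZeroAtImInfty g) : IsZeroAtImInfty fun τ => f τ * g τ := by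
  have := hf.mul_isLittleO ((Asymptotics.isLittleO_one_iff ℝ).2 hg)
  refine (Asymptotics.isLittleO_one_iff ℝ).1 (this.congr_right fun _ => by simp)
theorem Th_single (h : IsLeech B) (g : Fin 10 → ℂ) {t : ℂ} (ht : 0 < t.im) (z : CV) :
    Th B cls g t z = ∑ j, g j * Th B cls (Pi.single j 1) t z := by
  rw [← h.Th_lin _ _ _ ht]; congr 1; ext i; simp [Pi.single_apply]
theorem Th_smul (h : IsLeech B) (c : ℂ) (g : Fin 10 → ℂ) {t : ℂ} (ht : 0 < t.im) (z : CV) :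
    Th B cls (c • g) t z = c * Th B cls g t z := by
  simpa using h.Th_lin {0} (fun _ : Fin 1 => c) (fun _ => g) ht z
theorem converse (h : IsLeech B) (hc : Cls B cls) {k : ℤ} {H : ℍ → Fin 10 → ℂ} (hH : VF B cls (k - 12) H) :
    IsHolJacobiForm B k 3 (fun τ z => Th B cls (H τ) τ z) := by
  have hd : ∀ l : LV, ∃ d : ℕ, pairZ B l l = 2 * qq (cls l) + 6 * d := fun l => by
    obtain ⟨m, hm⟩ := hc.W l
    have h1 := h.pairZ_nonneg l
    have h2 : qq (cls l) ≤ 2 := by generalize cls l = j; revert j; decide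
    exact ⟨m.toNat, by omega⟩
  choose d hd using hd
  have hq : ∀ j, ∃ c : ℕ → ℂ, (∀ τ : ℍ, HasSum (fun m : ℕ => c m * eC (m * τ)) (H τ j * eC (qq j * τ / 3))) ∧ (0 < qq j → c 0 = 0) := fun j => by
    have he : ∀ τ : ℍ, ‖eC (qq j * τ / 3)‖ = Real.exp (-2 * π * (qq j * τ.im / 3)) := fun τ => by
      rw [norm_eC, show (qq j * τ / 3 : ℂ) = ((qq j / 3 : ℝ) : ℂ) * τ by push_cast; ring, Complex.im_ofReal_mul]; congr 2
      rw [UpperHalfPlane.coe_im]; ring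
    have hu := qser (u := fun τ => H τ j * eC (qq j * τ / 3)) ?_ ?_ fun τ => ?_
    · obtain ⟨c, h1, h2⟩ := hu
      refine ⟨c, h1, fun hj => h2 ?_⟩
      have h3 : IsZeroAtImInfty fun τ : ℍ => eC (qq j * τ / 3) := by
        rw [IsZeroAtImInfty, Filter.ZeroAtFilter, tendsto_zero_iff_norm_tendsto_zero]
        simp only [he]
        refine Real.tendsto_exp_atBot.comp ?_
        refine Filter.Tendsto.const_mul_atTop_of_neg (by linarith [Real.pi_pos]) ?_
        exact (Filter.Tendsto.const_mul_atTop (by exact_mod_cast hj) Filter.tendsto_comap).atTop_div_const (by norm_num)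
      exact bdd_mul_zero (hH.bdd j) h3
    · exact (hH.hol j).mul (mdiff_of_diffOn (f := fun t => eC (qq j * t / 3)) (by unfold eC; exact (Differentiable.differentiableOn (by fun_prop))))
    · obtain ⟨M, A, hb⟩ := UpperHalfPlane.isBoundedAtImInfty_iff.1 (hH.bdd j)
      refine UpperHalfPlane.isBoundedAtImInfty_iff.2 ⟨M, A, fun τ hτ => ?_⟩
      rw [norm_mul, he]
      refine (mul_le_of_le_one_right (norm_nonneg _) ?_).trans (hb τ hτ)
      rw [Real.exp_le_one_iff]
      have : 0 ≤ qq j * τ.im / 3 := by have := τ.im_pos; positivity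
      nlinarith [Real.pi_pos]
    · have := congrFun (hH.T τ) j
      rw [MM_apply] at this
      have e : eC (qq j * (T • τ : ℍ) / 3) = W ^ qq j * eC (qq j * τ / 3) := by
        rw [coe_T_smul, W, ← Complex.exp_nat_mul, eC, eC, ← Complex.exp_add]; congr 1; ring
      rw [e, ← this]; ring
  choose c hc1 hc2 using hq
  refine ⟨fun n l => if d l ≤ n then c (cls l) (n - d l) else 0, ⟨fun z => ?_, fun τ => h.Th_holz _ τ.im_pos, fun σ hσ τ z => Th_act h hc hσ z,
    fun x y τ z => Th_qp h hc x y z, modular_all (ψ := fun τ z => Th B cls (H τ) τ z) k (fun τ z => ?_) (fun τ z => ?_), fun τ z => ?_⟩, fun n l hn => ?_⟩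
  · simp only [Th_single h (H _) (UpperHalfPlane.im_pos _)]
    have e : (fun τ : ℍ => ∑ j, H τ j * Th B cls (Pi.single j 1) τ z) = ∑ j, (fun τ => H τ j) * fun τ : ℍ => Th B cls (Pi.single j 1) τ z := by
      ext τ; simp
    rw [e]
    refine MDifferentiable.sum fun j _ => (hH.hol j).mul ?_
    refine mdiff_of_diffOn (f := fun t => Th B cls (Pi.single j 1) t z) ?_
    have := h.diff_t (f := fun l => (Pi.single j 1 : Fin 10 → ℂ) (cls l)) (C := 1) (fun l => ?_) z
    · exact this.comp (f := fun t : ℂ => t / 3) (by fun_prop) fun t ht => im3 ht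
    · rw [Pi.single_apply]; split_ifs <;> simp
  · have e : jfactor S τ = τ := by simp [jfactor, slc, sld, S]
    have e2 : slc S = 1 := by simp [slc, S]
    simp only [e, e2]
    rw [coe_S_smul, Th_S h hc _ τ.im_pos, hH.S, map_smul, FF2 h hc, Th_smul h _ _ τ.im_pos]
    have : (τ : ℂ) ^ k = τ ^ 12 * τ ^ (k - 12) := by
      rw [← zpow_natCast, ← zpow_add₀ τ.ne_zero]; congr 1; push_cast; ring
    rw [this]; push_cast; ring_nf
  · have e : jfactor T τ = 1 := by simp [jfactor, slc, sld, T]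
    have e2 : slc T = 0 := by simp [slc, T]
    simp only [e, e2]
    rw [coe_T_smul, Th_T hc, hH.T]; simp
  · let F : LV × ℕ → ℂ := fun p => (c (cls p.1) p.2 * eC (p.2 * τ)) * (eC (-(qq (cls p.1) * τ / 3)) * thT B (τ / 3) z p.1)
    have hF : Summable F := by
      have hs : Summable fun p : LV × ℕ => ‖thT B (τ / 3) z p.1‖ * ∑ j, ‖eC (-(qq j * τ / 3))‖ * ‖c j p.2 * eC (p.2 * τ)‖ := by
        refine Summable.mul_of_nonneg (f := fun l => ‖thT B (τ / 3) z l‖) (g := fun m : ℕ => ∑ j, ‖eC (-(qq j * τ / 3))‖ * ‖c j m * eC (m * τ)‖)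
          (h.thT_summable (im3 τ.im_pos) z) (summable_sum fun j _ => (hc1 j τ).summable.norm.mul_left _) (fun _ => norm_nonneg _) fun m => ?_
        simp only [Pi.zero_apply]; positivity
      refine Summable.of_norm_bounded hs fun p => ?_
      have := Finset.single_le_sum (f := fun j => ‖eC (-(qq j * τ / 3))‖ * ‖c j p.2 * eC (p.2 * τ)‖) (fun _ _ => by positivity) (Finset.mem_univ (cls p.1))
      refine le_trans (le_of_eq ?_) (mul_le_mul_of_nonneg_left this (norm_nonneg _))
      simp only [F, norm_mul]; ring
    have hF2 := hF.hasSum.prod_fiberwise (g := fun l => H τ (cls l) * thT B (τ / 3) z l) fun l => by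
      have hh := ((hc1 (cls l) τ).mul_right (eC (-(qq (cls l) * τ / 3)) * thT B (τ / 3) z l))
      have : eC (qq (cls l) * τ / 3) * eC (-(qq (cls l) * τ / 3)) = 1 := by rw [← eC_add]; simp [eC]
      rwa [show ∀ a b c d : ℂ, a * b * (c * d) = a * (b * c) * d by intros; ring, this, mul_one] at hh
    have hF3 : HasSum F (Th B cls (H τ) τ z) := by
      rw [Th, hF2.tsum_eq]; exact hF.hasSum
    have hi : Function.Injective fun p : LV × ℕ => (p.2 + d p.1, p.1) := fun p p' e => by
      simp only [Prod.mk.injEq] at e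
      obtain ⟨e1, e2⟩ := e
      rw [e2] at e1
      exact Prod.ext e2 (by omega)
    refine (hi.hasSum_iff fun p hp => ?_).1 (hF3.congr_fun fun p => ?_)
    · rw [if_neg, zero_mul]
      exact fun hle => hp ⟨(p.2, p.1 - d p.2), by simp [Nat.sub_add_cancel hle]⟩
    · simp only [Function.comp, F, le_add_iff_nonneg_left, zero_le, if_true, Nat.add_sub_cancel]
      rw [mul_assoc]; congr 1
      simp only [fterm, thT, eC, ← Complex.exp_add, hd]
      congr 1; push_cast; ring
  · dsimp only
    split_ifs with hle
    · rw [hd] at hn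
      have h2 : qq (cls l) ≤ 2 := by generalize cls l = j; revert j; decide
      push_cast at hn
      rw [show n - d l = 0 by omega]
      exact hc2 _ (by omega)
    · rfl
end

section
variable {B : Matrix (Fin 24) (Fin 24) ℤ}
variable {cls : LV → Fin 10}
open ModularGroup ModularForm
theorem sqrt8 {z : ℂ} (hz : z ≠ 0) : Complex.sqrt z ^ 8 = z ^ 4 := by
  rw [_root_.sqrt_eq_exp hz, ← Complex.exp_nat_mul, show ((8 : ℕ) : ℂ) * (Complex.log z / 2) = (4 : ℕ) * Complex.log z by push_cast; ring,
    Complex.exp_nat_mul, Complex.exp_log hz]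
def e8 (τ : ℍ) : ℂ := η τ ^ 8
theorem e8_disc (τ : ℍ) : discriminant τ = e8 τ ^ 3 := by rw [e8, ← pow_mul]; rfl
theorem e8_ne (τ : ℍ) : e8 τ ≠ 0 := pow_ne_zero _ (eta_ne_zero τ.2)
theorem e8_S (τ : ℍ) : e8 (S • τ) = (τ : ℂ) ^ 4 * e8 τ := by
  have := eta_comp_eq_csqrt_I_inv τ.2
  simp only [Function.comp, Pi.smul_apply, Pi.mul_apply, smul_eq_mul] at this
  rw [e8, coe_S_smul, show -(τ : ℂ)⁻¹ = -1 / τ by ring, this, mul_pow, mul_pow, inv_pow, sqrt8 Complex.I_ne_zero, sqrt8 τ.ne_zero, Complex.I_pow_four]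
  simp [e8]
theorem e8_T (τ : ℍ) : e8 (T • τ) = W * e8 τ := by
  have h1 : ∀ n, eta_q n (τ + 1) = eta_q n τ := fun n => by
    rw [eta_q_eq_pow, eta_q_eq_pow, mul_add, mul_one, Complex.exp_add, Complex.exp_two_pi_mul_I, mul_one]
  rw [e8, coe_T_smul, e8, ModularForm.eta, ModularForm.eta]
  simp only [h1]
  rw [mul_pow, mul_pow, ← mul_assoc]; congr 1
  rw [Function.Periodic.qParam, Function.Periodic.qParam, ← Complex.exp_nat_mul, ← Complex.exp_nat_mul, W, ← Complex.exp_add]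
  congr 1; push_cast; ring
theorem e8_hol : MDifferentiable 𝓘(ℂ) 𝓘(ℂ) e8 :=
  mdiff_of_diffOn (f := fun t => η t ^ 8) fun t ht => ((differentiableAt_eta_of_mem_upperHalfPlaneSet ht).pow 8).differentiableWithinAt
theorem e8_zero : IsZeroAtImInfty e8 := by
  have := discriminant_isZeroAtImInfty
  rw [IsZeroAtImInfty, Filter.ZeroAtFilter, tendsto_zero_iff_norm_tendsto_zero] at this ⊢
  have h := this.rpow_const (p := 3⁻¹) (Or.inr (by norm_num))
  rw [Real.zero_rpow (by norm_num)] at h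
  refine h.congr fun τ => ?_
  rw [e8_disc, norm_pow, ← Real.rpow_natCast, ← Real.rpow_mul (norm_nonneg _)]; norm_num
theorem e8_inv : IsBoundedAtImInfty fun τ : ℍ => eC (τ / 3) / e8 τ := by
  obtain ⟨C, hC⟩ := exp_isBigO_discriminant.bound
  obtain ⟨A, hA⟩ := (UpperHalfPlane.atImInfty_mem _).1 hC
  refine UpperHalfPlane.isBoundedAtImInfty_iff.2 ⟨1 + C, A, fun τ hτ => ?_⟩
  have h1 := hA τ hτ
  simp only [Set.mem_setOf_eq, Real.norm_eq_abs, Real.abs_exp, e8_disc, norm_pow] at h1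
  have h2 : Real.exp (-2 * π * τ.im) = ‖eC (τ / 3)‖ ^ 3 := by
    rw [norm_eC, ← Real.exp_nat_mul, show (τ / 3 : ℂ) = ((1 / 3 : ℝ) : ℂ) * τ by push_cast; ring, Complex.im_ofReal_mul, UpperHalfPlane.coe_im]
    congr 1; push_cast; ring
  rw [h2] at h1
  have h3 := norm_pos_iff.2 (e8_ne τ)
  have h4 : (‖eC (τ / 3)‖ / ‖e8 τ‖) ^ 3 ≤ C := by rw [div_pow, div_le_iff₀ (by positivity)]; exact h1
  rw [norm_div]
  have h5 : 0 ≤ ‖eC (τ / 3)‖ / ‖e8 τ‖ := by positivity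
  generalize ‖eC (τ / 3)‖ / ‖e8 τ‖ = x at h4 h5
  nlinarith [mul_nonneg h5 (sq_nonneg (x - 1)), sq_nonneg (x - 1)]
theorem cusp_zero {k : ℤ} (hk : k < 12) (F : CuspForm 𝒮ℒ k) : F = 0 :=
  rank_zero_iff_forall_zero.1 (CuspForm.rank_eq_zero_of_weight_lt_twelve hk) F
theorem ser_zero {a : ℕ → ℂ} (ha : ∀ τ : ℍ, HasSum (fun n => a n * Complex.exp (2 * π * Complex.I * τ) ^ n) 0) (n : ℕ) : a n = 0 := by
  have := ModularFormClass.qExpansion_coeff_unique (Γ := 𝒮ℒ) (k := 0) (F := ModularForm 𝒮ℒ 0) (f := 0) (c := a) one_pos one_mem_strictPeriods_SL (fun τ => by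
    simpa [Function.Periodic.qParam] using ha τ) n
  rw [this]; simp [qExpansion_zero]
theorem no_fix (h : IsLeech B) (hc : Cls B cls) {g : Fin 10 → ℂ} (hM : MM g = W • g) (hF : FF B cls g = g) : g = 0 := by
  have hW1 : W ≠ 1 := fun e => by
    rw [W, Complex.exp_eq_one_iff] at e
    obtain ⟨n, hn⟩ := e
    have : (1 : ℂ) = 3 * n := by
      have hp := Complex.two_pi_I_ne_zero
      field_simp at hn; linear_combination hn
    norm_cast at this; omega
  have hg : ∀ j, qq j ≠ 1 → g j = 0 := fun j hj => by
    have := congrFun hM j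
    simp only [MM_apply, Pi.smul_apply, smul_eq_mul] at this
    have h2 : qq j = 0 ∨ qq j = 2 := by clear this; revert j; decide
    rcases h2 with e | e <;> rw [e] at this
    · exact (mul_eq_zero.1 (by linear_combination this : (1 - W) * g j = 0)).resolve_left (sub_ne_zero.2 hW1.symm)
    · exact (mul_eq_zero.1 (by linear_combination this : W * (W - 1) * g j = 0)).resolve_left (mul_ne_zero W_ne (sub_ne_zero.2 hW1))
  let a : ℕ → ℂ := fun n => ∑ l ∈ h.shell n, g (cls l)
  have ha : ∀ n < 4, a n = 0 := fun n hn => by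
    refine Finset.sum_eq_zero fun l hl => hg _ fun hq => ?_
    rw [h.mem_shell] at hl
    obtain ⟨m, hm⟩ := hc.W l
    have := h.2.2.2.2 l
    omega
  have hs : ∀ {t : ℂ}, 0 < t.im → HasSum (fun n => a n * Complex.exp (2 * π * Complex.I * t) ^ n) (∑' l, g (cls l) * thT B t 0 l) :=
    fun ht => h.hasSum_shell (f := fun l => g (cls l)) (fun l => g_le g (cls l)) ht
  have h0 : ∀ τ : ℍ, Th B cls g τ 0 = 0 := by
    have hT : ∀ τ : ℍ, Th B cls g (T • τ : ℍ) 0 = W * Th B cls g τ 0 := fun τ => by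
      rw [coe_T_smul, Th_T hc, hM, Th_smul h _ _ τ.im_pos]
    have hS : ∀ τ : ℍ, Th B cls g (S • τ : ℍ) 0 = (τ : ℂ) ^ 12 * Th B cls g τ 0 := fun τ => by
      have := Th_S h hc g τ.im_pos 0
      rw [smul_zero, hF] at this
      rw [coe_S_smul, this]; simp [pairC]
    have hu := mkCF (g := fun τ => Th B cls g τ 0 / e8 τ) (k := 8) ?_ (fun τ => ?_) (fun τ => ?_) ?_
    · obtain ⟨F, hFF⟩ := hu
      intro τ
      have := congrFun hFF τ
      rw [cusp_zero (by norm_num) F] at this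
      simpa [e8_ne] using this.symm
    · refine MDifferentiable.div (mdiff_of_diffOn (f := fun t => Th B cls g t 0) ?_) e8_hol e8_ne
      exact (h.diff_t (fun l => g_le g (cls l)) 0).comp (f := fun t : ℂ => t / 3) (by fun_prop) fun t ht => im3 ht
    · rw [hT, e8_T, mul_div_mul_left _ _ W_ne]
    · rw [hS, e8_S]
      have := τ.ne_zero; have := e8_ne τ
      field_simp
    · have h1 := (eC_series (c := a) (a := 4) (fun n hn => ha n (by exact_mod_cast hn)) (fun y hy => by
        have := (hs (t := y * Complex.I) (by simpa using hy)).summable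
        refine this.congr fun n => ?_
        rw [← Complex.exp_nat_mul, eC]; congr 2; ring)).2
      obtain ⟨C, A, hb⟩ := UpperHalfPlane.isBoundedAtImInfty_iff.1 h1
      have h2 : IsBoundedAtImInfty fun τ : ℍ => Th B cls g τ 0 / eC (4 * (τ / 3)) := by
        refine UpperHalfPlane.isBoundedAtImInfty_iff.2 ⟨C, 3 * A, fun τ hτ => ?_⟩
        have ht := im3 τ.im_pos
        have h3 := hb ⟨τ / 3, ht⟩ (by
          rw [show UpperHalfPlane.im ⟨τ / 3, ht⟩ = ((τ : ℂ) / 3).im from rfl, show ((τ : ℂ) / 3).im = τ.im / 3 by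
            rw [show (τ / 3 : ℂ) = ((1 / 3 : ℝ) : ℂ) * τ by push_cast; ring, Complex.im_ofReal_mul, UpperHalfPlane.coe_im]; ring]
          linarith)
        convert h3 using 2
        rw [Th, ← (hs ht).tsum_eq, ← tsum_div_const]
        refine tsum_congr fun n => ?_
        rw [mul_div_assoc, ← Complex.exp_nat_mul, eC, eC, ← Complex.exp_sub]
        congr 2; push_cast; ring
      have h4 := bdd_mul_zero (h2.mul e8_inv) (g := fun τ => eC τ) (by
        rw [IsZeroAtImInfty, Filter.ZeroAtFilter, tendsto_zero_iff_norm_tendsto_zero]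
        simp only [norm_eC]
        refine Real.tendsto_exp_atBot.comp ?_
        exact Filter.Tendsto.const_mul_atTop_of_neg (by linarith [Real.pi_pos]) Filter.tendsto_comap)
      convert h4 using 2 with τ
      have : eC (4 * (τ / 3)) = eC τ * eC (τ / 3) := by rw [← eC_add]; congr 1; ring
      rw [Pi.mul_apply, this]
      have : eC τ ≠ 0 := Complex.exp_ne_zero _
      have : eC (τ / 3) ≠ 0 := Complex.exp_ne_zero _
      field_simp
  have ha0 : ∀ n, a n = 0 := ser_zero fun τ => by
    have ht : 0 < ((3 : ℂ) * τ).im := by simpa using τ.im_pos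
    have h1 := h0 ⟨3 * τ, ht⟩
    have h2 := hs τ.im_pos
    rw [Th] at h1
    simp only [mul_div_cancel_left₀ (τ : ℂ) (three_ne_zero (α := ℂ))] at h1
    rwa [h1] at h2
  obtain ⟨_, h8, h14, v, hv⟩ := Cls.sur h hc
  have key : ∀ n (j : Fin 10), (∀ l ∈ h.shell n, cls l = j) → (h.shell n).Nonempty → g j = 0 := fun n j hl hne => by
    have h1 : (h.shell n).card * g j = 0 := by
      rw [← ha0 n, ← nsmul_eq_mul, ← Finset.sum_const]; exact Finset.sum_congr rfl fun l hl' => by rw [hl l hl']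
    exact (mul_eq_zero.1 h1).resolve_left (by exact_mod_cast hne.card_ne_zero)
  have g5 : g 5 = 0 := key 4 5 (fun l hl => h8 l (by rw [h.mem_shell] at hl; exact hl)) (Finset.card_pos.1 (by rw [h.card_shells.2.2.1]; norm_num))
  have g6 : g 6 = 0 := key 7 6 (fun l hl => h14 l (by rw [h.mem_shell] at hl; exact hl)) ⟨v, h.mem_shell.2 hv⟩
  ext j
  by_cases hj : qq j = 1
  · have : j = 5 ∨ j = 6 := by revert j; decide
    rcases this with rfl | rfl <;> assumption
  · exact hg j hj
end

section
variable {B : Matrix (Fin 24) (Fin 24) ℤ}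
variable {cls : LV → Fin 10}
theorem W_ne1 : W ≠ 1 := fun e => by
  rw [W, Complex.exp_eq_one_iff] at e
  obtain ⟨n, hn⟩ := e
  have : (1 : ℂ) = 3 * n := by
    have hp := Complex.two_pi_I_ne_zero
    field_simp at hn; linear_combination hn
  norm_cast at this; omega
theorem W_sum : 1 + W + W ^ 2 = 0 :=
  (mul_eq_zero.1 (by linear_combination W3 : (W - 1) * (1 + W + W ^ 2) = 0)).resolve_left (sub_ne_zero.2 W_ne1)
abbrev V10 := Fin 10 → ℂ
theorem MM_eig {g : V10} {q : ℕ} (hq : q < 3) : MM g = W ^ q • g ↔ ∀ j, qq j ≠ q → g j = 0 := by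
  have hW : ∀ a b : ℕ, a < 3 → b < 3 → a ≠ b → W ^ a - W ^ b ≠ 0 := fun a b ha hb hab e => by
    have h1 := sub_ne_zero.2 W_ne1
    have h2 := W_ne
    have h3 := W_sum
    have h4 : 1 + W ≠ 0 := fun e => h2 (pow_eq_zero_iff two_ne_zero |>.1 (by linear_combination h3 - e))
    interval_cases a <;> interval_cases b <;> first | exact absurd rfl hab | skip
    · exact h1 (by linear_combination -e)
    · exact mul_ne_zero h1 h4 (by linear_combination -e)
    · exact h1 (by linear_combination e)
    · exact mul_ne_zero h1 h2 (by linear_combination -e)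
    · exact mul_ne_zero h1 h4 (by linear_combination e)
    · exact mul_ne_zero h1 h2 (by linear_combination e)
  have hj3 : ∀ j, qq j < 3 := by decide
  constructor
  · intro h j hj
    have := congrFun h j
    simp only [MM_apply, Pi.smul_apply, smul_eq_mul] at this
    exact (mul_eq_zero.1 (by linear_combination this : (W ^ qq j - W ^ q) * g j = 0)).resolve_left (hW _ _ (hj3 j) hq hj)
  · intro h; ext j
    simp only [MM_apply, Pi.smul_apply, smul_eq_mul]
    by_cases hj : qq j = q
    · rw [hj]
    · simp [h j hj]
abbrev Iq (q : ℕ) := {j : Fin 10 // qq j = q}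
def io (q : ℕ) : (Iq q → ℂ) →ₗ[ℂ] V10 where
  toFun c j := if h : qq j = q then c ⟨j, h⟩ else 0
  map_add' a b := by ext j; simp only [Pi.add_apply]; split_ifs <;> simp
  map_smul' a b := by ext j; simp only [Pi.smul_apply, RingHom.id_apply]; split_ifs <;> simp
theorem io_inj (q : ℕ) : Function.Injective (io q) := fun a b e => by
  ext ⟨j, hj⟩
  have := congrFun e j
  simpa [io, hj] using this
theorem io_M {q : ℕ} (hq : q < 3) (c : Iq q → ℂ) : MM (io q c) = W ^ q • io q c :=
  (MM_eig hq).2 fun j hj => by simp [io, hj]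
theorem io_sur {q : ℕ} (hq : q < 3) {g : V10} (hg : MM g = W ^ q • g) : io q (fun j => g j.1) = g := by
  ext j
  have := (MM_eig hq).1 hg j
  by_cases hj : qq j = q
  · simp [io, hj]
  · simp [io, hj, this hj]
theorem io_sum (g : V10) : g = io 0 (fun j => g j.1) + io 1 (fun j => g j.1) + io 2 (fun j => g j.1) := by
  ext j
  have : qq j = 0 ∨ qq j = 1 ∨ qq j = 2 := by revert j; decide
  rcases this with e | e | e <;> simp [io, e]
def S1 (B : Matrix (Fin 24) (Fin 24) ℤ) (cls : LV → Fin 10) : V10 →ₗ[ℂ] V10 := MM ∘ₗ FF B cls ∘ₗ MM ∘ₗ MM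
def S2 (B : Matrix (Fin 24) (Fin 24) ℤ) (cls : LV → Fin 10) : V10 →ₗ[ℂ] V10 := MM ∘ₗ MM ∘ₗ FF B cls ∘ₗ MM
def p0 (B : Matrix (Fin 24) (Fin 24) ℤ) (cls : LV → Fin 10) : V10 →ₗ[ℂ] V10 :=
  (4⁻¹ : ℂ) • (LinearMap.id + FF B cls - S1 B cls - S2 B cls)
def pe (B : Matrix (Fin 24) (Fin 24) ℤ) (cls : LV → Fin 10) : V10 →ₗ[ℂ] V10 :=
  (4⁻¹ : ℂ) • (LinearMap.id + FF B cls + S1 B cls + S2 B cls)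
theorem Sl (h : IsLeech B) (hc : Cls B cls) (v : V10) : FF B cls (FF B cls v) = v ∧ S1 B cls (S1 B cls v) = v ∧ S2 B cls (S2 B cls v) = v ∧
    FF B cls (S1 B cls v) = S2 B cls v ∧ S1 B cls (FF B cls v) = S2 B cls v ∧ FF B cls (S2 B cls v) = S1 B cls v ∧ S2 B cls (FF B cls v) = S1 B cls v ∧
    S1 B cls (S2 B cls v) = FF B cls v ∧ S2 B cls (S1 B cls v) = FF B cls v ∧
    MM (FF B cls v) = S1 B cls (MM v) ∧ MM (S1 B cls v) = S2 B cls (MM v) ∧ MM (S2 B cls v) = FF B cls (MM v) := by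
  have f2 := FF2 h hc
  have f3 := FM3 h hc
  have d1 : ∀ v, S1 B cls v = MM (FF B cls (MM (MM v))) := fun _ => rfl
  have d2 : ∀ v, S2 B cls v = MM (MM (FF B cls (MM v))) := fun _ => rfl
  have a0 := f2
  have a1 : ∀ v, S1 B cls (S1 B cls v) = v := fun v => by rw [d1, d1, MM3, f2, MM3]
  have a2 : ∀ v, S2 B cls (S2 B cls v) = v := fun v => by rw [d2, d2, MM3, f2, MM3]
  have m0 : ∀ v, MM (FF B cls v) = S1 B cls (MM v) := fun v => by rw [d1, MM3]
  have m1 : ∀ v, MM (S1 B cls v) = S2 B cls (MM v) := fun v => by rw [d1, d2]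
  have m2 : ∀ v, MM (S2 B cls v) = FF B cls (MM v) := fun v => by rw [d2, MM3]
  have b0 : ∀ v, FF B cls (S1 B cls (S2 B cls v)) = v := fun v => by rw [d1, d2, MM3]; exact f3 v
  have c0 : ∀ v, S1 B cls (S2 B cls v) = FF B cls v := fun v => by rw [← b0 v, a0, b0]
  have c1 : ∀ v, FF B cls (S1 B cls v) = S2 B cls v := fun v => by have := b0 (S2 B cls v); rwa [a2] at this
  have c2 : ∀ v, FF B cls (S2 B cls v) = S1 B cls v := fun v => by rw [← c1, a0]
  have c3 : ∀ v, S1 B cls (FF B cls v) = S2 B cls v := fun v => by rw [← c0, a1]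
  have c4 : ∀ v, S2 B cls (S1 B cls v) = FF B cls v := fun v => by rw [← c3, c1, c0]
  have c5 : ∀ v, S2 B cls (FF B cls v) = S1 B cls v := fun v => by rw [← c4, a2]
  exact ⟨a0 v, a1 v, a2 v, c1 v, c3 v, c2 v, c5 v, c0 v, c4 v, m0 v, m1 v, m2 v⟩
theorem p_rules (h : IsLeech B) (hc : Cls B cls) (v : V10) :
    FF B cls (p0 B cls v) = p0 B cls v ∧ FF B cls (MM (p0 B cls v)) = -MM (p0 B cls v) ∧ FF B cls (MM (MM (p0 B cls v))) = -MM (MM (p0 B cls v)) ∧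
    p0 B cls (p0 B cls v) = p0 B cls v ∧ p0 B cls (MM (p0 B cls v)) = 0 ∧ p0 B cls (MM (MM (p0 B cls v))) = 0 ∧
    FF B cls (pe B cls v) = pe B cls v ∧ MM (pe B cls v) = pe B cls (MM v) ∧ p0 B cls (pe B cls v) = 0 ∧
    v = pe B cls v + p0 B cls v + MM (p0 B cls (MM (MM v))) + MM (MM (p0 B cls (MM v))) := by
  have e0 : ∀ v, p0 B cls v = (4⁻¹ : ℂ) • (v + FF B cls v - S1 B cls v - S2 B cls v) := fun _ => rfl
  have ee : ∀ v, pe B cls v = (4⁻¹ : ℂ) • (v + FF B cls v + S1 B cls v + S2 B cls v) := fun _ => rfl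
  have s1 := fun v => (Sl h hc v).1
  have s2 := fun v => (Sl h hc v).2.1
  have s3 := fun v => (Sl h hc v).2.2.1
  have s4 := fun v => (Sl h hc v).2.2.2.1
  have s5 := fun v => (Sl h hc v).2.2.2.2.1
  have s6 := fun v => (Sl h hc v).2.2.2.2.2.1
  have s7 := fun v => (Sl h hc v).2.2.2.2.2.2.1
  have s8 := fun v => (Sl h hc v).2.2.2.2.2.2.2.1
  have s9 := fun v => (Sl h hc v).2.2.2.2.2.2.2.2.1
  have m1 := fun v => (Sl h hc v).2.2.2.2.2.2.2.2.2.1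
  have m2 := fun v => (Sl h hc v).2.2.2.2.2.2.2.2.2.2.1
  have m3 := fun v => (Sl h hc v).2.2.2.2.2.2.2.2.2.2.2
  refine ⟨?_, ?_, ?_, ?_, ?_, ?_, ?_, ?_, ?_, ?_⟩ <;>
    simp only [e0, ee, map_add, map_sub, map_smul, s1, s2, s3, s4, s5, s6, s7, s8, s9, m1, m2, m3, MM3] <;> module
theorem finrank_ker (h : IsLeech B) (hc : Cls B cls) {q : ℕ} (hq : q < 3) :
    LinearMap.range (p0 B cls ∘ₗ io q) = LinearMap.range (p0 B cls) := by
  refine le_antisymm (LinearMap.range_comp_le_range _ _) ?_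
  rintro _ ⟨v, rfl⟩
  set w := p0 B cls v with hw
  obtain ⟨r, hr⟩ : ∃ r, W ^ q * r = 1 ∧ W ^ q * r ^ 2 = r ∧ W ^ q = r ^ 2 := ⟨W ^ (2 * q), by
    have h3 := W3
    refine ⟨?_, ?_, ?_⟩ <;> interval_cases q <;> simp <;> ring_nf <;> simp [show W ^ 6 = (W ^ 3) ^ 2 by ring, show W ^ 9 = (W ^ 3) ^ 3 by ring, show W ^ 12 = (W ^ 3) ^ 4 by ring,
      show W ^ 8 = (W ^ 3) ^ 2 * W ^ 2 by ring, show W ^ 5 = W ^ 3 * W ^ 2 by ring, show W ^ 4 = W ^ 3 * W by ring, show W ^ 10 = (W ^ 3) ^ 3 * W by ring, h3]⟩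
  obtain ⟨r1, r2, r3⟩ := hr
  have hY : MM (w + r • MM w + r ^ 2 • MM (MM w)) = W ^ q • (w + r • MM w + r ^ 2 • MM (MM w)) := by
    simp only [map_add, map_smul, MM3, smul_add, smul_smul, r1, r2]
    rw [r3]; module
  refine ⟨_, ((LinearMap.comp_apply _ _ _).trans (congrArg _ (io_sur hq hY))).trans ?_⟩
  obtain ⟨-, -, -, h1, h2, h3, -⟩ := p_rules h hc v
  rw [map_add, map_add, map_smul, map_smul, ← hw] at *
  rw [hw, h1, h2, h3]; simp
theorem ker1 (h : IsLeech B) (hc : Cls B cls) : LinearMap.ker (p0 B cls ∘ₗ io 1) = ⊥ := by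
  refine (LinearMap.ker_eq_bot').2 fun c hc0 => io_inj 1 ?_
  have hM := io_M (q := 1) (by norm_num) c
  rw [pow_one] at hM
  have h0 : p0 B cls (io 1 c) = 0 := hc0
  obtain ⟨-, -, -, -, -, -, h1, -, -, h2⟩ := p_rules h hc (io 1 c)
  rw [hM, map_smul, map_smul, hM, map_smul, map_smul, map_smul, h0] at h2
  simp only [smul_zero, map_zero, add_zero] at h2
  rw [map_zero]
  exact no_fix h hc hM (by rw [← h2] at h1; exact h1)
theorem basis_ex (h : IsLeech B) (hc : Cls B cls) : ∃ (a : Fin 3 → V10) (u : V10) (e : Fin 2 → V10),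
    (∀ i, MM (a i) = a i ∧ FF B cls (a i) = a i) ∧ (MM u = W ^ 2 • u ∧ FF B cls u = u) ∧
    (∀ i, FF B cls (e i) = e i ∧ FF B cls (MM (e i)) = -MM (e i) ∧ FF B cls (MM (MM (e i))) = -MM (MM (e i))) ∧
    ∃ b : Module.Basis (Fin 10) ℂ V10, ⇑b = ![a 0, a 1, a 2, u, e 0, MM (e 0), MM (MM (e 0)), e 1, MM (e 1), MM (MM (e 1))] := by
  have hr : ∀ q, q < 3 → Module.finrank ℂ (LinearMap.range (p0 B cls)) + Module.finrank ℂ (LinearMap.ker (p0 B cls ∘ₗ io q)) = Fintype.card (Iq q) := fun q hq => by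
    have := LinearMap.finrank_range_add_finrank_ker (p0 B cls ∘ₗ io q)
    rwa [finrank_ker h hc hq, Module.finrank_fintype_fun_eq_card] at this
  have c0 : Fintype.card (Iq 0) = 5 := by decide
  have c1 : Fintype.card (Iq 1) = 2 := by decide
  have c2 : Fintype.card (Iq 2) = 3 := by decide
  have r0 := hr 0 (by norm_num)
  have r1 := hr 1 (by norm_num)
  have r2 := hr 2 (by norm_num)
  rw [ker1 h hc, finrank_bot, c1] at r1
  have k0 : Module.finrank ℂ (LinearMap.ker (p0 B cls ∘ₗ io 0)) = 3 := by omega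
  have k2 : Module.finrank ℂ (LinearMap.ker (p0 B cls ∘ₗ io 2)) = 1 := by omega
  have kp : Module.finrank ℂ (LinearMap.range (p0 B cls)) = 2 := by omega
  let A := Module.finBasisOfFinrankEq ℂ _ k0
  let U := Module.finBasisOfFinrankEq ℂ _ k2
  let E := Module.finBasisOfFinrankEq ℂ _ kp
  have fix : ∀ q (c : LinearMap.ker (p0 B cls ∘ₗ io q)), q < 3 → FF B cls (io q c) = io q c := fun q c hq => by
    have hM := io_M hq c.1
    have h0 : p0 B cls (io q c.1) = 0 := c.2
    obtain ⟨-, -, -, -, -, -, h1, -, -, h2⟩ := p_rules h hc (io q c.1)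
    rw [hM, map_smul, map_smul, hM, map_smul, map_smul, map_smul, h0] at h2
    simp only [smul_zero, map_zero, add_zero] at h2
    rw [← h2] at h1; exact h1
  have hE : ∀ i, ∃ v, p0 B cls v = E i := fun i => (E i).2
  let a := fun i => io 0 (A i).1
  let u := io 2 (U 0).1
  let e := fun i => (E i).1
  refine ⟨a, u, e, fun i => ⟨?_, fix 0 _ (by norm_num)⟩, ⟨io_M (by norm_num) _, fix 2 _ (by norm_num)⟩, fun i => ?_, ?_⟩
  · have := io_M (q := 0) (by norm_num) (A i).1
    rwa [pow_zero, one_smul] at this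
  · obtain ⟨v, hv⟩ := hE i
    obtain ⟨h1, h2, h3, -⟩ := p_rules h hc v
    simp only [e, ← hv]; exact ⟨h1, h2, h3⟩
  set f : Fin 10 → V10 := ![a 0, a 1, a 2, u, e 0, MM (e 0), MM (MM (e 0)), e 1, MM (e 1), MM (MM (e 1))] with hf
  have hm : ∀ i, f i ∈ Submodule.span ℂ (Set.range f) := fun i => Submodule.subset_span ⟨i, rfl⟩
  have ha : ∀ c : LinearMap.ker (p0 B cls ∘ₗ io 0), io 0 c ∈ Submodule.span ℂ (Set.range f) := fun c => by
    rw [← A.sum_repr c, Fin.sum_univ_three]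
    simp only [Submodule.coe_add, Submodule.coe_smul, map_add, map_smul]
    exact add_mem (add_mem (Submodule.smul_mem _ _ (hm 0)) (Submodule.smul_mem _ _ (hm 1))) (Submodule.smul_mem _ _ (hm 2))
  have hu : ∀ c : LinearMap.ker (p0 B cls ∘ₗ io 2), io 2 c ∈ Submodule.span ℂ (Set.range f) := fun c => by
    rw [← U.sum_repr c, Fin.sum_univ_one]
    simp only [Submodule.coe_smul, map_smul]
    exact Submodule.smul_mem _ _ (hm 3)
  have he : ∀ v, p0 B cls v = E.repr ⟨_, v, rfl⟩ 0 • e 0 + E.repr ⟨_, v, rfl⟩ 1 • e 1 := fun v => by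
    have := congrArg Subtype.val (E.sum_repr ⟨_, v, rfl⟩)
    rw [Fin.sum_univ_two] at this
    exact this.symm
  have hp : ∀ q c, q < 3 → ∃ d : LinearMap.ker (p0 B cls ∘ₗ io q), pe B cls (io q c) = io q d := fun q c hq => by
    obtain ⟨-, -, -, -, -, -, -, h1, h2, -⟩ := p_rules h hc (io q c)
    rw [io_M hq, map_smul] at h1
    have := io_sur hq h1
    exact ⟨⟨_, by rw [LinearMap.mem_ker, LinearMap.comp_apply, this, h2]⟩, this.symm⟩
  refine ⟨basisOfTopLeSpanOfCardEqFinrank f ?_ (by simp), coe_basisOfTopLeSpanOfCardEqFinrank _ _ _⟩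
  intro v _
  obtain ⟨-, -, -, -, -, -, -, -, -, h2⟩ := p_rules h hc v
  rw [h2]
  refine add_mem (add_mem (add_mem ?_ ?_) ?_) ?_
  · obtain ⟨d0, h0⟩ := hp 0 (fun j => v j.1) (by norm_num)
    obtain ⟨d1, h1⟩ := hp 1 (fun j => v j.1) (by norm_num)
    obtain ⟨d2, h2⟩ := hp 2 (fun j => v j.1) (by norm_num)
    have : d1.1 = 0 := LinearMap.ker_eq_bot'.1 (ker1 h hc) _ d1.2
    rw [io_sum v, map_add, map_add, h0, h1, h2, this, map_zero, add_zero]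
    exact add_mem (ha _) (hu _)
  · rw [he]; exact add_mem (Submodule.smul_mem _ _ (hm 4)) (Submodule.smul_mem _ _ (hm 7))
  · rw [he, map_add, map_smul, map_smul]; exact add_mem (Submodule.smul_mem _ _ (hm 5)) (Submodule.smul_mem _ _ (hm 8))
  · rw [he, map_add, map_add, map_smul, map_smul, map_smul, map_smul]; exact add_mem (Submodule.smul_mem _ _ (hm 6)) (Submodule.smul_mem _ _ (hm 9))
end

section
variable {B : Matrix (Fin 24) (Fin 24) ℤ}
open ModularGroup Filter
def fE (t : ℂ) : ℂ := EisensteinSeries.E2 (ofComplex t)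
theorem fE_S {t : ℂ} (ht : 0 < t.im) : fE (-t⁻¹) = t ^ 2 * fE t + (1 / (2 * riemannZeta 2) * (-2 * π * Complex.I)) * t := by
  have h1 := EisensteinSeries.G2_S_transform ⟨t, ht⟩
  have h2 : ofComplex (-t⁻¹) = S • (⟨t, ht⟩ : ℍ) := by
    have : (((S • (⟨t, ht⟩ : ℍ)) : ℍ) : ℂ) = -t⁻¹ := coe_S_smul _
    rw [← this, ofComplex_apply]
  have h0 : t ≠ 0 := fun e => by simp [e] at ht
  rw [fE, fE, h2, ofComplex_apply_of_im_pos ht, EisensteinSeries.E2]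
  simp only [Pi.smul_apply, smul_eq_mul]
  rw [h1]
  change _ = _ * (_ * ((t ^ 2)⁻¹ * _ - _ / t)) + _
  field_simp
  ring
theorem fE_T {t : ℂ} (ht : 0 < t.im) : fE (t + 1) = fE t := by
  have h2 : ofComplex (t + 1) = T • (⟨t, ht⟩ : ℍ) := by
    have : (((T • (⟨t, ht⟩ : ℍ)) : ℍ) : ℂ) = t + 1 := coe_T_smul _
    rw [← this, ofComplex_apply]
  have h1 := congrFun EisensteinSeries.G2_T_transform ⟨t, ht⟩
  rw [ModularForm.SL_slash_apply] at h1
  rw [fE, fE, h2, ofComplex_apply_of_im_pos ht, EisensteinSeries.E2]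
  simp only [Pi.smul_apply, smul_eq_mul]
  rw [← h1]
  have : denom T (⟨t, ht⟩ : ℍ) = 1 := by rw [ModularGroup.denom_apply]; simp [T]
  simp [this]
theorem fE_hol : DifferentiableOn ℂ fE {t | 0 < t.im} := UpperHalfPlane.mdifferentiable_iff.1 _root_.E2_mdifferentiable
theorem fE_lim : Tendsto EisensteinSeries.E2 atImInfty (𝓝 1) := by
  have hf : ∀ τ : ℍ, HasSum (fun m : ℕ ↦ (if m = 0 then 1 else -24 * (ArithmeticFunction.sigma 1 m : ℕ) : ℂ) • Function.Periodic.qParam 1 τ ^ m) (EisensteinSeries.E2 τ) := fun τ => by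
    simpa only [Function.Periodic.qParam, Complex.ofReal_one, div_one] using EisensteinSeries.hasSum_qExpansion_E2 (z := τ)
  have hb : IsBoundedAtImInfty fun τ : ℍ => (EisensteinSeries.E2 τ - 1) / Function.Periodic.qParam 1 τ :=
    isBoundedAtImInfty_of_hasSum_qExpansion (c := fun m => -24 * (ArithmeticFunction.sigma 1 (m + 1) : ℕ)) one_pos fun τ => by
      have h1 := (hasSum_nat_add_iff' 1).2 (hf τ)
      simp only [Finset.sum_range_one, if_true, pow_zero, smul_eq_mul, mul_one] at h1
      refine (h1.div_const (Function.Periodic.qParam 1 τ)).congr_fun fun m => ?_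
      have := Function.Periodic.qParam_ne_zero (h := 1) (τ : ℂ)
      rw [if_neg (Nat.succ_ne_zero m), pow_succ, smul_eq_mul]; field_simp
  have hz := bdd_mul_zero hb (qParam_tendsto_atImInfty one_pos)
  have : EisensteinSeries.E2 = fun τ : ℍ => (EisensteinSeries.E2 τ - 1) / Function.Periodic.qParam 1 τ * Function.Periodic.qParam 1 τ + 1 := by
    ext τ
    have := Function.Periodic.qParam_ne_zero (h := 1) (τ : ℂ)
    field_simp; ring
  rw [this]
  have hz' := Tendsto.add_const (1 : ℂ) hz
  rwa [zero_add] at hz'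
theorem fE_limc {a b : ℂ} {r : ℝ} (hr : 0 < r) (ha : a = r) (hb : b.im = 0) : Tendsto (fun τ : ℍ => fE (a * τ + b)) atImInfty (𝓝 1) := by
  refine fE_lim.comp ?_
  rw [atImInfty, tendsto_comap_iff]
  have : (UpperHalfPlane.im ∘ fun τ : ℍ => ofComplex (a * τ + b)) = fun τ : ℍ => r * τ.im := by
    ext τ
    have h : (a * τ + b).im = r * τ.im := by simp [ha, hb]
    have h' : 0 < (a * τ + b).im := h ▸ mul_pos hr τ.2
    simp only [Function.comp, ofComplex_apply_of_im_pos h']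
    exact h
  rw [this]
  exact tendsto_comap.const_mul_atTop hr
/-- triples: the sign representation induced to the modular group -/
structure Tri (κ : ℤ) (g : Fin 3 → ℍ → ℂ) : Prop where
  hol : ∀ i, MDifferentiable 𝓘(ℂ) 𝓘(ℂ) (g i)
  bdd : ∀ i, IsBoundedAtImInfty (g i)
  T : ∀ i τ, g i (T • τ) = g (i + 1) τ
  S0 : ∀ τ : ℍ, g 0 (S • τ) = (τ : ℂ) ^ κ * g 0 τ
  S1 : ∀ τ : ℍ, g 1 (S • τ) = -((τ : ℂ) ^ κ * g 1 τ)
  S2 : ∀ τ : ℍ, g 2 (S • τ) = -((τ : ℂ) ^ κ * g 2 τ)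
def ei (t : ℂ) : ℂ := 3 * fE (3 * t + 0)
def ej (a : ℂ) (t : ℂ) : ℂ := 3⁻¹ * fE (3⁻¹ * t + a)
def xx (i : Fin 3) (τ : ℍ) : ℂ := ei τ + ej (i / 3) τ - ej ((i + 1 : Fin 3) / 3) τ - ej ((i + 2 : Fin 3) / 3) τ
theorem xx_lim (i : Fin 3) : Tendsto (xx i) atImInfty (𝓝 (8 / 3)) := by
  have h1 : Tendsto (fun τ : ℍ => ei τ) atImInfty (𝓝 (3 * 1)) := (fE_limc (r := 3) (by norm_num) (by norm_num) (by simp)).const_mul 3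
  have h2 : ∀ n : ℕ, Tendsto (fun τ : ℍ => ej (n / 3) τ) atImInfty (𝓝 (3⁻¹ * 1)) := fun n => (fE_limc (r := 3⁻¹) (by norm_num) (by norm_num)
    (by rw [show (n / 3 : ℂ) = ((n / 3 : ℝ) : ℂ) by push_cast; rfl]; exact Complex.ofReal_im _)).const_mul _
  have := ((h1.add (h2 i)).sub (h2 (i + 1 : Fin 3))).sub (h2 (i + 2 : Fin 3))
  norm_num at this
  exact this
theorem xx_tri : Tri 2 xx := by
  have i3 : ∀ {t : ℂ}, 0 < t.im → 0 < (3 * t).im := fun h => by simp; positivity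
  have hT3 : ∀ {t : ℂ} (n : ℕ), 0 < t.im → fE (t + n) = fE t := fun {t} n ht => by
    induction n with
    | zero => simp
    | succ n ih => rw [← ih, ← fE_T (t := t + n) (by simpa using ht)]; congr 1; push_cast; ring
  have pos : ∀ {t : ℂ} (n : ℕ), 0 < t.im → 0 < (3⁻¹ * t + n / 3).im := fun {t} n ht => by
    rw [show (3⁻¹ * t + n / 3 : ℂ) = ((1 / 3 : ℝ) : ℂ) * t + ((n / 3 : ℝ) : ℂ) by push_cast; ring]
    simp; positivity
  have h01 : ((0 : Fin 3) : ℕ) = 0 := rfl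
  have h11 : ((1 : Fin 3) : ℕ) = 1 := rfl
  have h21 : ((2 : Fin 3) : ℕ) = 2 := rfl
  have g1 : (1 : Fin 3) + 1 = 2 := rfl
  have g2 : (1 : Fin 3) + 2 = 0 := rfl
  have g3 : (2 : Fin 3) + 1 = 0 := rfl
  have g4 : (2 : Fin 3) + 2 = 1 := rfl
  have X0 : ∀ τ, xx 0 τ = ei τ + ej (0 / 3) τ - ej (1 / 3) τ - ej (2 / 3) τ := fun τ => by simp [xx]
  have X1 : ∀ τ, xx 1 τ = ei τ + ej (1 / 3) τ - ej (2 / 3) τ - ej (0 / 3) τ := fun τ => by simp [xx, g1, g2]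
  have X2 : ∀ τ, xx 2 τ = ei τ + ej (2 / 3) τ - ej (0 / 3) τ - ej (1 / 3) τ := fun τ => by simp [xx, g3, g4]
  have S0 : ∀ τ : ℍ, ∃ c, ei (-(τ : ℂ)⁻¹) = τ ^ 2 * ej (0 / 3) τ + c ∧ ej (0 / 3) (-(τ : ℂ)⁻¹) = τ ^ 2 * ei τ + c ∧
      ej (1 / 3) (-(τ : ℂ)⁻¹) = τ ^ 2 * ej (2 / 3) τ + c ∧ ej (2 / 3) (-(τ : ℂ)⁻¹) = τ ^ 2 * ej (1 / 3) τ + c := fun τ => by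
    have key : ∀ t : ℂ, 0 < t.im → ej (1 / 3) (-t⁻¹) = t ^ 2 * ej (2 / 3) t + (1 / (2 * riemannZeta 2) * (-2 * π * Complex.I)) * t := fun t ht => by
      obtain ⟨v, hv⟩ : ∃ v, v = 3⁻¹ * t - 1 / 3 := ⟨_, rfl⟩
      have v1 : 0 < v.im := by
        have := pos 0 ht
        rw [hv]; simpa using this
      have v2 : 0 < (-v⁻¹).im := by
        have := (S • (⟨v, v1⟩ : ℍ)).2
        change 0 < ((S • (⟨v, v1⟩ : ℍ) : ℍ) : ℂ).im at this
        rwa [coe_S_smul] at this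
      have v0 : v ≠ 0 := fun e => by simp [e] at v1
      have t0 : t ≠ 0 := fun e => by simp [e] at ht
      have y1 : 0 < (-v⁻¹ - 3).im := by simpa using v2
      have e2 := hT3 3 y1
      rw [Nat.cast_ofNat, sub_add_cancel] at e2
      have e3 := hT3 1 v1
      have e5 : -v⁻¹ - 3 = -t / v := by
        field_simp; rw [hv]; ring
      have ht' : t = 3 * v + 1 := by rw [hv]; ring
      rw [ej, ej, show 3⁻¹ * -t⁻¹ + 1 / 3 = -(-v⁻¹ - 3)⁻¹ by rw [e5, inv_div]; field_simp; rw [hv]; ring, fE_S y1, ← e2, fE_S v1, ← e3, e5,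
        show v + (1 : ℕ) = 3⁻¹ * t + 2 / 3 by rw [hv]; push_cast; ring]
      rw [ht'] at t0 ⊢
      field_simp; ring
    refine ⟨(1 / (2 * riemannZeta 2) * (-2 * π * Complex.I)) * τ, ?_, ?_, key τ τ.2, ?_⟩
    · have := fE_S (t := 3⁻¹ * τ) (by simpa using pos 0 τ.2)
      rw [ei, ej, zero_div, add_zero, add_zero, show 3 * -(τ : ℂ)⁻¹ = -(3⁻¹ * τ : ℂ)⁻¹ by rw [mul_inv]; ring, this]; ring
    · have := fE_S (i3 τ.2)
      rw [ei, ej, zero_div, add_zero, add_zero, show 3⁻¹ * -(τ : ℂ)⁻¹ = -(3 * τ : ℂ)⁻¹ by rw [mul_inv]; ring, this]; ring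
    · have := key _ (S • τ).2
      change ej (1 / 3) (-((S • τ : ℍ) : ℂ)⁻¹) = _ at this
      rw [coe_S_smul] at this
      have h0 := τ.ne_zero
      rw [inv_neg, inv_inv, neg_neg] at this
      rw [this]; field_simp; ring
  have T0 : ∀ τ : ℍ, ei (τ + 1) = ei τ ∧ ej (0 / 3) (τ + 1) = ej (1 / 3) τ ∧ ej (1 / 3) (τ + 1) = ej (2 / 3) τ ∧ ej (2 / 3) (τ + 1) = ej (0 / 3) τ := fun τ => by
    refine ⟨?_, ?_, ?_, ?_⟩
    · rw [ei, ei, ← hT3 (t := 3 * τ + 0) 3 (by simpa using i3 τ.2)]; congr 2; push_cast; ring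
    · rw [ej, ej]; congr 2; ring
    · rw [ej, ej]; congr 2; ring
    · rw [ej, ej, ← hT3 (t := 3⁻¹ * τ + 0 / 3) 1 (by simpa using pos 0 τ.2)]; congr 2; push_cast; ring
  refine ⟨fun i => ?_, fun i => (xx_lim i).isBigO_one ℝ, fun i τ => ?_, fun τ => ?_, fun τ => ?_, fun τ => ?_⟩
  · refine mdiff_of_diffOn (f := fun t => ei t + ej (i / 3) t - ej ((i + 1 : Fin 3) / 3) t - ej ((i + 2 : Fin 3) / 3) t) ?_
    have h1 : DifferentiableOn ℂ ei {t | 0 < t.im} := (fE_hol.comp (f := fun t => 3 * t + 0) (by fun_prop) fun t ht => by simpa using i3 ht).const_mul _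
    have h2 : ∀ n : ℕ, DifferentiableOn ℂ (ej (n / 3)) {t | 0 < t.im} := fun n => (fE_hol.comp (f := fun t => 3⁻¹ * t + (n / 3 : ℂ)) (by fun_prop) fun t ht => pos n ht).const_mul _
    exact ((h1.add (h2 _)).sub (h2 _)).sub (h2 _)
  · obtain ⟨t1, t2, t3, t4⟩ := T0 τ
    fin_cases i <;> simp only [Fin.zero_eta, Fin.mk_one, Fin.reduceFinMk, zero_add, g1, g3, X0, X1, X2, coe_T_smul, t1, t2, t3, t4] <;> ring
  all_goals
    obtain ⟨c, t1, t2, t3, t4⟩ := S0 τ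
    simp only [X0, X1, X2, coe_S_smul, t1, t2, t3, t4, zpow_ofNat]
    ring
end

section
variable {B : Matrix (Fin 24) (Fin 24) ℤ}
open ModularGroup Filter
structure UU (m : ℕ) (κ : ℤ) (s : ℍ → ℂ) : Prop where
  hol : MDifferentiable 𝓘(ℂ) 𝓘(ℂ) s
  bdd : IsBoundedAtImInfty s
  T : ∀ τ, s (T • τ) = W ^ m * s τ
  S : ∀ τ : ℍ, s (S • τ) = (τ : ℂ) ^ κ * s τ
variable {m n : ℕ} {κ κ' : ℤ} {s r : ℍ → ℂ}
theorem UU.mul (hs : UU m κ s) (hr : UU n κ' r) : UU (m + n) (κ + κ') fun τ => s τ * r τ :=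
  ⟨hs.hol.mul hr.hol, hs.bdd.mul hr.bdd, fun τ => by rw [hs.T, hr.T, pow_add]; ring, fun τ => by
    rw [hs.S, hr.S, zpow_add₀ τ.ne_zero]; ring⟩
theorem UU.add (hs : UU m κ s) (hr : UU m κ r) : UU m κ fun τ => s τ + r τ :=
  ⟨hs.hol.add hr.hol, hs.bdd.add hr.bdd, fun τ => by rw [hs.T, hr.T]; ring, fun τ => by rw [hs.S, hr.S]; ring⟩
theorem UU.cmul (c : ℂ) (hs : UU m κ s) : UU m κ fun τ => c * s τ :=
  ⟨mdifferentiable_const.mul hs.hol, (Filter.const_boundedAtFilter _ c).mul hs.bdd, fun τ => by rw [hs.T]; ring, fun τ => by rw [hs.S]; ring⟩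
theorem UU_e8 : UU 1 4 e8 := ⟨e8_hol, e8_zero.boundedAtFilter, fun τ => by rw [e8_T, pow_one], fun τ => by rw [e8_S]; norm_cast⟩
theorem UU_mf (F : ModularForm 𝒮ℒ κ) : UU 0 κ F := by
  refine ⟨F.holo', ModularFormClass.bdd_at_infty F, fun τ => ?_, fun τ => ?_⟩
  · have := SlashInvariantForm.slash_action_eqn' (Γ := 𝒮ℒ) F (γ := SpecialLinearGroup.mapGL ℝ T) ⟨_, rfl⟩ τ
    have hd : denom T τ = 1 := by rw [ModularGroup.denom_apply]; simp [T]
    refine this.trans ?_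
    change (denom T τ) ^ κ * _ = _
    rw [hd]; simp
  · have := SlashInvariantForm.slash_action_eqn' (Γ := 𝒮ℒ) F (γ := SpecialLinearGroup.mapGL ℝ S) ⟨_, rfl⟩ τ
    refine this.trans ?_
    change (denom S τ) ^ κ * _ = _
    rw [ModularGroup.denom_S]
theorem UU.mf (hs : UU 0 κ s) : ∃ F : ModularForm 𝒮ℒ κ, ⇑F = s := mkMF hs.hol (fun τ => by rw [hs.T]; simp) hs.S hs.bdd
theorem UU.div (hm : m = 1 ∨ m = 2) (hs : UU m κ s) : UU 0 (κ - 4 * m) fun τ => s τ / e8 τ ^ m := by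
  have h3 := W3
  obtain ⟨n, hn, hu⟩ : ∃ n, m + n = 3 ∧ (UU (m + n) (κ + 4 * n) fun τ => s τ * e8 τ ^ n) ∧ n ≠ 0 := by
    rcases hm with rfl | rfl
    · refine ⟨2, rfl, ?_, by norm_num⟩
      have := hs.mul (UU_e8.mul UU_e8)
      rw [show (4 : ℤ) * (2 : ℕ) = 4 + 4 by norm_num]; simpa only [pow_two] using this
    · refine ⟨1, rfl, ?_, by norm_num⟩
      have := hs.mul UU_e8
      simpa only [pow_one, Nat.cast_one, mul_one] using this
  have hz : IsZeroAtImInfty fun τ => s τ * e8 τ ^ n := by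
    obtain ⟨k, rfl⟩ := Nat.exists_eq_succ_of_ne_zero hu.2
    have hz := bdd_mul_zero (hs.bdd.mul (show IsBoundedAtImInfty (e8 ^ k) from by simpa [IsBoundedAtImInfty, BoundedAtFilter, Pi.one_def] using! (e8_zero.boundedAtFilter (f := e8)).pow k)) e8_zero
    exact hz.congr fun τ => by simp [pow_succ]; ring
  obtain ⟨F, hF⟩ := mkCF hu.1.hol (fun τ => by rw [hu.1.T, hn, W3, one_mul]) hu.1.S hz
  have := UU_mf (CuspForm.discriminantEquiv F)
  convert this using 1
  · omega
  ext τ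
  have h0 := e8_ne τ
  rw [CuspForm.discriminantEquiv_apply, hF, e8_disc, ← hn, pow_add]
  field_simp
variable {x g : Fin 3 → ℍ → ℂ}
theorem Tri.ft (hx : Tri κ x) (hg : Tri κ' g) (m : ℕ) :
    UU m (κ + κ') fun τ => 3⁻¹ * (x 0 τ * g 0 τ + W ^ (2 * m) * (x 1 τ * g 1 τ) + W ^ m * (x 2 τ * g 2 τ)) := by
  have hm : W ^ m * W ^ (2 * m) = 1 := by rw [← pow_add, show m + 2 * m = 3 * m by ring, pow_mul, W3, one_pow]
  refine ⟨?_, ?_, fun τ => ?_, fun τ => ?_⟩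
  · have h : ∀ i, MDifferentiable 𝓘(ℂ) 𝓘(ℂ) fun τ => x i τ * g i τ := fun i => (hx.hol i).mul (hg.hol i)
    have := mdifferentiable_const (c := (3⁻¹ : ℂ)) (I := 𝓘(ℂ)) (I' := 𝓘(ℂ)) (M := ℍ) |>.mul (((h 0).add ((mdifferentiable_const (c := W ^ (2 * m))).mul (h 1))).add ((mdifferentiable_const (c := W ^ m)).mul (h 2)))
    exact this
  · have h : ∀ i, IsBoundedAtImInfty (x i * g i) := fun i => (hx.bdd i).mul (hg.bdd i)
    have := (Filter.const_boundedAtFilter atImInfty (3⁻¹ : ℂ)).mul (((h 0).add ((Filter.const_boundedAtFilter _ (W ^ (2 * m))).mul (h 1))).add ((Filter.const_boundedAtFilter _ (W ^ m)).mul (h 2)))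
    exact this
  · simp only [hx.T, hg.T, show (1 : Fin 3) + 1 = 2 from rfl, show (2 : Fin 3) + 1 = 0 from rfl, zero_add]
    rw [pow_mul' W 2 m] at *
    linear_combination (-3⁻¹ * x 1 τ * g 1 τ) * hm
  · rw [hx.S0, hx.S1, hx.S2, hg.S0, hg.S1, hg.S2, zpow_add₀ τ.ne_zero]; ring
theorem Tri.X (hx : Tri κ x) : Tri (κ + κ) fun i τ => x (i + 1) τ * x (i + 2) τ := by
  refine ⟨fun i => (hx.hol _).mul (hx.hol _), fun i => (hx.bdd _).mul (hx.bdd _), fun i τ => ?_, fun τ => ?_, fun τ => ?_, fun τ => ?_⟩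
  · rw [hx.T, hx.T]; congr 2; omega
  · rw [zero_add, zero_add, hx.S1, hx.S2, zpow_add₀ τ.ne_zero]; ring
  · rw [show (1 : Fin 3) + 1 = 2 from rfl, show (1 : Fin 3) + 2 = 0 from rfl, hx.S0, hx.S2, zpow_add₀ τ.ne_zero]; ring
  · rw [show (2 : Fin 3) + 1 = 0 from rfl, show (2 : Fin 3) + 2 = 1 from rfl, hx.S0, hx.S1, zpow_add₀ τ.ne_zero]; ring
theorem Tri.E (hx : Tri κ x) : Tri (4 + κ) fun i τ => W ^ (i : ℕ) * (e8 τ * x i τ) := by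
  refine ⟨fun i => mdifferentiable_const.mul (e8_hol.mul (hx.hol _)), fun i => (Filter.const_boundedAtFilter _ _).mul (UU_e8.bdd.mul (hx.bdd _)), fun i τ => ?_, fun τ => ?_, fun τ => ?_, fun τ => ?_⟩
  · have h3 := W3
    rw [hx.T, e8_T]
    fin_cases i
    · simp; ring
    · simp; ring
    · simp; linear_combination (e8 τ * x 0 τ) * h3
  · rw [UU_e8.S, hx.S0, zpow_add₀ τ.ne_zero]; ring
  · rw [UU_e8.S, hx.S1, zpow_add₀ τ.ne_zero]; ring
  · rw [UU_e8.S, hx.S2, zpow_add₀ τ.ne_zero]; ring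
theorem x_sq : ∃ (A : ℍ → ℂ) (b : ℂ), UU 0 4 A ∧ b ≠ 0 ∧ ∀ τ, xx 0 τ ^ 2 = A τ + b * e8 τ ∧ xx 1 τ ^ 2 = A τ + W * (b * e8 τ) ∧ xx 2 τ ^ 2 = A τ + W ^ 2 * (b * e8 τ) := by
  obtain ⟨b, hb⟩ : ∃ b : ℂ, ∀ τ, 3⁻¹ * (xx 0 τ * xx 0 τ + W ^ (2 * 1) * (xx 1 τ * xx 1 τ) + W ^ 1 * (xx 2 τ * xx 2 τ)) = b * e8 τ := by
    obtain ⟨F, hF⟩ := ((xx_tri.ft xx_tri 1).div (Or.inl rfl)).mf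
    obtain ⟨b, hb⟩ := ModularFormClass.levelOne_weight_zero_const (F := ModularForm 𝒮ℒ 0) F
    refine ⟨b, fun τ => ?_⟩
    have := congrFun (hF.symm.trans hb) τ
    have h0 := e8_ne τ
    simp only [Function.const, pow_one] at this
    rw [div_eq_iff h0] at this
    simpa using this
  have h2 : ∀ τ, 3⁻¹ * (xx 0 τ * xx 0 τ + W ^ (2 * 2) * (xx 1 τ * xx 1 τ) + W ^ 2 * (xx 2 τ * xx 2 τ)) = 0 := fun τ => by
    obtain ⟨F, hF⟩ := ((xx_tri.ft xx_tri 2).div (Or.inr rfl)).mf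
    have hb := ModularFormClass.levelOne_neg_weight_eq_zero (by norm_num) F
    have := congrFun (hF.symm.trans hb) τ
    have h0 := e8_ne τ
    simp only [Pi.zero_apply] at this
    rw [div_eq_iff (pow_ne_zero _ h0), zero_mul] at this
    exact this
  have hA := xx_tri.ft xx_tri 0
  have h3 := W3
  have hs := W_sum
  have key : ∀ τ, xx 0 τ ^ 2 = 3⁻¹ * (xx 0 τ * xx 0 τ + W ^ (2 * 0) * (xx 1 τ * xx 1 τ) + W ^ 0 * (xx 2 τ * xx 2 τ)) + b * e8 τ ∧
     xx 1 τ ^ 2 = 3⁻¹ * (xx 0 τ * xx 0 τ + W ^ (2 * 0) * (xx 1 τ * xx 1 τ) + W ^ 0 * (xx 2 τ * xx 2 τ)) + W * (b * e8 τ) ∧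
     xx 2 τ ^ 2 = 3⁻¹ * (xx 0 τ * xx 0 τ + W ^ (2 * 0) * (xx 1 τ * xx 1 τ) + W ^ 0 * (xx 2 τ * xx 2 τ)) + W ^ 2 * (b * e8 τ) := fun τ => by
    rw [← hb]
    have h2 := h2 τ
    have h4 : W ^ 4 = W := by linear_combination W * h3
    generalize xx 0 τ = a at *
    generalize xx 1 τ = c at *
    generalize xx 2 τ = d at *
    simp only [Nat.reduceMul, h4, pow_zero, pow_one, one_mul] at *
    refine ⟨?_, ?_, ?_⟩
    · linear_combination h2 - 3⁻¹ * (c ^ 2 + d ^ 2) * hs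
    · linear_combination W ^ 2 * h2 - 3⁻¹ * (a ^ 2 + d ^ 2) * hs - 3⁻¹ * (2 * c ^ 2 + W * d ^ 2) * h3
    · linear_combination W * h2 - 3⁻¹ * (a ^ 2 + c ^ 2) * hs - 3⁻¹ * (2 * d ^ 2 + W * c ^ 2) * h3
  refine ⟨_, b, hA, fun hb0 => ?_, key⟩
  have hz : (fun τ => xx 0 τ - xx 1 τ) * (fun τ => xx 0 τ + xx 1 τ) = 0 := by
    ext τ
    have := key τ
    rw [hb0] at this
    simp only [Pi.mul_apply, Pi.zero_apply]
    linear_combination this.1 - this.2.1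
  have hx0 : ∀ τ, xx 0 τ = 0 := fun τ => by
    have n0 := zpow_ne_zero 2 τ.ne_zero
    rcases (UpperHalfPlane.mul_eq_zero_iff ((xx_tri.hol 0).sub (xx_tri.hol 1)) ((xx_tri.hol 0).add (xx_tri.hol 1))).1 hz with e | e
    · have e1 := congrFun e τ
      have e2 := congrFun e (S • τ)
      simp only [Pi.zero_apply, Pi.sub_apply, Pi.add_apply, xx_tri.S0, xx_tri.S1] at e1 e2
      refine (mul_eq_zero.1 (?_ : (τ : ℂ) ^ (2 : ℤ) * xx 0 τ = 0)).resolve_left n0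
      linear_combination 2⁻¹ * e2 + 2⁻¹ * (τ : ℂ) ^ (2 : ℤ) * e1
    · have e1 := congrFun e τ
      have e2 := congrFun e (S • τ)
      simp only [Pi.zero_apply, Pi.sub_apply, Pi.add_apply, xx_tri.S0, xx_tri.S1] at e1 e2
      refine (mul_eq_zero.1 (?_ : (τ : ℂ) ^ (2 : ℤ) * xx 0 τ = 0)).resolve_left n0
      linear_combination 2⁻¹ * e2 + 2⁻¹ * (τ : ℂ) ^ (2 : ℤ) * e1
  have hl := xx_lim 0
  rw [show xx 0 = fun _ => 0 from funext hx0] at hl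
  have := tendsto_nhds_unique hl tendsto_const_nhds
  norm_num at this
end

section
variable {B : Matrix (Fin 24) (Fin 24) ℤ}
open ModularGroup Filter
variable {m n : ℕ} {κ κ' : ℤ} {s r : ℍ → ℂ} {g : Fin 3 → ℍ → ℂ}
theorem tri_alg {x0 x1 x2 A t r0 r1 r2 : ℂ} (ht : t ≠ 0) (e0 : x0 ^ 2 = A + t) (e1 : x1 ^ 2 = A + W * t) (e2 : x2 ^ 2 = A + W ^ 2 * t)
    (h1 : x0 * r0 + W ^ 2 * (x1 * r1) + W * (x2 * r2) = 0) (h2 : x0 * r0 + W * (x1 * r1) + W ^ 2 * (x2 * r2) = 0)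
    (hK : x1 * x2 * r0 + W * (x2 * x0 * r1) + W ^ 2 * (x0 * x1 * r2) = 0) : r0 = 0 ∧ r1 = 0 ∧ r2 = 0 := by
  have h3 := W3
  have hs := W_sum
  have a1 : x1 * r1 = x2 * r2 := by
    refine sub_eq_zero.1 ((mul_eq_zero.1 (?_ : (W * (W - 1)) * (x1 * r1 - x2 * r2) = 0)).resolve_left (mul_ne_zero W_ne (sub_ne_zero.2 W_ne1)))
    linear_combination h1 - h2
  have a0 : x0 * r0 = x1 * r1 := by
    linear_combination h1 - x1 * r1 * hs + W * a1
  have hX : x1 ^ 2 * x2 ^ 2 + W * (x2 ^ 2 * x0 ^ 2) + W ^ 2 * (x0 ^ 2 * x1 ^ 2) = 3 * t ^ 2 := by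
    rw [e0, e1, e2]; linear_combination (A ^ 2 + 2 * W * A * t) * hs + 3 * t ^ 2 * h3
  have ht3 : 3 * t ^ 2 ≠ 0 := by simpa using ht
  refine ⟨(mul_eq_zero.1 (?_ : 3 * t ^ 2 * r0 = 0)).resolve_left ht3, (mul_eq_zero.1 (?_ : 3 * t ^ 2 * r1 = 0)).resolve_left ht3, (mul_eq_zero.1 (?_ : 3 * t ^ 2 * r2 = 0)).resolve_left ht3⟩
  · linear_combination x1 * x2 * hK - r0 * hX + W * x2 ^ 2 * x0 * a0 + W ^ 2 * x1 ^ 2 * x0 * (a0 + a1)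
  · linear_combination x2 * x0 * hK - r1 * hX - x2 ^ 2 * x1 * a0 + W ^ 2 * x0 ^ 2 * x1 * a1
  · linear_combination x0 * x1 * hK - r2 * hX - x1 ^ 2 * x2 * (a0 + a1) - W * x0 ^ 2 * x2 * a1
theorem vdm {c0 c1 c2 : ℂ} (h0 : c0 + c1 + c2 = 0) (h1 : c0 + W * c1 + W ^ 2 * c2 = 0) (h2 : c0 + W ^ 2 * c1 + W * c2 = 0) : c0 = 0 ∧ c1 = 0 ∧ c2 = 0 := by
  have h3 := W3
  have hs := W_sum
  refine ⟨?_, ?_, ?_⟩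
  · linear_combination 3⁻¹ * (h0 + h1 + h2) - 3⁻¹ * (c1 + c2) * hs
  · linear_combination 3⁻¹ * (h0 + W ^ 2 * h1 + W * h2) - 3⁻¹ * (c0 + c2) * hs - 3⁻¹ * (2 * c1 + W * c2) * h3
  · linear_combination 3⁻¹ * (h0 + W * h1 + W ^ 2 * h2) - 3⁻¹ * (c0 + c1) * hs - 3⁻¹ * (2 * c2 + W * c1) * h3
theorem tri_uniq {A b : ℂ} {τ : ℍ} (hb : b ≠ 0) (hx : xx 0 τ ^ 2 = A + b * e8 τ ∧ xx 1 τ ^ 2 = A + W * (b * e8 τ) ∧ xx 2 τ ^ 2 = A + W ^ 2 * (b * e8 τ))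
    {α β γ : ℂ} (h : ∀ i : Fin 3, α * xx i τ + β * (xx (i + 1) τ * xx (i + 2) τ) + γ * (W ^ (i : ℕ) * (e8 τ * xx i τ)) = 0) : α = 0 ∧ β = 0 ∧ γ = 0 := by
  have h3 := W3
  have hs := W_sum
  obtain ⟨e0, e1, e2⟩ := hx
  have n0 := e8_ne τ
  have k0 := h 0
  have k1 := h 1
  have k2 := h 2
  simp only [Fin.coe_ofNat_eq_mod, Nat.zero_mod, Nat.one_mod, Nat.reduceMod, zero_add, show (1 : Fin 3) + 1 = 2 from rfl, show (2 : Fin 3) + 1 = 0 from rfl, show (1 : Fin 3) + 2 = 0 from rfl, show (2 : Fin 3) + 2 = 1 from rfl] at k0 k1 k2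
  generalize xx 0 τ = x0 at *
  generalize xx 1 τ = x1 at *
  generalize xx 2 τ = x2 at *
  generalize e8 τ = e at *
  obtain ⟨v0, v1, v2⟩ := vdm (c0 := α * A + β * (x0 * x1 * x2)) (c1 := α * (b * e) + γ * e * A) (c2 := γ * e * (b * e))
    (by linear_combination x0 * k0 - (α + γ * e) * e0)
    (by linear_combination x1 * k1 - (α + γ * W * e) * e1)
    (by linear_combination x2 * k2 - (α + γ * W ^ 2 * e) * e2 - γ * e * (b * e) * W * h3)
  have g0 : γ = 0 := by simpa [n0, hb] using v2
  rw [g0] at v1 k0 k1 k2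
  have a0 : α = 0 := by simpa [n0, hb] using v1
  rw [a0] at k0 k1 k2
  refine ⟨a0, by_contra fun hβ => ?_, g0⟩
  have b1 : x1 * x2 = 0 := by simpa [hβ] using k0
  have b2 : x2 * x0 = 0 := by simpa [hβ] using k1
  have b3 : x0 * x1 = 0 := by simpa [hβ] using k2
  have : 3 * (b * e) ^ 2 = 0 := by
    have hX : x1 ^ 2 * x2 ^ 2 + W * (x2 ^ 2 * x0 ^ 2) + W ^ 2 * (x0 ^ 2 * x1 ^ 2) = 3 * (b * e) ^ 2 := by
      rw [e0, e1, e2]; linear_combination (A ^ 2 + 2 * W * A * (b * e)) * hs + 3 * (b * e) ^ 2 * h3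
    rw [← hX]; linear_combination x1 * x2 * b1 + W * x2 * x0 * b2 + W ^ 2 * x0 * x1 * b3
  simp [hb, n0] at this
theorem dec_alg {x0 x1 x2 A e b g0 g1 g2 α β γ : ℂ} (e0 : x0 ^ 2 = A + b * e) (e1 : x1 ^ 2 = A + W * (b * e)) (e2 : x2 ^ 2 = A + W ^ 2 * (b * e))
    (hα : x0 * g0 + W ^ 2 * (x1 * g1) + W * (x2 * g2) = 3 * (α * b * e + γ * e * A)) (hγ : x0 * g0 + W * (x1 * g1) + W ^ 2 * (x2 * g2) = 3 * γ * b * e ^ 2)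
    (hβ : x1 * x2 * g0 + W * (x2 * x0 * g1) + W ^ 2 * (x0 * x1 * g2) = 3 * β * (b * e) ^ 2) :
    x0 * (g0 - (α * x0 + β * (x1 * x2) + γ * (e * x0))) + W ^ 2 * (x1 * (g1 - (α * x1 + β * (x2 * x0) + γ * (W * (e * x1))))) + W * (x2 * (g2 - (α * x2 + β * (x0 * x1) + γ * (W ^ 2 * (e * x2))))) = 0 ∧
    x0 * (g0 - (α * x0 + β * (x1 * x2) + γ * (e * x0))) + W * (x1 * (g1 - (α * x1 + β * (x2 * x0) + γ * (W * (e * x1))))) + W ^ 2 * (x2 * (g2 - (α * x2 + β * (x0 * x1) + γ * (W ^ 2 * (e * x2))))) = 0 ∧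
    x1 * x2 * (g0 - (α * x0 + β * (x1 * x2) + γ * (e * x0))) + W * (x2 * x0 * (g1 - (α * x1 + β * (x2 * x0) + γ * (W * (e * x1))))) + W ^ 2 * (x0 * x1 * (g2 - (α * x2 + β * (x0 * x1) + γ * (W ^ 2 * (e * x2))))) = 0 := by
  have h3 := W3
  have hs := W_sum
  obtain ⟨t, ht⟩ : ∃ t, t = b * e := ⟨_, rfl⟩
  rw [← ht] at e0 e1 e2 hβ
  have hX : x1 ^ 2 * x2 ^ 2 + W * (x2 ^ 2 * x0 ^ 2) + W ^ 2 * (x0 ^ 2 * x1 ^ 2) = 3 * t ^ 2 := by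
    rw [e0, e1, e2]; linear_combination (A ^ 2 + 2 * W * A * t) * hs + 3 * t ^ 2 * h3
  refine ⟨?_, ?_, ?_⟩
  · linear_combination hα - α * (e0 + W ^ 2 * e1 + W * e2) - γ * e * (e0 + W ^ 3 * e1 + W ^ 3 * e2) - (α * A + β * (x0 * x1 * x2) + γ * e * t) * hs - (2 * α * t + γ * e * (2 * A + (W + W ^ 2) * t)) * h3 - 3 * α * ht
  · linear_combination hγ - α * (e0 + W * e1 + W ^ 2 * e2) - γ * e * (e0 + W ^ 2 * e1 + W ^ 4 * e2) - (α * A + α * t + β * (x0 * x1 * x2) + γ * e * A) * hs - (α * t * W + γ * e * A * W + γ * e * t * (2 + W ^ 3)) * h3 - 3 * γ * e * ht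
  · linear_combination hβ - β * hX - (α + γ * e) * (x0 * x1 * x2) * hs - γ * e * (x0 * x1 * x2) * W * h3
theorem Tri.dec {A : ℍ → ℂ} {b : ℂ} (hA : UU 0 4 A) (hb : b ≠ 0) (hx : ∀ τ, xx 0 τ ^ 2 = A τ + b * e8 τ ∧ xx 1 τ ^ 2 = A τ + W * (b * e8 τ) ∧ xx 2 τ ^ 2 = A τ + W ^ 2 * (b * e8 τ))
    (hg : Tri κ g) : ∃ α β γ : ℍ → ℂ, UU 0 (κ - 2) α ∧ UU 0 (κ - 4) β ∧ UU 0 (κ - 6) γ ∧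
      ∀ i τ, g i τ = α τ * xx i τ + β τ * (xx (i + 1) τ * xx (i + 2) τ) + γ τ * (W ^ (i : ℕ) * (e8 τ * xx i τ)) := by
  have u1 := (xx_tri.ft hg 1).div (Or.inl rfl)
  have u2 := ((xx_tri.ft hg 2).div (Or.inr rfl)).cmul b⁻¹
  have uK := ((xx_tri.X.ft hg 2).div (Or.inr rfl)).cmul (b ^ 2)⁻¹
  have ua := (u1.cmul b⁻¹).add ((by convert (u2.mul hA).cmul (-b⁻¹) using 1; push_cast; ring : UU 0 (2 + κ - 4 * (1 : ℕ)) _))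
  refine ⟨_, _, _, by convert ua using 1; push_cast; ring, by convert uK using 1; push_cast; ring, by convert u2 using 1; push_cast; ring, ?_⟩
  have h3 := W3
  have hs := W_sum
  have h4 : W ^ 4 = W := by linear_combination W * h3
  suffices ∀ τ, _ ∧ _ ∧ _ from fun i τ => sub_eq_zero.1 (by
    fin_cases i
    exacts [(this τ).1, (this τ).2.1, (this τ).2.2])
  intro τ
  obtain ⟨e0, e1, e2⟩ := hx τ
  have n0 := e8_ne τ
  refine tri_alg (mul_ne_zero hb n0) e0 e1 e2 ?_ ?_ ?_
  all_goals
    simp only [Fin.zero_eta, Fin.mk_one, Fin.reduceFinMk, Fin.coe_ofNat_eq_mod, Nat.zero_mod, Nat.one_mod, Nat.reduceMod, zero_add, show (1 : Fin 3) + 1 = 2 from rfl, show (2 : Fin 3) + 1 = 0 from rfl, show (1 : Fin 3) + 2 = 0 from rfl, show (2 : Fin 3) + 2 = 1 from rfl, Nat.reduceMul, h4, pow_one, pow_zero, one_mul]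
  · refine (dec_alg e0 e1 e2 ?_ ?_ ?_).1 <;> field_simp <;> ring
  · refine (dec_alg e0 e1 e2 ?_ ?_ ?_).2.1 <;> field_simp <;> ring
  · refine (dec_alg e0 e1 e2 ?_ ?_ ?_).2.2 <;> field_simp <;> ring
end

section
variable {B : Matrix (Fin 24) (Fin 24) ℤ}
open ModularGroup Filter
variable {cls : LV → Fin 10}
def cv (p q r s : ℍ → ℂ) (f g : Fin 3 → ℍ → ℂ) (τ : ℍ) : Fin 10 → ℂ :=
  ![p τ, q τ, r τ, s τ, f 0 τ, f 1 τ, f 2 τ, g 0 τ, g 1 τ, g 2 τ]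
def lc (b : Fin 10 → V10) (c : Fin 10 → ℂ) : V10 := ∑ j, c j • b j
structure Bas (B : Matrix (Fin 24) (Fin 24) ℤ) (cls : LV → Fin 10) (b : Fin 10 → V10) : Prop where
  M : ∀ c, MM (lc b c) = lc b ![c 0, c 1, c 2, W ^ 2 * c 3, c 6, c 4, c 5, c 9, c 7, c 8]
  F : ∀ c, FF B cls (lc b c) = lc b ![c 0, c 1, c 2, c 3, c 4, -c 5, -c 6, c 7, -c 8, -c 9]
  inj : ∀ c c', lc b c = lc b c' → c = c'
  ex : ∃ L : Fin 10 → Fin 10 → ℂ, ∀ v, lc b (fun j => ∑ i, L j i * v i) = v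
theorem hb_lin {C : ℍ → Fin 10 → ℂ} (hol : ∀ j, MDifferentiable 𝓘(ℂ) 𝓘(ℂ) fun τ => C τ j) (bdd : ∀ j, IsBoundedAtImInfty fun τ => C τ j) (a : Fin 10 → ℂ) :
    (MDifferentiable 𝓘(ℂ) 𝓘(ℂ) fun τ => ∑ i, a i * C τ i) ∧ IsBoundedAtImInfty fun τ => ∑ i, a i * C τ i := by
  classical
  induction (Finset.univ : Finset (Fin 10)) using Finset.induction_on with
  | empty => simpa using ⟨mdifferentiable_const, Filter.const_boundedAtFilter _ _⟩
  | insert i s hi ih =>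
    simp only [Finset.sum_insert hi]
    exact ⟨(mdifferentiable_const.mul (hol i)).add ih.1, ((Filter.const_boundedAtFilter _ (a i)).mul (bdd i)).add ih.2⟩
theorem bas_ex (h : IsLeech B) (hc : Cls B cls) : ∃ b, Bas B cls b := by
  obtain ⟨a, u, e, ha, hu, he, b, hb⟩ := basis_ex h hc
  refine ⟨b, ⟨fun c => ?_, fun c => ?_, fun c c' hh => ?_, fun j i => b.repr (Pi.single i 1) j, fun v => ?_⟩⟩
  · simp only [lc, hb, Fin.sum_univ_succ, map_add, map_smul]
    simp [ha, hu, MM3, smul_smul]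
    rw [mul_comm (W ^ 2)]
    abel
  · simp only [lc, hb, Fin.sum_univ_succ, map_add, map_smul]
    simp [ha, hu, he]
  · have := b.linearIndependent
    rw [Fintype.linearIndependent_iff] at this
    funext j
    rw [← sub_eq_zero]
    refine this (fun j => c j - c' j) ?_ j
    simp only [sub_smul, Finset.sum_sub_distrib]
    exact sub_eq_zero.2 hh
  · conv_rhs => rw [← b.sum_repr v]
    refine Finset.sum_congr rfl fun j _ => ?_
    congr 1
    conv_rhs => rw [pi_eq_sum_univ' v]
    simp [mul_comm]
theorem Bas.vf {b : Fin 10 → V10} (hb : Bas B cls b) {κ : ℤ} {p q r s : ℍ → ℂ} {f g : Fin 3 → ℍ → ℂ} (hp : UU 0 κ p) (hq : UU 0 κ q) (hr : UU 0 κ r)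
    (hs : UU 1 κ s) (hf : Tri κ f) (hg : Tri κ g) : VF B cls κ fun τ => lc b (cv p q r s f g τ) := by
  have h1 : ∀ j, MDifferentiable 𝓘(ℂ) 𝓘(ℂ) fun τ => cv p q r s f g τ j := by
    intro j
    fin_cases j
    exacts [hp.hol, hq.hol, hr.hol, hs.hol, hf.hol 0, hf.hol 1, hf.hol 2, hg.hol 0, hg.hol 1, hg.hol 2]
  have h2 : ∀ j, IsBoundedAtImInfty fun τ => cv p q r s f g τ j := by
    intro j
    fin_cases j
    exacts [hp.bdd, hq.bdd, hr.bdd, hs.bdd, hf.bdd 0, hf.bdd 1, hf.bdd 2, hg.bdd 0, hg.bdd 1, hg.bdd 2]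
  have h3 := fun j => hb_lin h1 h2 fun i => b i j
  refine ⟨fun j => ?_, fun j => ?_, fun τ => ?_, fun τ => ?_⟩
  · simpa [lc, mul_comm] using (h3 j).1
  · simpa [lc, mul_comm] using (h3 j).2
  · rw [hb.M]; congr 1
    have e3 : W ^ 2 * (W * s τ) = s τ := by linear_combination s τ * W3
    simp only [cv, hp.T, hq.T, hr.T, hs.T, hf.T, hg.T]
    simp [e3]
  · rw [hb.F]
    simp only [cv, hp.S, hq.S, hr.S, hs.S, hf.S0, hf.S1, hf.S2, hg.S0, hg.S1, hg.S2, lc, Finset.smul_sum, smul_smul]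
    refine Finset.sum_congr rfl fun j _ => ?_
    congr 1
    fin_cases j <;> simp
theorem Bas.vf_inv {b : Fin 10 → V10} (hb : Bas B cls b) {κ : ℤ} {H : ℍ → V10} (hH : VF B cls κ H) :
    ∃ p q r s f g, UU 0 κ p ∧ UU 0 κ q ∧ UU 0 κ r ∧ UU 1 κ s ∧ Tri κ f ∧ Tri κ g ∧ ∀ τ, H τ = lc b (cv p q r s f g τ) := by
  obtain ⟨L, hL⟩ := hb.ex
  set C : ℍ → Fin 10 → ℂ := fun τ j => ∑ i, L j i * H τ i with hC
  have hol : ∀ j, MDifferentiable 𝓘(ℂ) 𝓘(ℂ) fun τ => C τ j := fun j => (hb_lin hH.hol hH.bdd (L j)).1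
  have bdd : ∀ j, IsBoundedAtImInfty fun τ => C τ j := fun j => (hb_lin hH.hol hH.bdd (L j)).2
  have hT : ∀ τ, ![C (T • τ) 0, C (T • τ) 1, C (T • τ) 2, W ^ 2 * C (T • τ) 3, C (T • τ) 6, C (T • τ) 4, C (T • τ) 5, C (T • τ) 9, C (T • τ) 7, C (T • τ) 8] = C τ := fun τ =>
    hb.inj _ _ (by rw [← hb.M, hL, hL, hH.T])
  have hS : ∀ τ, C (S • τ) = fun j => (τ : ℂ) ^ κ * ![C τ 0, C τ 1, C τ 2, C τ 3, C τ 4, -C τ 5, -C τ 6, C τ 7, -C τ 8, -C τ 9] j := fun τ =>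
    hb.inj _ _ (by
      rw [hL, hH.S]
      simp only [lc, mul_smul]
      rw [← Finset.smul_sum]
      congr 1
      rw [show H τ = lc b (C τ) from (hL _).symm, hb.F]; rfl)
  have e3 : W * W ^ 2 = 1 := by linear_combination W3
  refine ⟨fun τ => C τ 0, fun τ => C τ 1, fun τ => C τ 2, fun τ => C τ 3, fun i τ => C τ (![4, 5, 6] i), fun i τ => C τ (![7, 8, 9] i),
    ⟨hol 0, bdd 0, fun τ => ?_, fun τ => ?_⟩, ⟨hol 1, bdd 1, fun τ => ?_, fun τ => ?_⟩, ⟨hol 2, bdd 2, fun τ => ?_, fun τ => ?_⟩,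
    ⟨hol 3, bdd 3, fun τ => ?_, fun τ => ?_⟩, ⟨fun i => hol _, fun i => bdd _, fun i τ => ?_, fun τ => ?_, fun τ => ?_, fun τ => ?_⟩,
    ⟨fun i => hol _, fun i => bdd _, fun i τ => ?_, fun τ => ?_, fun τ => ?_, fun τ => ?_⟩, fun τ => ?_⟩
  iterate 3
    · rw [← hT τ]; simp
    · rw [hS]; simp
  · rw [← hT τ]; simp [← mul_assoc, e3]
  · rw [hS]; simp
  iterate 2
    · rw [← hT τ]; fin_cases i <;> rfl
    all_goals try (rw [hS]; simp)
  rw [← hL (H τ)]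
  congr 1
  funext j; fin_cases j <;> rfl
theorem UU.mf1 {κ κ' : ℤ} {s : ℍ → ℂ} (hs : UU 0 κ s) (hk : κ = κ') : ∃ F : MForm κ', ⇑F = s := by
  subst hk
  have : ∀ Γ : Subgroup (GL (Fin 2) ℝ), Γ = 𝒮ℒ → ∃ F : ModularForm Γ κ, ⇑F = s := by
    rintro _ rfl; exact hs.mf
  exact this _ (by rw [CongruenceSubgroup.Gamma_one_top, MonoidHom.range_eq_map])
theorem UU_z {m : ℕ} {κ : ℤ} : UU m κ fun _ => 0 := ⟨mdifferentiable_const, Filter.const_boundedAtFilter _ _, fun _ => by simp, fun _ => by simp⟩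
theorem UU_one : UU 0 0 fun _ => 1 := ⟨mdifferentiable_const, Filter.const_boundedAtFilter _ _, fun _ => by simp, fun _ => by simp⟩
theorem Tri_z {κ : ℤ} : Tri κ fun _ _ => 0 :=
  ⟨fun _ => mdifferentiable_const, fun _ => Filter.const_boundedAtFilter _ _, fun _ _ => rfl, fun _ => by simp, fun _ => by simp, fun _ => by simp⟩
def oo : ℍ → ℂ := fun _ => 0
def ii : ℍ → ℂ := fun _ => 1
def o3 : Fin 3 → ℍ → ℂ := fun _ _ => 0
def XX : Fin 3 → ℍ → ℂ := fun i τ => xx (i + 1) τ * xx (i + 2) τ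
def EE : Fin 3 → ℍ → ℂ := fun i τ => W ^ (i : ℕ) * (e8 τ * xx i τ)
def Gn : Fin 10 → ℍ → Fin 10 → ℂ := ![cv ii oo oo oo o3 o3, cv oo ii oo oo o3 o3, cv oo oo ii oo o3 o3,
  cv oo oo oo oo xx o3, cv oo oo oo oo o3 xx, cv oo oo oo e8 o3 o3, cv oo oo oo oo XX o3, cv oo oo oo oo o3 XX,
  cv oo oo oo oo EE o3, cv oo oo oo oo o3 EE]
theorem Gn_sum (b : Fin 10 → V10) (c : Fin 10 → ℂ) (τ : ℍ) : ∑ i, c i • lc b (Gn i τ) = lc b ![c 0, c 1, c 2, c 5 * e8 τ,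
    c 3 * xx 0 τ + c 6 * XX 0 τ + c 8 * EE 0 τ, c 3 * xx 1 τ + c 6 * XX 1 τ + c 8 * EE 1 τ, c 3 * xx 2 τ + c 6 * XX 2 τ + c 8 * EE 2 τ,
    c 4 * xx 0 τ + c 7 * XX 0 τ + c 9 * EE 0 τ, c 4 * xx 1 τ + c 7 * XX 1 τ + c 9 * EE 1 τ, c 4 * xx 2 τ + c 7 * XX 2 τ + c 9 * EE 2 τ] := by
  simp only [lc, Finset.smul_sum, smul_smul]
  rw [Finset.sum_comm]
  refine Finset.sum_congr rfl fun j _ => ?_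
  rw [← Finset.sum_smul]
  congr 1
  fin_cases j <;> simp [Gn, cv, Fin.sum_univ_succ, oo, ii, o3] <;> ring
theorem gn_vf {b : Fin 10 → V10} (hb : Bas B cls b) (i : Fin 10) :
    VF B cls (![(12 : ℤ), 12, 12, 14, 14, 16, 16, 16, 18, 18] i - 12) fun τ => lc b (Gn i τ) := by
  have z {κ} : UU 0 κ oo := UU_z
  have z1 {κ} : UU 1 κ oo := UU_z
  have t {κ} : Tri κ o3 := Tri_z
  fin_cases i
  · exact hb.vf UU_one z z z1 t t
  · exact hb.vf z UU_one z z1 t t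
  · exact hb.vf z z UU_one z1 t t
  · exact hb.vf z z z z1 xx_tri t
  · exact hb.vf z z z z1 t xx_tri
  · exact hb.vf z z z UU_e8 t t
  · exact hb.vf z z z z1 xx_tri.X t
  · exact hb.vf z z z z1 t xx_tri.X
  · exact hb.vf z z z z1 xx_tri.E t
  · exact hb.vf z z z z1 t xx_tri.E
theorem Gn_inj {b : Fin 10 → V10} (hb : Bas B cls b) {A β : ℂ} {τ : ℍ} (hβ : β ≠ 0)
    (hx : xx 0 τ ^ 2 = A + β * e8 τ ∧ xx 1 τ ^ 2 = A + W * (β * e8 τ) ∧ xx 2 τ ^ 2 = A + W ^ 2 * (β * e8 τ)) {c : Fin 10 → ℂ}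
    (he : ∑ i, c i • lc b (Gn i τ) = 0) (i : Fin 10) : c i = 0 := by
  rw [Gn_sum] at he
  have e4 := hb.inj _ 0 (he.trans (by simp [lc]))
  have d0 := congrFun e4 0
  have d1 := congrFun e4 1
  have d2 := congrFun e4 2
  have d3 := congrFun e4 3
  have d4 := congrFun e4 4
  have d5 := congrFun e4 5
  have d6 := congrFun e4 6
  have d7 := congrFun e4 7
  have d8 := congrFun e4 8
  have d9 := congrFun e4 9
  obtain ⟨x1, x2, x3⟩ := tri_uniq (α := c 3) (β := c 6) (γ := c 8) hβ hx (fun i => by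
    fin_cases i
    exacts [d4, d5, d6])
  obtain ⟨y1, y2, y3⟩ := tri_uniq (α := c 4) (β := c 7) (γ := c 9) hβ hx (fun i => by
    fin_cases i
    exacts [d7, d8, d9])
  fin_cases i
  exacts [d0, d1, d2, x1, y1, (mul_eq_zero.1 d3).resolve_right (e8_ne τ), x2, y2, x3, y3]
theorem main_free (B : Matrix (Fin 24) (Fin 24) ℤ) (h : IsLeech B) :
    ∃ φ : Fin 10 → UpperHalfPlane → CV → ℂ, FreelyGenerates (fun k ψ => IsHolJacobiForm B k 3 ψ) ![(12 : ℤ), 12, 12, 14, 14, 16, 16, 16, 18, 18] φ := by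
  obtain ⟨cls, hc⟩ := h.exists_cls
  obtain ⟨b, hb⟩ := bas_ex h hc
  obtain ⟨A, β, hA, hβ, hx⟩ := x_sq
  have hsur := (Cls.sur h hc).1
  refine ⟨fun i τ z => Th B cls (lc b (Gn i τ)) τ z, fun i => converse h hc (gn_vf hb i), fun k ψ hψ => ?_⟩
  obtain ⟨H, hH, hψH⟩ := forward h hc hψ
  obtain ⟨p, q, r, s, f, g, hp, hq, hr, hs, hf, hg, hHe⟩ := hb.vf_inv hH
  obtain ⟨f1, f2, f3, hf1, hf2, hf3, hfe⟩ := hf.dec hA hβ hx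
  obtain ⟨g1, g2, g3, hg1, hg2, hg3, hge⟩ := hg.dec hA hβ hx
  have hs' := hs.div (.inl rfl)
  have key : ∀ i, ∃ F : MForm (k - ![(12 : ℤ), 12, 12, 14, 14, 16, 16, 16, 18, 18] i), ⇑F = ![p, q, r, f1, g1, fun τ => s τ / e8 τ ^ 1, f2, g2, f3, g3] i := by
    intro i
    fin_cases i
    · exact hp.mf1 rfl
    · exact hq.mf1 rfl
    · exact hr.mf1 rfl
    · exact hf1.mf1 (by norm_num; ring)
    · exact hg1.mf1 (by norm_num; ring)
    · exact hs'.mf1 (by norm_num; ring)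
    · exact hf2.mf1 (by norm_num; ring)
    · exact hg2.mf1 (by norm_num; ring)
    · exact hf3.mf1 (by norm_num; ring)
    · exact hg3.mf1 (by norm_num; ring)
  choose F hF using key
  have h0 : ∀ τ z, ψ τ z = ∑ i, F i τ * Th B cls (lc b (Gn i τ)) τ z := by
    intro τ z
    rw [hψH, ← h.Th_lin _ _ _ τ.2, Gn_sum, hHe]
    congr 2
    simp only [hF, cv, hfe, hge]
    simp [XX, EE, e8_ne]
  refine ⟨F, h0, fun G hG => ?_⟩
  have h1 : ∀ τ i, G i τ - F i τ = 0 := by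
    intro τ
    have e : ∑ i, G i τ • lc b (Gn i τ) = ∑ i, F i τ • lc b (Gn i τ) := h.Th_inj hsur τ.2 fun z => by
      rw [h.Th_lin _ _ _ τ.2, h.Th_lin _ _ _ τ.2, ← h0, ← hG]
    exact Gn_inj hb hβ (hx τ) (c := fun i => G i τ - F i τ) (by simp only [sub_smul, Finset.sum_sub_distrib]; rw [e, sub_self])
  funext i
  exact DFunLike.ext _ _ fun τ => sub_eq_zero.1 (h1 τ i)
end

/-- Theorem (Sun–Wang): The module `J^{Co₀}_{*,Λ,3}` of Conway invariant holomorphic Jacobi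
forms of integral weight and index 3 is a free module over `ℂ[E₄,E₆]`, generated by ten forms
of weights 12, 12, 12, 14, 14, 16, 16, 16, 18 and 18. -/
theorem conway_hol_jacobi_index_three_free
    (B : Matrix (Fin 24) (Fin 24) ℤ) (hB : IsLeech B) :
    ∃ φ : Fin 10 → UpperHalfPlane → CV → ℂ,
      FreelyGenerates (fun k ψ => IsHolJacobiForm B k 3 ψ)
        ![(12 : ℤ), 12, 12, 14, 14, 16, 16, 16, 18, 18] φ := by
  exact main_free B hB

end
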